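/- (Alesker.) Let n ≥ 1 and 0 ≤ k ≤ 2n. The real vector space Val_k^{U(n)} of continuous, translation-invariant, U(n)-invariant valuations on ℂⁿ that are homogeneous of degree k has dimension min(⌊k/2⌋, ⌊(2n−k)/2⌋) + 1. -/

import Mathlib

open MeasureTheory Pointwise
open scoped NNReal ENNReal

noncomputable section

/-- Euclidean `n`-space `ℝⁿ`. -/
abbrev Eucl (n : ℕ) : Type := EuclideanSpace ℝ (Fin n)

section Generic

variable {V : Type*} [NormedAddCommGroup V] [NormedSpace ℝ V]

/-- `μ` is a valuation: whenever the union of two convex bodies `K`, `L` is again a convex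
body `M` (with intersection the convex body `I`), one has `μ M + μ I = μ K + μ L`. -/
def IsValuation (μ : ConvexBody V → ℝ) : Prop :=
  ∀ K L M I : ConvexBody V,
    (M : Set V) = (K : Set V) ∪ (L : Set V) → (I : Set V) = (K : Set V) ∩ (L : Set V) →
      μ M + μ I = μ K + μ L

/-- The translate `K + x` of a convex body. -/
def ConvexBody.translate (K : ConvexBody V) (x : V) : ConvexBody V :=
  ⟨(K : Set V) + {x}, K.convex.add (convex_singleton x),
    K.isCompact.add isCompact_singleton, K.nonempty.add (Set.singleton_nonempty x)⟩

/-- Translation invariance of a valuation. -/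
def TransInv (μ : ConvexBody V → ℝ) : Prop :=
  ∀ (K : ConvexBody V) (x : V), μ (K.translate x) = μ K

/-- The dilate `t • K` of a convex body. -/
def ConvexBody.dilate (t : ℝ) (K : ConvexBody V) : ConvexBody V :=
  ⟨t • (K : Set V), K.convex.smul t, K.isCompact.smul t, K.nonempty.smul_set⟩

/-- Homogeneity of degree `k` of a valuation: `μ (t • K) = t ^ k * μ K` for `t > 0`. -/
def Homog (k : ℕ) (μ : ConvexBody V → ℝ) : Prop :=
  ∀ (K : ConvexBody V) (t : ℝ), 0 < t → μ (ConvexBody.dilate t K) = t ^ k * μ K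

/-- The reflection `-K` of a convex body. -/
def ConvexBody.reflect (K : ConvexBody V) : ConvexBody V :=
  ⟨-(K : Set V), K.convex.neg, K.isCompact.neg, K.nonempty.neg⟩

/-- Even valuations: `μ (-K) = μ K`. -/
def EvenVal (μ : ConvexBody V → ℝ) : Prop := ∀ K : ConvexBody V, μ K.reflect = μ K

/-- Odd valuations: `μ (-K) = -μ K`. -/
def OddVal (μ : ConvexBody V → ℝ) : Prop := ∀ K : ConvexBody V, μ K.reflect = -μ K

end Generic

/-- Hermitian `n`-space `ℂⁿ`, viewed with its underlying real Euclidean structure coming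
from the real inner product `⟨z,w⟩ = Re ⟪z,w⟫`. -/
abbrev Ecl (n : ℕ) : Type := EuclideanSpace ℂ (Fin n)

instance (n : ℕ) : MeasurableSpace (Ecl n) := borel _
instance (n : ℕ) : BorelSpace (Ecl n) := ⟨rfl⟩

/-- The image of a convex body in `ℂⁿ` under the `ℂ`-linear map given by a complex matrix. -/
def matBodyC {n : ℕ} (A : Matrix (Fin n) (Fin n) ℂ) (K : ConvexBody (Ecl n)) :
    ConvexBody (Ecl n) :=
  ⟨Matrix.toEuclideanLin A '' (K : Set (Ecl n)),
    K.convex.linear_image ((Matrix.toEuclideanLin A).restrictScalars ℝ),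
    K.isCompact.image (Matrix.toEuclideanLin A).continuous_of_finiteDimensional,
    K.nonempty.image _⟩

/-- Invariance of a valuation on `ℂⁿ` under the unitary group `U(n)`. -/
def UInv {n : ℕ} (μ : ConvexBody (Ecl n) → ℝ) : Prop :=
  ∀ A : Matrix (Fin n) (Fin n) ℂ, A ∈ Matrix.unitaryGroup (Fin n) ℂ →
    ∀ K : ConvexBody (Ecl n), μ (matBodyC A K) = μ K

open Filter Topology ProbabilityTheory

section Basics

variable {V W : Type*} [NormedAddCommGroup V] [NormedSpace ℝ V]
  [NormedAddCommGroup W] [NormedSpace ℝ W]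

/-- Continuous translation invariant valuations. -/
structure Good (μ : ConvexBody V → ℝ) : Prop where
  val : IsValuation μ
  cont : Continuous μ
  ti : TransInv μ

/-- The point `x` as a convex body. -/
def ptB (x : V) : ConvexBody V :=
  ⟨{x}, convex_singleton x, isCompact_singleton, Set.singleton_nonempty x⟩

@[simp] lemma coe_ptB (x : V) : (ptB x : Set V) = {x} := rfl

lemma ptB_zero : ptB (0 : V) = 0 := rfl

lemma translate_eq (K : ConvexBody V) (x : V) : K.translate x = K + ptB x := rfl

lemma dilate_eq (t : ℝ) (K : ConvexBody V) : ConvexBody.dilate t K = t • K := rfl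

/-- The segment from `0` to `v`. -/
def segB (v : V) : ConvexBody V :=
  ⟨segment ℝ 0 v, convex_segment 0 v, by
    rw [segment_eq_image]
    exact isCompact_Icc.image (by fun_prop), ⟨0, left_mem_segment ℝ 0 v⟩⟩

lemma mem_segB {v x : V} : x ∈ (segB v : Set V) ↔ ∃ t : ℝ, 0 ≤ t ∧ t ≤ 1 ∧ x = t • v := by
  change x ∈ segment ℝ 0 v ↔ _
  rw [segment_eq_image]
  constructor
  · rintro ⟨t, ⟨h0, h1⟩, rfl⟩
    exact ⟨t, h0, h1, by simp⟩
  · rintro ⟨t, h0, h1, rfl⟩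
    exact ⟨t, ⟨h0, h1⟩, by simp⟩

lemma segB_zero : segB (0 : V) = 0 := by
  ext x
  rw [mem_segB]
  constructor
  · rintro ⟨t, -, -, rfl⟩; simp
  · intro h
    exact ⟨0, le_rfl, zero_le_one, by simpa using h⟩

/-- The parallelotope spanned by a list of vectors. -/
def parB {k : ℕ} (v : Fin k → V) : ConvexBody V := ∑ i, segB (v i)

/-- The image of a convex body under a continuous linear map. -/
def mapB (A : V →L[ℝ] W) (K : ConvexBody V) : ConvexBody W :=
  ⟨A '' (K : Set V), K.convex.linear_image A.toLinearMap, K.isCompact.image A.continuous,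
    K.nonempty.image _⟩

@[simp] lemma coe_mapB (A : V →L[ℝ] W) (K : ConvexBody V) :
    (mapB A K : Set W) = A '' (K : Set V) := rfl

lemma mapB_add (A : V →L[ℝ] W) (K L : ConvexBody V) : mapB A (K + L) = mapB A K + mapB A L := by
  apply ConvexBody.ext
  simp [Set.image_add]

lemma mapB_zero (A : V →L[ℝ] W) : mapB A (0 : ConvexBody V) = 0 := by
  apply ConvexBody.ext
  simp only [coe_mapB, ConvexBody.coe_zero, ← Set.singleton_zero, Set.image_singleton, map_zero]

lemma mapB_smul (A : V →L[ℝ] W) (t : ℝ) (K : ConvexBody V) : mapB A (t • K) = t • mapB A K := by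
  apply ConvexBody.ext
  rw [coe_mapB, ConvexBody.coe_smul, ConvexBody.coe_smul, coe_mapB]
  exact Set.image_smul_comm A t _ fun x => map_smul A t x

lemma mapB_ptB (A : V →L[ℝ] W) (x : V) : mapB A (ptB x) = ptB (A x) := by
  apply ConvexBody.ext
  simp

lemma mapB_segB (A : V →L[ℝ] W) (x : V) : mapB A (segB x) = segB (A x) := by
  apply ConvexBody.ext
  change A '' (segment ℝ 0 x) = segment ℝ 0 (A x)
  have := image_segment ℝ A.toLinearMap.toAffineMap 0 x
  simpa using this

lemma mapB_sum (A : V →L[ℝ] W) {ι : Type*} (s : Finset ι) (K : ι → ConvexBody V) :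
    mapB A (∑ i ∈ s, K i) = ∑ i ∈ s, mapB A (K i) := by
  classical
  induction s using Finset.induction_on with
  | empty => simp [mapB_zero]
  | insert a s ha ih => rw [Finset.sum_insert ha, Finset.sum_insert ha, mapB_add, ih]

lemma mapB_parB (A : V →L[ℝ] W) {k : ℕ} (v : Fin k → V) :
    mapB A (parB v) = parB (fun i => A (v i)) := by
  simp [parB, mapB_sum, mapB_segB]

lemma mapB_mapB {U : Type*} [NormedAddCommGroup U] [NormedSpace ℝ U]
    (B : W →L[ℝ] U) (A : V →L[ℝ] W) (K : ConvexBody V) :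
    mapB B (mapB A K) = mapB (B.comp A) K := by
  apply ConvexBody.ext
  simp only [coe_mapB, Set.image_image]
  rfl

lemma reflect_eq (K : ConvexBody V) :
    K.reflect = mapB (-ContinuousLinearMap.id ℝ V) K := by
  apply ConvexBody.ext
  simp [ConvexBody.reflect]

lemma smul_add_smul_body (K : ConvexBody V) {s t : ℝ} (hs : 0 ≤ s) (ht : 0 ≤ t) :
    (s + t) • K = s • K + t • K := by
  apply ConvexBody.ext
  rw [ConvexBody.coe_smul, ConvexBody.coe_add, ConvexBody.coe_smul, ConvexBody.coe_smul,
    Convex.add_smul K.convex hs ht]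

lemma smul_segB (t : ℝ) (v : V) : t • segB v = segB (t • v) := by
  have h := mapB_segB (t • ContinuousLinearMap.id ℝ V) v
  rw [show (t • ContinuousLinearMap.id ℝ V) v = t • v by simp] at h
  rw [← h]
  apply ConvexBody.ext
  ext; simp [Set.mem_smul_set]

lemma zero_mem_segB (v : V) : (0 : V) ∈ (segB v : Set V) := left_mem_segment ℝ 0 v

lemma segB_neg (v : V) : segB (-v) + ptB v = segB v := by
  apply ConvexBody.ext
  ext x
  simp only [ConvexBody.coe_add, coe_ptB, Set.add_singleton, Set.image_add_right,
    Set.mem_preimage, mem_segB]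
  constructor
  · rintro ⟨t, h0, h1, h⟩
    refine ⟨1 - t, by linarith, by linarith, ?_⟩
    rw [show x = (x + -v) + v by abel, h]; module
  · rintro ⟨t, h0, h1, rfl⟩
    exact ⟨1 - t, by linarith, by linarith, by module⟩

lemma TransInv.add_ptB {μ : ConvexBody V → ℝ} (h : TransInv μ) (K : ConvexBody V) (x : V) :
    μ (K + ptB x) = μ K := h K x

/-! ### Hausdorff distance estimates -/

lemma exists_dist_le_body (K L : ConvexBody V) {x : V} (hx : x ∈ (K : Set V)) :
    ∃ y ∈ (L : Set V), dist x y ≤ dist K L := by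
  obtain ⟨y, hy, h⟩ := L.isCompact.exists_infDist_eq_dist L.nonempty x
  refine ⟨y, hy, ?_⟩
  rw [← h]
  exact Metric.infDist_le_hausdorffDist_of_mem hx ConvexBody.hausdorffEDist_ne_top

lemma dist_body_le {K L : ConvexBody V} {r : ℝ} (hr : 0 ≤ r)
    (h1 : ∀ x ∈ (K : Set V), ∃ y ∈ (L : Set V), dist x y ≤ r)
    (h2 : ∀ x ∈ (L : Set V), ∃ y ∈ (K : Set V), dist x y ≤ r) : dist K L ≤ r :=
  Metric.hausdorffDist_le_of_mem_dist hr h1 h2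

lemma dist_mapB_le (A : V →L[ℝ] W) (K L : ConvexBody V) :
    dist (mapB A K) (mapB A L) ≤ ‖A‖ * dist K L := by
  have key : ∀ K L : ConvexBody V, ∀ x ∈ (mapB A K : Set W), ∃ y ∈ (mapB A L : Set W),
      dist x y ≤ ‖A‖ * dist K L := by
    rintro K L _ ⟨x, hx, rfl⟩
    obtain ⟨y, hy, h⟩ := exists_dist_le_body K L hx
    refine ⟨A y, ⟨y, hy, rfl⟩, (A.lipschitz.dist_le_mul x y).trans ?_⟩
    simpa using mul_le_mul_of_nonneg_left h (norm_nonneg A)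
  refine dist_body_le (by positivity) (key K L) ?_
  rw [dist_comm]; exact key L K

lemma continuous_mapB (A : V →L[ℝ] W) : Continuous (mapB A) :=
  (LipschitzWith.of_dist_le_mul (K := ‖A‖₊) fun K L => dist_mapB_le A K L).continuous

lemma dist_add_body_le (K L K' L' : ConvexBody V) :
    dist (K + L) (K' + L') ≤ dist K K' + dist L L' := by
  have key : ∀ K L K' L' : ConvexBody V, ∀ x ∈ ((K + L : ConvexBody V) : Set V),
      ∃ y ∈ ((K' + L' : ConvexBody V) : Set V), dist x y ≤ dist K K' + dist L L' := by
    rintro K L K' L' _ ⟨x, hx, z, hz, rfl⟩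
    obtain ⟨y, hy, h⟩ := exists_dist_le_body K K' hx
    obtain ⟨w, hw, h'⟩ := exists_dist_le_body L L' hz
    exact ⟨y + w, ⟨y, hy, w, hw, rfl⟩, (dist_add_add_le _ _ _ _).trans (add_le_add h h')⟩
  refine dist_body_le (by positivity) (key K L K' L') ?_
  rw [dist_comm K, dist_comm L]; exact key K' L' K L

lemma continuous_add_body : Continuous fun p : ConvexBody V × ConvexBody V => p.1 + p.2 := by
  refine (LipschitzWith.of_dist_le_mul (K := 2) fun p q => ?_).continuous
  refine (dist_add_body_le _ _ _ _).trans ?_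
  have h1 : dist p.1 q.1 ≤ dist p q := le_max_left _ _
  have h2 : dist p.2 q.2 ≤ dist p q := le_max_right _ _
  norm_num; linarith

instance : ContinuousAdd (ConvexBody V) := ⟨continuous_add_body⟩

lemma continuous_segB : Continuous (segB : V → ConvexBody V) := by
  refine (LipschitzWith.of_dist_le_mul (K := 1) fun v w => ?_).continuous
  have key : ∀ v w : V, ∀ x ∈ (segB v : Set V), ∃ y ∈ (segB w : Set V), dist x y ≤ dist v w := by
    intro v w x hx
    obtain ⟨t, h0, h1, rfl⟩ := mem_segB.1 hx
    refine ⟨t • w, mem_segB.2 ⟨t, h0, h1, rfl⟩, ?_⟩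
    rw [dist_smul₀, Real.norm_of_nonneg h0]
    exact mul_le_of_le_one_left dist_nonneg h1
  rw [NNReal.coe_one, one_mul]
  refine dist_body_le dist_nonneg (key v w) ?_
  rw [dist_comm]; exact key w v

lemma continuous_smul_body (K : ConvexBody V) : Continuous fun t : ℝ => t • K := by
  obtain ⟨C, hC, h⟩ := K.isBounded.exists_pos_norm_le
  refine (LipschitzWith.of_dist_le_mul (K := C.toNNReal) fun s t => ?_).continuous
  have key : ∀ s t : ℝ, ∀ x ∈ ((s • K : ConvexBody V) : Set V),
      ∃ y ∈ ((t • K : ConvexBody V) : Set V), dist x y ≤ C * dist s t := by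
    rintro s t _ ⟨x, hx, rfl⟩
    refine ⟨t • x, ⟨x, hx, rfl⟩, ?_⟩
    change dist (s • x) (t • x) ≤ _
    rw [dist_eq_norm, ← sub_smul, norm_smul, mul_comm, ← dist_eq_norm]
    exact mul_le_mul_of_nonneg_right (h x hx) dist_nonneg
  rw [Real.coe_toNNReal _ hC.le]
  refine dist_body_le (by positivity) (key s t) ?_
  rw [dist_comm]; exact key t s

/-! ### Extension by zero to all sets, and cutting -/

lemma inter_nonempty_of_union_convex {A B : Set V} (hA : IsClosed A) (hB : IsClosed B)
    (hU : Convex ℝ (A ∪ B)) {a b : V} (ha : a ∈ A) (hb : b ∈ B) :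
    ∃ x ∈ segment ℝ a b, x ∈ A ∩ B := by
  have hsub : segment ℝ a b ⊆ A ∪ B := hU.segment_subset (Or.inl ha) (Or.inr hb)
  have hp := (convex_segment (𝕜 := ℝ) a b).isPreconnected
  rw [isPreconnected_closed_iff] at hp
  exact hp A B hA hB hsub ⟨a, left_mem_segment ℝ a b, ha⟩ ⟨b, right_mem_segment ℝ a b, hb⟩

lemma inter_add_of_union_convex {A B X : Set V} (hA : IsClosed A) (hB : IsClosed B)
    (hU : Convex ℝ (A ∪ B)) (hX : Convex ℝ X) : (A ∩ B) + X = (A + X) ∩ (B + X) := by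
  apply Set.Subset.antisymm (Set.inter_add_subset)
  rintro z ⟨⟨a, ha, x, hx, rfl⟩, ⟨b, hb, y, hy, h⟩⟩
  obtain ⟨m, ⟨s, t, hs, ht, hst, rfl⟩, hm⟩ := inter_nonempty_of_union_convex hA hB hU ha hb
  refine ⟨_, hm, s • x + t • y, hX hx hy hs ht hst, ?_⟩
  change s • a + t • b + (s • x + t • y) = a + x
  change b + y = a + x at h
  calc _ = s • (a + x) + t • (b + y) := by module
    _ = _ := by rw [h, ← add_smul, hst, one_smul]

open Classical in
/-- Extension of a functional on convex bodies to all sets by zero. -/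
def extV (μ : ConvexBody V → ℝ) (S : Set V) : ℝ :=
  if h : Convex ℝ S ∧ IsCompact S ∧ S.Nonempty then μ ⟨S, h.1, h.2.1, h.2.2⟩ else 0

lemma extV_coe (μ : ConvexBody V → ℝ) (K : ConvexBody V) : extV μ (K : Set V) = μ K :=
  dif_pos ⟨K.convex, K.isCompact, K.nonempty⟩

lemma extV_empty (μ : ConvexBody V → ℝ) : extV μ ∅ = 0 := by
  simp [extV]

lemma IsValuation.extV_union {μ : ConvexBody V → ℝ} (h : IsValuation μ) {A B : Set V}
    (hA : Convex ℝ A) (hA' : IsCompact A) (hB : Convex ℝ B) (hB' : IsCompact B)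
    (hU : Convex ℝ (A ∪ B)) :
    extV μ (A ∪ B) + extV μ (A ∩ B) = extV μ A + extV μ B := by
  rcases A.eq_empty_or_nonempty with rfl | hAn
  · simp [extV_empty]
  rcases B.eq_empty_or_nonempty with rfl | hBn
  · simp [extV_empty]
  obtain ⟨a, ha⟩ := id hAn
  obtain ⟨b, hb⟩ := id hBn
  obtain ⟨x, -, hx⟩ := inter_nonempty_of_union_convex hA'.isClosed hB'.isClosed hU ha hb
  have key := h ⟨A, hA, hA', hAn⟩ ⟨B, hB, hB', hBn⟩
      ⟨A ∪ B, hU, hA'.union hB', hAn.inl⟩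
      ⟨A ∩ B, hA.inter hB, hA'.inter_right hB'.isClosed, ⟨x, hx⟩⟩ rfl rfl
  simp only [← extV_coe] at key
  exact key

lemma IsValuation.extV_cut {μ : ConvexBody V → ℝ} (h : IsValuation μ) {S : Set V}
    (hS : Convex ℝ S) (hS' : IsCompact S) (f : V →L[ℝ] ℝ) (c : ℝ) :
    extV μ S + extV μ (S ∩ {x | f x = c}) =
      extV μ (S ∩ {x | f x ≤ c}) + extV μ (S ∩ {x | c ≤ f x}) := by
  have e1 : S = (S ∩ {x | f x ≤ c}) ∪ (S ∩ {x | c ≤ f x}) := by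
    ext x; simp only [Set.mem_union, Set.mem_inter_iff, Set.mem_ofPred_eq]
    have := le_total (f x) c; tauto
  have e2 : S ∩ {x | f x = c} = (S ∩ {x | f x ≤ c}) ∩ (S ∩ {x | c ≤ f x}) := by
    ext x; simp only [Set.mem_inter_iff, Set.mem_ofPred_eq, le_antisymm_iff]; tauto
  rw [e2]
  conv_lhs => rw [e1]
  have h1 : Convex ℝ {x | f x ≤ c} := convex_halfSpace_le f.toLinearMap.isLinear c
  have h2 : Convex ℝ {x | c ≤ f x} := convex_halfSpace_ge f.toLinearMap.isLinear c
  have h3 : IsClosed {x | f x ≤ c} := isClosed_le f.continuous continuous_const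
  have h4 : IsClosed {x | c ≤ f x} := isClosed_le continuous_const f.continuous
  have := h.extV_union (hS.inter h1) (hS'.inter_right h3) (hS.inter h2) (hS'.inter_right h4)
    (by rw [← e1]; exact hS)
  rw [← e1] at this ⊢
  exact this

/-! ### Operations on good valuations -/

lemma Good.add {μ ν : ConvexBody V → ℝ} (hμ : Good μ) (hν : Good ν) :
    Good (fun K => μ K + ν K) where
  val := fun K L M I hM hI => by
    have h1 := hμ.val K L M I hM hI
    have h2 := hν.val K L M I hM hI
    simp only; linarith
  cont := hμ.cont.add hν.cont
  ti := fun K x => by simp only [hμ.ti K x, hν.ti K x]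

lemma Good.const_mul {μ : ConvexBody V → ℝ} (hμ : Good μ) (c : ℝ) :
    Good (fun K => c * μ K) where
  val := fun K L M I hM hI => by
    have h1 := hμ.val K L M I hM hI
    simp only; linear_combination c * h1
  cont := continuous_const.mul hμ.cont
  ti := fun K x => by simp only [hμ.ti K x]

lemma Good.sub {μ ν : ConvexBody V → ℝ} (hμ : Good μ) (hν : Good ν) :
    Good (fun K => μ K - ν K) := by
  simpa [sub_eq_add_neg] using hμ.add (hν.const_mul (-1))

lemma Good.sum {ι : Type*} (s : Finset ι) {μ : ι → ConvexBody V → ℝ} (h : ∀ i ∈ s, Good (μ i)) :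
    Good (fun K => ∑ i ∈ s, μ i K) where
  val := fun K L M I hM hI => by
    simp only [← Finset.sum_add_distrib]
    exact Finset.sum_congr rfl fun i hi => (h i hi).val K L M I hM hI
  cont := continuous_finsetSum s fun i hi => (h i hi).cont
  ti := fun K x => Finset.sum_congr rfl fun i hi => (h i hi).ti K x

lemma Good.add_body {μ : ConvexBody V → ℝ} (h : Good μ) (X : ConvexBody V) :
    Good (fun K => μ (K + X)) where
  val := fun K L M I hM hI => by
    refine h.val _ _ _ _ ?_ ?_
    · simp [hM, Set.union_add]
    · simp only [ConvexBody.coe_add, hI]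
      exact inter_add_of_union_convex K.isClosed L.isClosed (hM ▸ M.convex) X.convex
  cont := h.cont.comp (by fun_prop)
  ti := fun K x => by
    simp only [translate_eq]
    rw [add_right_comm]; exact h.ti _ x

lemma Good.comp_mapB {μ : ConvexBody W → ℝ} (h : Good μ) (A : V →L[ℝ] W)
    (hA : Function.Injective A) : Good (fun K => μ (mapB A K)) where
  val := fun K L M I hM hI => by
    refine h.val _ _ _ _ ?_ ?_
    · simp [hM, Set.image_union]
    · simp [hI, Set.image_inter hA]
  cont := h.cont.comp (continuous_mapB A)
  ti := fun K x => by
    simp only [translate_eq, mapB_add, mapB_ptB]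
    exact h.ti _ _

lemma Homog.comp_mapB {μ : ConvexBody W → ℝ} {k : ℕ} (h : Homog k μ) (A : V →L[ℝ] W) :
    Homog k (fun K => μ (mapB A K)) := fun K t ht => by
  simp only [dilate_eq, mapB_smul]
  exact h _ t ht

lemma EvenVal.comp_mapB {μ : ConvexBody W → ℝ} (h : EvenVal μ) (A : V →L[ℝ] W) :
    EvenVal (fun K => μ (mapB A K)) := fun K => by
  have : mapB A K.reflect = (mapB A K).reflect := by
    rw [reflect_eq, reflect_eq, mapB_mapB, mapB_mapB]
    congr 1; ext; simp
  simp only [this]; exact h _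

end Basics

section Differences

variable {V : Type*} [NormedAddCommGroup V] [NormedSpace ℝ V]

/-- The difference operator `K ↦ μ (K + [0,v]) - μ K`. -/
def Dv (v : V) (μ : ConvexBody V → ℝ) : ConvexBody V → ℝ := fun K => μ (K + segB v) - μ K

lemma Good.Dv {μ : ConvexBody V → ℝ} (h : Good μ) (v : V) : Good (Dv v μ) :=
  (h.add_body (segB v)).sub h

lemma additive_eq_mul {f : ℝ → ℝ} (hadd : ∀ s t, 0 ≤ s → 0 ≤ t → f (s + t) = f s + f t)
    (hc : Continuous f) {s : ℝ} (hs : 0 ≤ s) : f s = s * f 1 := by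
  have h0 : f 0 = 0 := by have := hadd 0 0 le_rfl le_rfl; simp at this; linarith
  have hn : ∀ (n : ℕ) (t : ℝ), 0 ≤ t → f (n * t) = n * f t := by
    intro n t ht
    induction n with
    | zero => simp [h0]
    | succ n ih =>
      push_cast
      rw [add_mul, one_mul, hadd _ _ (by positivity) ht, ih]; ring
  have hq : ∀ n : ℕ, 0 < n → f ((⌊s * n⌋₊ : ℝ) / n) = (⌊s * n⌋₊ : ℝ) / n * f 1 := by
    intro n hn'
    have hn0 : (n : ℝ) ≠ 0 := by positivity
    have h1 := hn n (1 / n) (by positivity)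
    rw [mul_one_div_cancel hn0] at h1
    rw [div_eq_mul_one_div, hn _ _ (by positivity), h1]
    field_simp
  have hl : Tendsto (fun n : ℕ => (⌊s * n⌋₊ : ℝ) / n) atTop (𝓝 s) :=
    (tendsto_nat_floor_mul_div_atTop hs).comp tendsto_natCast_atTop_atTop
  refine tendsto_nhds_unique ((hc.tendsto s).comp hl) (((hl.mul_const (f 1))).congr' ?_)
  filter_upwards [eventually_gt_atTop 0] with n hn'
  exact (hq n hn').symm

lemma Good.segB_smul_add {μ : ConvexBody V → ℝ} (h : Good μ) (K : ConvexBody V) (v : V) {s t : ℝ}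
    (hs : 0 ≤ s) (ht : 0 ≤ t) :
    μ (K + segB ((s + t) • v)) - μ K
      = (μ (K + segB (s • v)) - μ K) + (μ (K + segB (t • v)) - μ K) := by
  have key := h.val (K + segB (s • v)) (K + segB (t • v) + ptB (s • v)) (K + segB ((s + t) • v))
    (K + ptB (s • v)) ?_ ?_
  · rw [h.ti.add_ptB, h.ti.add_ptB] at key
    linarith
  · ext z
    simp only [ConvexBody.coe_add, Set.mem_union, Set.mem_add, coe_ptB, Set.mem_singleton_iff,
      mem_segB]
    constructor
    · rintro ⟨k, hk, _, ⟨a, ha0, ha1, rfl⟩, rfl⟩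
      rcases le_total (a * (s + t)) s with hle | hle
      · left
        rcases hs.eq_or_lt with rfl | hs'
        · have : a * (0 + t) = 0 := le_antisymm hle (by positivity)
          exact ⟨k, hk, 0, ⟨0, le_rfl, zero_le_one, by simp⟩, by rw [smul_smul, this]; simp⟩
        · refine ⟨k, hk, _, ⟨a * (s + t) / s, by positivity, by rw [div_le_one hs']; exact hle, rfl⟩,
            ?_⟩
          rw [smul_smul, smul_smul, div_mul_cancel₀ _ hs'.ne']
      · right
        have hle' : a * (s + t) ≤ s + t := mul_le_of_le_one_left (by positivity) ha1
        rcases ht.eq_or_lt with rfl | ht'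
        · have : a * (s + 0) = s := le_antisymm (by linarith) hle
          exact ⟨_, ⟨k, hk, 0, ⟨0, le_rfl, zero_le_one, by simp⟩, rfl⟩, _, rfl, by
            rw [smul_smul, this]; simp⟩
        · refine ⟨_, ⟨k, hk, _, ⟨(a * (s + t) - s) / t, div_nonneg (by linarith) ht,
            by rw [div_le_one ht']; linarith, rfl⟩, rfl⟩, _, rfl, ?_⟩
          rw [smul_smul, smul_smul, div_mul_cancel₀ _ ht'.ne']
          module
    · have aux : ∀ b : ℝ, 0 ≤ b → b ≤ s + t →
          ∃ c : ℝ, 0 ≤ c ∧ c ≤ 1 ∧ b • v = c • (s + t) • v := by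
        intro b hb hb'
        rcases (add_nonneg hs ht).eq_or_lt with h0 | h0
        · exact ⟨0, le_rfl, zero_le_one, by
            rw [← h0, show b = 0 by linarith]; simp⟩
        · exact ⟨b / (s + t), by positivity, by rw [div_le_one h0]; exact hb', by
            rw [smul_smul, div_mul_cancel₀ _ h0.ne']⟩
      rintro (⟨k, hk, _, ⟨a, ha0, ha1, rfl⟩, rfl⟩ |
        ⟨_, ⟨k, hk, _, ⟨a, ha0, ha1, rfl⟩, rfl⟩, _, rfl, rfl⟩)
      · obtain ⟨c, hc0, hc1, hc⟩ := aux (a * s) (by positivity) (by nlinarith)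
        exact ⟨k, hk, _, ⟨c, hc0, hc1, rfl⟩, by rw [← hc, smul_smul]⟩
      · obtain ⟨c, hc0, hc1, hc⟩ := aux (a * t + s) (by positivity) (by nlinarith)
        exact ⟨k, hk, _, ⟨c, hc0, hc1, rfl⟩, by rw [← hc]; module⟩
  · ext z
    simp only [ConvexBody.coe_add, Set.mem_inter_iff, Set.mem_add, coe_ptB, Set.mem_singleton_iff,
      mem_segB]
    constructor
    · rintro ⟨k, hk, _, rfl, rfl⟩
      exact ⟨⟨k, hk, _, ⟨1, zero_le_one, le_rfl, rfl⟩, by simp⟩,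
        _, ⟨k, hk, 0, ⟨0, le_rfl, zero_le_one, by simp⟩, rfl⟩, _, rfl, by simp⟩
    · rintro ⟨⟨k, hk, _, ⟨a, ha0, ha1, rfl⟩, rfl⟩,
        ⟨_, ⟨k', hk', _, ⟨b, hb0, hb1, rfl⟩, rfl⟩, _, rfl, heq⟩⟩
      refine ⟨k + (a * s - s) • v, ?_, _, rfl, by module⟩
      have e : k' = k + (a * s - s - b * t) • v := by
        have : k' = (k' + b • t • v + s • v) - (b • t • v + s • v) := by abel
        rw [this, heq]; module
      rcases (show 0 ≤ (s - a * s) + b * t by nlinarith [mul_nonneg hb0 ht]).eq_or_lt with h0 | h0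
      · have h1 : 0 ≤ b * t := by positivity
        have h2 : 0 ≤ s - a * s := by nlinarith
        rw [show a * s - s = 0 by linarith]; simpa using hk
      · have := K.convex hk hk' (a := b * t / ((s - a * s) + b * t))
          (b := (s - a * s) / ((s - a * s) + b * t))
          (by positivity) (div_nonneg (by nlinarith) h0.le)
          (by rw [← add_div, add_comm]; exact div_self h0.ne')
        convert this using 1
        rw [e, smul_add, ← add_assoc, ← add_smul, ← add_div,
          show (b * t + (s - a * s)) / ((s - a * s) + b * t) = 1 by
            rw [add_comm]; exact div_self h0.ne', one_smul, smul_smul]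
        congr 2
        rw [show a * s - s - b * t = -((s - a * s) + b * t) by ring, mul_neg,
          div_mul_cancel₀ _ h0.ne']
        ring

lemma Good.Dv_smul_nonneg {μ : ConvexBody V → ℝ} (h : Good μ) (v : V) {s : ℝ} (hs : 0 ≤ s)
    (K : ConvexBody V) : _root_.Dv (s • v) μ K = s * _root_.Dv v μ K := by
  have := additive_eq_mul (f := fun s => μ (K + segB (s • v)) - μ K)
    (fun s t hs ht => h.segB_smul_add K v hs ht)
    ((h.cont.comp (continuous_const.add (continuous_segB.comp (by fun_prop)))).sub
      continuous_const) hs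
  simpa [_root_.Dv] using this

lemma Good.Dv_neg {μ : ConvexBody V → ℝ} (h : Good μ) (v : V) (K : ConvexBody V) :
    _root_.Dv (-v) μ K = _root_.Dv v μ K := by
  unfold _root_.Dv
  rw [← h.ti.add_ptB (K + segB (-v)) v, add_assoc, segB_neg]

lemma Good.Dv_smul {μ : ConvexBody V → ℝ} (h : Good μ) (v : V) (s : ℝ)
    (K : ConvexBody V) : _root_.Dv (s • v) μ K = |s| * _root_.Dv v μ K := by
  rcases le_total 0 s with hs | hs
  · rw [abs_of_nonneg hs, h.Dv_smul_nonneg v hs]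
  · rw [abs_of_nonpos hs, ← h.Dv_smul_nonneg v (by linarith), neg_smul, h.Dv_neg]

lemma Dv_comm (v w : V) (μ : ConvexBody V → ℝ) : Dv v (Dv w μ) = Dv w (Dv v μ) := by
  funext K
  simp only [Dv]
  rw [add_right_comm]; ring

lemma Good.Dv_add_segB {μ : ConvexBody V → ℝ} (h : Good μ) (v : V) {s : ℝ} (hs : 0 ≤ s)
    (K : ConvexBody V) : _root_.Dv v μ (K + segB (s • v)) = _root_.Dv v μ K := by
  have h1 : segB (s • v) + segB v = segB ((s + 1) • v) := by
    rw [← smul_segB, ← smul_segB, smul_add_smul_body _ hs zero_le_one, one_smul]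
  have h2 := h.Dv_smul_nonneg v (add_nonneg hs zero_le_one) K
  have h3 := h.Dv_smul_nonneg v hs K
  simp only [_root_.Dv] at *
  rw [add_assoc, h1]
  linarith

lemma Homog.Dv {μ : ConvexBody V → ℝ} {k : ℕ} (hμ : Good μ) (h : Homog (k + 1) μ) (v : V) :
    Homog k (Dv v μ) := fun K t ht => by
  have h1 := hμ.Dv_smul_nonneg v (inv_nonneg.2 ht.le) K
  simp only [_root_.Dv, dilate_eq] at *
  have h2 : t • K + segB v = t • (K + segB (t⁻¹ • v)) := by
    rw [smul_add, smul_segB, smul_smul, mul_inv_cancel₀ ht.ne', one_smul]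
  have e1 := h K t ht
  have e2 := h (K + segB (t⁻¹ • v)) t ht
  simp only [dilate_eq] at e1 e2
  rw [h2, e1, e2, ← mul_sub, h1, pow_succ]
  field_simp

/-- The sum of the segments `[0,v]` over a list. -/
def parL : List V → ConvexBody V
  | [] => 0
  | v :: l => parL l + segB v

/-- Iterated difference operators. -/
def DL : List V → (ConvexBody V → ℝ) → ConvexBody V → ℝ
  | [], μ => μ
  | v :: l, μ => DL l (Dv v μ)

lemma parL_eq_sum (l : List V) : parL l = (l.map segB).sum := by
  induction l with
  | nil => rfl
  | cons a l ih => simp [parL, ih, add_comm]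

lemma parB_eq_parL {k : ℕ} (v : Fin k → V) : parB v = parL (List.ofFn v) := by
  rw [parL_eq_sum, parB, List.map_ofFn, List.sum_ofFn]; rfl

lemma parL_perm {l l' : List V} (h : l.Perm l') : parL l = parL l' := by
  rw [parL_eq_sum, parL_eq_sum]; exact (h.map _).sum_eq

lemma parL_append (l l' : List V) : parL (l ++ l') = parL l + parL l' := by
  simp [parL_eq_sum]

lemma Good.DL {μ : ConvexBody V → ℝ} (h : Good μ) (l : List V) : Good (DL l μ) := by
  induction l generalizing μ with
  | nil => exact h
  | cons v l ih => exact ih (h.Dv v)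

lemma Homog.DL {μ : ConvexBody V → ℝ} (hμ : Good μ) (l : List V) {k : ℕ}
    (h : Homog (k + l.length) μ) : Homog k (DL l μ) := by
  induction l generalizing μ with
  | nil => exact h
  | cons v l ih => exact ih (hμ.Dv v) (Homog.Dv hμ h v)

lemma Homog.apply_zero {μ : ConvexBody V → ℝ} {k : ℕ} (h : Homog k μ) (hk : k ≠ 0) : μ 0 = 0 := by
  have := h 0 2 two_pos
  rw [dilate_eq, smul_zero] at this
  have h2 : (2 : ℝ) ^ k ≠ 1 := (one_lt_pow₀ one_lt_two hk).ne'
  have h3 : (2 ^ k - 1) * μ 0 = 0 := by linarith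
  exact (mul_eq_zero.1 h3).resolve_left (sub_ne_zero.2 h2)

lemma Homog.parL_eq_zero {μ : ConvexBody V → ℝ} (hμ : Good μ) {k : ℕ} (h : Homog k μ)
    (l : List V) (hl : l.length < k) : μ (parL l) = 0 := by
  induction l generalizing μ k with
  | nil => exact h.apply_zero (by simp at hl; omega)
  | cons v l ih =>
    obtain ⟨k, rfl⟩ : ∃ j, k = j + 1 := ⟨k - 1, by simp at hl; omega⟩
    have h1 := ih (hμ.Dv v) (Homog.Dv hμ h v) (by simpa using hl)
    have h2 := ih hμ h (by simp at hl; omega)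
    simp only [_root_.Dv] at h1
    simp only [parL]; linarith

lemma Homog.parL_eq_DL {μ : ConvexBody V → ℝ} (hμ : Good μ) (l : List V)
    (h : Homog l.length μ) : μ (parL l) = _root_.DL l μ 0 := by
  induction l generalizing μ with
  | nil => rfl
  | cons v l ih =>
    have h1 := ih (hμ.Dv v) (Homog.Dv hμ h v)
    have h2 := h.parL_eq_zero hμ l (by simp)
    simp only [_root_.Dv] at h1
    simp only [parL, _root_.DL]
    rw [← h1, h2, sub_zero]

end Differences

open scoped RealInnerProductSpace

section Support

variable {E : Type*} [NormedAddCommGroup E] [InnerProductSpace ℝ E]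

/-- The support function of a convex body. -/
def hB (K : ConvexBody E) (x : E) : ℝ := sSup ((fun y => ⟪x, y⟫) '' (K : Set E))

lemma bddAbove_inner (K : ConvexBody E) (x : E) :
    BddAbove ((fun y => ⟪x, y⟫) '' (K : Set E)) :=
  (K.isCompact.image (by fun_prop)).bddAbove

lemma inner_le_hB {K : ConvexBody E} (x : E) {y : E} (hy : y ∈ (K : Set E)) : ⟪x, y⟫ ≤ hB K x :=
  le_csSup (bddAbove_inner K x) ⟨y, hy, rfl⟩

lemma hB_le {K : ConvexBody E} {x : E} {c : ℝ} (h : ∀ y ∈ (K : Set E), ⟪x, y⟫ ≤ c) :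
    hB K x ≤ c :=
  csSup_le (K.nonempty.image _) (by rintro _ ⟨y, hy, rfl⟩; exact h y hy)

lemma exists_hB (K : ConvexBody E) (x : E) : ∃ y ∈ (K : Set E), ⟪x, y⟫ = hB K x := by
  obtain ⟨y, hy, h⟩ := (K.isCompact.image (f := fun y => ⟪x, y⟫) (by fun_prop)).sSup_mem
    (K.nonempty.image _)
  exact ⟨y, hy, h⟩

lemma hB_eq {K : ConvexBody E} {x : E} {c : ℝ} (h : ∀ y ∈ (K : Set E), ⟪x, y⟫ ≤ c)
    (h' : ∃ y ∈ (K : Set E), ⟪x, y⟫ = c) : hB K x = c := by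
  obtain ⟨y, hy, e⟩ := h'
  exact le_antisymm (hB_le h) (e ▸ inner_le_hB x hy)

lemma hB_add (K L : ConvexBody E) (x : E) : hB (K + L) x = hB K x + hB L x := by
  apply hB_eq
  · rintro _ ⟨y, hy, z, hz, rfl⟩
    change ⟪x, y + z⟫ ≤ _
    rw [inner_add_right]
    exact add_le_add (inner_le_hB x hy) (inner_le_hB x hz)
  · obtain ⟨y, hy, e⟩ := exists_hB K x
    obtain ⟨z, hz, e'⟩ := exists_hB L x
    exact ⟨y + z, ⟨y, hy, z, hz, rfl⟩, by rw [inner_add_right, e, e']⟩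

lemma hB_ptB (v x : E) : hB (ptB v) x = ⟪x, v⟫ :=
  hB_eq (by rintro y rfl; rfl) ⟨v, rfl, rfl⟩

@[simp] lemma hB_zero_body (x : E) : hB (0 : ConvexBody E) x = 0 := by
  rw [← ptB_zero, hB_ptB, inner_zero_right]

lemma hB_smul_body {t : ℝ} (ht : 0 ≤ t) (K : ConvexBody E) (x : E) :
    hB (t • K) x = t * hB K x := by
  apply hB_eq
  · rintro _ ⟨y, hy, rfl⟩
    change ⟪x, t • y⟫ ≤ _
    rw [inner_smul_right]
    exact mul_le_mul_of_nonneg_left (inner_le_hB x hy) ht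
  · obtain ⟨y, hy, e⟩ := exists_hB K x
    exact ⟨t • y, ⟨y, hy, rfl⟩, by rw [inner_smul_right, e]⟩

lemma hB_smul {t : ℝ} (ht : 0 ≤ t) (K : ConvexBody E) (x : E) :
    hB K (t • x) = t * hB K x := by
  apply hB_eq
  · intro y hy
    rw [inner_smul_left]
    exact mul_le_mul_of_nonneg_left (inner_le_hB x hy) ht
  · obtain ⟨y, hy, e⟩ := exists_hB K x
    exact ⟨y, hy, by rw [inner_smul_left, e]; simp⟩

lemma hB_zero (K : ConvexBody E) : hB K 0 = 0 := by
  have := hB_smul le_rfl K 0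
  simpa using this

lemma hB_add_le (K : ConvexBody E) (x y : E) : hB K (x + y) ≤ hB K x + hB K y :=
  hB_le fun z hz => by
    rw [inner_add_left]; exact add_le_add (inner_le_hB x hz) (inner_le_hB y hz)

/-- The segment from `-v` to `v`. -/
def sseg (v : E) : ConvexBody E := segB ((2 : ℝ) • v) + ptB (-v)

lemma hB_sseg (v x : E) : hB (sseg v) x = |⟪x, v⟫| := by
  unfold sseg
  rw [hB_add, hB_ptB, inner_neg_right]
  rcases le_total 0 ⟪x, v⟫ with h | h
  · rw [abs_of_nonneg h, hB_eq (c := 2 * ⟪x, v⟫)]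
    · ring
    · intro y hy
      obtain ⟨t, h0, h1, rfl⟩ := mem_segB.1 hy
      rw [inner_smul_right, inner_smul_right]; nlinarith
    · exact ⟨(2 : ℝ) • v, mem_segB.2 ⟨1, zero_le_one, le_rfl, by simp⟩, by rw [inner_smul_right]⟩
  · rw [abs_of_nonpos h, hB_eq (c := 0)]
    · ring
    · intro y hy
      obtain ⟨t, h0, h1, rfl⟩ := mem_segB.1 hy
      rw [inner_smul_right, inner_smul_right]
      nlinarith [mul_nonneg h0 (neg_nonneg.2 h)]
    · exact ⟨0, zero_mem_segB _, by simp⟩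

lemma hB_sum {ι : Type*} (s : Finset ι) (K : ι → ConvexBody E) (x : E) :
    hB (∑ i ∈ s, K i) x = ∑ i ∈ s, hB (K i) x := by
  classical
  induction s using Finset.induction_on with
  | empty => simp
  | insert a s ha ih => rw [Finset.sum_insert ha, Finset.sum_insert ha, hB_add, ih]

lemma body_subset_of_hB_le [CompleteSpace E] {K L : ConvexBody E} (h : ∀ x, hB K x ≤ hB L x) :
    (K : Set E) ⊆ L := by
  intro z hz
  by_contra hzL
  obtain ⟨f, u, h1, h2⟩ := geometric_hahn_banach_closed_point L.convex L.isClosed hzL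
  set x := (InnerProductSpace.toDual ℝ E).symm f
  have hx : ∀ y, ⟪x, y⟫ = f y := fun y => InnerProductSpace.toDual_symm_apply
  have h3 : hB L x ≤ u := hB_le fun y hy => by rw [hx]; exact (h1 y hy).le
  have h4 := inner_le_hB x hz
  rw [hx] at h4
  linarith [h x]

lemma body_eq_of_hB_eq [CompleteSpace E] {K L : ConvexBody E} (h : ∀ x, hB K x = hB L x) :
    K = L :=
  ConvexBody.ext ((body_subset_of_hB_le fun x => (h x).le).antisymm
    (body_subset_of_hB_le fun x => (h x).ge))

lemma mem_body_iff [CompleteSpace E] {K : ConvexBody E} {y : E} :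
    y ∈ (K : Set E) ↔ ∀ x, ⟪x, y⟫ ≤ hB K x := by
  refine ⟨fun h x => inner_le_hB x h, fun h => ?_⟩
  have : (ptB y : Set E) ⊆ K := body_subset_of_hB_le fun x => by rw [hB_ptB]; exact h x
  exact this rfl

lemma continuous_hB (K : ConvexBody E) : Continuous (hB K) := by
  obtain ⟨C, hC, h⟩ := K.isBounded.exists_pos_norm_le
  refine (LipschitzWith.of_le_add_mul C.toNNReal fun x y => ?_).continuous
  rw [Real.coe_toNNReal _ hC.le]
  refine hB_le fun z hz => ?_
  have h1 := inner_le_hB y hz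
  have h2 : ⟪x - y, z⟫ ≤ ‖x - y‖ * ‖z‖ := real_inner_le_norm _ _
  rw [inner_sub_left] at h2
  have h3 := mul_le_mul_of_nonneg_left (h z hz) (norm_nonneg (x - y))
  rw [dist_eq_norm]; linarith

lemma hB_reflect (K : ConvexBody E) (x : E) : hB K.reflect x = hB K (-x) := by
  apply hB_eq
  · intro y hy
    have : -y ∈ (K : Set E) := hy
    have := inner_le_hB (-x) this
    simpa using this
  · obtain ⟨y, hy, e⟩ := exists_hB K (-x)
    refine ⟨-y, ?_, by rw [← e]; simp⟩
    change - -y ∈ (K : Set E)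
    simpa using hy

variable [FiniteDimensional ℝ E]

/-- The closed unit ball as a convex body. -/
def unitB (E : Type*) [NormedAddCommGroup E] [InnerProductSpace ℝ E] [FiniteDimensional ℝ E] :
    ConvexBody E :=
  ⟨Metric.closedBall 0 1, convex_closedBall 0 1,
    have := FiniteDimensional.proper_real E
    isCompact_closedBall 0 1, ⟨0, by simp⟩⟩

lemma mem_unitB {x : E} : x ∈ (unitB E : Set E) ↔ ‖x‖ ≤ 1 := by
  change x ∈ Metric.closedBall (0 : E) 1 ↔ _
  simp

lemma mem_smul_unitB {r : ℝ} (hr : 0 ≤ r) {x : E} :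
    x ∈ ((r • unitB E : ConvexBody E) : Set E) ↔ ‖x‖ ≤ r := by
  rw [ConvexBody.coe_smul]
  change x ∈ r • Metric.closedBall (0 : E) 1 ↔ _
  rw [smul_closedBall _ _ zero_le_one]
  simp [abs_of_nonneg hr]

lemma hB_unitB (x : E) : hB (unitB E) x = ‖x‖ := by
  apply hB_eq
  · intro y hy
    refine (real_inner_le_norm _ _).trans (mul_le_of_le_one_right (norm_nonneg _) (mem_unitB.1 hy))
  · by_cases hx : x = 0
    · exact ⟨0, mem_unitB.2 (by simp), by simp [hx]⟩
    · refine ⟨‖x‖⁻¹ • x, mem_unitB.2 ?_, ?_⟩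
      · rw [norm_smul, norm_inv, norm_norm, inv_mul_cancel₀ (norm_ne_zero_iff.2 hx)]
      · rw [inner_smul_right, real_inner_self_eq_norm_sq]
        have := norm_ne_zero_iff.2 hx
        field_simp

lemma dist_le_of_hB {K L : ConvexBody E} {ε : ℝ} (hε : 0 ≤ ε)
    (h : ∀ x, ‖x‖ = 1 → |hB K x - hB L x| ≤ ε) : dist K L ≤ ε := by
  have key : ∀ K L : ConvexBody E, (∀ x, ‖x‖ = 1 → |hB K x - hB L x| ≤ ε) →
      ∀ x ∈ (K : Set E), ∃ y ∈ (L : Set E), dist x y ≤ ε := by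
    intro K L h x hx
    have hsub : (K : Set E) ⊆ ((L + ε • unitB E : ConvexBody E) : Set E) := by
      apply body_subset_of_hB_le
      intro z
      rw [hB_add, hB_smul_body hε, hB_unitB]
      by_cases hz : z = 0
      · simp [hz, hB_zero]
      have hz' := norm_ne_zero_iff.2 hz
      have h1 := h (‖z‖⁻¹ • z) (by
        rw [norm_smul, norm_inv, norm_norm, inv_mul_cancel₀ hz'])
      rw [hB_smul (by positivity), hB_smul (by positivity), ← mul_sub] at h1
      have h2 := (le_abs_self _).trans h1
      have h3 := mul_le_mul_of_nonneg_left h2 (norm_nonneg z)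
      rw [← mul_assoc, mul_inv_cancel₀ hz'] at h3
      linarith
    obtain ⟨y, hy, w, hw, rfl⟩ := hsub hx
    refine ⟨y, hy, ?_⟩
    have := (mem_smul_unitB hε).1 hw
    simpa [dist_eq_norm] using this
  exact dist_body_le hε (key K L h) (key L K fun x hx => by rw [abs_sub_comm]; exact h x hx)

lemma tendsto_body_of_hB {K : ℕ → ConvexBody E} {L : ConvexBody E}
    (h : ∀ x, Tendsto (fun n => hB (K n) x) atTop (𝓝 (hB L x))) : Tendsto K atTop (𝓝 L) := by
  have := FiniteDimensional.proper_real E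
  -- uniform bound
  set b := stdOrthonormalBasis ℝ E
  obtain ⟨C, hC0, hC⟩ : ∃ C : ℝ, 0 < C ∧ ∀ n, ∀ y ∈ (K n : Set E), ‖y‖ ≤ C := by
    have hb : ∀ x, ∃ c, 0 ≤ c ∧ ∀ n, hB (K n) x ≤ c := by
      intro x
      obtain ⟨c, hc⟩ := (h x).bddAbove_range
      exact ⟨max c 0, le_max_right _ _, fun n => (hc ⟨n, rfl⟩).trans (le_max_left _ _)⟩
    choose c hc0 hc using hb
    refine ⟨∑ i, (c (b i) + c (-b i)) + 1,
      add_pos_of_nonneg_of_pos (Finset.sum_nonneg fun i _ => add_nonneg (hc0 _) (hc0 _)) one_pos,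
      fun n y hy => ?_⟩
    have e : y = ∑ i, ⟪b i, y⟫ • b i := (b.sum_repr' y).symm
    calc ‖y‖ = ‖∑ i, ⟪b i, y⟫ • b i‖ := by rw [← e]
      _ ≤ ∑ i, ‖⟪b i, y⟫ • b i‖ := norm_sum_le _ _
      _ ≤ ∑ i, (c (b i) + c (-b i)) := by
        refine Finset.sum_le_sum fun i _ => ?_
        rw [norm_smul, b.norm_eq_one, mul_one, Real.norm_eq_abs]
        have h1 := (inner_le_hB (b i) hy).trans (hc _ n)
        have h2 := (inner_le_hB (-b i) hy).trans (hc _ n)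
        rw [inner_neg_left] at h2
        rw [abs_le]
        constructor <;> linarith [hc0 (b i), hc0 (-b i)]
      _ ≤ _ := by linarith
  obtain ⟨C', hC0', hC'⟩ := L.isBounded.exists_pos_norm_le
  have lip : ∀ (M : ConvexBody E) (D : ℝ), (∀ y ∈ (M : Set E), ‖y‖ ≤ D) → ∀ x y,
      hB M x ≤ hB M y + D * ‖x - y‖ := by
    intro M D hD x y
    refine hB_le fun z hz => ?_
    have h1 := inner_le_hB y hz
    have h2 : ⟪x - y, z⟫ ≤ ‖x - y‖ * ‖z‖ := real_inner_le_norm _ _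
    rw [inner_sub_left] at h2
    have h3 := mul_le_mul_of_nonneg_left (hD z hz) (norm_nonneg (x - y))
    linarith
  rw [Metric.tendsto_atTop]
  intro ε hε
  set δ := ε / (4 * (C + C')) with hδ
  have hδ0 : 0 < δ := by positivity
  obtain ⟨t, -, htf, htc⟩ := (isCompact_sphere (0 : E) 1).finite_cover_balls hδ0
  have hev : ∀ᶠ n in atTop, ∀ y ∈ t, |hB (K n) y - hB L y| < ε / 4 := by
    rw [htf.eventually_all]
    intro y _
    have := (Metric.tendsto_nhds.1 (h y)) (ε / 4) (by positivity)
    simpa [Real.dist_eq] using this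
  obtain ⟨N, hN⟩ := eventually_atTop.1 hev
  refine ⟨N, fun n hn => lt_of_le_of_lt (dist_le_of_hB (ε := ε / 2) (by positivity) ?_)
    (by linarith)⟩
  intro x hx
  have : x ∈ Metric.sphere (0 : E) 1 := by simpa using hx
  obtain ⟨y, hy, hxy⟩ := Set.mem_iUnion₂.1 (htc this)
  have hxy' : ‖x - y‖ < δ := by simpa [dist_eq_norm] using hxy
  have hyx' : ‖y - x‖ < δ := by rwa [norm_sub_rev]
  have h1 := hN n hn y hy
  have h2 := lip (K n) C (hC n) x y
  have h3 := lip (K n) C (hC n) y x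
  have h4 := lip L C' hC' x y
  have h5 := lip L C' hC' y x
  have h6 : C * δ + C' * δ = ε / 4 := by rw [hδ]; field_simp
  have h7 := mul_le_mul_of_nonneg_left hxy'.le hC0.le
  have h8 := mul_le_mul_of_nonneg_left hxy'.le hC0'.le
  have h9 := mul_le_mul_of_nonneg_left hyx'.le hC0.le
  have h10 := mul_le_mul_of_nonneg_left hyx'.le hC0'.le
  rw [abs_lt] at h1
  rw [abs_le]
  constructor <;> linarith

lemma exists_body_of_sublinear {h : E → ℝ} (hhom : ∀ c : ℝ, 0 < c → ∀ x, h (c • x) = c * h x)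
    (hadd : ∀ x y, h (x + y) ≤ h x + h y) : ∃ K : ConvexBody E, ∀ x, hB K x = h x := by
  have := FiniteDimensional.proper_real E
  have h0 : h 0 = 0 := by
    have := hhom 2 two_pos 0
    rw [smul_zero] at this; linarith
  have hcont : Continuous h := by
    have hconv : ConvexOn ℝ Set.univ h := ⟨convex_univ, fun x _ y _ a b ha hb hab => by
      refine (hadd _ _).trans ?_
      rcases ha.eq_or_lt with rfl | ha
      · rcases hb.eq_or_lt with rfl | hb
        · simp [h0]
        · rw [hhom b hb]; simp [h0]
      · rcases hb.eq_or_lt with rfl | hb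
        · rw [hhom a ha]; simp [h0]
        · rw [hhom a ha, hhom b hb]; simp⟩
    exact continuousOn_univ.1 (hconv.continuousOn isOpen_univ)
  have key : ∀ x₀, ∃ y : E, (∀ x, ⟪x, y⟫ ≤ h x) ∧ ⟪x₀, y⟫ = h x₀ := by
    intro x₀
    by_cases hx : x₀ = 0
    · obtain ⟨g, -, hg⟩ := exists_extension_of_le_sublinear (⊥ : E →ₗ.[ℝ] ℝ) h hhom hadd (by
        rintro ⟨x, hx⟩
        have hx0 : x = 0 := (Submodule.mem_bot ℝ).1 hx
        subst hx0
        have : (⟨0, hx⟩ : (⊥ : E →ₗ.[ℝ] ℝ).domain) = 0 := rfl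
        rw [this, LinearPMap.map_zero]
        exact h0.ge)
      refine ⟨(InnerProductSpace.toDual ℝ E).symm (LinearMap.toContinuousLinearMap g), fun x => ?_,
        by simp [hx, h0]⟩
      rw [real_inner_comm, InnerProductSpace.toDual_symm_apply]; exact hg x
    · obtain ⟨g, hg', hg⟩ := exists_extension_of_le_sublinear
        (LinearPMap.mkSpanSingleton x₀ (h x₀) hx) h hhom hadd (by
        rintro ⟨x, hx'⟩
        obtain ⟨c, rfl⟩ := Submodule.mem_span_singleton.1 hx'
        rw [LinearPMap.mkSpanSingleton'_apply]
        change (RingHom.id ℝ c) • h x₀ ≤ h (c • x₀)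
        rw [smul_eq_mul, RingHom.id_apply]
        rcases lt_trichotomy c 0 with hc | rfl | hc
        · have h1 := hadd (c • x₀) ((-c) • x₀)
          rw [← add_smul, add_neg_cancel, zero_smul, h0, hhom (-c) (by linarith)] at h1
          linarith
        · simp [h0]
        · rw [hhom c hc])
      refine ⟨(InnerProductSpace.toDual ℝ E).symm (LinearMap.toContinuousLinearMap g), fun x => ?_,
        ?_⟩
      · rw [real_inner_comm, InnerProductSpace.toDual_symm_apply]; exact hg x
      · rw [real_inner_comm, InnerProductSpace.toDual_symm_apply]
        have := hg' ⟨x₀, Submodule.mem_span_singleton_self x₀⟩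
        rw [LinearPMap.mkSpanSingleton_apply] at this
        exact this
  have hbd : ∃ C, 0 ≤ C ∧ ∀ x, ‖x‖ = 1 → h x ≤ C := by
    obtain ⟨C, hC⟩ := ((isCompact_sphere (0 : E) 1).image hcont).bddAbove
    exact ⟨max C 0, le_max_right _ _,
      fun x hx => (hC ⟨x, by simpa using hx, rfl⟩).trans (le_max_left _ _)⟩
  obtain ⟨C, hC0, hC⟩ := hbd
  let S : Set E := {y | ∀ x, ⟪x, y⟫ ≤ h x}
  have hSc : IsClosed S := by
    have : S = ⋂ x, {y | ⟪x, y⟫ ≤ h x} := by ext; simp [S]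
    rw [this]
    exact isClosed_iInter fun x => isClosed_le (by fun_prop) continuous_const
  have hSb : S ⊆ Metric.closedBall 0 C := by
    intro y hy
    rw [mem_closedBall_zero_iff]
    by_cases hy0 : y = 0
    · rw [hy0, norm_zero]; exact hC0
    · have hn := norm_ne_zero_iff.2 hy0
      have h1 := (hy (‖y‖⁻¹ • y)).trans (hC _ (by
        rw [norm_smul, norm_inv, norm_norm, inv_mul_cancel₀ hn]))
      rw [inner_smul_left, real_inner_self_eq_norm_sq] at h1
      have : ‖y‖⁻¹ * ‖y‖ ^ 2 = ‖y‖ := by field_simp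
      simpa [this] using h1
  refine ⟨⟨S, ?_, (isCompact_closedBall 0 C).of_isClosed_subset hSc hSb, ?_⟩, fun x => ?_⟩
  · intro y hy z hz a b ha hb hab x
    rw [inner_add_right, inner_smul_right, inner_smul_right]
    have := mul_le_mul_of_nonneg_left (hy x) ha
    have := mul_le_mul_of_nonneg_left (hz x) hb
    have e : a * h x + b * h x = h x := by rw [← add_mul, hab, one_mul]
    linarith
  · obtain ⟨y, hy, -⟩ := key 0
    exact ⟨y, hy⟩
  · obtain ⟨y, hy, e⟩ := key x
    exact hB_eq (fun z hz => hz x) ⟨y, hy, e⟩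

end Support

section Zonoid

variable {E : Type*} [NormedAddCommGroup E] [InnerProductSpace ℝ E] [FiniteDimensional ℝ E]
  [MeasurableSpace E] [BorelSpace E] {Ω : Type*} [MeasurableSpace Ω]

/-- `Z` is the zonoid generated by the random vector `φ`. -/
def IsZon (γ : Measure Ω) (φ : Ω → E) (Z : ConvexBody E) : Prop :=
  ∀ x, hB Z x = ∫ ω, |⟪x, φ ω⟫| ∂γ

lemma integrable_abs_inner {γ : Measure Ω} {φ : Ω → E} (h : Integrable φ γ) (x : E) :
    Integrable (fun ω => |⟪x, φ ω⟫|) γ :=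
  (h.const_inner x).abs

lemma exists_isZon {γ : Measure Ω} {φ : Ω → E} (h : Integrable φ γ) :
    ∃ Z : ConvexBody E, IsZon γ φ Z := by
  refine exists_body_of_sublinear (h := fun x => ∫ ω, |⟪x, φ ω⟫| ∂γ) ?_ ?_
  · intro c hc x
    simp only [inner_smul_left, abs_mul, RCLike.conj_to_real, abs_of_pos hc, integral_const_mul]
  · intro x y
    rw [← integral_add (integrable_abs_inner h x) (integrable_abs_inner h y)]
    refine integral_mono (integrable_abs_inner h _)
      ((integrable_abs_inner h x).add (integrable_abs_inner h y)) fun ω => ?_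
    simp only [inner_add_left]
    exact abs_add_le _ _

/-- The zonotope of a simple function. -/
def zonS (γ : Measure Ω) (s : SimpleFunc Ω E) : ConvexBody E :=
  ∑ c ∈ s.range, sseg (γ.real (s ⁻¹' {c}) • c)

lemma integral_simpleFunc_comp {γ : Measure Ω} [IsFiniteMeasure γ] (s : SimpleFunc Ω E)
    {f : E → ℝ} (hf : f 0 = 0) :
    ∫ ω, f (s ω) ∂γ = ∑ c ∈ s.range, γ.real (s ⁻¹' {c}) * f c := by
  have h1 := SimpleFunc.map_integral s f (SimpleFunc.integrable_of_isFiniteMeasure (μ := γ) s) hf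
  rw [SimpleFunc.integral_eq_integral _ (SimpleFunc.integrable_of_isFiniteMeasure (μ := γ) _)] at h1
  simpa using h1

lemma zonS_isZon {γ : Measure Ω} [IsFiniteMeasure γ] (s : SimpleFunc Ω E) :
    IsZon γ s (zonS γ s) := fun x => by
  rw [integral_simpleFunc_comp (f := fun c => |⟪x, c⟫|) s (by simp), zonS, hB_sum]
  refine Finset.sum_congr rfl fun c _ => ?_
  rw [hB_sseg, inner_smul_right, abs_mul, abs_of_nonneg measureReal_nonneg]

/-- Approximation of an integrable function by simple functions. -/
def simpA {φ : Ω → E} (hφ : Measurable φ) (N : ℕ) : SimpleFunc Ω E :=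
  SimpleFunc.approxOn φ hφ Set.univ 0 (Set.mem_univ _) N

lemma simpA_tendsto {φ : Ω → E} (hφ : Measurable φ) (ω : Ω) :
    Tendsto (fun N => simpA hφ N ω) atTop (𝓝 (φ ω)) :=
  SimpleFunc.tendsto_approxOn hφ _ (by simp)

lemma simpA_norm_le {φ : Ω → E} (hφ : Measurable φ) (N : ℕ) (ω : Ω) :
    ‖simpA hφ N ω‖ ≤ 2 * ‖φ ω‖ := by
  rw [two_mul]
  exact SimpleFunc.norm_approxOn_zero_le hφ _ ω N

lemma tendsto_integral_simpA {γ : Measure Ω} {φ : Ω → E} (hφ : Measurable φ)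
    (hi : Integrable φ γ) {f : E → ℝ} (hf : Continuous f) {C : ℝ} (hC : ∀ v, |f v| ≤ C * ‖v‖)
    (hC0 : 0 ≤ C) :
    Tendsto (fun N => ∫ ω, f (simpA hφ N ω) ∂γ) atTop (𝓝 (∫ ω, f (φ ω) ∂γ)) := by
  refine tendsto_integral_of_dominated_convergence (fun ω => C * (2 * ‖φ ω‖)) ?_ ?_ ?_ ?_
  · exact fun N => (hf.measurable.comp (SimpleFunc.measurable _)).aestronglyMeasurable
  · exact (hi.norm.const_mul 2).const_mul C
  · exact fun N => .of_forall fun ω => (hC _).trans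
      (mul_le_mul_of_nonneg_left (simpA_norm_le hφ N ω) hC0)
  · exact .of_forall fun ω => (hf.tendsto _).comp (simpA_tendsto hφ ω)

lemma tendsto_zonS {γ : Measure Ω} [IsFiniteMeasure γ] {φ : Ω → E} (hφ : Measurable φ)
    (hi : Integrable φ γ) {Z : ConvexBody E} (hZ : IsZon γ φ Z) :
    Tendsto (fun N => zonS γ (simpA hφ N)) atTop (𝓝 Z) := by
  refine tendsto_body_of_hB fun x => ?_
  rw [hZ x]
  simp only [zonS_isZon (γ := γ) _ x]
  exact tendsto_integral_simpA hφ hi (f := fun v => |⟪x, v⟫|) (C := ‖x‖) (by fun_prop)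
    (fun v => by rw [abs_abs]; exact abs_real_inner_le_norm x v) (norm_nonneg x)

/-- A closed property of bodies stable under adding segments is stable under adding zonoids. -/
lemma IsZon.induction {γ : Measure Ω} [IsFiniteMeasure γ] {φ : Ω → E} (hφ : Measurable φ)
    (hi : Integrable φ γ) {Z : ConvexBody E} (hZ : IsZon γ φ Z) {P : ConvexBody E → Prop}
    (hP : IsClosed {K | P K}) (hs : ∀ K v, P K → P (K + sseg v)) {K : ConvexBody E} (hK : P K) :
    P (K + Z) := by
  have h1 : ∀ N, P (K + zonS γ (simpA hφ N)) := by
    intro N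
    unfold zonS
    induction (simpA hφ N).range using Finset.cons_induction with
    | empty => simpa using hK
    | cons a s ha ih =>
      rw [Finset.sum_cons, add_comm (sseg _), ← add_assoc]
      exact hs _ _ ih
  exact hP.mem_of_tendsto (tendsto_const_nhds.add (tendsto_zonS hφ hi hZ)) (.of_forall h1)

lemma Good.add_sseg {μ : ConvexBody E → ℝ} (h : Good μ) (K : ConvexBody E) (v : E) :
    μ (K + sseg v) = μ K + 2 * _root_.Dv v μ K := by
  have h1 := h.Dv_smul_nonneg v (zero_le_two) K
  rw [sseg, ← add_assoc, h.ti.add_ptB, ← h1, _root_.Dv]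
  ring

lemma Homog.zero_const {μ : ConvexBody E → ℝ} (hμ : Good μ) (h : Homog 0 μ) (K : ConvexBody E) :
    μ K = μ 0 := by
  have h1 : Tendsto (fun t : ℝ => μ (t • K)) (𝓝[>] 0) (𝓝 (μ ((0 : ℝ) • K))) :=
    ((hμ.cont.comp (continuous_smul_body K)).tendsto 0).mono_left nhdsWithin_le_nhds
  have h2 : Tendsto (fun t : ℝ => μ (t • K)) (𝓝[>] 0) (𝓝 (μ K)) := by
    refine tendsto_const_nhds.congr' ?_
    filter_upwards [self_mem_nhdsWithin] with t ht
    have := h K t ht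
    rw [dilate_eq] at this
    rw [this]; simp
  have h3 : (0 : ℝ) • K = 0 := by
    apply ConvexBody.ext
    rw [ConvexBody.coe_smul, Set.zero_smul_set K.nonempty]
    rfl
  rw [← h3]
  exact tendsto_nhds_unique h2 h1

lemma Good.continuous_Dv {μ : ConvexBody E → ℝ} (h : Good μ) (K : ConvexBody E) :
    Continuous fun v => _root_.Dv v μ K :=
  (h.cont.comp (continuous_const.add continuous_segB)).sub continuous_const

lemma Good.exists_Dv_bound {μ : ConvexBody E → ℝ} (h : Good μ) (K : ConvexBody E) :
    ∃ C : ℝ, 0 ≤ C ∧ ∀ v, |_root_.Dv v μ K| ≤ C * ‖v‖ := by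
  have := FiniteDimensional.proper_real E
  obtain ⟨C, hC⟩ := (isCompact_closedBall (0 : E) 1).exists_bound_of_continuousOn
    (h.continuous_Dv K).continuousOn
  have hC0 : 0 ≤ C := (norm_nonneg _).trans (hC 0 (by simp))
  refine ⟨C, hC0, fun v => ?_⟩
  rcases eq_or_ne v 0 with rfl | hv
  · simp [_root_.Dv, segB_zero]
  have h1 : v = ‖v‖ • (‖v‖⁻¹ • v) := by
    rw [smul_smul, mul_inv_cancel₀ (norm_ne_zero_iff.2 hv), one_smul]
  have h2 := hC (‖v‖⁻¹ • v) (by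
    rw [mem_closedBall_zero_iff, norm_smul, norm_inv, norm_norm,
      inv_mul_cancel₀ (norm_ne_zero_iff.2 hv)])
  rw [h1, h.Dv_smul, abs_mul, abs_abs, abs_norm, ← h1, mul_comm]
  exact mul_le_mul_of_nonneg_right h2 (norm_nonneg _)

lemma Homog.one_add_sseg {ρ : ConvexBody E → ℝ} (hρ : Good ρ) (h : Homog 1 ρ) (K : ConvexBody E)
    (v : E) : ρ (K + sseg v) = ρ K + 2 * _root_.Dv v ρ 0 := by
  rw [hρ.add_sseg, Homog.zero_const (hρ.Dv v) (Homog.Dv hρ h v) K]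

lemma Homog.one_add_zon {ρ : ConvexBody E → ℝ} (hρ : Good ρ) (h : Homog 1 ρ)
    {γ : Measure Ω} [IsFiniteMeasure γ] {φ : Ω → E} (hφ : Measurable φ)
    (hi : Integrable φ γ) {Z : ConvexBody E} (hZ : IsZon γ φ Z) (X : ConvexBody E) :
    ρ (X + Z) = ρ X + 2 * ∫ ω, _root_.Dv (φ ω) ρ 0 ∂γ := by
  obtain ⟨C, hC0, hC⟩ := hρ.exists_Dv_bound 0
  have h0 : _root_.Dv 0 ρ 0 = 0 := by simp [_root_.Dv, segB_zero]
  have h1 : ∀ N, ρ (X + zonS γ (simpA hφ N))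
      = ρ X + 2 * ∫ ω, _root_.Dv (simpA hφ N ω) ρ 0 ∂γ := by
    intro N
    rw [integral_simpleFunc_comp (f := fun c => _root_.Dv c ρ 0) _ h0]
    unfold zonS
    induction (simpA hφ N).range using Finset.cons_induction with
    | empty => simp
    | cons a s ha ih =>
      rw [Finset.sum_cons, add_comm (sseg _), ← add_assoc, Homog.one_add_sseg hρ h, ih,
        Finset.sum_cons, hρ.Dv_smul, abs_of_nonneg measureReal_nonneg]
      ring
  have h2 := ((hρ.cont.tendsto _).comp
    ((tendsto_const_nhds (x := X)).add (tendsto_zonS hφ hi hZ)))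
  refine tendsto_nhds_unique h2 ?_
  refine Tendsto.congr (fun N => (h1 N).symm) ?_
  exact tendsto_const_nhds.add
    ((tendsto_integral_simpA hφ hi (hρ.continuous_Dv 0) hC hC0).const_mul 2)

/-- The mixed second difference of a `2`-homogeneous valuation on a pair of zonoids. -/
lemma Homog.two_zon {ν : ConvexBody E → ℝ} (hν : Good ν) (h : Homog 2 ν)
    {γ : Measure Ω} [IsFiniteMeasure γ] {φ : Ω → E} (hφ : Measurable φ)
    (hi : Integrable φ γ) {Z : ConvexBody E} (hZ : IsZon γ φ Z)
    {Ω' : Type*} [MeasurableSpace Ω'] {γ' : Measure Ω'} [IsFiniteMeasure γ'] {φ' : Ω' → E}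
    (hφ' : Measurable φ') (hi' : Integrable φ' γ') {Z' : ConvexBody E} (hZ' : IsZon γ' φ' Z') :
    ν (Z + Z') - ν Z - ν Z' = 4 * ∫ ω', ∫ ω, _root_.Dv (φ ω) (_root_.Dv (φ' ω') ν) 0 ∂γ ∂γ' := by
  have hD : ∀ u, Good (_root_.Dv u ν) ∧ Homog 1 (_root_.Dv u ν) := fun u => ⟨hν.Dv u, Homog.Dv hν h u⟩
  have hν0 : ν 0 = 0 := h.apply_zero two_ne_zero
  have hseg : ∀ u, ν (segB u) = 0 := fun u => by
    have := Homog.parL_eq_zero hν h [u] (by simp)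
    simpa [parL] using this
  have hzero : ∀ u, _root_.Dv u ν 0 = 0 := fun u => by simp [_root_.Dv, hν0, hseg]
  have hadd : ∀ u Y, _root_.Dv u ν (Z + Y) = _root_.Dv u ν Z + _root_.Dv u ν Y := fun u Y => by
    rw [add_comm, Homog.one_add_zon (hD u).1 (hD u).2 hφ hi hZ]
    have := Homog.one_add_zon (hD u).1 (hD u).2 hφ hi hZ 0
    rw [zero_add, hzero, zero_add] at this
    rw [this]; ring
  -- the mixed functional in the second variable
  have hP : Z.1 = Z.1 ∧ Homog 1 (fun Y => ν (Z + Y) - ν Z - ν Y) := by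
    refine ⟨rfl, ?_⟩
    have key := hZ.induction hφ hi (K := 0) (P := fun X =>
      (∀ u Y, _root_.Dv u ν (X + Y) = _root_.Dv u ν X + _root_.Dv u ν Y) ∧
      ∀ Y : ConvexBody E, ∀ t : ℝ, 0 < t →
        ν (X + t • Y) - ν X - ν (t • Y) = t * (ν (X + Y) - ν X - ν Y)) ?_ ?_ ?_
    · rw [zero_add] at key
      intro Y t ht
      rw [dilate_eq, pow_one]
      exact key.2 Y t ht
    · have hc := hν.cont
      have hcD : ∀ u, Continuous (_root_.Dv u ν) := fun u => (hD u).1.cont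
      refine IsClosed.and ?_ ?_
      · simp only [Set.ofPred_forall]
        refine isClosed_iInter fun u => isClosed_iInter fun Y => isClosed_eq ?_ ?_
        · exact (hcD u).comp (continuous_id.add continuous_const)
        · exact (hcD u).add continuous_const
      · simp only [Set.ofPred_forall]
        refine isClosed_iInter fun Y => isClosed_iInter fun t => isClosed_iInter fun ht =>
          isClosed_eq ?_ ?_
        · exact ((hc.comp (continuous_id.add continuous_const)).sub hc).sub continuous_const
        · exact continuous_const.mul
            (((hc.comp (continuous_id.add continuous_const)).sub hc).sub continuous_const)
    · rintro X v ⟨h1, h2⟩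
      have e1 : ∀ Y, ν (X + sseg v + Y) = ν (X + Y) + 2 * _root_.Dv v ν (X + Y) := fun Y => by
        rw [add_right_comm, hν.add_sseg]
      refine ⟨fun u Y => ?_, fun Y t ht => ?_⟩
      · rw [add_right_comm, Homog.one_add_sseg (hD u).1 (hD u).2, h1,
          Homog.one_add_sseg (hD u).1 (hD u).2]
        ring
      · have h3 := h2 Y t ht
        have h4 := (hD v).2 Y t ht
        rw [dilate_eq, pow_one] at h4
        rw [e1, e1, hν.add_sseg, h1, h1, h4]
        linear_combination h3
    · refine ⟨fun u Y => by rw [zero_add, hzero, zero_add], fun Y t ht => ?_⟩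
      simp [hν0]
  have hG : Good (fun Y => ν (Z + Y) - ν Z - ν Y) := by
    have h1 := hν.add_body Z
    refine ⟨fun K L M I hM hI => ?_, ?_, fun K x => ?_⟩
    · have a := h1.val K L M I hM hI
      have b := hν.val K L M I hM hI
      simp only [add_comm Z]
      linarith
    · exact ((hν.cont.comp (continuous_const.add continuous_id)).sub continuous_const).sub hν.cont
    · have := h1.ti K x
      simp only [add_comm Z]
      rw [this, hν.ti]
  have h5 := Homog.one_add_zon hG hP.2 hφ' hi' hZ' 0
  simp only [zero_add, add_zero, hν0, sub_zero, sub_self] at h5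
  rw [h5]
  have h6 : ∀ u, _root_.Dv u (fun Y => ν (Z + Y) - ν Z - ν Y) 0 = 2 * ∫ ω, _root_.Dv (φ ω) (_root_.Dv u ν) 0 ∂γ := by
    intro u
    have := Homog.one_add_zon (hD u).1 (hD u).2 hφ hi hZ 0
    rw [zero_add, hzero, zero_add] at this
    rw [← this]
    simp [_root_.Dv, hseg, hν0]
  simp only [h6]
  rw [integral_const_mul]
  ring

end Zonoid

section PolyGrowth

variable {X Y Z : Type*} [NormedAddCommGroup X] [NormedAddCommGroup Y] [NormedAddCommGroup Z]

/-- Continuous maps of polynomial growth. -/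
def PG (f : X → Y) : Prop :=
  Continuous f ∧ ∃ (C : ℝ) (m : ℕ), 0 ≤ C ∧ ∀ x, ‖f x‖ ≤ C * (1 + ‖x‖) ^ m

lemma PG.const (c : Y) : PG (fun _ : X => c) :=
  ⟨continuous_const, ‖c‖, 0, norm_nonneg _, fun x => by simp⟩

lemma PG.of_le {f : X → Y} {g : X → Z} (hg : PG g) (hf : Continuous f) {C : ℝ}
    (h : ∀ x, ‖f x‖ ≤ C * (1 + ‖g x‖)) : PG f := by
  obtain ⟨-, D, m, hD, h'⟩ := hg
  refine ⟨hf, |C| * (1 + D), m, by positivity, fun x => (h x).trans ?_⟩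
  have h1 : (1 : ℝ) ≤ (1 + ‖x‖) ^ m := one_le_pow₀ (by linarith [norm_nonneg x])
  calc C * (1 + ‖g x‖) ≤ |C| * (1 + ‖g x‖) := by gcongr; exact le_abs_self C
    _ ≤ |C| * ((1 + ‖x‖) ^ m + D * (1 + ‖x‖) ^ m) := by gcongr; exact h' x
    _ = _ := by ring

lemma PG.id : PG (fun x : X => x) :=
  ⟨continuous_id, 1, 1, zero_le_one, fun x => by simp⟩

lemma PG.comp {f : Y → Z} (hf : PG f) {g : X → Y} (hg : PG g) : PG (fun x => f (g x)) := by
  obtain ⟨hfc, C, m, hC, h⟩ := hf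
  obtain ⟨hgc, D, k, hD, h'⟩ := hg
  refine ⟨hfc.comp hgc, C * (1 + D) ^ m, k * m, by positivity, fun x => (h _).trans ?_⟩
  have h1 : (1 : ℝ) ≤ (1 + ‖x‖) ^ k := one_le_pow₀ (by linarith [norm_nonneg x])
  rw [mul_assoc, pow_mul, ← mul_pow]
  gcongr
  linarith [h' x]

lemma PG.prodMk {f : X → Y} (hf : PG f) {g : X → Z} (hg : PG g) : PG (fun x => (f x, g x)) := by
  obtain ⟨hfc, C, m, hC, h⟩ := hf
  obtain ⟨hgc, D, k, hD, h'⟩ := hg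
  refine ⟨hfc.prodMk hgc, C + D, m + k, by positivity, fun x => ?_⟩
  have h1 : (1 : ℝ) ≤ 1 + ‖x‖ := by linarith [norm_nonneg x]
  have h2 : (1 + ‖x‖) ^ m ≤ (1 + ‖x‖) ^ (m + k) := pow_le_pow_right₀ h1 (by omega)
  have h3 : (1 + ‖x‖) ^ k ≤ (1 + ‖x‖) ^ (m + k) := pow_le_pow_right₀ h1 (by omega)
  have h4 := mul_le_mul_of_nonneg_left h2 hC
  have h5 := mul_le_mul_of_nonneg_left h3 hD
  have h6 : 0 ≤ C * (1 + ‖x‖) ^ (m + k) := by positivity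
  have h7 : 0 ≤ D * (1 + ‖x‖) ^ (m + k) := by positivity
  rw [Prod.norm_mk, add_mul]
  exact max_le (by linarith [h x]) (by linarith [h' x])

lemma PG.fst : PG (fun p : X × Y => p.1) :=
  PG.of_le (C := 1) PG.id continuous_fst fun x => by
    linarith [norm_fst_le x]

lemma PG.snd : PG (fun p : X × Y => p.2) :=
  PG.of_le (C := 1) PG.id continuous_snd fun x => by
    linarith [norm_snd_le x]

lemma PG.norm {f : X → Y} (hf : PG f) : PG (fun x => ‖f x‖) :=
  PG.of_le (C := 1) hf hf.1.norm fun x => by rw [norm_norm]; linarith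

lemma PG.abs {f : X → ℝ} (hf : PG f) : PG (fun x => |f x|) := hf.norm

lemma PG.neg {f : X → Y} (hf : PG f) : PG (fun x => -f x) :=
  PG.of_le (C := 1) hf hf.1.neg fun x => by rw [norm_neg]; linarith

lemma PG.add {f g : X → Y} (hf : PG f) (hg : PG g) : PG (fun x => f x + g x) :=
  PG.of_le (C := 2) (hf.prodMk hg) (hf.1.add hg.1) fun x => by
    have h1 := norm_fst_le (f x, g x)
    have h2 := norm_snd_le (f x, g x)
    have h3 := norm_add_le (f x) (g x)
    dsimp only at h1 h2
    linarith

lemma PG.sub {f g : X → Y} (hf : PG f) (hg : PG g) : PG (fun x => f x - g x) := by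
  simpa only [sub_eq_add_neg] using hf.add hg.neg

lemma PG.sum {ι : Type*} (s : Finset ι) {f : ι → X → Y} (hf : ∀ i ∈ s, PG (f i)) :
    PG (fun x => ∑ i ∈ s, f i x) := by
  classical
  induction s using Finset.induction_on with
  | empty => simpa using PG.const 0
  | insert a s ha ih =>
    simp only [Finset.sum_insert ha]
    exact (hf a (by simp)).add (ih fun i hi => hf i (by simp [hi]))

lemma PG.mul' : PG (fun p : ℝ × ℝ => p.1 * p.2) := by
  refine ⟨by fun_prop, 1, 2, zero_le_one, fun p => ?_⟩
  have h1 := norm_fst_le p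
  have h2 := norm_snd_le p
  have h3 := mul_le_mul h1 h2 (norm_nonneg _) (norm_nonneg _)
  rw [norm_mul]
  nlinarith [norm_nonneg p]

lemma PG.mul {f g : X → ℝ} (hf : PG f) (hg : PG g) : PG (fun x => f x * g x) :=
  PG.mul'.comp (hf.prodMk hg)

lemma PG.pow {f : X → ℝ} (hf : PG f) (n : ℕ) : PG (fun x => f x ^ n) := by
  induction n with
  | zero => simpa using PG.const 1
  | succ n ih => simpa only [pow_succ] using ih.mul hf

lemma PG.const_mul {f : X → ℝ} (hf : PG f) (c : ℝ) : PG (fun x => c * f x) :=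
  (PG.const c).mul hf

lemma PG.smul [NormedSpace ℝ Y] {f : X → ℝ} {g : X → Y} (hf : PG f) (hg : PG g) :
    PG (fun x => f x • g x) :=
  PG.of_le (C := 1) (hf.norm.mul hg.norm) (hf.1.smul hg.1) fun x => by
    rw [norm_smul, Real.norm_of_nonneg (r := ‖f x‖ * ‖g x‖) (by positivity)]; linarith

lemma PG.inner [InnerProductSpace ℝ Y] {f g : X → Y} (hf : PG f) (hg : PG g) :
    PG (fun x => ⟪f x, g x⟫) :=
  PG.of_le (C := 1) (hf.norm.mul hg.norm) (hf.1.inner hg.1) fun x => by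
    rw [Real.norm_of_nonneg (r := ‖f x‖ * ‖g x‖) (by positivity)]
    linarith [norm_inner_le_norm (𝕜 := ℝ) (f x) (g x)]

lemma PG.clm [NormedSpace ℝ X] [NormedSpace ℝ Y] (L : X →L[ℝ] Y) : PG (fun x => L x) :=
  ⟨L.continuous, ‖L‖, 1, norm_nonneg _, fun x => (L.le_opNorm x).trans (by
    gcongr; linarith [norm_nonneg x])⟩

/-- Finite measures with all moments. -/
def HM [MeasurableSpace X] (η : Measure X) : Prop :=
  IsFiniteMeasure η ∧ ∀ m : ℕ, Integrable (fun x => (1 + ‖x‖) ^ m) η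

variable [MeasurableSpace X] [BorelSpace X] [MeasurableSpace Y] [BorelSpace Y]
  [SecondCountableTopology X] [SecondCountableTopology Y]

lemma PG.integrable {f : X → Y} (hf : PG f) {η : Measure X} (hη : HM η) : Integrable f η := by
  obtain ⟨hc, C, m, hC, h⟩ := hf
  refine ((hη.2 m).const_mul C).mono' ?_ (.of_forall h)
  exact hc.measurable.aestronglyMeasurable

lemma HM.map {η : Measure X} (hη : HM η) {g : X → Y} (hg : PG g) : HM (η.map g) := by
  have := hη.1
  refine ⟨Measure.isFiniteMeasure_map _ _, fun m => ?_⟩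
  rw [integrable_map_measure (by fun_prop) hg.1.measurable.aemeasurable]
  exact PG.integrable (((PG.const 1).add hg.norm).pow m) hη

lemma HM.prod {η : Measure X} (hη : HM η) {θ : Measure Y} (hθ : HM θ) : HM (η.prod θ) := by
  have := hη.1
  have := hθ.1
  refine ⟨inferInstance, fun m => ?_⟩
  refine ((hη.2 m).mul_prod (hθ.2 m)).mono' ?_ (.of_forall fun p => ?_)
  · exact Measurable.aestronglyMeasurable (by fun_prop)
  · have h1 := norm_nonneg p.1
    have h2 := norm_nonneg p.2
    rw [Real.norm_of_nonneg (by positivity), ← mul_pow]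
    gcongr
    rw [Prod.norm_def]
    rcases max_cases ‖p.1‖ ‖p.2‖ with ⟨h, _⟩ | ⟨h, _⟩ <;> rw [h] <;> nlinarith

lemma PG.integral {f : X × Y → Z} [NormedSpace ℝ Z] [SecondCountableTopology Z] (hf : PG f)
    {η : Measure Y} (hη : HM η) : PG (fun x => ∫ y, f (x, y) ∂η) := by
  obtain ⟨hc, C, m, hC, h⟩ := hf
  have key : ∀ x y, ‖f (x, y)‖ ≤ C * ((1 + ‖x‖) ^ m * (1 + ‖y‖) ^ m) := fun x y => by
    refine (h _).trans ?_
    have h1 := norm_nonneg x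
    have h2 := norm_nonneg y
    rw [← mul_pow]
    gcongr
    rw [Prod.norm_def]
    rcases max_cases ‖x‖ ‖y‖ with ⟨h, _⟩ | ⟨h, _⟩ <;> dsimp only <;> rw [h] <;> nlinarith
  have hm : ∀ x, AEStronglyMeasurable (fun y => f (x, y)) η := fun x =>
    (hc.comp (Continuous.prodMk_right x)).aestronglyMeasurable
  refine ⟨?_, C * ∫ y, (1 + ‖y‖) ^ m ∂η, m, ?_, fun x => ?_⟩
  · refine continuous_iff_continuousAt.2 fun x₀ => ?_
    refine continuousAt_of_dominated (bound := fun y => C * ((1 + (‖x₀‖ + 1)) ^ m * (1 + ‖y‖) ^ m))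
      (.of_forall hm) ?_ (((hη.2 m).const_mul _).const_mul _) (.of_forall fun y =>
        (hc.comp (by fun_prop : Continuous fun x => (x, y))).continuousAt)
    filter_upwards [Metric.ball_mem_nhds x₀ one_pos] with x hx
    refine .of_forall fun y => (key x y).trans ?_
    have : ‖x‖ ≤ ‖x₀‖ + 1 := by
      have h1 := norm_sub_norm_le x x₀
      rw [Metric.mem_ball, dist_eq_norm] at hx
      linarith
    gcongr
  · have : 0 ≤ ∫ y, (1 + ‖y‖) ^ m ∂η := integral_nonneg fun y => by positivity
    positivity
  · refine (norm_integral_le_of_norm_le (((hη.2 m).const_mul _).const_mul _)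
      (.of_forall fun y => key x y)).trans (le_of_eq ?_)
    rw [integral_const_mul, integral_const_mul]
    ring

lemma PG.integral_swap {f : X × Y → Z} [NormedSpace ℝ Z] [SecondCountableTopology Z] (hf : PG f)
    {η : Measure X} (hη : HM η) {θ : Measure Y} (hθ : HM θ) :
    ∫ x, ∫ y, f (x, y) ∂θ ∂η = ∫ y, ∫ x, f (x, y) ∂η ∂θ := by
  have := hη.1
  have := hθ.1
  borelize Z
  exact MeasureTheory.integral_integral_swap (hf.integrable (hη.prod hθ))

end PolyGrowth

section GaussianLaws

variable {H E F : Type*} [NormedAddCommGroup H] [InnerProductSpace ℝ H] [FiniteDimensional ℝ H]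
  [MeasurableSpace H] [BorelSpace H]
  [NormedAddCommGroup E] [InnerProductSpace ℝ E] [FiniteDimensional ℝ E]
  [MeasurableSpace E] [BorelSpace E]
  [NormedAddCommGroup F] [InnerProductSpace ℝ F] [FiniteDimensional ℝ F]
  [MeasurableSpace F] [BorelSpace F]

lemma hm_of_isGaussian (η : Measure E) [IsGaussian η] : HM η := by
  refine ⟨inferInstance, fun m => ?_⟩
  have h1 : MemLp (fun x : E => 1 + ‖x‖) m η :=
    (memLp_const (1 : ℝ)).add (IsGaussian.memLp_id η m (ENNReal.natCast_ne_top m)).norm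
  have h2 : Integrable (fun x : E => ‖1 + ‖x‖‖ ^ m) η := h1.integrable_norm_pow'
  have h3 : (fun x : E => (1 + ‖x‖) ^ m) = fun x : E => ‖1 + ‖x‖‖ ^ m := by
    ext x
    rw [Real.norm_of_nonneg (by positivity)]
  rw [h3]
  exact h2

lemma stdGaussian_map_coisometry (L : H →L[ℝ] E) (hL : ∀ t, ‖L.adjoint t‖ = ‖t‖) :
    (stdGaussian H).map L = stdGaussian E := by
  apply Measure.ext_of_charFun
  ext t
  rw [charFun_apply, integral_map (by fun_prop) (by fun_prop), charFun_stdGaussian, ← hL,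
    ← charFun_stdGaussian, charFun_apply]
  simp only [ContinuousLinearMap.adjoint_inner_right]

lemma indepFun_stdGaussian (L : H →L[ℝ] E) (M : H →L[ℝ] F)
    (h : ∀ s t, ⟪L.adjoint s, M.adjoint t⟫ = 0) : IndepFun L M (stdGaussian H) := by
  refine HasGaussianLaw.indepFun_of_covariance_inner ?_ fun x y => ?_
  · have : HasGaussianLaw (id : H → H) (stdGaussian H) :=
      ⟨by rw [Measure.map_id]; infer_instance⟩
    exact this.map (L.prod M)
  · have e1 : (fun ω => ⟪x, L ω⟫) = fun ω => ⟪L.adjoint x, ω⟫ := by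
      ext ω; rw [ContinuousLinearMap.adjoint_inner_left]
    have e2 : (fun ω => ⟪y, M ω⟫) = fun ω => ⟪M.adjoint y, ω⟫ := by
      ext ω; rw [ContinuousLinearMap.adjoint_inner_left]
    rw [e1, e2, ← covarianceBilin_apply_eq_cov, covarianceBilin_stdGaussian]
    · exact h x y
    · exact IsGaussian.memLp_id _ _ (by simp)

lemma integral_stdGaussian_pair (L : H →L[ℝ] E) (M : H →L[ℝ] F)
    (h : ∀ s t, ⟪L.adjoint s, M.adjoint t⟫ = 0) {f : E × F → ℝ} (hf : PG f) :
    ∫ g, f (L g, M g) ∂stdGaussian H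
      = ∫ a, ∫ b, f (a, b) ∂(stdGaussian H).map M ∂(stdGaussian H).map L := by
  have h1 := (indepFun_iff_map_prod_eq_prod_map_map (by fun_prop) (by fun_prop)).1
    (indepFun_stdGaussian L M h)
  have hLM : HM ((stdGaussian H).map L) := (hm_of_isGaussian _).map (PG.clm L)
  have hM : HM ((stdGaussian H).map M) := (hm_of_isGaussian _).map (PG.clm M)
  have := hLM.1
  have := hM.1
  rw [← integral_prod _ (hf.integrable (hLM.prod hM)), ← h1,
    integral_map (by fun_prop) (hf.1.measurable.aestronglyMeasurable)]

lemma stdGaussian_map_inner (x : E) :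
    (stdGaussian E).map (fun g => ⟪x, g⟫) = gaussianReal 0 (‖x‖₊ ^ 2) := by
  apply Measure.ext_of_charFun
  ext t
  rw [charFun_apply, integral_map (by fun_prop) (by fun_prop), charFun_gaussianReal]
  have := charFun_stdGaussian (t • x)
  rw [charFun_apply] at this
  simp only [RCLike.inner_apply, conj_trivial]
  convert this using 2
  · ext g
    rw [inner_smul_right, real_inner_comm]
  · have h1 : ‖t • x‖ ^ 2 = t ^ 2 * ‖x‖ ^ 2 := by
      rw [norm_smul, mul_pow, Real.norm_eq_abs, sq_abs]
    have h2 : ((‖t • x‖ : ℝ) : ℂ) ^ 2 = (t : ℂ) ^ 2 * (‖x‖ : ℂ) ^ 2 := by exact_mod_cast h1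
    rw [h2]
    simp only [NNReal.coe_pow, coe_nnnorm, Complex.ofReal_pow, Complex.ofReal_zero]
    ring

end GaussianLaws

section Hermite

open ProbabilityTheory Polynomial

/-- The standard normal density. -/
def gphi (u : ℝ) : ℝ := gaussianPDFReal 0 1 u

lemma gphi_eq (u : ℝ) : gphi u = (√(2 * Real.pi))⁻¹ * Real.exp (-u ^ 2 / 2) := by
  simp [gphi, gaussianPDFReal_def]

lemma gphi_pos (u : ℝ) : 0 < gphi u := gaussianPDFReal_pos _ _ _ one_ne_zero

lemma gphi_abs (u : ℝ) : gphi |u| = gphi u := by simp [gphi_eq]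

lemma hasDerivAt_gphi (u : ℝ) : HasDerivAt gphi (-u * gphi u) u := by
  have h1 : HasDerivAt (fun u : ℝ => -u ^ 2 / 2) (-u) u :=
    ((hasDerivAt_pow 2 u).fun_neg.div_const 2).congr_deriv (by norm_num; ring)
  have h2 := (h1.exp.const_mul (√(2 * Real.pi))⁻¹)
  have h3 : gphi = fun u => (√(2 * Real.pi))⁻¹ * Real.exp (-u ^ 2 / 2) := funext gphi_eq
  rw [h3]
  exact h2.congr_deriv (by ring)

lemma integral_gaussian_eq (f : ℝ → ℝ) :
    ∫ u, f u ∂gaussianReal 0 1 = ∫ u, f u * gphi u := by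
  rw [integral_gaussianReal_eq_integral_smul one_ne_zero]
  simp [gphi, mul_comm]

lemma PG.poly (p : ℝ[X]) : PG (fun u : ℝ => p.eval u) := by
  simp only [eval_eq_sum, Polynomial.sum]
  exact PG.sum _ fun i _ => (PG.id.pow i).const_mul _

lemma PG.integrable_gphi {f : ℝ → ℝ} (hf : PG f) : Integrable fun u => f u * gphi u := by
  have h := hf.integrable (hm_of_isGaussian (gaussianReal 0 1))
  rw [gaussianReal_of_var_ne_zero _ one_ne_zero,
    integrable_withDensity_iff (measurable_gaussianPDF _ _)
      (ae_of_all _ fun _ => gaussianPDF_lt_top)] at h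
  simpa [gphi, gaussianPDF, ENNReal.toReal_ofReal (gaussianPDFReal_nonneg _ _ _)] using h

lemma hasDerivAt_poly_gphi (p : ℝ[X]) (u : ℝ) :
    HasDerivAt (fun u => p.eval u * gphi u) ((derivative p - X * p).eval u * gphi u) u := by
  refine ((p.hasDerivAt u).mul (hasDerivAt_gphi u)).congr_deriv ?_
  rw [eval_sub, eval_mul, eval_X]
  ring

lemma integral_poly_gphi (p : ℝ[X]) : ∫ u, (derivative p - X * p).eval u * gphi u = 0 :=
  integral_eq_zero_of_hasDerivAt_of_integrable (hasDerivAt_poly_gphi p)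
    (PG.poly _).integrable_gphi (PG.poly _).integrable_gphi

lemma integral_Ioi_poly_gphi (p : ℝ[X]) :
    ∫ u in Set.Ioi (0 : ℝ), (derivative p - X * p).eval u * gphi u = - (p.eval 0 * gphi 0) := by
  have h1 := (PG.poly p).integrable_gphi
  have h2 := (PG.poly (derivative p - X * p)).integrable_gphi
  rw [integral_Ioi_of_hasDerivAt_of_tendsto' (fun x _ => hasDerivAt_poly_gphi p x)
    h2.integrableOn (tendsto_zero_of_hasDerivAt_of_integrableOn_Ioi (a := 0)
      (fun x _ => hasDerivAt_poly_gphi p x) h2.integrableOn h1.integrableOn), zero_sub]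

/-- Gaussian integration by parts for polynomials. -/
lemma gaussian_ibp (p : ℝ[X]) :
    ∫ u, u * p.eval u ∂gaussianReal 0 1 = ∫ u, (derivative p).eval u ∂gaussianReal 0 1 := by
  have h := integral_poly_gphi p
  have h' := (integral_gaussian_eq (fun u => (derivative p - X * p).eval u)).trans h
  simp only [eval_sub, eval_mul, eval_X] at h'
  rw [integral_sub ((PG.poly _).integrable (hm_of_isGaussian _))
    ((PG.id.mul (PG.poly _)).integrable (hm_of_isGaussian _))] at h'
  linarith

lemma integral_gaussian_abs (f : ℝ → ℝ) :
    ∫ u, f |u| ∂gaussianReal 0 1 = 2 * ∫ u in Set.Ioi (0 : ℝ), f u * gphi u := by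
  rw [integral_gaussian_eq, ← integral_comp_abs (f := fun u => f u * gphi u)]
  simp only [gphi_abs]

lemma gaussian_abs_moment_succ (m : ℕ) :
    ∫ u, |u| ^ (m + 2) ∂gaussianReal 0 1 = (m + 1) * ∫ u, |u| ^ m ∂gaussianReal 0 1 := by
  rw [integral_gaussian_abs (fun u => u ^ (m + 2)), integral_gaussian_abs (fun u => u ^ m)]
  have h := integral_Ioi_poly_gphi (X ^ (m + 1))
  have h2 : ∀ u : ℝ, (derivative (X ^ (m + 1) : ℝ[X]) - X * X ^ (m + 1)).eval u * gphi u
      = (m + 1) * (u ^ m * gphi u) - u ^ (m + 2) * gphi u := fun u => by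
    simp; ring
  simp only [h2] at h
  rw [integral_sub (((PG.id.pow m).integrable_gphi.const_mul _).integrableOn)
    ((PG.id.pow _).integrable_gphi.integrableOn), integral_const_mul] at h
  simp at h
  linarith

lemma gaussian_abs_moment_pos (m : ℕ) : 0 < ∫ u, |u| ^ m ∂gaussianReal 0 1 := by
  have : ∫ u, |u| ^ m ∂gaussianReal 0 1 = ∫ u, |u| ^ m * gphi u := integral_gaussian_eq _
  rw [this]
  have hi := (PG.id.abs.pow m).integrable_gphi
  refine (integral_pos_iff_support_of_nonneg (fun u => by
    have := gphi_pos u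
    positivity) hi).2 ?_
  refine lt_of_lt_of_le (b := volume (Set.Ioi (0 : ℝ))) (by simp) (measure_mono fun u hu => ?_)
  have h1 : 0 < u := hu
  have h2 := gphi_pos u
  exact (by positivity : |u| ^ m * gphi u ≠ 0)

/-- Real Hermite polynomials. -/
def He (n : ℕ) : ℝ[X] := (hermite n).map (Int.castRingHom ℝ)

lemma He_zero : He 0 = 1 := by simp [He]

lemma He_succ (n : ℕ) : He (n + 1) = X * He n - derivative (He n) := by
  simp [He, hermite_succ, derivative_map]

lemma derivative_He (n : ℕ) : derivative (He (n + 1)) = (n + 1 : ℝ[X]) * He n := by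
  induction n with
  | zero => simp [He_succ, He_zero]
  | succ n ih =>
    rw [He_succ (n + 1), derivative_sub, derivative_mul, ih, derivative_mul]
    have : derivative ((n : ℝ[X]) + 1) = 0 := by simp
    rw [this, He_succ n]
    simp
    ring

lemma He_even_zero_ne (l : ℕ) : (He (2 * l)).eval 0 ≠ 0 := by
  rw [← coeff_zero_eq_eval_zero, He, coeff_map]
  have := coeff_hermite_explicit l 0
  rw [add_zero] at this
  rw [this]
  simp
  exact (Nat.doubleFactorial_pos _).ne'

lemma He_even_abs (l : ℕ) (u : ℝ) : (He (2 * l)).eval |u| = (He (2 * l)).eval u := by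
  simp only [eval_eq_sum_range]
  refine Finset.sum_congr rfl fun i _ => ?_
  rcases Nat.even_or_odd i with hi | hi
  · rw [hi.pow_abs]
  · rw [He, coeff_map, coeff_hermite_of_odd_add ((even_two_mul l).add_odd hi)]
    simp

/-- The constants `E |U| He n U`. -/
def aHe (n : ℕ) : ℝ := ∫ u, |u| * (He n).eval u ∂gaussianReal 0 1

lemma aHe_ne_zero (l : ℕ) : aHe (2 * l) ≠ 0 := by
  have h0 : aHe (2 * l) = 2 * ∫ u in Set.Ioi (0 : ℝ), (u * (He (2 * l)).eval u) * gphi u := by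
    rw [← integral_gaussian_abs (fun u => u * (He (2 * l)).eval u)]
    simp only [aHe, He_even_abs]
  cases l with
  | zero =>
    have := gaussian_abs_moment_pos 1
    simp only [aHe, mul_zero, He_zero, eval_one, mul_one]
    simp only [pow_one] at this
    exact this.ne'
  | succ l =>
    have h := integral_Ioi_poly_gphi (X * He (2 * l + 1) + He (2 * l))
    have h2 : derivative (X * He (2 * l + 1) + He (2 * l)) - X * (X * He (2 * l + 1) + He (2 * l))
        = - (X * He (2 * l + 1 + 1)) := by
      rw [He_succ (2 * l + 1), He_succ (2 * l)]
      simp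
      ring
    rw [h2] at h
    rw [h0, show 2 * (l + 1) = 2 * l + 1 + 1 by ring]
    simp only [eval_neg, eval_mul, eval_X, neg_mul, integral_neg, eval_add, zero_mul, zero_add,
      neg_inj] at h
    rw [h]
    exact mul_ne_zero two_ne_zero (mul_ne_zero (He_even_zero_ne l) (gphi_pos 0).ne')

/-- Mehler's formula for Hermite polynomials. -/
lemma mehler {z r : ℝ} (h : z ^ 2 + r ^ 2 = 1) (n : ℕ) (u : ℝ) :
    ∫ w, (He n).eval (z * u + r * w) ∂gaussianReal 0 1 = z ^ n * (He n).eval u := by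
  have hI : ∀ p : ℝ[X], Integrable (fun w => p.eval (z * u + r * w)) (gaussianReal 0 1) :=
    fun p => ((PG.poly p).comp ((PG.const (z * u)).add (PG.id.const_mul r))).integrable
      (hm_of_isGaussian _)
  induction n using Nat.strong_induction_on with
  | _ n ih =>
    match n with
    | 0 => simp [He_zero]
    | 1 =>
      have h1 : ∀ w : ℝ, (He 1).eval (z * u + r * w) = z * u + r * (w * (1 : ℝ[X]).eval w) :=
        fun w => by simp [He_succ 0, He_zero]
      simp only [h1]
      rw [integral_add (integrable_const _) (((PG.id.mul (PG.poly 1)).const_mul r).integrable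
        (hm_of_isGaussian _)), integral_const_mul r, gaussian_ibp]
      simp [He_succ 0, He_zero]
    | n + 2 =>
      have e1 : ∀ w : ℝ, (He (n + 2)).eval (z * u + r * w)
          = z * u * (He (n + 1)).eval (z * u + r * w)
            + r * (w * ((He (n + 1)).comp (C (z * u) + C r * X)).eval w)
            - (n + 1) * (He n).eval (z * u + r * w) := fun w => by
        rw [He_succ (n + 1), derivative_He]
        simp
        ring
      have i2 : Integrable (fun w : ℝ =>
          r * (w * ((He (n + 1)).comp (C (z * u) + C r * X)).eval w)) (gaussianReal 0 1) :=
        ((PG.id.mul (PG.poly _)).const_mul r).integrable (hm_of_isGaussian _)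
      simp only [e1]
      have i1 : Integrable (fun w : ℝ => z * u * (He (n + 1)).eval (z * u + r * w)
          + r * (w * ((He (n + 1)).comp (C (z * u) + C r * X)).eval w)) (gaussianReal 0 1) :=
        ((hI _).const_mul _).add i2
      rw [integral_sub i1 ((hI _).const_mul _), integral_add ((hI _).const_mul _) i2, integral_const_mul, integral_const_mul,
        integral_const_mul, gaussian_ibp, ih (n + 1) (by omega), ih n (by omega)]
      have e2 : ∀ w : ℝ, (derivative ((He (n + 1)).comp (C (z * u) + C r * X))).eval w
          = r * ((n + 1) * (He n).eval (z * u + r * w)) := fun w => by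
        rw [derivative_comp, derivative_He]
        simp
      simp only [e2]
      rw [integral_const_mul, integral_const_mul, ih n (by omega), He_succ (n + 1), derivative_He]
      simp
      linear_combination (((n : ℝ) + 1) * z ^ n * (He n).eval u) * h

end Hermite

section CosRep

open ProbabilityTheory Polynomial

variable {E : Type*} [NormedAddCommGroup E] [InnerProductSpace ℝ E] [FiniteDimensional ℝ E]
  [MeasurableSpace E] [BorelSpace E]

lemma integral_stdGaussian_inner_eq (x : E) {f : ℝ → ℝ} (hf : PG f) :
    ∫ g, f ⟪x, g⟫ ∂stdGaussian E = ∫ u, f (‖x‖ * u) ∂gaussianReal 0 1 := by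
  have h1 : (gaussianReal 0 1).map (fun u => ‖x‖ * u) = gaussianReal 0 (‖x‖₊ ^ 2) := by
    rw [gaussianReal_map_const_mul]
    congr 1
    · simp
    · ext; simp
  rw [← integral_map (φ := fun g => ⟪x, g⟫) (f := f) (by fun_prop)
      hf.1.measurable.aestronglyMeasurable,
    stdGaussian_map_inner, ← h1, integral_map (by fun_prop) hf.1.measurable.aestronglyMeasurable]

lemma cos_hermite {x e : E} (hx : ‖x‖ = 1) (he : ‖e‖ = 1) (n : ℕ) :
    ∫ g, |⟪x, g⟫| * (He n).eval ⟪e, g⟫ ∂stdGaussian E = aHe n * ⟪x, e⟫ ^ n := by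
  set z := ⟪x, e⟫ with hz
  set w := e - z • x with hw
  have hxx : ⟪x, x⟫ = 1 := by rw [real_inner_self_eq_norm_sq, hx]; norm_num
  have hxw : ⟪x, w⟫ = 0 := by rw [hw, inner_sub_right, inner_smul_right, hxx, ← hz]; ring
  have hr : z ^ 2 + ‖w‖ ^ 2 = 1 := by
    have h1 : e = z • x + w := by simp [hw]
    have h2 : ‖e‖ ^ 2 = z ^ 2 + ‖w‖ ^ 2 := by
      rw [h1, norm_add_sq_real, norm_smul, hx, inner_smul_left, hxw]
      simp
    rw [← h2, he]; norm_num
  have hf : PG (fun p : ℝ × ℝ => |p.1| * (He n).eval (z * p.1 + p.2)) :=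
    PG.fst.abs.mul ((PG.poly _).comp ((PG.fst.const_mul z).add PG.snd))
  have key := integral_stdGaussian_pair (innerSL ℝ x) (innerSL ℝ w) (fun s t => by
    have a1 : ∀ (v : E) (s : ℝ), (innerSL ℝ v).adjoint s = s • v := fun v s => by
      refine ext_inner_right ℝ fun y => ?_
      rw [ContinuousLinearMap.adjoint_inner_left, inner_smul_left]
      simp [mul_comm]
    rw [a1, a1, inner_smul_left, inner_smul_right, hxw]; simp) hf
  have e1 : ∀ g : E, z * ⟪x, g⟫ + ⟪w, g⟫ = ⟪e, g⟫ := fun g => by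
    rw [hw, inner_sub_left, inner_smul_left]; simp
  simp only [innerSL_apply_apply, e1] at key
  rw [key]
  have m1 : (stdGaussian E).map (innerSL ℝ x) = gaussianReal 0 1 := by
    have := stdGaussian_map_inner x
    rw [show ‖x‖₊ = 1 from NNReal.eq hx, one_pow] at this
    exact this
  rw [m1, aHe, ← integral_mul_const]
  refine integral_congr_ae (.of_forall fun u => ?_)
  have hp : PG (fun b : ℝ => |u| * (He n).eval (z * u + b)) :=
    ((PG.poly _).comp ((PG.const _).add PG.id)).const_mul _
  simp only
  rw [integral_map (by fun_prop) hp.1.measurable.aestronglyMeasurable]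
  simp only [innerSL_apply_apply]
  rw [integral_stdGaussian_inner_eq w hp, integral_const_mul, mehler hr]
  ring

/-- Homogenized Hermite polynomials. -/
def hHe (n : ℕ) (s ρ : ℝ) : ℝ := ∑ m ∈ Finset.range (n + 1), (He n).coeff m * (s ^ m * ρ ^ (n - m))

lemma hHe_smul (n : ℕ) (ρ s : ℝ) : hHe n (ρ * s) ρ = ρ ^ n * (He n).eval s := by
  have hd : (He n).natDegree < n + 1 :=
    Nat.lt_succ_of_le ((natDegree_map_le).trans natDegree_hermite.le)
  rw [hHe, eval_eq_sum_range' hd, Finset.mul_sum]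
  refine Finset.sum_congr rfl fun m hm => ?_
  have : ρ ^ n = ρ ^ m * ρ ^ (n - m) := by
    rw [← pow_add]; congr 1; have := Finset.mem_range.1 hm; omega
  rw [this, mul_pow]
  ring

lemma cos_power {x : E} (hx : ‖x‖ = 1) (y : E) (n : ℕ) :
    ∫ g, |⟪x, g⟫| * hHe n ⟪y, g⟫ ‖y‖ ∂stdGaussian E = aHe n * ⟪x, y⟫ ^ n := by
  obtain ⟨e, he, hy⟩ : ∃ e : E, ‖e‖ = 1 ∧ y = ‖y‖ • e := by
    rcases eq_or_ne y 0 with rfl | h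
    · exact ⟨x, hx, by simp⟩
    · exact ⟨‖y‖⁻¹ • y, norm_smul_inv_norm h, by
        rw [smul_smul, mul_inv_cancel₀ (norm_ne_zero_iff.2 h), one_smul]⟩
  have h1 : ∀ g, ⟪y, g⟫ = ‖y‖ * ⟪e, g⟫ := fun g => by
    conv_lhs => rw [hy]
    rw [inner_smul_left]; simp
  have h2 : ⟪x, y⟫ = ‖y‖ * ⟪x, e⟫ := by
    conv_lhs => rw [hy]
    rw [inner_smul_right]
  simp only [h1, hHe_smul]
  rw [h2, mul_pow]
  have := cos_hermite hx he n
  calc _ = ∫ g, ‖y‖ ^ n * (|⟪x, g⟫| * (He n).eval ⟪e, g⟫) ∂stdGaussian E := by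
        congr 1; ext g; ring
    _ = _ := by rw [integral_const_mul, this]; ring

/-- Spherical-harmonics-free inversion of the cosine transform. -/
lemma cos_rep {η : Measure E} (hη : HM η) {h : E → ℝ} (hh : PG h) (N : ℕ) (b : ℕ → ℝ) :
    ∃ t : E → ℝ, PG t ∧ ∀ x : E, ‖x‖ = 1 →
      ∑ l ∈ Finset.range N, b l * ∫ y, h y * ⟪x, y⟫ ^ (2 * l) ∂η
        = ∫ g, |⟪x, g⟫| * t g ∂stdGaussian E := by
  have hP : ∀ n, PG (fun p : E × E => h p.2 * hHe n ⟪p.2, p.1⟫ ‖p.2‖) := fun n =>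
    (hh.comp PG.snd).mul (PG.sum _ fun m _ =>
      (((PG.snd.inner PG.fst).pow m).mul (PG.snd.norm.pow _)).const_mul _)
  have hG : HM (stdGaussian E) := hm_of_isGaussian _
  refine ⟨fun g => ∑ l ∈ Finset.range N, b l / aHe (2 * l) *
      ∫ y, h y * hHe (2 * l) ⟪y, g⟫ ‖y‖ ∂η,
    PG.sum _ fun l _ => ((hP (2 * l)).integral hη).const_mul _, fun x hx => ?_⟩
  have e1 : ∀ g, |⟪x, g⟫| * ∑ l ∈ Finset.range N, b l / aHe (2 * l) *
      ∫ y, h y * hHe (2 * l) ⟪y, g⟫ ‖y‖ ∂η = ∑ l ∈ Finset.range N, b l / aHe (2 * l) *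
        ∫ y, |⟪x, g⟫| * (h y * hHe (2 * l) ⟪y, g⟫ ‖y‖) ∂η := fun g => by
    rw [Finset.mul_sum]
    refine Finset.sum_congr rfl fun l _ => ?_
    rw [integral_const_mul]; ring
  have hQ : ∀ n, PG (fun p : E × E => |⟪x, p.1⟫| * (h p.2 * hHe n ⟪p.2, p.1⟫ ‖p.2‖)) :=
    fun n => ((PG.const x).inner PG.fst).abs.mul (hP n)
  simp only [e1]
  rw [integral_finsetSum _ fun l _ => (((hQ (2 * l)).integral hη).const_mul _).integrable hG]
  refine Finset.sum_congr rfl fun l _ => ?_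
  rw [integral_const_mul, PG.integral_swap (hQ (2 * l)) hG hη]
  have e2 : ∀ y, ∫ g, |⟪x, g⟫| * (h y * hHe (2 * l) ⟪y, g⟫ ‖y‖) ∂stdGaussian E
      = aHe (2 * l) * (h y * ⟪x, y⟫ ^ (2 * l)) := fun y => by
    rw [mul_left_comm, ← cos_power hx y, ← integral_const_mul]
    congr 1; ext g; ring
  simp only [e2]
  rw [integral_const_mul, ← mul_assoc, div_mul_cancel₀ _ (aHe_ne_zero l)]

end CosRep

section Smoothing

variable {E : Type*} [NormedAddCommGroup E] [InnerProductSpace ℝ E] [FiniteDimensional ℝ E]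
  [MeasurableSpace E] [BorelSpace E]

lemma innerSL_adjoint_real {H : Type*} [NormedAddCommGroup H] [InnerProductSpace ℝ H]
    [CompleteSpace H] (v : H) (s : ℝ) : (innerSL ℝ v).adjoint s = s • v := by
  refine ext_inner_right ℝ fun y => ?_
  rw [ContinuousLinearMap.adjoint_inner_left, inner_smul_left]
  simp [mul_comm]

lemma sum_range_even_of_odd_eq_zero {F : ℕ → ℝ} (h : ∀ l, F (2 * l + 1) = 0) (n : ℕ) :
    ∑ m ∈ Finset.range (2 * n + 1), F m = ∑ l ∈ Finset.range (n + 1), F (2 * l) := by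
  induction n with
  | zero => simp
  | succ n ih =>
    rw [show 2 * (n + 1) + 1 = 2 * n + 1 + 1 + 1 by ring, Finset.sum_range_succ,
      Finset.sum_range_succ, ih, h, Finset.sum_range_succ _ (n + 1), add_zero]
    congr 1

lemma gaussian_odd_moment (v : ℝ≥0) {m : ℕ} (hm : Odd m) : ∫ u, u ^ m ∂gaussianReal 0 v = 0 := by
  have h1 : (gaussianReal 0 v).map (fun u => -u) = gaussianReal 0 v := by
    simpa using gaussianReal_map_neg (μ := 0) (v := v)
  have h2 : ∫ u, u ^ m ∂gaussianReal 0 v = ∫ u, (-u) ^ m ∂gaussianReal 0 v := by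
    conv_lhs => rw [← h1]
    rw [integral_map (by fun_prop) (by fun_prop)]
  simp only [hm.neg_pow, integral_neg] at h2
  linarith

/-- Even moments of a shifted centred Gaussian are even polynomials in the shift. -/
lemma gaussian_shift_moment (v : ℝ≥0) (N : ℕ) : ∃ b : ℕ → ℝ, ∀ s : ℝ,
    ∫ u, (s + u) ^ (2 * N) ∂gaussianReal 0 v = ∑ l ∈ Finset.range (N + 1), b l * s ^ (2 * l) := by
  refine ⟨fun l => ((2 * N).choose (2 * l)) * ∫ u, u ^ (2 * N - 2 * l) ∂gaussianReal 0 v,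
    fun s => ?_⟩
  simp only [add_pow]
  have hG : HM (gaussianReal 0 v) := hm_of_isGaussian _
  rw [integral_finsetSum _ fun m _ =>
    (((PG.id.pow _).const_mul _).mul (PG.const _)).integrable hG]
  have h1 : ∀ m, ∫ u, s ^ m * u ^ (2 * N - m) * ((2 * N).choose m : ℝ) ∂gaussianReal 0 v
      = (if m ≤ 2 * N then 1 else 0) *
        (((2 * N).choose m : ℝ) * (∫ u, u ^ (2 * N - m) ∂gaussianReal 0 v) * s ^ m) := fun m => by
    rw [integral_mul_const, integral_const_mul]
    split_ifs with h
    · ring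
    · rw [Nat.choose_eq_zero_of_lt (not_le.1 h)]; simp
  simp only [h1]
  rw [sum_range_even_of_odd_eq_zero]
  · refine Finset.sum_congr rfl fun l hl => ?_
    rw [if_pos (by have := Finset.mem_range.1 hl; omega), one_mul]
  · intro l
    split_ifs with h
    · rw [gaussian_odd_moment]
      · simp
      · rw [Nat.odd_iff]; omega
    · simp

lemma hB_abs_sub_le {K : ConvexBody E} (hK : ∀ x, hB K (-x) = hB K x) {R : ℝ}
    (hR : ∀ y, |hB K y| ≤ R * ‖y‖) (c : ℝ) (x z : E) :
    |hB K (c • x + z) - |c| * hB K x| ≤ R * ‖z‖ := by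
  have h1 : hB K (c • x) = |c| * hB K x := by
    rcases le_total 0 c with h | h
    · rw [abs_of_nonneg h, hB_smul h]
    · rw [abs_of_nonpos h, ← hK, ← neg_smul, hB_smul (by linarith)]
  rw [← h1]
  have h2 := hB_add_le K (c • x) z
  have h3 := hB_add_le K (c • x + z) (-z)
  rw [add_neg_cancel_right, hK] at h3
  have h4 := (le_abs_self _).trans (hR z)
  rw [abs_le]
  constructor <;> linarith

lemma exists_hB_bound (K : ConvexBody E) : ∃ R, 0 ≤ R ∧ ∀ y, |hB K y| ≤ R * ‖y‖ := by
  obtain ⟨C, hC, h⟩ := K.isBounded.exists_pos_norm_le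
  refine ⟨C, hC.le, fun y => ?_⟩
  obtain ⟨z, hz, e⟩ := exists_hB K y
  rw [← e]
  refine (abs_real_inner_le_norm y z).trans ?_
  rw [mul_comm]
  exact mul_le_mul_of_nonneg_right (h z hz) (norm_nonneg _)

lemma PG.hB (K : ConvexBody E) : PG (hB K) := by
  obtain ⟨R, hR, h⟩ := exists_hB_bound K
  exact PG.of_le (C := R) PG.id (continuous_hB K) fun x => (h x).trans (by
    gcongr; linarith [norm_nonneg x])

lemma gaussian_moment_ratio : Tendsto (fun N : ℕ =>
    (∫ u, u ^ (2 * N + 2) ∂gaussianReal 0 1) / ∫ u, |u| ^ (2 * N + 3) ∂gaussianReal 0 1)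
    atTop (𝓝 0) := by
  have h2 : Tendsto (fun N : ℕ => (√(2 * N + 2))⁻¹) atTop (𝓝 0) := by
    refine (Real.tendsto_sqrt_atTop.comp ?_).inv_tendsto_atTop
    exact tendsto_atTop_add_const_right _ _
      (tendsto_natCast_atTop_atTop.const_mul_atTop two_pos)
  refine squeeze_zero (fun N => div_nonneg (integral_nonneg fun u => ?_)
    (gaussian_abs_moment_pos _).le) (fun N => ?_) h2
  · exact Even.pow_nonneg ⟨N + 1, by ring⟩ u
  · rw [div_le_iff₀ (gaussian_abs_moment_pos _)]
    set c := √(2 * (N : ℝ) + 2) with hc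
    have hcc : c ^ 2 = 2 * N + 2 := Real.sq_sqrt (by positivity)
    have hc0 : 0 < c := Real.sqrt_pos.2 (by positivity)
    have hm := gaussian_abs_moment_succ (2 * N + 1)
    have hp := gaussian_abs_moment_pos (2 * N + 1)
    set m1 := ∫ u, |u| ^ (2 * N + 1) ∂gaussianReal 0 1
    have hG : HM (gaussianReal 0 1) := hm_of_isGaussian _
    have hi : ∀ k, Integrable (fun u : ℝ => |u| ^ k) (gaussianReal 0 1) := fun k =>
      (PG.id.abs.pow k).integrable hG
    have h3 : ∫ u, 2 * |u| ^ (2 * N + 2) ∂gaussianReal 0 1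
        ≤ ∫ u, (c * |u| ^ (2 * N + 1) + c⁻¹ * |u| ^ (2 * N + 3)) ∂gaussianReal 0 1 := by
      refine integral_mono ((hi _).const_mul _) (((hi _).const_mul _).add ((hi _).const_mul _))
        fun u => ?_
      have h4 : 0 ≤ |u| ^ (2 * N + 1) * (c⁻¹ * (c - |u|) ^ 2) := by positivity
      have h5 : |u| ^ (2 * N + 1) * (c⁻¹ * (c - |u|) ^ 2) = c * |u| ^ (2 * N + 1)
          + c⁻¹ * |u| ^ (2 * N + 3) - 2 * |u| ^ (2 * N + 2) := by
        field_simp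
        ring
      simp only
      linarith
    rw [integral_const_mul, integral_add ((hi _).const_mul _) ((hi _).const_mul _),
      integral_const_mul, integral_const_mul] at h3
    have h6 : ∀ u : ℝ, |u| ^ (2 * N + 2) = u ^ (2 * N + 2) := fun u =>
      Even.pow_abs ⟨N + 1, by ring⟩ u
    simp only [h6] at h3
    rw [show 2 * N + 1 + 2 = 2 * N + 3 by ring] at hm
    rw [hm] at h3 ⊢
    push_cast at h3 ⊢
    have h7 : c⁻¹ * ((2 * (N : ℝ) + 1 + 1) * m1) = c * m1 := by
      rw [show 2 * (N : ℝ) + 1 + 1 = c ^ 2 by rw [hcc]; ring]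
      field_simp
    rw [h7] at h3 ⊢
    linarith

variable {d : ℕ} (b : OrthonormalBasis (Fin d) ℝ E)

/-- The evaluation at `x` of a matrix, given as a tuple of columns. -/
def evM (x : E) : PiLp 2 (fun _ : Fin d => E) →L[ℝ] E :=
  ∑ i, ⟪b i, x⟫ • PiLp.proj 2 (𝕜 := ℝ) (fun _ : Fin d => E) i

/-- The identity matrix. -/
def idM : PiLp 2 (fun _ : Fin d => E) := WithLp.toLp 2 fun i => b i

lemma evM_apply (x : E) (A : PiLp 2 (fun _ : Fin d => E)) :
    evM b x A = ∑ i, ⟪b i, x⟫ • A i := by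
  simp [evM]

lemma evM_add (x y : E) (A : PiLp 2 (fun _ : Fin d => E)) :
    evM b (x + y) A = evM b x A + evM b y A := by
  simp [evM_apply, inner_add_right, add_smul, Finset.sum_add_distrib]

lemma evM_smul (c : ℝ) (x : E) (A : PiLp 2 (fun _ : Fin d => E)) :
    evM b (c • x) A = c • evM b x A := by
  simp [evM_apply, inner_smul_right, Finset.smul_sum, smul_smul]

lemma evM_adjoint (x s : E) :
    (evM b x).adjoint s = WithLp.toLp 2 fun i => ⟪b i, x⟫ • s := by
  refine ext_inner_right ℝ fun A => ?_
  rw [ContinuousLinearMap.adjoint_inner_left, evM_apply, PiLp.inner_apply, inner_sum]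
  simp [inner_smul_left, inner_smul_right]

lemma sum_inner_sq (x : E) : ∑ i, ⟪b i, x⟫ ^ 2 = ‖x‖ ^ 2 := by
  simpa using b.sum_sq_norm_inner_right x

lemma evM_adjoint_norm {x : E} (hx : ‖x‖ = 1) (s : E) : ‖(evM b x).adjoint s‖ = ‖s‖ := by
  rw [← sq_eq_sq₀ (norm_nonneg _) (norm_nonneg _), evM_adjoint, PiLp.norm_sq_eq_of_L2]
  simp only [norm_smul, mul_pow, Real.norm_eq_abs, sq_abs]
  rw [← Finset.sum_mul, sum_inner_sq, hx]
  simp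

lemma evM_idM (x : E) : evM b x (idM b) = x := by
  rw [evM_apply]
  exact b.sum_repr' x

lemma norm_idM : ‖idM b‖ ^ 2 = d := by
  rw [PiLp.norm_sq_eq_of_L2]
  simp [idM]

lemma inner_idM_adjoint (x s : E) : ⟪idM b, (evM b x).adjoint s⟫ = ⟪x, s⟫ := by
  rw [ContinuousLinearMap.adjoint_inner_right, evM_idM]

/-- The unnormalized mollified support function. -/
def molM (h : E → ℝ) (N : ℕ) (x : E) : ℝ :=
  ∫ A, h (evM b x A) * ⟪idM b, A⟫ ^ (2 * N) ∂stdGaussian (PiLp 2 (fun _ : Fin d => E))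

lemma molM_eq {h : E → ℝ} (hh : PG h) (N : ℕ) : ∃ β : ℕ → ℝ, ∀ x : E, ‖x‖ = 1 →
    molM b h N x = ∑ l ∈ Finset.range (N + 1),
      β l * ∫ y, h y * ⟪x, y⟫ ^ (2 * l) ∂stdGaussian E := by
  obtain ⟨β, hβ⟩ := gaussian_shift_moment ((d : ℝ≥0) - 1) N
  refine ⟨β, fun x hx => ?_⟩
  set v := idM b - (evM b x).adjoint x with hv
  have hx1 : ⟪x, x⟫ = 1 := by rw [real_inner_self_eq_norm_sq, hx]; norm_num
  have hLL : evM b x ((evM b x).adjoint x) = x := by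
    rw [evM_adjoint, evM_apply]
    simp only [smul_smul, ← sq]
    rw [← Finset.sum_smul, sum_inner_sq, hx]
    simp
  have hLv : evM b x v = 0 := by rw [hv, map_sub, evM_idM, hLL, sub_self]
  have hvn : ‖v‖ ^ 2 = d - 1 := by
    rw [hv, norm_sub_sq_real, norm_idM, inner_idM_adjoint, evM_adjoint_norm b hx, hx, hx1]
    norm_num
    ring
  have hvn' : ‖v‖₊ ^ 2 = (d : ℝ≥0) - 1 := by
    have h1 : (1 : ℝ≥0) ≤ d := by
      have := sq_nonneg ‖v‖
      rw [hvn] at this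
      exact_mod_cast sub_nonneg.1 this
    ext
    rw [NNReal.coe_sub h1]
    simpa using hvn
  have hf : PG (fun p : E × ℝ => h p.1 * (⟪x, p.1⟫ + p.2) ^ (2 * N)) :=
    (hh.comp PG.fst).mul ((((PG.const x).inner PG.fst).add PG.snd).pow _)
  have key := integral_stdGaussian_pair (evM b x) (innerSL ℝ v) (fun s t => by
    rw [innerSL_adjoint_real, inner_smul_right, ContinuousLinearMap.adjoint_inner_left, hLv]
    simp) hf
  have e1 : ∀ A, ⟪x, evM b x A⟫ + innerSL ℝ v A = ⟪idM b, A⟫ := fun A => by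
    rw [innerSL_apply_apply, hv, inner_sub_left, ContinuousLinearMap.adjoint_inner_left]
    ring
  simp only [e1] at key
  have hm : (stdGaussian (PiLp 2 (fun _ : Fin d => E))).map (innerSL ℝ v)
      = gaussianReal 0 ((d : ℝ≥0) - 1) := by
    rw [← hvn']
    exact stdGaussian_map_inner v
  rw [molM, key, stdGaussian_map_coisometry _ (evM_adjoint_norm b hx), hm]
  simp only [integral_const_mul, hβ, Finset.mul_sum]
  rw [integral_finsetSum]
  · refine Finset.sum_congr rfl fun l _ => ?_
    rw [← integral_const_mul]
    congr 1; ext y; ring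
  · intro l _
    exact (hh.mul ((((PG.const x).inner PG.id).pow _).const_mul _)).integrable
      (hm_of_isGaussian _)

lemma molM_tendsto {K : ConvexBody E} (hK : ∀ x, hB K (-x) = hB K x) (hd : 0 < d) (x : E) :
    Tendsto (fun N : ℕ => (√d / (√d ^ (2 * N + 2) * ∫ u, |u| ^ (2 * N + 3) ∂gaussianReal 0 1)) *
      molM b (hB K) (N + 1) x) atTop (𝓝 (hB K x)) := by
  obtain ⟨R, hR0, hR⟩ := exists_hB_bound K
  set w := idM b
  have hd' : (0 : ℝ) < d := by exact_mod_cast hd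
  have hsd : 0 < √(d : ℝ) := Real.sqrt_pos.2 hd'
  have hw : ‖w‖ = √d := by rw [← norm_idM b, Real.sqrt_sq (norm_nonneg _)]
  set M : PiLp 2 (fun _ : Fin d => E) →L[ℝ] E :=
    evM b x - (d : ℝ)⁻¹ • (innerSL ℝ w).smulRight x with hM
  have hMA : ∀ A, evM b x A = ((d : ℝ)⁻¹ * ⟪w, A⟫) • x + M A := fun A => by
    simp [hM, smul_smul]
  have hMw : M w = 0 := by
    have : ⟪w, w⟫ = d := by rw [real_inner_self_eq_norm_sq]; exact norm_idM b
    simp only [hM, ContinuousLinearMap.sub_apply, ContinuousLinearMap.smul_apply,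
      ContinuousLinearMap.smulRight_apply, innerSL_apply_apply, this, smul_smul,
      inv_mul_cancel₀ hd'.ne', one_smul]
    rw [sub_eq_zero]
    exact evM_idM b x
  have hG : HM (stdGaussian (PiLp 2 (fun _ : Fin d => E))) := hm_of_isGaussian _
  set C := ∫ A, ‖M A‖ ∂stdGaussian (PiLp 2 (fun _ : Fin d => E)) with hC
  have pgM : PG (fun A => ‖M A‖) := (PG.clm M).norm
  have pgw : PG (fun A => ⟪w, A⟫) := (PG.const w).inner PG.id
  set me := fun N : ℕ => ∫ u, u ^ (2 * N + 2) ∂gaussianReal 0 1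
  set mo := fun N : ℕ => ∫ u, |u| ^ (2 * N + 3) ∂gaussianReal 0 1
  have hmo : ∀ N, 0 < mo N := fun N => gaussian_abs_moment_pos _
  have hprod : ∀ N : ℕ, ∫ A, ⟪w, A⟫ ^ (2 * N + 2) * ‖M A‖
      ∂stdGaussian (PiLp 2 (fun _ : Fin d => E)) = √d ^ (2 * N + 2) * me N * C := fun N => by
    have hf : PG (fun p : ℝ × E => p.1 ^ (2 * N + 2) * ‖p.2‖) := (PG.fst.pow _).mul PG.snd.norm
    have key := integral_stdGaussian_pair (innerSL ℝ w) M (fun s t => by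
      rw [innerSL_adjoint_real, inner_smul_left, ContinuousLinearMap.adjoint_inner_right, hMw]
      simp) hf
    simp only [innerSL_apply_apply] at key
    rw [key]
    simp only [integral_const_mul, integral_mul_const]
    rw [integral_map (by fun_prop) (by fun_prop), integral_map (by fun_prop) (by fun_prop)]
    simp only [innerSL_apply_apply]
    rw [integral_stdGaussian_inner_eq w (PG.id.pow (2 * N + 2)), hw]
    simp only [mul_pow, integral_const_mul]
    rfl
  have habs : ∀ N : ℕ, ∫ A, |⟪w, A⟫| ^ (2 * N + 3)
      ∂stdGaussian (PiLp 2 (fun _ : Fin d => E)) = √d ^ (2 * N + 3) * mo N := fun N => by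
    rw [integral_stdGaussian_inner_eq w (PG.id.abs.pow (2 * N + 3)), hw]
    simp only [abs_mul, mul_pow, integral_const_mul, abs_of_pos hsd]
    rfl
  have hest : ∀ N : ℕ, |molM b (hB K) (N + 1) x - (d : ℝ)⁻¹ * (√d ^ (2 * N + 3) * mo N) * hB K x|
      ≤ R * (√d ^ (2 * N + 2) * me N * C) := fun N => by
    have i1 : Integrable (fun A => hB K (evM b x A) * ⟪w, A⟫ ^ (2 * (N + 1)))
        (stdGaussian (PiLp 2 (fun _ : Fin d => E))) :=
      (((PG.hB K).comp (PG.clm _)).mul (pgw.pow _)).integrable hG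
    have i2 : Integrable (fun A => (d : ℝ)⁻¹ * |⟪w, A⟫| ^ (2 * N + 3) * hB K x)
        (stdGaussian (PiLp 2 (fun _ : Fin d => E))) :=
      (((pgw.abs.pow _).const_mul _).mul (PG.const _)).integrable hG
    rw [← habs, ← integral_const_mul, ← integral_mul_const, molM, ← integral_sub i1 i2, ← hprod,
      ← integral_const_mul]
    have i3 : Integrable (fun A => R * (⟪w, A⟫ ^ (2 * N + 2) * ‖M A‖))
        (stdGaussian (PiLp 2 (fun _ : Fin d => E))) :=
      (((pgw.pow _).mul pgM).const_mul R).integrable hG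
    rw [← Real.norm_eq_abs]
    refine norm_integral_le_of_norm_le i3 (.of_forall fun A => ?_)
    have h1 := hB_abs_sub_le hK hR ((d : ℝ)⁻¹ * ⟪w, A⟫) x (M A)
    rw [← hMA, abs_mul, abs_of_pos (inv_pos.2 hd')] at h1
    have hev : ⟪w, A⟫ ^ (2 * N + 2) = |⟪w, A⟫| ^ (2 * N + 2) :=
      (Even.pow_abs ⟨N + 1, by ring⟩ _).symm
    have h2 : hB K (evM b x A) * ⟪w, A⟫ ^ (2 * (N + 1)) - (d : ℝ)⁻¹ * |⟪w, A⟫| ^ (2 * N + 3) * hB K x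
        = |⟪w, A⟫| ^ (2 * N + 2) * (hB K (evM b x A) - (d : ℝ)⁻¹ * |⟪w, A⟫| * hB K x) := by
      rw [show 2 * (N + 1) = 2 * N + 2 by ring, hev]; ring
    rw [h2, hev, norm_mul, Real.norm_of_nonneg (by positivity), Real.norm_eq_abs]
    have := mul_le_mul_of_nonneg_left h1 (by positivity : 0 ≤ |⟪w, A⟫| ^ (2 * N + 2))
    linarith
  have hrat : Tendsto (fun N => √d * R * C * (me N / mo N)) atTop (𝓝 0) := by
    simpa using gaussian_moment_ratio.const_mul (√d * R * C)
  rw [tendsto_iff_norm_sub_tendsto_zero]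
  refine squeeze_zero (fun N => norm_nonneg _) (fun N => ?_) hrat
  have hs : (d : ℝ)⁻¹ * √d ^ 2 = 1 := by rw [Real.sq_sqrt hd'.le]; field_simp
  have hpos : 0 < √(d : ℝ) ^ (2 * N + 2) := by positivity
  have e1 : (√d / (√d ^ (2 * N + 2) * mo N)) * molM b (hB K) (N + 1) x - hB K x
      = (√d / (√d ^ (2 * N + 2) * mo N)) *
        (molM b (hB K) (N + 1) x - (d : ℝ)⁻¹ * (√d ^ (2 * N + 3) * mo N) * hB K x) := by
    have h0 := hmo N
    have : (√d / (√d ^ (2 * N + 2) * mo N)) * ((d : ℝ)⁻¹ * (√d ^ (2 * N + 3) * mo N) * hB K x)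
        = ((d : ℝ)⁻¹ * √d ^ 2) * hB K x := by
      field_simp
      ring
    rw [mul_sub, this, hs, one_mul]
  have hc : 0 ≤ √d / (√d ^ (2 * N + 2) * mo N) := by have := hmo N; positivity
  rw [e1, norm_mul, Real.norm_of_nonneg hc, Real.norm_eq_abs]
  refine (mul_le_mul_of_nonneg_left (hest N) hc).trans (le_of_eq ?_)
  have h0 := hmo N
  field_simp

/-- Symmetric convex bodies are limits of generalized zonoids. -/
lemma exists_genzon_approx {K : ConvexBody E} (hK : ∀ x, hB K (-x) = hB K x)
    (hd : 0 < Module.finrank ℝ E) :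
    ∃ (Kn : ℕ → ConvexBody E) (tp tm : ℕ → E → ℝ), (∀ N, PG (tp N)) ∧ (∀ N, PG (tm N)) ∧
      (∀ N x, hB (Kn N) x + ∫ g, |⟪x, tm N g • g⟫| ∂stdGaussian E
        = ∫ g, |⟪x, tp N g • g⟫| ∂stdGaussian E) ∧ Tendsto Kn atTop (𝓝 K) := by
  set b := stdOrthonormalBasis ℝ E
  set d := Module.finrank ℝ E
  have hsd : 0 < √(d : ℝ) := Real.sqrt_pos.2 (by exact_mod_cast hd)
  set c := fun N : ℕ => √d / (√d ^ (2 * N + 2) * ∫ u, |u| ^ (2 * N + 3) ∂gaussianReal 0 1)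
  have hc : ∀ N, 0 < c N := fun N => by
    have := gaussian_abs_moment_pos (2 * N + 3)
    positivity
  have hG : HM (stdGaussian (PiLp 2 (fun _ : Fin d => E))) := hm_of_isGaussian _
  have pg : ∀ (N : ℕ) (x : E), PG (fun A : PiLp 2 (fun _ : Fin d => E) =>
      hB K (evM b x A) * ⟪idM b, A⟫ ^ (2 * N)) := fun N x =>
    ((PG.hB K).comp (PG.clm _)).mul (((PG.const _).inner PG.id).pow _)
  have hhom : ∀ N (s : ℝ), 0 < s → ∀ x,
      c N * molM b (hB K) (N + 1) (s • x) = s * (c N * molM b (hB K) (N + 1) x) := by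
    intro N s hs x
    have : molM b (hB K) (N + 1) (s • x) = s * molM b (hB K) (N + 1) x := by
      rw [molM, molM, ← integral_const_mul]
      refine integral_congr_ae (.of_forall fun A => ?_)
      simp only [evM_smul, hB_smul hs.le]
      ring
    rw [this]; ring
  have hbody : ∀ N, ∃ L : ConvexBody E, ∀ x, hB L x = c N * molM b (hB K) (N + 1) x := by
    intro N
    refine exists_body_of_sublinear (hhom N) fun x y => ?_
    rw [← mul_add]
    refine mul_le_mul_of_nonneg_left ?_ (hc N).le
    rw [molM, molM, molM, ← integral_add ((pg _ _).integrable hG) ((pg _ _).integrable hG)]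
    refine integral_mono ((pg _ _).integrable hG)
      (((pg _ _).integrable hG).add ((pg _ _).integrable hG)) fun A => ?_
    simp only [evM_add, ← add_mul]
    exact mul_le_mul_of_nonneg_right (hB_add_le _ _ _)
      (Even.pow_nonneg ⟨N + 1, by ring⟩ _)
  choose Kn hKn using hbody
  have hrep : ∀ N, ∃ t : E → ℝ, PG t ∧ ∀ x : E, ‖x‖ = 1 →
      molM b (hB K) (N + 1) x = ∫ g, |⟪x, g⟫| * t g ∂stdGaussian E := by
    intro N
    obtain ⟨β, hβ⟩ := molM_eq b (PG.hB K) (N + 1)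
    obtain ⟨t, ht, ht'⟩ := cos_rep (hm_of_isGaussian (stdGaussian E)) (PG.hB K) (N + 1 + 1) β
    exact ⟨t, ht, fun x hx => (hβ x hx).trans (ht' x hx)⟩
  choose t ht hrep using hrep
  have pgp : ∀ N, PG (fun g => (|t N g| + t N g) * (c N / 2)) := fun N =>
    ((ht N).abs.add (ht N)).mul (PG.const _)
  have pgm : ∀ N, PG (fun g => (|t N g| - t N g) * (c N / 2)) := fun N =>
    ((ht N).abs.sub (ht N)).mul (PG.const _)
  refine ⟨Kn, fun N g => (|t N g| + t N g) * (c N / 2), fun N g => (|t N g| - t N g) * (c N / 2),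
    pgp, pgm, fun N x => ?_, ?_⟩
  · have hun : ∀ x : E, ‖x‖ = 1 → hB (Kn N) x + ∫ g, |⟪x, ((|t N g| - t N g) * (c N / 2)) • g⟫|
        ∂stdGaussian E = ∫ g, |⟪x, ((|t N g| + t N g) * (c N / 2)) • g⟫| ∂stdGaussian E := by
      intro x hx
      rw [hKn, hrep N x hx, ← integral_const_mul, ← integral_add]
      · refine integral_congr_ae (.of_forall fun g => ?_)
        have h1 := hc N
        simp only [inner_smul_right, abs_mul, abs_of_pos (half_pos h1),
          abs_of_nonneg (by linarith [neg_abs_le (t N g)] : 0 ≤ |t N g| + t N g),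
          abs_of_nonneg (by linarith [le_abs_self (t N g)] : 0 ≤ |t N g| - t N g)]
        ring
      · exact ((((PG.const x).inner PG.id).abs.mul (ht N)).const_mul _).integrable
          (hm_of_isGaussian _)
      · exact ((PG.const x).inner ((pgm N).smul PG.id)).abs.integrable (hm_of_isGaussian _)
    rcases eq_or_ne x 0 with rfl | hx
    · simp [hB_zero]
    · have hx' : 0 < ‖x‖ := norm_pos_iff.2 hx
      have h1 := hun (‖x‖⁻¹ • x) (norm_smul_inv_norm hx)
      simp only [inner_smul_left, abs_mul, integral_const_mul, hB_smul (inv_pos.2 hx').le,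
        conj_trivial, abs_of_pos (inv_pos.2 hx')] at h1
      rw [← mul_add] at h1
      exact mul_left_cancel₀ (inv_pos.2 hx').ne' h1
  · refine tendsto_body_of_hB fun x => ?_
    simp only [hKn]
    exact molM_tendsto b hK hd x

end Smoothing

section Slices

variable {E : Type*} [NormedAddCommGroup E] [InnerProductSpace ℝ E]

/-- Orthogonal projection along `v`. -/
def prL (v : E) : E →L[ℝ] E :=
  ContinuousLinearMap.id ℝ E - (‖v‖ ^ 2)⁻¹ • (innerSL ℝ v).smulRight v

lemma prL_apply (v x : E) : prL v x = x - (⟪v, x⟫ / ‖v‖ ^ 2) • v := by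
  simp [prL, smul_smul, div_eq_inv_mul]

lemma inner_prL {v : E} (hv : v ≠ 0) (x : E) : ⟪v, prL v x⟫ = 0 := by
  have : ‖v‖ ^ 2 ≠ 0 := by simpa using hv
  rw [prL_apply, inner_sub_right, inner_smul_right, real_inner_self_eq_norm_sq]
  field_simp
  ring

lemma prL_add (v x : E) : prL v x + (⟪v, x⟫ / ‖v‖ ^ 2) • v = x := by
  rw [prL_apply]; abel

lemma prL_add_smul {v : E} (hv : v ≠ 0) (x : E) (t : ℝ) : prL v (x + t • v) = prL v x := by
  have : ‖v‖ ^ 2 ≠ 0 := by simpa using hv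
  rw [prL_apply, prL_apply, inner_add_right, inner_smul_right, real_inner_self_eq_norm_sq]
  have e : (⟪v, x⟫ + t * ‖v‖ ^ 2) / ‖v‖ ^ 2 = ⟪v, x⟫ / ‖v‖ ^ 2 + t := by field_simp
  rw [e, add_smul]; abel

/-- The projection along `v` as a map to the hyperplane `vᗮ`. -/
def prO {v : E} (hv : v ≠ 0) : E →L[ℝ] (Submodule.span ℝ {v})ᗮ :=
  (prL v).codRestrict _ fun x => Submodule.mem_orthogonal_singleton_iff_inner_right.2 (inner_prL hv x)

lemma mapB_prL {v : E} (hv : v ≠ 0) (K : ConvexBody E) :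
    mapB (prL v) K = mapB (Submodule.subtypeL _) (mapB (prO hv) K) := by
  rw [mapB_mapB]; rfl

/-- A compact convex set contained in a hyperplane, as a translate of a projection. -/
lemma Good.extV_slice {μ : ConvexBody E → ℝ} (hμ : Good μ) {v : E}
    (hH : ∀ K, μ (mapB (prL v) K) = 0) {S : Set E} (hS : Convex ℝ S) (hS' : IsCompact S)
    {c : ℝ} (hc : ∀ x ∈ S, ⟪v, x⟫ = c) : extV μ S = 0 := by
  rcases S.eq_empty_or_nonempty with rfl | hne
  · exact extV_empty μ
  have e := extV_coe μ ⟨S, hS, hS', hne⟩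
  change extV μ S = _ at e
  rw [e, show (⟨S, hS, hS', hne⟩ : ConvexBody E) =
    mapB (prL v) ⟨S, hS, hS', hne⟩ + ptB ((c / ‖v‖ ^ 2) • v) from ?_, hμ.ti.add_ptB, hH]
  apply ConvexBody.ext
  rw [ConvexBody.coe_add, coe_ptB, coe_mapB]
  change S = prL v '' S + _
  ext x
  rw [Set.add_singleton, Set.image_image]
  constructor
  · intro hx
    refine ⟨x, hx, ?_⟩
    change prL v x + _ = x
    rw [← hc x hx, prL_add]
  · rintro ⟨y, hy, rfl⟩
    change prL v y + _ ∈ S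
    rwa [← hc y hy, prL_add]

lemma coe_add_ptB (K : ConvexBody E) (x : E) :
    ((K + ptB x : ConvexBody E) : Set E) = (fun y => y + x) '' K := by
  rw [ConvexBody.coe_add, coe_ptB, Set.add_singleton]

lemma mem_add_segB {K : ConvexBody E} {v y : E} {s : ℝ} (hs : 0 ≤ s) :
    y ∈ ((K + segB (s • v) : ConvexBody E) : Set E) ↔
      ∃ x ∈ (K : Set E), ∃ t, 0 ≤ t ∧ t ≤ s ∧ y = x + t • v := by
  constructor
  · rintro ⟨x, hx, z, hz, rfl⟩
    obtain ⟨t, h0, h1, rfl⟩ := mem_segB.1 hz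
    exact ⟨x, hx, t * s, by positivity, by nlinarith, by simp [smul_smul]⟩
  · rintro ⟨x, hx, t, h0, h1, rfl⟩
    refine ⟨x, hx, _, mem_segB.2 ⟨t / s, by positivity, div_le_one_of_le₀ h1 hs, rfl⟩, ?_⟩
    rcases hs.eq_or_lt with rfl | hs
    · have : t = 0 := le_antisymm h1 h0
      simp [this]
    · simp [smul_smul, hs.ne']

lemma Good.Dv_eq_zero_of_slices {μ : ConvexBody E → ℝ} (hμ : Good μ) {v : E} (hv : v ≠ 0)
    (hH : ∀ K, μ (mapB (prL v) K) = 0) (hC : ∀ K, μ (mapB (prL v) K + segB v) = 0)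
    (K : ConvexBody E) : _root_.Dv v μ K = 0 := by
  have hN : 0 < ‖v‖ ^ 2 := by positivity
  set N := ‖v‖ ^ 2 with hNdef
  set c := hB K v with hc
  set s := (c + hB K (-v)) / N with hs
  have hup : ∀ x ∈ (K : Set E), ⟪v, x⟫ ≤ c := fun x hx => inner_le_hB v hx
  have hlo : ∀ x ∈ (K : Set E), c - s * N ≤ ⟪v, x⟫ := fun x hx => by
    have := inner_le_hB (-v) hx
    rw [inner_neg_left] at this
    rw [hs, div_mul_cancel₀ _ hN.ne']; linarith
  have hs0 : 0 ≤ s := by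
    obtain ⟨x, hx⟩ := K.nonempty
    have := hup x hx
    have := hlo x hx
    by_contra! h
    nlinarith
  have hF : ∀ x t, ⟪v, x + t • v⟫ = ⟪v, x⟫ + t * N := fun x t => by
    rw [inner_add_right, inner_smul_right, real_inner_self_eq_norm_sq]
  let f : E →L[ℝ] ℝ := innerSL ℝ v
  have hf : ∀ x, f x = ⟪v, x⟫ := fun x => rfl
  set S : ConvexBody E := K + segB (s • v) with hSdef
  set S' : ConvexBody E := K + segB ((s + 1) • v) with hSdef'
  have memS : ∀ y, y ∈ (S : Set E) ↔ _ := fun y => mem_add_segB (K := K) (v := v) (y := y) hs0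
  have memS' : ∀ y, y ∈ (S' : Set E) ↔ _ :=
    fun y => mem_add_segB (K := K) (v := v) (y := y) (by linarith : (0:ℝ) ≤ s + 1)
  have cle : ∀ d, IsClosed {x | f x ≤ d} := fun d => isClosed_le f.continuous continuous_const
  have cge : ∀ d, IsClosed {x | d ≤ f x} := fun d => isClosed_le continuous_const f.continuous
  have ceq : ∀ d, IsClosed {x | f x = d} := fun d => isClosed_eq f.continuous continuous_const
  have vle : ∀ d, Convex ℝ {x | f x ≤ d} := fun d => convex_halfSpace_le f.toLinearMap.isLinear d
  have vge : ∀ d, Convex ℝ {x | d ≤ f x} := fun d => convex_halfSpace_ge f.toLinearMap.isLinear d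
  have veq : ∀ d, Convex ℝ {x | f x = d} := fun d => convex_hyperplane f.toLinearMap.isLinear d
  have cut1 := hμ.val.extV_cut S.convex S.isCompact f c
  have cut2 := hμ.val.extV_cut S'.convex S'.isCompact f c
  have cut3 := hμ.val.extV_cut (S'.convex.inter (vge c)) (S'.isCompact.inter_right (cge c)) f (c + N)
  have z1 : extV μ ((S : Set E) ∩ {x | f x = c}) = 0 :=
    hμ.extV_slice hH (S.convex.inter (veq c)) (S.isCompact.inter_right (ceq c)) fun x hx => hx.2
  have z2 : extV μ ((S' : Set E) ∩ {x | f x = c}) = 0 :=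
    hμ.extV_slice hH (S'.convex.inter (veq c)) (S'.isCompact.inter_right (ceq c)) fun x hx => hx.2
  have z3 : extV μ ((S' : Set E) ∩ {x | c ≤ f x} ∩ {x | f x = c + N}) = 0 :=
    hμ.extV_slice hH ((S'.convex.inter (vge c)).inter (veq _))
      ((S'.isCompact.inter_right (cge c)).inter_right (ceq _)) fun x hx => hx.2
  have e1 : (S' : Set E) ∩ {x | f x ≤ c} = (S : Set E) ∩ {x | f x ≤ c} := by
    ext y
    constructor
    · rintro ⟨hy, hy'⟩
      refine ⟨?_, hy'⟩
      obtain ⟨x, hx, t, h0, h1, rfl⟩ := (memS' y).1 hy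
      refine (memS _).2 ⟨x, hx, t, h0, ?_, rfl⟩
      have hy' : ⟪v, x + t • v⟫ ≤ c := hy'
      rw [hF] at hy'
      have := hlo x hx
      by_contra! h
      nlinarith
    · rintro ⟨hy, hy'⟩
      refine ⟨?_, hy'⟩
      obtain ⟨x, hx, t, h0, h1, rfl⟩ := (memS y).1 hy
      exact (memS' _).2 ⟨x, hx, t, h0, by linarith, rfl⟩
  have e2 : (S' : Set E) ∩ {x | c ≤ f x} ∩ {x | f x ≤ c + N} =
      (mapB (prL v) K + segB v + ptB ((c / N) • v) : ConvexBody E) := by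
    ext y
    rw [coe_add_ptB]
    constructor
    · rintro ⟨⟨hy, hy1⟩, hy2⟩
      obtain ⟨x, hx, t, h0, h1, rfl⟩ := (memS' y).1 hy
      have hy1 : c ≤ ⟪v, x + t • v⟫ := hy1
      have hy2 : ⟪v, x + t • v⟫ ≤ c + N := hy2
      refine ⟨_, ⟨prL v x, ⟨x, hx, rfl⟩, _, mem_segB.2 ⟨⟪v, x + t • v⟫ / N - c / N, ?_, ?_, rfl⟩,
        rfl⟩, ?_⟩
      · rw [← sub_div]; exact div_nonneg (by linarith) hN.le
      · rw [← sub_div]; exact div_le_one_of_le₀ (by linarith) hN.le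
      · have := prL_add v (x + t • v)
        rw [prL_add_smul hv] at this
        change prL v x + (_ - _) • v + _ = _
        rw [← hNdef] at this
        rw [sub_smul]
        conv_rhs => rw [← this]
        abel
    · rintro ⟨_, ⟨_, ⟨x, hx, rfl⟩, _, hz, rfl⟩, rfl⟩
      obtain ⟨t, h0, h1, rfl⟩ := mem_segB.1 hz
      change prL v x + t • v + (c / N) • v ∈ _
      have hx1 := hup x hx
      have hx2 := hlo x hx
      have e : prL v x + t • v + (c / N) • v = x + (t + (c - ⟪v, x⟫) / N) • v := by
        conv_rhs => rw [← prL_add v x, prL_add]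
        rw [add_smul, sub_div, sub_smul, prL_apply]
        abel
      have e' : ⟪v, x + (t + (c - ⟪v, x⟫) / N) • v⟫ = c + t * N := by
        rw [hF]; field_simp; ring
      rw [e]
      refine ⟨⟨(memS' _).2 ⟨x, hx, _, ?_, ?_, rfl⟩, ?_⟩, ?_⟩
      · have : 0 ≤ (c - ⟪v, x⟫) / N := div_nonneg (by linarith) hN.le
        linarith
      · have : (c - ⟪v, x⟫) / N ≤ s := by rw [div_le_iff₀ hN]; linarith
        linarith
      · change c ≤ ⟪v, _⟫
        rw [e']; nlinarith
      · change ⟪v, _⟫ ≤ _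
        rw [e']; nlinarith
  have hne : ((S : Set E) ∩ {x | c ≤ f x}).Nonempty := by
    obtain ⟨x, hx⟩ := K.nonempty
    refine ⟨x + s • v, (memS _).2 ⟨x, hx, s, hs0, le_rfl, rfl⟩, ?_⟩
    change c ≤ ⟪v, _⟫
    rw [hF]; have := hlo x hx; linarith
  let T : ConvexBody E := ⟨_, S.convex.inter (vge c), S.isCompact.inter_right (cge c), hne⟩
  have hT : (S : Set E) ∩ {x | c ≤ f x} = (T : Set E) := rfl
  have e3 : (S' : Set E) ∩ {x | c ≤ f x} ∩ {x | c + N ≤ f x} = (T + ptB v : ConvexBody E) := by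
    ext y
    rw [coe_add_ptB, ← hT]
    constructor
    · rintro ⟨⟨hy, hy1⟩, hy2⟩
      obtain ⟨x, hx, t, h0, h1, rfl⟩ := (memS' y).1 hy
      have hy2 : c + N ≤ ⟪v, x + t • v⟫ := hy2
      rw [hF] at hy2
      have hx1 := hup x hx
      refine ⟨x + (t - 1) • v, ⟨(memS _).2 ⟨x, hx, t - 1, ?_, by linarith, rfl⟩, ?_⟩, ?_⟩
      · by_contra! h
        nlinarith
      · change c ≤ ⟪v, _⟫
        rw [hF]; linarith
      · change x + (t - 1) • v + v = _
        rw [sub_smul, one_smul]; abel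
    · rintro ⟨_, ⟨hy, hy1⟩, rfl⟩
      obtain ⟨x, hx, t, h0, h1, rfl⟩ := (memS _).1 hy
      change x + t • v + v ∈ _
      have hy1 : c ≤ ⟪v, x + t • v⟫ := hy1
      rw [hF] at hy1
      have e : x + t • v + v = x + (t + 1) • v := by rw [add_smul, one_smul]; abel
      rw [e]
      refine ⟨⟨(memS' _).2 ⟨x, hx, t + 1, by linarith, by linarith, rfl⟩, ?_⟩, ?_⟩
      · change c ≤ ⟪v, _⟫
        rw [hF]; nlinarith
      · change c + N ≤ ⟪v, _⟫
        rw [hF]; nlinarith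
  rw [e2, extV_coe, hμ.ti.add_ptB, hC, e3, extV_coe, hμ.ti.add_ptB, z3] at cut3
  rw [extV_coe, z1, hT, extV_coe] at cut1
  rw [extV_coe, z2, e1] at cut2
  have d1 := hμ.Dv_smul_nonneg v hs0 K
  have d2 := hμ.Dv_smul_nonneg v (by linarith : (0:ℝ) ≤ s + 1) K
  simp only [_root_.Dv] at d1 d2 ⊢
  rw [← hSdef] at d1
  rw [← hSdef'] at d2
  linarith

lemma Good.eq_of_isZon [FiniteDimensional ℝ E] [MeasurableSpace E] [BorelSpace E]
    {μ : ConvexBody E → ℝ} (hμ : Good μ) (hD : ∀ v K, _root_.Dv v μ K = 0)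
    {Ω : Type*} [MeasurableSpace Ω] {γ : Measure Ω} [IsFiniteMeasure γ] {φ : Ω → E}
    (hφ : Measurable φ) (hi : Integrable φ γ) {Z : ConvexBody E} (hZ : IsZon γ φ Z)
    (K : ConvexBody E) : μ (K + Z) = μ K := by
  refine hZ.induction hφ hi (P := fun L => μ L = μ K) (isClosed_eq hμ.cont continuous_const) ?_ rfl
  intro L v h
  rw [hμ.add_sseg, hD, h]; ring

lemma Good.eq_zero_of_symm [FiniteDimensional ℝ E] [MeasurableSpace E] [BorelSpace E]
    {μ : ConvexBody E → ℝ} (hμ : Good μ) (hD : ∀ v K, _root_.Dv v μ K = 0) (h0 : μ 0 = 0)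
    (hd : 0 < Module.finrank ℝ E) {K : ConvexBody E} (hK : ∀ x, hB K (-x) = hB K x) : μ K = 0 := by
  obtain ⟨Kn, tp, tm, hp, hm, he, hlim⟩ := exists_genzon_approx hK hd
  have hn : ∀ N, μ (Kn N) = 0 := by
    intro N
    have PGs : ∀ t : E → ℝ, PG t → PG (fun g : E => t g • g) := fun t ht => ht.smul PG.id
    have ip := (PGs _ (hp N)).integrable (hm_of_isGaussian (ProbabilityTheory.stdGaussian E))
    have im := (PGs _ (hm N)).integrable (hm_of_isGaussian (ProbabilityTheory.stdGaussian E))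
    obtain ⟨Zp, hZp⟩ := exists_isZon ip
    obtain ⟨Zm, hZm⟩ := exists_isZon im
    have e : Kn N + Zm = 0 + Zp := by
      refine body_eq_of_hB_eq fun x => ?_
      rw [hB_add, hB_add, hB_zero_body, zero_add, hZp, hZm, he]
    have := hμ.eq_of_isZon hD (PGs _ (hm N)).1.measurable im hZm (Kn N)
    rw [e, hμ.eq_of_isZon hD (PGs _ (hp N)).1.measurable ip hZp, h0] at this
    exact this.symm
  refine tendsto_nhds_unique ((hμ.cont.tendsto K).comp hlim) ?_
  simp [Function.comp_def, hn]

end Slices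

section HalfSpaces

variable {E : Type*} [NormedAddCommGroup E] [InnerProductSpace ℝ E]

lemma extV_inter_le_eq_zero {μ : ConvexBody E → ℝ} {ι : Type*} [DecidableEq ι] (f : ι → E →L[ℝ] ℝ)
    (c : ι → ℝ) (hcut : ∀ S : Set E, Convex ℝ S → IsCompact S → ∀ i,
      extV μ S = extV μ (S ∩ {x | f i x ≤ c i}) + extV μ (S ∩ {x | c i ≤ f i x}))
    (F : Finset ι) : ∀ T : Set E, Convex ℝ T → IsCompact T →
      (∀ J ⊆ F, extV μ (T ∩ {x | ∀ j ∈ J, c j ≤ f j x}) = 0) →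
        extV μ (T ∩ {x | ∀ j ∈ F, f j x ≤ c j}) = 0 := by
  induction F using Finset.induction_on with
  | empty =>
    intro T _ _ h
    simpa using h ∅ (by simp)
  | insert a F ha ih =>
    intro T hT hT' h
    have cle : IsClosed {x | f a x ≤ c a} := isClosed_le (f a).continuous continuous_const
    have vle : Convex ℝ {x | f a x ≤ c a} := convex_halfSpace_le (f a).toLinearMap.isLinear _
    have e : T ∩ {x | ∀ j ∈ insert a F, f j x ≤ c j} =
        T ∩ {x | f a x ≤ c a} ∩ {x | ∀ j ∈ F, f j x ≤ c j} := by
      ext x; simp [and_assoc]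
    rw [e]
    refine ih _ (hT.inter vle) (hT'.inter_right cle) fun J hJ => ?_
    have hc : IsClosed {x | ∀ j ∈ J, c j ≤ f j x} := by
      simp only [Set.ofPred_forall]
      exact isClosed_biInter fun j _ => isClosed_le continuous_const (f j).continuous
    have hv : Convex ℝ {x | ∀ j ∈ J, c j ≤ f j x} := by
      simp only [Set.ofPred_forall]
      exact convex_iInter₂ fun j _ => convex_halfSpace_ge (f j).toLinearMap.isLinear _
    have h1 := hcut _ (hT.inter hv) (hT'.inter_right hc) a
    have h2 := h J (hJ.trans (Finset.subset_insert a F))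
    have h3 := h (insert a J) (Finset.insert_subset_insert a hJ)
    have e3 : T ∩ {x | ∀ j ∈ insert a J, c j ≤ f j x} =
        T ∩ {x | ∀ j ∈ J, c j ≤ f j x} ∩ {x | c a ≤ f a x} := by
      ext x; simp only [Set.mem_inter_iff, Set.mem_ofPred_eq, Finset.forall_mem_insert]; tauto
    rw [e3] at h3
    rw [h2, h3, add_zero, Set.inter_right_comm] at h1
    exact h1.symm

lemma norm_add_sq_le_of_opposite {C : ℝ} (hC : 0 < C) {u w x x0 : E} (hu : ‖u‖ = 1) (hw : ‖w‖ = 1)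
    (hx : ‖x‖ ≤ 8 * C) (hx0 : ‖x0‖ ≤ 8 * C) (h1 : 6 * C ≤ ⟪u, x⟫) (h2 : 6 * C ≤ ⟪w, -x⟫)
    (h3 : 6 * C ≤ ⟪u, x0⟫) (h4 : 6 * C ≤ ⟪w, x0⟫) : False := by
  have a1 : 12 * C ≤ ‖x0 + x‖ := by
    have := real_inner_le_norm u (x0 + x)
    rw [hu, one_mul, inner_add_right] at this
    linarith
  have a2 : 12 * C ≤ ‖x0 - x‖ := by
    have := real_inner_le_norm w (x0 - x)
    rw [hw, one_mul, sub_eq_add_neg, inner_add_right, ← sub_eq_add_neg] at this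
    linarith
  have := parallelogram_law_with_norm ℝ x0 x
  have := norm_nonneg x
  have := norm_nonneg x0
  nlinarith

lemma Good.extV_ball_inter [FiniteDimensional ℝ E] {μ : ConvexBody E → ℝ} (hμ : Good μ)
    (he : EvenVal μ) (hH : ∀ v : E, v ≠ 0 → ∀ K, μ (mapB (prL v) K) = 0)
    (hs : ∀ K : ConvexBody E, (∀ x, hB K (-x) = hB K x) → μ K = 0) {C : ℝ} (hC : 0 < C)
    (c : Metric.sphere (0 : E) 1 → ℝ) (hc : ∀ u, 6 * C ≤ c u) (F : Finset (Metric.sphere (0 : E) 1)) :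
    extV μ (Metric.closedBall (0 : E) (8 * C) ∩ {x | ∀ u ∈ F, ⟪(u : E), x⟫ ≤ c u}) = 0 := by
  classical
  let f : Metric.sphere (0 : E) 1 → E →L[ℝ] ℝ := fun u => innerSL ℝ (u : E)
  have hn : ∀ u : Metric.sphere (0 : E) 1, ‖(u : E)‖ = 1 := fun u => by simp
  have hcut : ∀ S : Set E, Convex ℝ S → IsCompact S → ∀ u,
      extV μ S = extV μ (S ∩ {x | f u x ≤ c u}) + extV μ (S ∩ {x | c u ≤ f u x}) := by
    intro S hS hS' u
    have z : extV μ (S ∩ {x | f u x = c u}) = 0 := by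
      refine hμ.extV_slice (v := (u : E)) (c := c u) (hH _ ?_)
        (hS.inter (convex_hyperplane (f u).toLinearMap.isLinear _))
        (hS'.inter_right (isClosed_eq (f u).continuous continuous_const)) fun x hx => hx.2
      have := hn u
      intro h; simp [h] at this
    rw [← hμ.val.extV_cut hS hS', z, add_zero]
  have hcut' : ∀ S : Set E, Convex ℝ S → IsCompact S → ∀ u,
      extV μ S = extV μ (S ∩ {x | (-f u) x ≤ -c u}) + extV μ (S ∩ {x | -c u ≤ (-f u) x}) := by
    intro S hS hS' u
    rw [hcut S hS hS' u, add_comm]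
    simp
  have hM := convex_closedBall (0 : E) (8 * C)
  have hM' := isCompact_closedBall (0 : E) (8 * C)
  set M := Metric.closedBall (0 : E) (8 * C)
  have memM : ∀ x, x ∈ M ↔ ‖x‖ ≤ 8 * C := fun x => by simp [M]
  refine extV_inter_le_eq_zero f c hcut F M hM hM' fun J _ => ?_
  rcases (M ∩ {x | ∀ j ∈ J, c j ≤ f j x}).eq_empty_or_nonempty with h | ⟨x0, hx0M, hx0⟩
  · rw [h, extV_empty]
  have key := extV_inter_le_eq_zero (fun u => -f u) (fun u => -c u) hcut' J M hM hM' ?_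
  · simpa using key
  intro J' hJ'
  have e : {x : E | ∀ j ∈ J', -c j ≤ (-f j) x} = {x | ∀ j ∈ J', f j x ≤ c j} := by
    ext x; simp
  rw [e]
  have hPc : IsClosed {x | ∀ j ∈ J', f j x ≤ c j} := by
    simp only [Set.ofPred_forall]
    exact isClosed_biInter fun j _ => isClosed_le (f j).continuous continuous_const
  have hPv : Convex ℝ {x | ∀ j ∈ J', f j x ≤ c j} := by
    simp only [Set.ofPred_forall]
    exact convex_iInter₂ fun j _ => convex_halfSpace_le (f j).toLinearMap.isLinear _
  have z0 : (0 : E) ∈ M ∩ {x | ∀ j ∈ J', f j x ≤ c j} := by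
    refine ⟨by rw [memM]; simp [hC.le], fun j _ => ?_⟩
    have := hc j
    simp only [map_zero]; linarith
  let P : ConvexBody E := ⟨_, hM.inter hPv, hM'.inter_right hPc, ⟨0, z0⟩⟩
  let Mb : ConvexBody E := ⟨M, hM, hM', ⟨0, z0.1⟩⟩
  let I : ConvexBody E := ⟨(P : Set E) ∩ (P.reflect : Set E), P.convex.inter P.reflect.convex,
    P.isCompact.inter P.reflect.isCompact, ⟨0, z0, by
      change -(0:E) ∈ (P : Set E); rw [neg_zero]; exact z0⟩⟩
  have symm : ∀ L : ConvexBody E, (∀ x ∈ (L : Set E), -x ∈ (L : Set E)) → μ L = 0 := by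
    intro L hL
    have : L.reflect = L := by
      apply ConvexBody.ext
      ext x
      change -x ∈ (L : Set E) ↔ _
      exact ⟨fun h => by simpa using hL _ h, hL x⟩
    exact hs L fun x => by rw [← hB_reflect, this]
  have hMb : μ Mb = 0 := symm Mb fun x hx => by
    change -x ∈ M; have hx : x ∈ M := hx; rw [memM] at hx ⊢; simpa using hx
  have hI : μ I = 0 := symm I fun x hx => by
    refine ⟨hx.2, ?_⟩
    change - -x ∈ (P : Set E)
    simpa using hx.1
  have hv := hμ.val P P.reflect Mb I ?_ rfl
  · rw [hMb, hI, he P] at hv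
    have e2 := extV_coe μ P
    change extV μ (M ∩ _) = _ at e2
    rw [e2]; linarith
  ext x
  constructor
  · intro hx
    have hx : x ∈ M := hx
    by_contra hcon
    rw [Set.mem_union, not_or] at hcon
    obtain ⟨h1, h2⟩ := hcon
    have h1 : ¬ (x ∈ M ∧ ∀ j ∈ J', f j x ≤ c j) := h1
    have h2 : ¬ (-x ∈ M ∧ ∀ j ∈ J', f j (-x) ≤ c j) := h2
    have hxM : -x ∈ M := by rw [memM] at hx ⊢; simpa using hx
    simp only [hx, hxM, true_and] at h1 h2
    push Not at h1 h2
    obtain ⟨u, hu, hu'⟩ := h1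
    obtain ⟨w, hw, hw'⟩ := h2
    exact norm_add_sq_le_of_opposite hC (hn u) (hn w) ((memM x).1 hx) ((memM x0).1 hx0M)
      ((hc u).trans hu'.le) ((hc w).trans hw'.le) ((hc u).trans (hx0 u (hJ' hu)))
      ((hc w).trans (hx0 w (hJ' hw)))
  · rintro (hx | hx)
    · exact hx.1
    · have : -x ∈ M := hx.1
      rw [memM] at this
      change x ∈ M
      rw [memM]; simpa using this

lemma Good.eq_zero_of_halfSpaces [FiniteDimensional ℝ E] {μ : ConvexBody E → ℝ} (hμ : Good μ)
    (he : EvenVal μ) (hH : ∀ v : E, v ≠ 0 → ∀ K, μ (mapB (prL v) K) = 0)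
    (hs : ∀ K : ConvexBody E, (∀ x, hB K (-x) = hB K x) → μ K = 0) {C : ℝ} (hC : 0 < C)
    {K : ConvexBody E} (hK : ∀ x ∈ (K : Set E), ‖x‖ ≤ 8 * C)
    (hc : ∀ u : Metric.sphere (0 : E) 1, 6 * C ≤ hB K u) : μ K = 0 := by
  have hF := hμ.extV_ball_inter he hH hs hC (fun u => hB K u) hc
  let V : Finset (Metric.sphere (0 : E) 1) → Set E := fun F =>
    Metric.closedBall (0 : E) (8 * C) ∩ {x | ∀ u ∈ F, ⟪(u : E), x⟫ ≤ hB K u}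
  have hcl : ∀ F : Finset (Metric.sphere (0 : E) 1), IsClosed {x : E | ∀ u ∈ F, ⟪((u : Metric.sphere (0 : E) 1) : E), x⟫ ≤ hB K u} := by
    intro F
    simp only [Set.ofPred_forall]
    exact isClosed_biInter fun j _ => isClosed_le (by fun_prop) continuous_const
  have hvx : ∀ F : Finset (Metric.sphere (0 : E) 1), Convex ℝ {x : E | ∀ u ∈ F, ⟪((u : Metric.sphere (0 : E) 1) : E), x⟫ ≤ hB K u} := by
    intro F
    simp only [Set.ofPred_forall]
    exact convex_iInter₂ fun j _ =>
      convex_halfSpace_le (innerSL ℝ (j : E)).toLinearMap.isLinear _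
  have hVc : ∀ F, IsCompact (V F) := fun F => (isCompact_closedBall _ _).inter_right (hcl F)
  have hKV : ∀ F, (K : Set E) ⊆ V F := fun F x hx =>
    ⟨by simpa using hK x hx, fun u _ => inner_le_hB _ hx⟩
  have hVx : ∀ F, Convex ℝ (V F) := fun F => (convex_closedBall _ _).inter (hvx F)
  let B : Finset (Metric.sphere (0 : E) 1) → ConvexBody E := fun F =>
    ⟨V F, hVx F, hVc F, K.nonempty.mono (hKV F)⟩
  have hB0 : ∀ F, μ (B F) = 0 := fun F => by
    rw [← extV_coe μ (B F)]; exact hF F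
  have hinter : ⋂ F, V F ⊆ (K : Set E) := by
    intro x hx
    rw [Set.mem_iInter] at hx
    rw [mem_body_iff]
    intro y
    by_cases hy : y = 0
    · simp [hy, hB_zero]
    have hy' : 0 < ‖y‖ := norm_pos_iff.2 hy
    let u : Metric.sphere (0 : E) 1 := ⟨‖y‖⁻¹ • y, by simp [norm_smul, hy]⟩
    have h1 := (hx {u}).2 u (by simp)
    have e : y = ‖y‖ • (u : E) := by simp [u, smul_smul, hy]
    rw [e, hB_smul hy'.le, inner_smul_left]
    exact mul_le_mul_of_nonneg_left h1 hy'.le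
  by_contra hne
  have hev : ∀ᶠ L in 𝓝 K, μ L ≠ 0 := hμ.cont.continuousAt.eventually_ne hne
  obtain ⟨ε, hε, hball⟩ := Metric.eventually_nhds_iff.1 hev
  have hdir : Directed (· ⊇ ·) V := by
    classical
    intro F G
    exact ⟨F ∪ G, fun x hx => ⟨hx.1, fun u hu => hx.2 u (Finset.mem_union_left _ hu)⟩,
      fun x hx => ⟨hx.1, fun u hu => hx.2 u (Finset.mem_union_right _ hu)⟩⟩
  obtain ⟨F, hFU⟩ := exists_subset_nhds_of_isCompact' hdir hVc (fun F => (hVc F).isClosed)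
    (U := Metric.thickening (ε / 2) (K : Set E)) fun x hx =>
      Metric.isOpen_thickening.mem_nhds (Metric.self_subset_thickening (by positivity) _ (hinter hx))
  refine hball (y := B F) ?_ (hB0 F)
  refine lt_of_le_of_lt (dist_body_le (r := ε / 2) (by positivity) (fun x hx => ?_)
    fun x hx => ⟨x, hKV F hx, by rw [dist_self]; positivity⟩) (by linarith)
  obtain ⟨y, hy, h⟩ := Metric.mem_thickening_iff.1 (hFU hx)
  exact ⟨y, hy, h.le⟩

end HalfSpaces

section Klain

lemma exists_ball_zonoid (E : Type*) [NormedAddCommGroup E] [InnerProductSpace ℝ E]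
    [FiniteDimensional ℝ E] [MeasurableSpace E] [BorelSpace E] :
    ∃ a : ℝ, 0 < a ∧ IsZon (stdGaussian E) (fun g : E => g) (a • unitB E) := by
  refine ⟨∫ u, |u| ∂gaussianReal 0 1, ?_, fun x => ?_⟩
  · simpa using gaussian_abs_moment_pos 1
  · have ha : 0 ≤ ∫ u, |u| ∂gaussianReal 0 1 := integral_nonneg fun u => abs_nonneg u
    rw [integral_stdGaussian_inner_eq x (f := fun u => |u|) PG.id.abs, hB_smul_body ha, hB_unitB]
    simp only [abs_mul, abs_norm, integral_const_mul]
    ring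

lemma parB_fin_zero {V : Type*} [NormedAddCommGroup V] [NormedSpace ℝ V] (v : Fin 0 → V) :
    parB v = 0 := by simp [parB]

/-- An even valuation vanishing on all nondegenerate parallelotopes of all dimensions
vanishes identically. -/
theorem Good.klain_aux (d : ℕ) : ∀ (E : Type*) [NormedAddCommGroup E] [InnerProductSpace ℝ E]
    [FiniteDimensional ℝ E] (_ : Module.finrank ℝ E = d) {μ : ConvexBody E → ℝ} (_ : Good μ)
    (_ : EvenVal μ) (_ : ∀ (k : ℕ) (v : Fin k → E), LinearIndependent ℝ v → μ (parB v) = 0)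
    (K : ConvexBody E), μ K = 0 := by
  induction d with
  | zero =>
    intro E _ _ _ hE μ hμ he h K
    have hsub : Subsingleton E := Module.finrank_zero_iff.1 hE
    have hK : K = 0 := by
      refine ConvexBody.ext ?_
      obtain ⟨x, hx⟩ := K.nonempty
      ext y
      simp [Subsingleton.elim y 0, Subsingleton.elim x 0 ▸ hx]
    rw [hK, ← parB_fin_zero (fun i => Fin.elim0 i : Fin 0 → E)]
    exact h 0 _ linearIndependent_empty_type
  | succ d ih =>
    intro E _ _ _ hE μ hμ he h K
    borelize E
    have h0 : μ 0 = 0 := by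
      rw [← parB_fin_zero (fun i => Fin.elim0 i : Fin 0 → E)]
      exact h 0 _ linearIndependent_empty_type
    have hdim : ∀ v : E, v ≠ 0 → Module.finrank ℝ (Submodule.span ℝ {v})ᗮ = d := by
      intro v hv
      have := Submodule.finrank_add_finrank_orthogonal (Submodule.span ℝ {v})
      rw [finrank_span_singleton hv, hE] at this
      omega
    have inj : ∀ v : E, Function.Injective (Submodule.subtypeL (Submodule.span ℝ {v})ᗮ) :=
      fun v => Subtype.val_injective
    have hH : ∀ v : E, v ≠ 0 → ∀ K, μ (mapB (prL v) K) = 0 := by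
      intro v hv K
      rw [mapB_prL hv]
      refine ih _ (hdim v hv) (hμ.comp_mapB _ (inj v)) (he.comp_mapB _) (fun k w hw => ?_) _
      rw [mapB_parB]
      exact h k _ (hw.map' (Submodule.subtype _) (Submodule.ker_subtype _))
    have hC : ∀ v : E, v ≠ 0 → ∀ K, μ (mapB (prL v) K + segB v) = 0 := by
      intro v hv K
      rw [mapB_prL hv]
      have g1 := (hμ.add_body (segB v)).comp_mapB _ (inj v)
      refine ih _ (hdim v hv) g1 (fun L => ?_) (fun k w hw => ?_) _
      · have e1 : mapB (Submodule.subtypeL (Submodule.span ℝ {v})ᗮ) L.reflect + segB v =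
            (mapB (Submodule.subtypeL _) L + segB v).reflect + ptB v := by
          rw [reflect_eq, reflect_eq, mapB_add, mapB_segB, add_assoc]
          have : (-ContinuousLinearMap.id ℝ E) v = -v := rfl
          rw [this, segB_neg, mapB_mapB, mapB_mapB]
          congr 2
        change μ (_ + _) = μ _
        rw [e1, hμ.ti.add_ptB, he]
      · have e : mapB (Submodule.subtypeL _) (parB w) + segB v =
            parB (Fin.cons v (fun i => (w i : E)) : Fin (k + 1) → E) := by
          rw [mapB_parB, parB, parB, Fin.sum_univ_succ, add_comm]
          rfl
        rw [e]
        refine h (k + 1) _ (linearIndependent_finCons.2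
          ⟨hw.map' (Submodule.subtype _) (Submodule.ker_subtype _), fun hmem => ?_⟩)
        have : v ∈ (Submodule.span ℝ {v})ᗮ := by
          refine (Submodule.span_le.2 ?_) hmem
          rintro _ ⟨i, rfl⟩
          exact (w i).2
        have := Submodule.mem_orthogonal_singleton_iff_inner_right.1 this
        exact hv (inner_self_eq_zero.1 this)
    have hD : ∀ v K, _root_.Dv v μ K = 0 := by
      intro v K
      by_cases hv : v = 0
      · simp [hv, _root_.Dv, segB_zero]
      · exact hμ.Dv_eq_zero_of_slices hv (hH v hv) (hC v hv) K
    have hs : ∀ K : ConvexBody E, (∀ x, hB K (-x) = hB K x) → μ K = 0 := fun K hK =>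
      hμ.eq_zero_of_symm hD h0 (by omega) hK
    obtain ⟨C, hC0, hCK⟩ : ∃ C, 0 < C ∧ ∀ x ∈ (K : Set E), ‖x‖ ≤ C := by
      obtain ⟨C, hC0, h⟩ := K.isCompact.isBounded.exists_pos_norm_le
      exact ⟨C, hC0, h⟩
    obtain ⟨a, ha, hz⟩ := exists_ball_zonoid E
    have hz' : IsZon (stdGaussian E) (fun g : E => (7 * C / a) • g) ((7 * C) • unitB E) := by
      intro x
      have := hz x
      rw [hB_smul_body (by positivity), hB_unitB] at this ⊢
      simp only [inner_smul_right, abs_mul, integral_const_mul]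
      rw [← this, abs_of_pos (by positivity)]
      field_simp
    have hpg : PG (fun g : E => (7 * C / a) • g) := (PG.const _).smul PG.id
    rw [← hμ.eq_of_isZon hD hpg.1.measurable (hpg.integrable (hm_of_isGaussian _)) hz' K]
    refine hμ.eq_zero_of_halfSpaces he hH hs hC0 ?_ ?_
    · rintro _ ⟨x, hx, y, hy, rfl⟩
      have h1 := hCK x hx
      have h2 := (mem_smul_unitB (by positivity)).1 hy
      exact (norm_add_le x y).trans (by linarith)
    · intro u
      obtain ⟨x, hx⟩ := K.nonempty
      have hu : ‖(u : E)‖ = 1 := by simp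
      have h1 := inner_le_hB (u : E) hx
      have h2 := neg_le_of_abs_le (abs_real_inner_le_norm (u : E) x)
      rw [hu, one_mul] at h2
      have h3 := hCK x hx
      rw [hB_add, hB_smul_body (by positivity), hB_unitB, hu]
      linarith

theorem Good.klain {E : Type*} [NormedAddCommGroup E] [InnerProductSpace ℝ E]
    [FiniteDimensional ℝ E] {μ : ConvexBody E → ℝ} (hμ : Good μ) (he : EvenVal μ)
    (h : ∀ (k : ℕ) (v : Fin k → E), LinearIndependent ℝ v → μ (parB v) = 0)
    (K : ConvexBody E) : μ K = 0 :=
  Good.klain_aux _ E rfl hμ he h K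

end Klain

section Shear

variable {V : Type*} [NormedAddCommGroup V] [NormedSpace ℝ V]

/-- Invariance of the area functional under shears, in the plane. -/
lemma Good.plane_shear {ν : ConvexBody (ℝ × ℝ) → ℝ} (h : Good ν) {c : ℝ} (hc : 0 ≤ c) :
    ν (segB (1, 0) + segB (c, 1)) + ν (segB (0, 1)) =
      ν (segB (1, 0) + segB (0, 1)) + ν (segB (c, 1)) := by
  let Q : Set (ℝ × ℝ) := {p | 0 ≤ p.2 ∧ p.2 ≤ 1 ∧ 0 ≤ p.1 ∧ p.1 ≤ 1 + c * p.2}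
  let f : (ℝ × ℝ) →L[ℝ] ℝ := ContinuousLinearMap.fst ℝ ℝ ℝ
  let g : (ℝ × ℝ) →L[ℝ] ℝ := ContinuousLinearMap.fst ℝ ℝ ℝ - c • ContinuousLinearMap.snd ℝ ℝ ℝ
  have hg : ∀ p, g p = p.1 - c * p.2 := fun p => rfl
  have hf : ∀ p, f p = p.1 := fun p => rfl
  have hQc : IsClosed Q := by
    change IsClosed ({p : ℝ × ℝ | 0 ≤ p.2} ∩ ({p | p.2 ≤ 1} ∩ ({p | 0 ≤ p.1} ∩ {p | p.1 ≤ 1 + c * p.2})))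
    refine (isClosed_le (by fun_prop) (by fun_prop)).inter ((isClosed_le (by fun_prop)
      (by fun_prop)).inter ((isClosed_le (by fun_prop) (by fun_prop)).inter
      (isClosed_le (by fun_prop) (by fun_prop))))
  have hQ : Convex ℝ Q := by
    rintro ⟨a, b⟩ ⟨h1, h2, h3, h4⟩ ⟨a', b'⟩ ⟨h1', h2', h3', h4'⟩ s t hs ht hst
    simp only at h1 h2 h3 h4 h1' h2' h3' h4'
    refine ⟨?_, ?_, ?_, ?_⟩ <;> simp only [Prod.smul_mk, Prod.mk_add_mk, smul_eq_mul]
    · positivity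
    · nlinarith
    · positivity
    · nlinarith
  have hQ' : IsCompact Q := by
    refine (isCompact_Icc (a := ((0:ℝ), (0:ℝ))) (b := (1 + c, 1))).of_isClosed_subset hQc ?_
    rintro ⟨a, b⟩ ⟨h1, h2, h3, h4⟩
    simp only at h1 h2 h3 h4
    exact ⟨⟨h3, h1⟩, ⟨by simp only; nlinarith, h2⟩⟩
  have c1 := h.val.extV_cut hQ hQ' f 1
  have c2 := h.val.extV_cut hQ hQ' g 0
  have T0v : Convex ℝ (Q ∩ {x | g x ≤ 0}) := hQ.inter (convex_halfSpace_le g.toLinearMap.isLinear _)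
  have T0c : IsCompact (Q ∩ {x | g x ≤ 0}) :=
    hQ'.inter_right (isClosed_le g.continuous continuous_const)
  let T0 : ConvexBody (ℝ × ℝ) := ⟨_, T0v, T0c, ⟨0, by simp [Q], by simp⟩⟩
  have seg_mem : ∀ (v p : ℝ × ℝ), p ∈ (segB v : Set (ℝ × ℝ)) ↔
      ∃ t, 0 ≤ t ∧ t ≤ 1 ∧ p.1 = t * v.1 ∧ p.2 = t * v.2 := by
    intro v p
    rw [mem_segB]
    simp [Prod.ext_iff]
  have par_mem : ∀ (v w p : ℝ × ℝ), p ∈ ((segB v + segB w : ConvexBody (ℝ × ℝ)) : Set (ℝ × ℝ)) ↔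
      ∃ s, 0 ≤ s ∧ s ≤ 1 ∧ ∃ t, 0 ≤ t ∧ t ≤ 1 ∧ p.1 = s * v.1 + t * w.1 ∧
        p.2 = s * v.2 + t * w.2 := by
    intro v w p
    rw [ConvexBody.coe_add, Set.mem_add]
    constructor
    · rintro ⟨x, hx, y, hy, rfl⟩
      obtain ⟨s, h0, h1, e1, e2⟩ := (seg_mem _ _).1 hx
      obtain ⟨t, h0', h1', e1', e2'⟩ := (seg_mem _ _).1 hy
      exact ⟨s, h0, h1, t, h0', h1', by rw [Prod.fst_add, e1, e1'], by rw [Prod.snd_add, e2, e2']⟩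
    · rintro ⟨s, h0, h1, t, h0', h1', e1, e2⟩
      refine ⟨s • v, (seg_mem _ _).2 ⟨s, h0, h1, rfl, rfl⟩, t • w,
        (seg_mem _ _).2 ⟨t, h0', h1', rfl, rfl⟩, ?_⟩
      ext
      · simp [e1]
      · simp [e2]
  have e1 : Q ∩ {x | f x ≤ 1} = (segB (1, 0) + segB (0, 1) : ConvexBody (ℝ × ℝ)) := by
    ext ⟨a, b⟩
    rw [par_mem]
    constructor
    · rintro ⟨⟨h1, h2, h3, h4⟩, h5⟩
      exact ⟨a, h3, h5, b, h1, h2, by simp, by simp⟩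
    · rintro ⟨s, h0, h1, t, h0', h1', ha, hb⟩
      simp only [mul_one, mul_zero, add_zero, zero_add] at ha hb
      subst ha hb
      exact ⟨⟨h0', h1', h0, by simp only; nlinarith⟩, h1⟩
  have e2 : Q ∩ {x | f x = 1} = (segB (0, 1) + ptB (1, 0) : ConvexBody (ℝ × ℝ)) := by
    ext ⟨a, b⟩
    rw [ConvexBody.coe_add, coe_ptB, Set.add_singleton]
    constructor
    · rintro ⟨⟨h1, h2, h3, h4⟩, h5⟩
      have h5 : a = 1 := h5
      subst h5
      exact ⟨(0, b), (seg_mem _ _).2 ⟨b, h1, h2, by simp, by simp⟩, by simp⟩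
    · rintro ⟨⟨a', b'⟩, hp, heq⟩
      obtain ⟨t, h0, h1, ha, hb⟩ := (seg_mem _ _).1 hp
      simp only [Prod.mk_add_mk, Prod.mk.injEq, mul_zero, mul_one] at ha hb heq
      obtain ⟨rfl, rfl⟩ := heq
      subst ha hb
      exact ⟨⟨by simpa, by simpa, by simp, by simp; positivity⟩, by simp [hf]⟩
  have e3 : Q ∩ {x | 1 ≤ f x} = (T0 + ptB (1, 0) : ConvexBody (ℝ × ℝ)) := by
    ext ⟨a, b⟩
    rw [ConvexBody.coe_add, coe_ptB, Set.add_singleton]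
    constructor
    · rintro ⟨⟨h1, h2, h3, h4⟩, h5⟩
      have h5 : 1 ≤ a := h5
      simp only at h1 h2 h3 h4
      refine ⟨(a - 1, b), ⟨⟨h1, h2, by simp only; linarith, by simp only; linarith⟩, ?_⟩, by simp⟩
      change (a - 1) - c * b ≤ 0
      linarith
    · rintro ⟨⟨a', b'⟩, ⟨⟨h1, h2, h3, h4⟩, h5⟩, heq⟩
      have h5 : a' - c * b' ≤ 0 := h5
      simp only [Prod.mk_add_mk, Prod.mk.injEq] at h1 h2 h3 h4 heq
      obtain ⟨rfl, rfl⟩ := heq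
      refine ⟨⟨by simpa, by simpa, by simp only; linarith, by simp only [add_zero]; linarith⟩, ?_⟩
      change 1 ≤ a' + 1
      linarith
  have e4 : Q ∩ {x | g x = 0} = (segB (c, 1) : ConvexBody (ℝ × ℝ)) := by
    ext ⟨a, b⟩
    rw [seg_mem]
    constructor
    · rintro ⟨⟨h1, h2, h3, h4⟩, h5⟩
      have h5 : a - c * b = 0 := h5
      exact ⟨b, h1, h2, by simp only; linarith, by simp⟩
    · rintro ⟨t, h0, h1, ha, hb⟩
      simp only [mul_one] at ha hb
      subst ha hb
      refine ⟨⟨h0, h1, by simp only; positivity, by simp only; linarith⟩, ?_⟩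
      change b * c - c * b = 0
      ring
  have e5 : Q ∩ {x | 0 ≤ g x} = (segB (1, 0) + segB (c, 1) : ConvexBody (ℝ × ℝ)) := by
    ext ⟨a, b⟩
    rw [par_mem]
    constructor
    · rintro ⟨⟨h1, h2, h3, h4⟩, h5⟩
      have h5 : 0 ≤ a - c * b := h5
      simp only at h1 h2 h3 h4
      exact ⟨a - c * b, h5, by linarith, b, h1, h2, by simp only; ring, by simp⟩
    · rintro ⟨s, h0, h1, t, h0', h1', ha, hb⟩
      simp only [mul_one, mul_zero, zero_add] at ha hb
      subst ha hb
      refine ⟨⟨h0', h1', by simp only; positivity, by simp only; linarith⟩, ?_⟩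
      change 0 ≤ s + b * c - c * b
      linarith
  have e6 : extV ν (Q ∩ {x | g x ≤ 0}) = ν T0 := extV_coe ν T0
  rw [e1, e2, e3, extV_coe, extV_coe, extV_coe, h.ti.add_ptB, h.ti.add_ptB] at c1
  rw [e4, e5, e6, extV_coe, extV_coe] at c2
  linarith

lemma Good.Dv_Dv_eq {ν : ConvexBody V → ℝ} (u v : V) :
    _root_.Dv u (_root_.Dv v ν) 0 = ν (segB u + segB v) - ν (segB u) - (ν (segB v) - ν 0) := by
  simp only [_root_.Dv, zero_add]

lemma Good.Dv_shear_nonneg {ν : ConvexBody V → ℝ} (h : Good ν) (h2 : Homog 2 ν) (u v : V) {c : ℝ}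
    (hc : 0 ≤ c) : _root_.Dv (u + c • v) (_root_.Dv v ν) 0 = _root_.Dv u (_root_.Dv v ν) 0 := by
  have seg0 : ∀ w, ν (segB w) = 0 := fun w => by
    have := h2.parL_eq_zero h [w] (by simp)
    simpa [parL] using this
  have self : ∀ a : ℝ, _root_.Dv (a • v) (_root_.Dv v ν) 0 = 0 := by
    intro a
    rw [(h.Dv v).Dv_smul]
    have := h.Dv_add_segB v zero_le_one 0
    rw [one_smul] at this
    rw [_root_.Dv, this, sub_self, mul_zero]
  by_cases hli : LinearIndependent ℝ ![v, u]
  · let A : (ℝ × ℝ) →L[ℝ] V := (ContinuousLinearMap.fst ℝ ℝ ℝ).smulRight v +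
      (ContinuousLinearMap.snd ℝ ℝ ℝ).smulRight u
    have hA : ∀ p, A p = p.1 • v + p.2 • u := fun p => rfl
    have hinj : Function.Injective A := by
      rw [injective_iff_map_eq_zero]
      rintro ⟨a, b⟩ hp
      rw [hA] at hp
      obtain ⟨h1, h2⟩ := LinearIndependent.pair_iff.1 hli a b hp
      simp_all
    have key := (h.comp_mapB A hinj).plane_shear hc
    simp only [mapB_add, mapB_segB, hA, one_smul, zero_smul, add_zero, zero_add, seg0] at key
    rw [Good.Dv_Dv_eq, Good.Dv_Dv_eq]
    simp only [seg0]
    rw [add_comm (segB (u + c • v)), add_comm (segB u), add_comm u, key]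
  · rw [LinearIndependent.pair_iff] at hli
    push Not at hli
    obtain ⟨a, b, hab, hne⟩ := hli
    by_cases hb : b = 0
    · have ha : a ≠ 0 := fun ha => hne ha hb
      subst hb
      have hv : v = 0 := by simpa [ha] using hab
      subst hv
      simp
    · have hu : u = (-(b⁻¹ * a)) • v := by
        have : b⁻¹ • (a • v + b • u) = 0 := by rw [hab, smul_zero]
        rw [smul_add, smul_smul, smul_smul, inv_mul_cancel₀ hb, one_smul] at this
        rw [neg_smul]
        exact eq_neg_of_add_eq_zero_right this
      rw [hu, ← add_smul, self, self]

lemma Good.Dv_shear {ν : ConvexBody V → ℝ} (h : Good ν) (h2 : Homog 2 ν) (u v : V) (c : ℝ) :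
    _root_.Dv (u + c • v) (_root_.Dv v ν) 0 = _root_.Dv u (_root_.Dv v ν) 0 := by
  rcases le_total 0 c with hc | hc
  · exact h.Dv_shear_nonneg h2 u v hc
  · have := h.Dv_shear_nonneg h2 (u + c • v) v (c := -c) (by linarith)
    rw [neg_smul, add_neg_cancel_right] at this
    exact this.symm

lemma DL_append (l l' : List V) (μ : ConvexBody V → ℝ) : DL (l ++ l') μ = DL l' (DL l μ) := by
  induction l generalizing μ with
  | nil => rfl
  | cons a l ih => exact ih _

lemma DL_const_mul (l : List V) (c : ℝ) (μ : ConvexBody V → ℝ) (K : ConvexBody V) :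
    DL l (fun K => c * μ K) K = c * DL l μ K := by
  induction l generalizing μ with
  | nil => rfl
  | cons a l ih =>
    change DL l (Dv a fun K => c * μ K) K = c * DL l (Dv a μ) K
    rw [← ih]
    congr 1
    funext L
    simp only [Dv]; ring

lemma Good.DL_smul {μ : ConvexBody V → ℝ} (h : Good μ) {ι : Type*} (l : List ι) (a : ι → ℝ)
    (w : ι → V) (K : ConvexBody V) :
    _root_.DL (l.map fun i => a i • w i) μ K = (l.map fun i => |a i|).prod * _root_.DL (l.map w) μ K := by
  induction l generalizing μ with
  | nil => simp
  | cons i l ih =>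
    simp only [List.map_cons, List.prod_cons]
    change _root_.DL _ (_root_.Dv (a i • w i) μ) K = _ * _root_.DL _ (_root_.Dv (w i) μ) K
    rw [ih (h.Dv _)]
    have : _root_.Dv (a i • w i) μ = fun K => |a i| * _root_.Dv (w i) μ K :=
      funext fun K => h.Dv_smul _ _ _
    rw [this, DL_const_mul]
    ring

/-- A homogeneous valuation of top degree on parallelotopes is a multiple of the determinant. -/
lemma Homog.parB_matrix {k : ℕ} {μ : ConvexBody V → ℝ} (h : Good μ) (hk : Homog k μ)
    (M : Matrix (Fin k) (Fin k) ℝ) (w : Fin k → V) :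
    μ (parB fun i => ∑ j, M i j • w j) = |M.det| * μ (parB w) := by
  have tolist : ∀ v : Fin k → V, μ (parB v) = _root_.DL ((List.finRange k).map v) μ 0 := by
    intro v
    rw [parB_eq_parL, List.ofFn_eq_map, Homog.parL_eq_DL h]
    simpa using hk
  revert w
  refine Matrix.diagonal_transvection_induction
    (fun M => ∀ w : Fin k → V, μ (parB fun i => ∑ j, M i j • w j) = |M.det| * μ (parB w)) M ?_ ?_ ?_
  · intro D _ w
    have : (fun i => ∑ j, Matrix.diagonal D i j • w j) = fun i => D i • w i := by
      funext i
      simp [Matrix.diagonal_apply, ite_smul]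
    rw [this, tolist, h.DL_smul, tolist, Matrix.det_diagonal, Finset.abs_prod,
      ← List.prod_ofFn, List.ofFn_eq_map]
  · rintro ⟨i, j, hij, c⟩ w
    have ew : (fun a => ∑ b, (Matrix.TransvectionStruct.toMatrix ⟨i, j, hij, c⟩) a b • w b) =
        Function.update w i (w i + c • w j) := by
      funext a
      simp only [Matrix.TransvectionStruct.toMatrix, Matrix.transvection, Matrix.add_apply,
        add_smul, Finset.sum_add_distrib, Matrix.one_apply, ite_smul, one_smul, zero_smul,
        Finset.sum_ite_eq, Finset.mem_univ, if_true]
      by_cases ha : a = i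
      · subst ha
        simp [Matrix.single_apply, ite_smul]
      · have : i ≠ a := fun h => ha h.symm
        simp [Matrix.single_apply, ha, this]
    rw [ew, Matrix.TransvectionStruct.det, abs_one, one_mul]
    set r : List V := ((Finset.univ.erase i).erase j).toList.map w with hr
    have hji : j ≠ i := fun h => hij h.symm
    have hjm : j ∈ Finset.univ.erase i := by simp [hji]
    have hlen : (r ++ [w j, w i]).length = k := by
      simp only [hr, List.length_append, List.length_map, Finset.length_toList, List.length_cons,
        List.length_nil]
      have h1 := Finset.card_erase_add_one hjm
      have h2 := Finset.card_erase_add_one (Finset.mem_univ i)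
      rw [Finset.card_univ, Fintype.card_fin] at h2
      omega
    have split : ∀ v : Fin k → V, (∀ a, a ≠ i → v a = w a) →
        parB v = parL (r ++ [w j, v i]) := by
      intro v hv
      rw [parL_eq_sum, parB, ← Finset.add_sum_erase _ _ (Finset.mem_univ i),
        ← Finset.add_sum_erase _ _ hjm]
      have : ∑ x ∈ (Finset.univ.erase i).erase j, segB (v x) = (r.map segB).sum := by
        rw [hr, List.map_map, Finset.sum_map_toList]
        refine Finset.sum_congr rfl fun a ha => ?_
        rw [hv a (by simp at ha; exact ha.2)]; rfl
      rw [this, hv j hji]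
      simp only [List.map_append, List.sum_append, List.map_cons, List.map_nil, List.sum_cons,
        List.sum_nil, add_zero]
      abel
    have val : ∀ x : V, μ (parL (r ++ [w j, x])) = _root_.Dv x (_root_.Dv (w j) (_root_.DL r μ)) 0 := by
      intro x
      have hl : (r ++ [w j, x]).length = k := by simpa using hlen
      rw [Homog.parL_eq_DL h _ (by rw [hl]; exact hk), DL_append]
      rfl
    have h2 : Homog 2 (_root_.DL r μ) := by
      apply Homog.DL h r
      have : 2 + r.length = k := by simpa [add_comm] using hlen
      rwa [this]
    rw [split w fun _ _ => rfl, split (Function.update w i (w i + c • w j))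
      fun a ha => Function.update_of_ne ha _ _, val, val, Function.update_self,
      (h.DL r).Dv_shear h2]
  · intro A B hA hB w
    have : (fun i => ∑ j, (A * B) i j • w j) = fun i => ∑ a, A i a • ∑ j, B a j • w j := by
      funext i
      simp only [Matrix.mul_apply, Finset.sum_smul, Finset.smul_sum, smul_smul]
      rw [Finset.sum_comm]
    rw [this, hA fun a => ∑ j, B a j • w j, hB, Matrix.det_mul, abs_mul, mul_assoc]

lemma Homog.parB_eq_zero_of_mem_span {k : ℕ} {μ : ConvexBody V → ℝ} (h : Good μ) (hk : Homog k μ)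
    {v w : Fin k → V} (hv : ∀ i, v i ∈ Submodule.span ℝ (Set.range w)) (hw : μ (parB w) = 0) :
    μ (parB v) = 0 := by
  have : ∀ i, ∃ c : Fin k → ℝ, ∑ j, c j • w j = v i :=
    fun i => (Submodule.mem_span_range_iff_exists_fun ℝ).1 (hv i)
  choose M hM using this
  have := Homog.parB_matrix h hk (Matrix.of M) w
  rw [hw, mul_zero] at this
  rw [← this]
  congr 2
  funext i
  exact (hM i).symm

lemma Good.parL_eq_zero_of_DL {μ : ConvexBody V → ℝ} (h : Good μ) (l : List V)
    (hl : ∀ s, s.Sublist l → _root_.DL s μ 0 = 0) : μ (parL l) = 0 := by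
  induction l generalizing μ with
  | nil => exact hl [] (List.Sublist.refl _)
  | cons v l ih =>
    have h1 := ih h fun s hs => hl s (hs.cons v)
    have h2 := ih (h.Dv v) fun s hs => hl (v :: s) (hs.cons_cons v)
    rw [_root_.Dv, h1, sub_zero] at h2
    exact h2

lemma Good.exists_poly_parL {μ : ConvexBody V → ℝ} (h : Good μ) (l : List V) :
    ∃ p : Polynomial ℝ, p.natDegree ≤ l.length ∧ ∀ t : ℝ, 0 < t → μ (t • parL l) = p.eval t := by
  induction l generalizing μ with
  | nil => exact ⟨Polynomial.C (μ 0), by simp, fun t ht => by simp [parL]⟩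
  | cons v l ih =>
    obtain ⟨p, hp, hp'⟩ := ih h
    obtain ⟨q, hq, hq'⟩ := ih (h.Dv v)
    refine ⟨p + Polynomial.X * q, ?_, fun t ht => ?_⟩
    · refine (Polynomial.natDegree_add_le _ _).trans (max_le (hp.trans (by simp)) ?_)
      refine Polynomial.natDegree_mul_le.trans ?_
      rw [Polynomial.natDegree_X, List.length_cons]; omega
    · have h1 := h.Dv_smul_nonneg v ht.le (t • parL l)
      rw [hq' t ht, _root_.Dv, hp' t ht] at h1
      rw [parL, smul_add, smul_segB, Polynomial.eval_add, Polynomial.eval_mul, Polynomial.eval_X,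
        ← h1]
      ring

lemma EvenVal.comp_smul {μ : ConvexBody V → ℝ} (h : EvenVal μ) (t : ℝ) :
    EvenVal (fun K => μ (t • K)) := fun K => by
  change μ (t • K.reflect) = μ (t • K)
  rw [reflect_eq, ← mapB_smul, ← reflect_eq, h]

lemma Good.comp_smul {μ : ConvexBody V → ℝ} (h : Good μ) {t : ℝ} (ht : t ≠ 0) :
    Good (fun K => μ (t • K)) := by
  have e : ∀ K : ConvexBody V, t • K = mapB (t • ContinuousLinearMap.id ℝ V) K := fun K => by
    apply ConvexBody.ext; rfl
  simp only [e]
  refine h.comp_mapB _ ?_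
  exact smul_right_injective V ht

end Shear

section Decomposition

variable {E : Type*} [NormedAddCommGroup E] [InnerProductSpace ℝ E] [FiniteDimensional ℝ E]

/-- A homogeneous even valuation vanishing on parallelotopes of its degree vanishes. -/
theorem Homog.klain {μ : ConvexBody E → ℝ} (hμ : Good μ) (he : EvenVal μ) {k : ℕ}
    (hk : Homog k μ) (h : ∀ v : Fin k → E, LinearIndependent ℝ v → μ (parB v) = 0)
    (K : ConvexBody E) : μ K = 0 := by
  refine hμ.klain he (fun j v hv => ?_) K
  rw [parB_eq_parL]
  refine hμ.parL_eq_zero_of_DL _ fun s hs => ?_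
  rcases lt_trichotomy s.length k with hlt | heq | hgt
  · obtain ⟨m, rfl⟩ := Nat.exists_eq_add_of_lt hlt
    refine Homog.apply_zero (k := m + 1) (Homog.DL hμ s ?_) (by omega)
    rwa [show m + 1 + s.length = s.length + m + 1 by ring]
  · subst heq
    have e : s = List.ofFn s.get := (List.ofFn_get s).symm
    rw [← Homog.parL_eq_DL hμ s hk, e, ← parB_eq_parL]
    obtain ⟨f, hf⟩ := List.sublist_iff_exists_fin_orderEmbedding_get_eq.1 hs
    refine h s.get ?_
    have e2 : s.get = v ∘ fun i => Fin.cast (by simp) (f i) := funext fun i => by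
      rw [hf i, List.get_ofFn]; rfl
    rw [e2]
    refine hv.comp _ fun i i' hii => ?_
    simpa using hii
  · obtain ⟨a, b, rfl, ha⟩ : ∃ a b, s = a ++ b ∧ a.length = k :=
      ⟨s.take k, s.drop k, (List.take_append_drop k s).symm, by simp; omega⟩
    have h0 : Homog 0 (_root_.DL a μ) := Homog.DL hμ a (by simpa [ha] using hk)
    cases b with
    | nil => simp at hgt; omega
    | cons x b =>
      rw [DL_append]
      borelize E
      change _root_.DL b (_root_.Dv x (_root_.DL a μ)) 0 = 0
      have : _root_.Dv x (_root_.DL a μ) = fun _ => 0 := funext fun K => by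
        rw [_root_.Dv, Homog.zero_const (hμ.DL a) h0, Homog.zero_const (hμ.DL a) h0 K, sub_self]
      rw [this]
      have := DL_const_mul b 0 (fun _ => 0) (0 : ConvexBody E)
      simpa using this

/-- McMullen's decomposition for even valuations. -/
theorem Good.exists_homogeneous_decomposition {ν : ConvexBody E → ℝ} (hν : Good ν) (he : EvenVal ν) :
    ∃ a : ℕ → ℕ → ℝ, ∀ (t : ℝ), 0 < t → ∀ K,
      ν (t • K) = ∑ k ∈ Finset.range (Module.finrank ℝ E + 1), t ^ k *
        ∑ i ∈ Finset.range (Module.finrank ℝ E + 1), a k i * ν (((i : ℝ) + 1) • K) := by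
  set d := Module.finrank ℝ E
  set s := Finset.range (d + 1)
  let x : ℕ → ℝ := fun i => (i : ℝ) + 1
  have hx : Set.InjOn x s := fun i _ j _ hij => by simpa [x] using hij
  refine ⟨fun k i => (Lagrange.basis s x i).coeff k, fun t ht K => ?_⟩
  have hdeg : ∀ i ∈ s, (Lagrange.basis s x i).natDegree < d + 1 := by
    intro i hi
    rw [Nat.lt_succ_iff, Polynomial.natDegree_le_iff_degree_le, Lagrange.degree_basis hx hi]
    simp [s]
  have hsum : ∀ K : ConvexBody E, ∑ k ∈ s, t ^ k * ∑ i ∈ s, (Lagrange.basis s x i).coeff k *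
      ν (x i • K) = ∑ i ∈ s, (Lagrange.basis s x i).eval t * ν (x i • K) := by
    intro K
    simp only [Finset.mul_sum]
    rw [Finset.sum_comm]
    refine Finset.sum_congr rfl fun i hi => ?_
    rw [Polynomial.eval_eq_sum_range' (hdeg i hi), Finset.sum_mul]
    exact Finset.sum_congr rfl fun k _ => by ring
  rw [hsum, ← sub_eq_zero]
  have hxi : ∀ i, x i ≠ 0 := fun i => by positivity
  have g : Good (fun K => ν (t • K) - ∑ i ∈ s, (Lagrange.basis s x i).eval t * ν (x i • K)) :=
    (hν.comp_smul ht.ne').sub (Good.sum s fun i _ => (hν.comp_smul (hxi i)).const_mul _)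
  refine g.klain (fun K => ?_) (fun k v hv => ?_) K
  · have := fun t => he.comp_smul t K
    simp only at this
    simp only [this]
  · obtain ⟨p, hp, hp'⟩ := hν.exists_poly_parL (List.ofFn v)
    have hk : k ≤ d := by simpa using hv.fintype_card_le_finrank
    have hp2 : p.degree < s.card := by
      rw [List.length_ofFn] at hp
      refine (Polynomial.degree_le_natDegree).trans_lt ?_
      simp only [s, Finset.card_range]
      exact_mod_cast by omega
    have := Lagrange.eq_interpolate hx hp2
    rw [parB_eq_parL, hp' t ht, sub_eq_zero]
    conv_lhs => rw [this]
    rw [Lagrange.interpolate_apply, Polynomial.eval_finsetSum]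
    refine Finset.sum_congr rfl fun i _ => ?_
    rw [Polynomial.eval_mul, Polynomial.eval_C, hp' (x i) (by positivity)]
    ring

end Decomposition

section MetricProjection

variable {E : Type*} [NormedAddCommGroup E] [InnerProductSpace ℝ E] [FiniteDimensional ℝ E]

lemma exists_metricProj (K : ConvexBody E) (x : E) :
    ∃ p ∈ (K : Set E), ∀ w ∈ (K : Set E), ⟪x - p, w - p⟫ ≤ 0 := by
  obtain ⟨p, hp, h⟩ := exists_norm_eq_iInf_of_complete_convex K.nonempty K.isCompact.isComplete
    K.convex x
  exact ⟨p, hp, (norm_eq_iInf_iff_real_inner_le_zero K.convex hp).1 h⟩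

/-- The metric projection onto a convex body. -/
def metricProj (K : ConvexBody E) (x : E) : E := (exists_metricProj K x).choose

lemma metricProj_mem (K : ConvexBody E) (x : E) : metricProj K x ∈ (K : Set E) :=
  (exists_metricProj K x).choose_spec.1

lemma inner_metricProj_le (K : ConvexBody E) (x : E) {w : E} (hw : w ∈ (K : Set E)) :
    ⟪x - metricProj K x, w - metricProj K x⟫ ≤ 0 :=
  (exists_metricProj K x).choose_spec.2 w hw

lemma norm_metricProj_sub_sq_le (K L : ConvexBody E) (x : E) :
    ‖metricProj K x - metricProj L x‖ ^ 2 ≤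
      dist K L * (‖x - metricProj K x‖ + ‖x - metricProj L x‖) := by
  set p := metricProj K x with hp
  set q := metricProj L x with hq
  obtain ⟨p1, hp1, hd1⟩ := exists_dist_le_body K L (metricProj_mem K x)
  obtain ⟨q1, hq1, hd2⟩ := exists_dist_le_body L K (metricProj_mem L x)
  have h1 := inner_metricProj_le K x hq1
  have h2 := inner_metricProj_le L x hp1
  rw [← hp] at h1 hd1
  rw [← hq] at h2 hd2
  have e : ‖p - q‖ ^ 2 = ⟪x - p, q1 - p⟫ + ⟪x - p, q - q1⟫ + (⟪x - q, p1 - q⟫ + ⟪x - q, p - p1⟫) := by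
    rw [← inner_add_right, ← inner_add_right, ← real_inner_self_eq_norm_sq]
    simp only [sub_add_sub_cancel', inner_sub_left, inner_sub_right, sub_add_sub_cancel]
    ring
  have h3 := real_inner_le_norm (x - p) (q - q1)
  have h4 := real_inner_le_norm (x - q) (p - p1)
  rw [← dist_eq_norm q] at h3
  rw [← dist_eq_norm p] at h4
  rw [dist_comm L K] at hd2
  have := mul_le_mul_of_nonneg_left hd2 (norm_nonneg (x - p))
  have := mul_le_mul_of_nonneg_left hd1 (norm_nonneg (x - q))
  nlinarith

lemma metricProj_unique {K : ConvexBody E} {x p : E} (hp : p ∈ (K : Set E))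
    (h : ∀ w ∈ (K : Set E), ⟪x - p, w - p⟫ ≤ 0) : metricProj K x = p := by
  have h1 := h _ (metricProj_mem K x)
  have h2 := inner_metricProj_le K x hp
  have : ‖metricProj K x - p‖ ^ 2 ≤ 0 := by
    rw [← real_inner_self_eq_norm_sq]
    set q := metricProj K x
    have : ⟪q - p, q - p⟫ = ⟪x - p, q - p⟫ + ⟪x - q, p - q⟫ := by
      simp only [inner_sub_left, inner_sub_right]; ring
    linarith
  have := pow_eq_zero_iff (two_ne_zero) |>.1 (le_antisymm this (sq_nonneg _))
  exact sub_eq_zero.1 (norm_eq_zero.1 this)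

lemma dist_metricProj_le (K : ConvexBody E) (x y : E) :
    ‖metricProj K x - metricProj K y‖ ≤ ‖x - y‖ := by
  have h1 := inner_metricProj_le K x (metricProj_mem K y)
  have h2 := inner_metricProj_le K y (metricProj_mem K x)
  set p := metricProj K x
  set q := metricProj K y
  have e : ‖p - q‖ ^ 2 = ⟪x - p, q - p⟫ + ⟪y - q, p - q⟫ + ⟪x - y, p - q⟫ := by
    rw [← real_inner_self_eq_norm_sq]
    simp only [inner_sub_left, inner_sub_right]; ring
  have h3 := real_inner_le_norm (x - y) (p - q)
  by_contra! h
  nlinarith [norm_nonneg (x - y), norm_nonneg (p - q)]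

lemma norm_sub_metricProj_le (K : ConvexBody E) (x : E) {w : E} (hw : w ∈ (K : Set E)) :
    ‖x - metricProj K x‖ ^ 2 + ‖metricProj K x - w‖ ^ 2 ≤ ‖x - w‖ ^ 2 := by
  have h1 := inner_metricProj_le K x hw
  set p := metricProj K x
  have : ‖x - w‖ ^ 2 = ‖x - p‖ ^ 2 - 2 * ⟪x - p, w - p⟫ + ‖p - w‖ ^ 2 := by
    rw [show x - w = (x - p) - (w - p) by abel, norm_sub_sq_real, norm_sub_rev p w]
  linarith

lemma metricProj_eq_of_norm_le {K : ConvexBody E} {x w : E} (hw : w ∈ (K : Set E))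
    (h : ‖x - w‖ ≤ ‖x - metricProj K x‖) : metricProj K x = w := by
  have h1 := norm_sub_metricProj_le K x hw
  have h2 : ‖x - w‖ ^ 2 ≤ ‖x - metricProj K x‖ ^ 2 := by gcongr
  have : ‖metricProj K x - w‖ ^ 2 = 0 := le_antisymm (by linarith) (sq_nonneg _)
  exact sub_eq_zero.1 (norm_eq_zero.1 (pow_eq_zero_iff (two_ne_zero) |>.1 this))

lemma metricProj_eq_of_subset {K M : ConvexBody E} (h : (K : Set E) ⊆ M) {x : E}
    (hx : metricProj M x ∈ (K : Set E)) : metricProj K x = metricProj M x :=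
  metricProj_unique hx fun _ hw => inner_metricProj_le M x (h hw)

lemma metricProj_inter {K L M I : ConvexBody E} (hM : (M : Set E) = (K : Set E) ∪ L)
    (hI : (I : Set E) = (K : Set E) ∩ L) {x : E} (hx : metricProj M x ∈ (K : Set E)) :
    metricProj L x = metricProj I x := by
  have hK : metricProj K x = metricProj M x :=
    metricProj_eq_of_subset (by rw [hM]; exact Set.subset_union_left) hx
  have hL : ‖x - metricProj M x‖ ≤ ‖x - metricProj L x‖ := by
    have := norm_sub_metricProj_le M x (w := metricProj L x)
      (by rw [hM]; exact Or.inr (metricProj_mem L x))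
    exact le_of_sq_le_sq (by nlinarith [sq_nonneg ‖metricProj M x - metricProj L x‖]) (norm_nonneg _)
  obtain ⟨z, hz, hzK, hzL⟩ := inter_nonempty_of_union_convex (A := (K : Set E)) (B := (L : Set E))
    K.isCompact.isClosed L.isCompact.isClosed (hM ▸ M.convex) hx (metricProj_mem L x)
  have hz' : ‖x - z‖ ≤ ‖x - metricProj L x‖ := by
    have := (convex_closedBall x ‖x - metricProj L x‖).segment_subset
      (x := metricProj M x) (y := metricProj L x) (by simpa [dist_eq_norm, norm_sub_rev] using hL)
      (by simp [dist_eq_norm, norm_sub_rev]) hz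
    simpa [dist_eq_norm, norm_sub_rev] using this
  have := metricProj_eq_of_norm_le hzL hz'
  refine (metricProj_eq_of_subset (by rw [hI]; exact Set.inter_subset_right) ?_).symm
  rw [this, hI]
  exact ⟨hzK, hzL⟩

lemma continuous_metricProj_body (x : E) : Continuous fun K : ConvexBody E => metricProj K x := by
  rw [continuous_iff_continuousAt]
  intro K
  rw [ContinuousAt, tendsto_iff_norm_sub_tendsto_zero]
  have hd : Tendsto (fun L : ConvexBody E => dist L K) (𝓝 K) (𝓝 0) := by
    have := (continuous_id.dist (continuous_const (y := K))).tendsto K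
    simpa using this
  have hb : ∀ L : ConvexBody E, ‖x - metricProj L x‖ ≤ ‖x - metricProj K x‖ + dist L K := by
    intro L
    obtain ⟨w, hw, h⟩ := exists_dist_le_body K L (metricProj_mem K x)
    have h1 := norm_sub_metricProj_le L x hw
    have h2 : ‖x - metricProj L x‖ ≤ ‖x - w‖ :=
      le_of_sq_le_sq (by nlinarith [sq_nonneg ‖metricProj L x - w‖]) (norm_nonneg _)
    rw [dist_comm K L] at h
    calc _ ≤ ‖x - w‖ := h2
      _ ≤ ‖x - metricProj K x‖ + ‖metricProj K x - w‖ := norm_sub_le_norm_sub_add_norm_sub _ _ _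
      _ ≤ _ := by rw [← dist_eq_norm (metricProj K x) w]; gcongr
  have h2 : Tendsto (fun L : ConvexBody E => √(dist L K * (‖x - metricProj K x‖ + dist L K +
      ‖x - metricProj K x‖))) (𝓝 K) (𝓝 0) := by
    have := (hd.mul ((hd.const_add ‖x - metricProj K x‖).add_const ‖x - metricProj K x‖)).sqrt
    simpa using this
  refine squeeze_zero (fun _ => norm_nonneg _) (fun L => ?_) h2
  refine Real.le_sqrt_of_sq_le ((norm_metricProj_sub_sq_le L K x).trans ?_)
  gcongr
  exact hb L

end MetricProjection

section Twisted

variable {E : Type*} [NormedAddCommGroup E] [InnerProductSpace ℝ E] [FiniteDimensional ℝ E]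
  {T : E →L[ℝ] E}

lemma norm_metricProj_sub_le_of_lt (hT : ‖T‖ < 1) (K L : ConvexBody E) (x y : E) :
    (1 - ‖T‖) * ‖x - y‖ ≤ ‖x + T (metricProj K x) - (y + T (metricProj L y))‖ +
      ‖T‖ * ‖metricProj K y - metricProj L y‖ := by
  have h1 : ‖T (metricProj K x - metricProj L y)‖ ≤
      ‖T‖ * (‖x - y‖ + ‖metricProj K y - metricProj L y‖) := by
    refine (T.le_opNorm _).trans ?_
    gcongr
    refine (norm_sub_le_norm_sub_add_norm_sub _ (metricProj K y) _).trans ?_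
    gcongr
    exact dist_metricProj_le K x y
  have h2 : ‖x - y‖ ≤ ‖x + T (metricProj K x) - (y + T (metricProj L y))‖ +
      ‖T (metricProj K x - metricProj L y)‖ := by
    have : x - y = (x + T (metricProj K x) - (y + T (metricProj L y))) -
      T (metricProj K x - metricProj L y) := by rw [map_sub]; abel
    conv_lhs => rw [this]
    exact norm_sub_le _ _
  linarith

lemma exists_twist (hT : ‖T‖ < 1) (K : ConvexBody E) (q : E) :
    ∃ x, x + T (metricProj K x) = q := by
  have hc : ContractingWith ‖T‖₊ fun x => q - T (metricProj K x) := by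
    refine ⟨by exact_mod_cast hT, LipschitzWith.of_dist_le_mul fun x y => ?_⟩
    rw [dist_eq_norm, dist_eq_norm, show q - T (metricProj K x) - (q - T (metricProj K y)) =
      T (metricProj K y - metricProj K x) by rw [map_sub]; abel, norm_sub_rev x y]
    refine (T.le_opNorm _).trans ?_
    rw [coe_nnnorm]
    gcongr
    exact dist_metricProj_le K y x
  refine ⟨hc.fixedPoint, ?_⟩
  have := hc.fixedPoint_isFixedPt
  rw [Function.IsFixedPt] at this
  conv_lhs => enter [1]; rw [← this]
  abel

open Classical in
/-- The solution `x` of `x + T (metricProj K x) = q`. -/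
def twist (T : E →L[ℝ] E) (K : ConvexBody E) (q : E) : E :=
  if h : ∃ x, x + T (metricProj K x) = q then h.choose else 0

lemma twist_spec (hT : ‖T‖ < 1) (K : ConvexBody E) (q : E) :
    twist T K q + T (metricProj K (twist T K q)) = q := by
  rw [twist, dif_pos (exists_twist hT K q)]
  exact (exists_twist hT K q).choose_spec

lemma twist_unique (hT : ‖T‖ < 1) {K : ConvexBody E} {q x : E}
    (h : x + T (metricProj K x) = q) : twist T K q = x := by
  have := norm_metricProj_sub_le_of_lt hT K K (twist T K q) x
  rw [h, twist_spec hT, sub_self, sub_self, norm_zero, mul_zero, add_zero] at this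
  have h2 : ‖twist T K q - x‖ ≤ 0 := by
    by_contra! h2
    nlinarith
  exact sub_eq_zero.1 (norm_le_zero_iff.1 h2)

lemma continuous_twist (hT : ‖T‖ < 1) (K : ConvexBody E) : Continuous (twist T K) := by
  have : LipschitzWith (Real.toNNReal (1 - ‖T‖)⁻¹) (twist T K) := by
    refine LipschitzWith.of_dist_le_mul fun p q => ?_
    have h := norm_metricProj_sub_le_of_lt hT K K (twist T K p) (twist T K q)
    rw [twist_spec hT, twist_spec hT, sub_self, norm_zero, mul_zero, add_zero] at h
    rw [Real.coe_toNNReal _ (inv_nonneg.2 (by linarith)), dist_eq_norm, dist_eq_norm,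
      inv_mul_eq_div, le_div_iff₀ (by linarith)]
    linarith
  exact this.continuous

lemma continuous_twist_body (hT : ‖T‖ < 1) (q : E) :
    Continuous fun K : ConvexBody E => twist T K q := by
  rw [continuous_iff_continuousAt]
  intro K
  rw [ContinuousAt, tendsto_iff_norm_sub_tendsto_zero]
  have h1 : Tendsto (fun L : ConvexBody E => (1 - ‖T‖)⁻¹ * (‖T‖ *
      ‖metricProj L (twist T K q) - metricProj K (twist T K q)‖)) (𝓝 K) (𝓝 0) := by
    have := tendsto_iff_norm_sub_tendsto_zero.1
      ((continuous_metricProj_body (twist T K q)).tendsto K)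
    simpa using (this.const_mul ‖T‖).const_mul (1 - ‖T‖)⁻¹
  refine squeeze_zero (fun _ => norm_nonneg _) (fun L => ?_) h1
  have h := norm_metricProj_sub_le_of_lt hT L K (twist T L q) (twist T K q)
  rw [twist_spec hT, twist_spec hT, sub_self, norm_zero, zero_add] at h
  rw [inv_mul_eq_div, le_div_iff₀ (by linarith)]
  linarith

/-- The normal displacement `x - metricProj K x` at `x = twist T K q`. -/
def nrm (T : E →L[ℝ] E) (K : ConvexBody E) (q : E) : E :=
  twist T K q - metricProj K (twist T K q)

lemma continuous_nrm (hT : ‖T‖ < 1) (K : ConvexBody E) : Continuous (nrm T K) := by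
  have h : Continuous (metricProj K) := by
    refine (LipschitzWith.of_dist_le_mul (K := 1) fun x y => ?_).continuous
    rw [dist_eq_norm, dist_eq_norm, NNReal.coe_one, one_mul]
    exact dist_metricProj_le K x y
  exact (continuous_twist hT K).sub (h.comp (continuous_twist hT K))

lemma continuous_nrm_body (hT : ‖T‖ < 1) (q : E) :
    Continuous fun K : ConvexBody E => nrm T K q := by
  refine (continuous_twist_body hT q).sub ?_
  rw [continuous_iff_continuousAt]
  intro K
  have h1 := (continuous_metricProj_body (twist T K q)).tendsto K
  have h2 : Tendsto (fun L : ConvexBody E => metricProj L (twist T L q) -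
      metricProj L (twist T K q)) (𝓝 K) (𝓝 0) := by
    have := tendsto_iff_norm_sub_tendsto_zero.1 ((continuous_twist_body hT q).tendsto K)
    exact squeeze_zero_norm (fun L => dist_metricProj_le L _ _) this
  have := h2.add h1
  simp only [sub_add_cancel, zero_add] at this
  exact this

lemma nrm_eq (hT : ‖T‖ < 1) {K : ConvexBody E} {q p y : E} (hp : p ∈ (K : Set E))
    (h : ∀ w ∈ (K : Set E), ⟪y, w - p⟫ ≤ 0) (hq : y + p + T p = q) : nrm T K q = y := by
  have h1 : metricProj K (y + p) = p := metricProj_unique hp (by simpa using h)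
  have h2 : twist T K q = y + p := twist_unique hT (by rw [h1, hq])
  rw [nrm, h2, h1, add_sub_cancel_right]

lemma nrm_spec (hT : ‖T‖ < 1) (K : ConvexBody E) (q : E) :
    ∃ p ∈ (K : Set E), (∀ w ∈ (K : Set E), ⟪nrm T K q, w - p⟫ ≤ 0) ∧ nrm T K q + p + T p = q :=
  ⟨_, metricProj_mem K _, fun _ hw => inner_metricProj_le K _ hw, by
    rw [nrm, sub_add_cancel, twist_spec hT]⟩

lemma nrm_union (hT : ‖T‖ < 1) {K L M I : ConvexBody E} (hM : (M : Set E) = (K : Set E) ∪ L)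
    (hI : (I : Set E) = (K : Set E) ∩ L) {q : E} (hx : metricProj M (twist T M q) ∈ (K : Set E)) :
    nrm T M q = nrm T K q ∧ nrm T I q = nrm T L q := by
  have e1 : ∀ {A B : ConvexBody E} {x : E}, metricProj A x = metricProj B x → twist T A q = x →
      twist T B q = x := fun {A B x} h h' => twist_unique hT (by rw [← h, ← h', twist_spec hT])
  have hKM : (K : Set E) ⊆ M := by rw [hM]; exact Set.subset_union_left
  have hLM : (L : Set E) ⊆ M := by rw [hM]; exact Set.subset_union_right
  have hIM : (I : Set E) ⊆ M := by rw [hI]; exact Set.inter_subset_left.trans hKM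
  have a1 := metricProj_eq_of_subset hKM hx
  have a2 := e1 a1.symm rfl
  refine ⟨by rw [nrm, nrm, a2, a1], ?_⟩
  have hmem : metricProj M (twist T L q) ∈ (K : Set E) ∪ L := by
    rw [← hM]; exact metricProj_mem M _
  have key : metricProj L (twist T L q) = metricProj I (twist T L q) := by
    rcases hmem with h | h
    · exact metricProj_inter hM hI h
    · have b1 := metricProj_eq_of_subset hLM h
      have b2 : twist T M q = twist T L q := e1 b1 rfl
      rw [b2] at hx
      rw [b1, metricProj_eq_of_subset hIM]
      rw [hI]
      exact ⟨hx, h⟩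
  rw [nrm, nrm, e1 key rfl, key]

/-- The tent function of the norm. -/
def tent (y : E) : ℝ := max 0 (1 - ‖y‖)

lemma continuous_tent : Continuous (tent : E → ℝ) := by
  unfold tent; fun_prop

end Twisted

section TubeIntegral

variable {E : Type*} [NormedAddCommGroup E] [InnerProductSpace ℝ E] [FiniteDimensional ℝ E]
  [MeasurableSpace E] [BorelSpace E] {T : E →L[ℝ] E}

lemma tent_nonneg (y : E) : 0 ≤ tent y := le_max_left _ _

lemma tent_le_one (y : E) : tent y ≤ 1 := max_le zero_le_one (by simp)

lemma tent_eq_zero {y : E} (h : 1 ≤ ‖y‖) : tent y = 0 := max_eq_left (by linarith)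

lemma tent_nrm_eq_zero (hT : ‖T‖ < 1) {K : ConvexBody E} {R : ℝ} (hK : ∀ x ∈ (K : Set E), ‖x‖ ≤ R)
    {q : E} (hq : q ∉ Metric.closedBall (0 : E) (1 + 2 * R)) : tent (nrm T K q) = 0 := by
  refine tent_eq_zero ?_
  obtain ⟨p, hp, -, h⟩ := nrm_spec hT K q
  rw [mem_closedBall_zero_iff, not_le, ← h] at hq
  have h1 := norm_add₃_le (a := nrm T K q) (b := p) (c := T p)
  have h2 : ‖T p‖ ≤ 1 * ‖p‖ := T.le_of_opNorm_le hT.le p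
  have h3 := hK p hp
  linarith

lemma exists_norm_bound_body (K : ConvexBody E) : ∃ R : ℝ, 0 ≤ R ∧ ∀ x ∈ (K : Set E), ‖x‖ ≤ R := by
  obtain ⟨R, h⟩ := K.isCompact.isBounded.exists_norm_le
  obtain ⟨x, hx⟩ := K.nonempty
  exact ⟨R, (norm_nonneg x).trans (h x hx), h⟩

lemma integrable_tent_nrm (hT : ‖T‖ < 1) (K : ConvexBody E) :
    Integrable fun q => tent (nrm T K q) := by
  obtain ⟨R, -, hR⟩ := exists_norm_bound_body K
  refine ((continuous_tent.comp (continuous_nrm hT K)).integrable_of_hasCompactSupport ?_)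
  exact HasCompactSupport.intro (isCompact_closedBall (0 : E) (1 + 2 * R))
    fun q hq => tent_nrm_eq_zero hT hR hq

/-- The twisted tube functional. -/
def tube (T : E →L[ℝ] E) (K : ConvexBody E) : ℝ := ∫ q, tent (nrm T K q)

lemma nrm_add_ptB (hT : ‖T‖ < 1) (K : ConvexBody E) (x q : E) :
    nrm T (K + ptB x) (q + (x + T x)) = nrm T K q := by
  obtain ⟨p, hp, h1, h2⟩ := nrm_spec hT K q
  refine nrm_eq hT (p := p + x) ?_ ?_ ?_
  · rw [ConvexBody.coe_add, coe_ptB]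
    exact Set.add_mem_add hp rfl
  · rw [ConvexBody.coe_add, coe_ptB]
    rintro _ ⟨w, hw, _, rfl, rfl⟩
    change ⟪_, w + _ - _⟫ ≤ 0
    rw [add_sub_add_right_eq_sub]
    exact h1 w hw
  · rw [map_add]
    conv_rhs => rw [← h2]
    abel

lemma nrm_mapB (hT : ‖T‖ < 1) (A : E ≃ₗᵢ[ℝ] E) (hA : ∀ x, A (T x) = T (A x)) (K : ConvexBody E)
    (q : E) : nrm T (mapB (A : E →L[ℝ] E) K) (A q) = A (nrm T K q) := by
  obtain ⟨p, hp, h1, h2⟩ := nrm_spec hT K q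
  refine nrm_eq hT (p := A p) ⟨p, hp, rfl⟩ ?_ ?_
  · rintro _ ⟨w, hw, rfl⟩
    change ⟪_, A w - A p⟫ ≤ 0
    rw [← map_sub, A.inner_map_map]
    exact h1 w hw
  · rw [← hA, ← map_add, ← map_add, h2]

theorem tube_mapB (hT : ‖T‖ < 1) (A : E ≃ₗᵢ[ℝ] E) (hA : ∀ x, A (T x) = T (A x))
    (K : ConvexBody E) : tube T (mapB (A : E →L[ℝ] E) K) = tube T K := by
  rw [tube, tube, ← (A.measurePreserving).integral_comp A.toMeasurableEquiv.measurableEmbedding]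
  refine integral_congr_ae (.of_forall fun q => ?_)
  change tent (nrm T _ (A q)) = tent (nrm T K q)
  rw [nrm_mapB hT A hA, tent, tent, A.norm_map]

theorem good_tube (hT : ‖T‖ < 1) : Good (tube T) where
  val := fun K L M I hM hI => by
    rw [tube, tube, tube, tube, ← integral_add (integrable_tent_nrm hT M) (integrable_tent_nrm hT I),
      ← integral_add (integrable_tent_nrm hT K) (integrable_tent_nrm hT L)]
    refine integral_congr_ae (.of_forall fun q => ?_)
    have hmem : metricProj M (twist T M q) ∈ (K : Set E) ∪ L := by
      rw [← hM]; exact metricProj_mem M _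
    beta_reduce
    rcases hmem with h | h
    · obtain ⟨h1, h2⟩ := nrm_union hT hM hI h
      rw [h1, h2]
    · obtain ⟨h1, h2⟩ := nrm_union hT (hM.trans (Set.union_comm _ _))
        (hI.trans (Set.inter_comm _ _)) h
      rw [h1, h2, add_comm]
  cont := by
    rw [continuous_iff_continuousAt]
    intro K
    obtain ⟨R, hR0, hR⟩ := exists_norm_bound_body K
    refine continuousAt_of_dominated
      (bound := (Metric.closedBall (0 : E) (1 + 2 * (R + 1))).indicator fun _ => 1)
      (.of_forall fun L => (integrable_tent_nrm hT L).aestronglyMeasurable) ?_ ?_ ?_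
    · filter_upwards [Metric.ball_mem_nhds K one_pos] with L hL
      refine .of_forall fun q => ?_
      have hL' : ∀ x ∈ (L : Set E), ‖x‖ ≤ R + 1 := by
        intro x hx
        obtain ⟨y, hy, hd⟩ := exists_dist_le_body L K hx
        rw [Metric.mem_ball] at hL
        calc ‖x‖ ≤ ‖y‖ + ‖x - y‖ := norm_le_norm_add_norm_sub' _ _
          _ ≤ R + 1 := by rw [← dist_eq_norm]; linarith [hR y hy]
      rw [Real.norm_of_nonneg (tent_nonneg _)]
      by_cases hq : q ∈ Metric.closedBall (0 : E) (1 + 2 * (R + 1))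
      · rw [Set.indicator_of_mem hq]; exact tent_le_one _
      · rw [Set.indicator_of_notMem hq, tent_nrm_eq_zero hT hL' hq]
    · exact (integrable_indicator_iff Metric.isClosed_closedBall.measurableSet).2
        (integrableOn_const (isCompact_closedBall _ _).measure_lt_top.ne)
    · exact .of_forall fun q =>
        (continuous_tent.comp (continuous_nrm_body hT q)).continuousAt
  ti := fun K x => by
    rw [translate_eq, tube, tube, ← integral_add_right_eq_self _ (x + T x)]
    simp only [nrm_add_ptB hT]

theorem evenVal_tube (hT : ‖T‖ < 1) : EvenVal (tube T) := fun K => by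
  rw [reflect_eq, ← tube_mapB hT (LinearIsometryEquiv.neg ℝ) (by simp) K]
  congr 1

/-- Asymptotics of the twisted tube functional on dilates of a body in a subspace. -/
theorem tendsto_tube (hT : ‖T‖ < 1) (P : E →L[ℝ] E) (hP : ∀ x, P (P x) = P x)
    (hPs : ∀ x y, ⟪P x, y⟫ = ⟪x, P y⟫) (C : ConvexBody E) (hC : ∀ x ∈ (C : Set E), P x = x)
    {k : ℕ} (hD : ∀ t : ℝ, 0 < t →
      LinearMap.det ((t • P + (ContinuousLinearMap.id ℝ E - P) : E →L[ℝ] E) : E →ₗ[ℝ] E) = t ^ k)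
    {D : ℝ} (hD0 : 0 < D)
    (hL : LinearMap.det ((ContinuousLinearMap.id ℝ E + T ∘L P : E →L[ℝ] E) : E →ₗ[ℝ] E) = D) :
    Tendsto (fun t : ℝ => (t ^ k)⁻¹ * tube T (t • C)) atTop
      (𝓝 (D * ∫ z, {z | P z ∈ (C : Set E)}.indicator (fun z => tent (z - P z)) z)) := by
  set L : E →L[ℝ] E := ContinuousLinearMap.id ℝ E + T ∘L P with hLdef
  let S : ℝ → E →L[ℝ] E := fun t => t • P + (ContinuousLinearMap.id ℝ E - P)
  have hLz : ∀ t z, L (S t z) = t • P z + (z - P z) + T (t • P z) := by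
    intro t z
    simp [hLdef, S, hP]
  have hdet : ∀ t : ℝ, 0 < t → LinearMap.det ((L ∘L S t : E →L[ℝ] E) : E →ₗ[ℝ] E) = D * t ^ k := by
    intro t ht
    rw [show ((L ∘L S t : E →L[ℝ] E) : E →ₗ[ℝ] E) = (L : E →ₗ[ℝ] E) ∘ₗ (S t : E →ₗ[ℝ] E) from rfl,
      LinearMap.det_comp, hL, hD t ht]
  have hIt : ∀ t : ℝ, 0 < t → (t ^ k)⁻¹ * tube T (t • C) =
      D * ∫ z, tent (nrm T (t • C) (L (S t z))) := by
    intro t ht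
    have hne : LinearMap.det ((L ∘L S t : E →L[ℝ] E) : E →ₗ[ℝ] E) ≠ 0 := by
      rw [hdet t ht]; positivity
    have h1 := Measure.map_linearMap_addHaar_eq_smul_addHaar (volume : Measure E) hne
    have hemb : MeasurableEmbedding (L ∘L S t) := by
      have hinj : Function.Injective (L ∘L S t) := by
        have := (LinearMap.equivOfDetNeZero _ hne).injective
        exact this
      exact (L ∘L S t).continuous.measurableEmbedding hinj
    have h2 : ∫ z, tent (nrm T (t • C) ((L ∘L S t) z)) =
        |(D * t ^ k)⁻¹| * tube T (t • C) := by
      rw [← hemb.integral_map (μ := volume) fun z => tent (nrm T (t • C) z)]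
      rw [ContinuousLinearMap.coe_coe, hdet t ht] at h1
      rw [h1, integral_smul_measure, ENNReal.toReal_ofReal (abs_nonneg _), tube, smul_eq_mul]
    simp only [ContinuousLinearMap.comp_apply] at h2
    rw [h2, abs_of_pos (by positivity), mul_inv]
    field_simp
  obtain ⟨R, hR0, hR⟩ := exists_norm_bound_body C
  set r := (1 - ‖T‖)⁻¹ with hr
  have hr0 : 0 < r := inv_pos.2 (by linarith)
  have hmem : ∀ (t : ℝ) (x : E), x ∈ ((t • C : ConvexBody E) : Set E) ↔ ∃ w ∈ (C : Set E), t • w = x := by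
    intro t x; rfl
  have key : ∀ t : ℝ, 0 < t → ∀ z, tent (nrm T (t • C) (L (S t z))) ≠ 0 →
      ∃ w ∈ (C : Set E), t * ‖P z - w‖ ≤ r ∧ ‖z - P z‖ ≤ 1 + 2 * r := by
    intro t ht z hne
    obtain ⟨p, hp, -, h⟩ := nrm_spec hT (t • C) (L (S t z))
    obtain ⟨w, hw, rfl⟩ := (hmem t p).1 hp
    have hy : ‖nrm T (t • C) (L (S t z))‖ < 1 := by
      by_contra! h'; exact hne (tent_eq_zero h')
    set y' := nrm T (t • C) (L (S t z))
    rw [hLz] at h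
    set a := t • (P z - w) with ha
    have hPa : P a = a := by rw [ha, map_smul, map_sub, hP, hC w hw]
    have e : y' = a + T a + (z - P z) := by
      have : y' = t • P z + (z - P z) + T (t • P z) - (t • w + T (t • w)) := by rw [← h]; abel
      rw [this, ha, smul_sub, map_sub]; abel
    have h0 : ⟪a, z - P z⟫ = 0 := by
      rw [← hPa, hPs, map_sub, hP, sub_self, inner_zero_right]
    have h1 : ⟪a, y'⟫ = ‖a‖ ^ 2 + ⟪a, T a⟫ := by
      rw [e, inner_add_right, inner_add_right, h0, real_inner_self_eq_norm_sq, add_zero]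
    have h2 := real_inner_le_norm a y'
    have h3 := neg_le_of_abs_le (abs_real_inner_le_norm a (T a))
    have h4 : ‖T a‖ ≤ ‖T‖ * ‖a‖ := T.le_opNorm a
    have h5 : (1 - ‖T‖) * ‖a‖ ≤ 1 := by
      by_contra! h6
      have : 0 < ‖a‖ := by
        rcases (norm_nonneg a).eq_or_lt with h7 | h7
        · rw [← h7] at h6; linarith
        · exact h7
      nlinarith [mul_le_mul_of_nonneg_left h4 this.le, mul_lt_mul_of_pos_left h6 this,
        mul_lt_mul_of_pos_left hy this]
    have h6 : ‖a‖ ≤ r := by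
      rw [hr, inv_eq_one_div, le_div_iff₀ (by linarith)]; linarith
    refine ⟨w, hw, ?_, ?_⟩
    · rwa [ha, norm_smul, Real.norm_of_nonneg ht.le] at h6
    · have : z - P z = y' - a - T a := by rw [e]; abel
      rw [this]
      have h7 : ‖T a‖ ≤ ‖a‖ := h4.trans (by nlinarith [norm_nonneg a])
      linarith [norm_sub_le (y' - a) (T a), norm_sub_le y' a]
  have hlim : Tendsto (fun t : ℝ => ∫ z, tent (nrm T (t • C) (L (S t z)))) atTop
      (𝓝 (∫ z, {z | P z ∈ (C : Set E)}.indicator (fun z => tent (z - P z)) z)) := by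
    refine tendsto_integral_filter_of_dominated_convergence
      ((Metric.closedBall (0 : E) (R + r + (1 + 2 * r))).indicator fun _ => 1) ?_ ?_ ?_ ?_
    · exact .of_forall fun t => (continuous_tent.comp ((continuous_nrm hT _).comp
        (L.continuous.comp (S t).continuous))).aestronglyMeasurable
    · filter_upwards [eventually_ge_atTop (1 : ℝ)] with t ht
      refine .of_forall fun z => ?_
      rw [Real.norm_of_nonneg (tent_nonneg _)]
      by_cases hne : tent (nrm T (t • C) (L (S t z))) = 0
      · rw [hne]; exact Set.indicator_nonneg (fun _ _ => zero_le_one) _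
      · obtain ⟨w, hw, h1, h2⟩ := key t (by linarith) z hne
        rw [Set.indicator_of_mem]
        · exact tent_le_one _
        · rw [mem_closedBall_zero_iff]
          have h3 : ‖P z - w‖ ≤ r := le_trans (by nlinarith [norm_nonneg (P z - w)]) h1
          have h4 : z = w + (P z - w) + (z - P z) := by abel
          rw [h4]
          exact norm_add₃_le.trans (by linarith [hR w hw])
    · exact (integrable_indicator_iff Metric.isClosed_closedBall.measurableSet).2
        (integrableOn_const (isCompact_closedBall _ _).measure_lt_top.ne)
    · refine .of_forall fun z => ?_
      refine tendsto_const_nhds.congr' ?_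
      by_cases hz : P z ∈ (C : Set E)
      · filter_upwards [eventually_gt_atTop (0 : ℝ)] with t ht
        rw [Set.indicator_of_mem (by exact hz)]
        congr 1
        symm
        refine nrm_eq hT (p := t • P z) ((hmem t _).2 ⟨_, hz, rfl⟩) ?_ ?_
        · intro x hx
          obtain ⟨w, hw, rfl⟩ := (hmem t x).1 hx
          rw [← smul_sub, inner_smul_right]
          rw [show w - P z = P (w - P z) by rw [map_sub, hP, hC w hw], ← hPs, map_sub, hP, sub_self,
            inner_zero_left, mul_zero]
        · rw [hLz]; abel
      · have hpos := (C.isCompact.isClosed.notMem_iff_infDist_pos C.nonempty).1 hz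
        filter_upwards [eventually_gt_atTop (r / Metric.infDist (P z) C), eventually_gt_atTop 0]
          with t ht ht0
        rw [Set.indicator_of_notMem (by exact hz)]
        by_contra hne
        obtain ⟨w, hw, h1, -⟩ := key t ht0 z (Ne.symm hne)
        have h2 := Metric.infDist_le_dist_of_mem (x := P z) hw
        rw [dist_eq_norm] at h2
        rw [div_lt_iff₀ hpos] at ht
        nlinarith
  refine (hlim.const_mul D).congr' ?_
  filter_upwards [eventually_gt_atTop (0 : ℝ)] with t ht
  exact (hIt t ht).symm

lemma integral_tent_pos (P : E →L[ℝ] E) (hP : ∀ x, P (P x) = P x)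
    (C : ConvexBody E) {c : E} (hc : P c = c) {ε : ℝ} (hε : 0 < ε)
    (hC : ∀ x, ‖x - c‖ < ε → P x ∈ (C : Set E)) :
    0 < ∫ z, {z | P z ∈ (C : Set E)}.indicator (fun z => tent (z - P z)) z := by
  set f : E → ℝ := {z | P z ∈ (C : Set E)}.indicator fun z => tent (z - P z) with hf
  have hf0 : ∀ z, 0 ≤ f z := fun z => Set.indicator_nonneg (fun _ _ => tent_nonneg _) _
  have hmeas : MeasurableSet {z | P z ∈ (C : Set E)} :=
    (C.isCompact.isClosed.preimage P.continuous).measurableSet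
  have hcont : Continuous fun z => tent (z - P z) :=
    continuous_tent.comp (continuous_id.sub P.continuous)
  have hIt : Integrable f := by
    obtain ⟨R, hR0, hR⟩ := exists_norm_bound_body C
    have hb : Integrable ((Metric.closedBall (0 : E) (R + 1)).indicator fun _ => (1 : ℝ)) :=
      (integrable_indicator_iff Metric.isClosed_closedBall.measurableSet).2
        (integrableOn_const (isCompact_closedBall _ _).measure_lt_top.ne)
    refine hb.mono' (hcont.aestronglyMeasurable.indicator hmeas) (.of_forall fun z => ?_)
    rw [Real.norm_of_nonneg (hf0 z)]
    by_cases hz : P z ∈ (C : Set E)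
    · rw [hf, Set.indicator_of_mem (by exact hz)]
      by_cases h1 : 1 ≤ ‖z - P z‖
      · rw [tent_eq_zero h1]; exact Set.indicator_nonneg (fun _ _ => zero_le_one) _
      · rw [Set.indicator_of_mem]
        · exact tent_le_one _
        · rw [mem_closedBall_zero_iff]
          linarith [norm_le_norm_add_norm_sub' z (P z), hR _ hz]
    · rw [hf, Set.indicator_of_notMem (by exact hz)]
      exact Set.indicator_nonneg (fun _ _ => zero_le_one) _
  rw [integral_pos_iff_support_of_nonneg hf0 hIt]
  have ho : IsOpen (Metric.ball c ε ∩ {z | ‖z - P z‖ < 1}) :=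
    Metric.isOpen_ball.inter (isOpen_lt (by fun_prop) continuous_const)
  refine (ho.measure_pos volume ⟨c, Metric.mem_ball_self hε, ?_⟩).trans_le (measure_mono ?_)
  · simp [hc]
  · rintro z ⟨hz, hz'⟩
    rw [Metric.mem_ball, dist_eq_norm] at hz
    rw [Function.mem_support, hf, Set.indicator_of_mem (by exact hC z hz)]
    exact (lt_max_of_lt_right (by simpa using hz')).ne'

end TubeIntegral

section HomogeneousPart

lemma Polynomial.coeff_eq_of_tendsto {p : Polynomial ℝ} {k : ℕ} {A : ℝ}
    (h : Tendsto (fun t : ℝ => (t ^ k)⁻¹ * p.eval t) atTop (𝓝 A)) : p.coeff k = A := by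
  have h' : Tendsto (fun t : ℝ => p.eval t / (X ^ k : Polynomial ℝ).eval t) atTop (𝓝 A) := by
    refine h.congr fun t => ?_
    rw [Polynomial.eval_pow, Polynomial.eval_X, div_eq_inv_mul]
  have hX : (X ^ k : Polynomial ℝ) ≠ 0 := pow_ne_zero _ Polynomial.X_ne_zero
  rcases lt_trichotomy p.degree (X ^ k : Polynomial ℝ).degree with hd | hd | hd
  · have h0 := Polynomial.div_tendsto_atTop_zero_of_degree_lt _ _ hd
    rw [Polynomial.degree_X_pow] at hd
    rw [Polynomial.coeff_eq_zero_of_degree_lt hd, tendsto_nhds_unique h' h0]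
  · have h0 := Polynomial.div_tendsto_atTop_leadingCoeff_div_of_degree_eq _ _ hd
    rw [Polynomial.degree_X_pow] at hd
    rw [tendsto_nhds_unique h' h0, Polynomial.leadingCoeff_X_pow, div_one,
      Polynomial.leadingCoeff, Polynomial.natDegree_eq_of_degree_eq_some hd]
  · have h0 := Polynomial.abs_div_tendsto_atTop_atTop_of_degree_gt _ _ hd hX
    exact absurd h'.abs (not_tendsto_nhds_of_tendsto_atTop h0 _)

variable {E : Type*} [NormedAddCommGroup E] [InnerProductSpace ℝ E] [FiniteDimensional ℝ E]

/-- The homogeneous component of degree `k` of an even valuation. -/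
theorem Good.exists_homog_part {ν : ConvexBody E → ℝ} (hν : Good ν) (he : EvenVal ν) {k : ℕ}
    (hk : k ≤ Module.finrank ℝ E) :
    ∃ μ : ConvexBody E → ℝ, Good μ ∧ EvenVal μ ∧ Homog k μ ∧
      (∀ C A, Tendsto (fun t : ℝ => (t ^ k)⁻¹ * ν (t • C)) atTop (𝓝 A) → μ C = A) ∧
      ∀ A : E →L[ℝ] E, (∀ K, ν (mapB A K) = ν K) → ∀ K, μ (mapB A K) = μ K := by
  obtain ⟨a, ha⟩ := hν.exists_homogeneous_decomposition he
  set d := Module.finrank ℝ E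
  let c : ℕ → ConvexBody E → ℝ := fun k K =>
    ∑ i ∈ Finset.range (d + 1), a k i * ν (((i : ℝ) + 1) • K)
  have ha' : ∀ t : ℝ, 0 < t → ∀ K, ν (t • K) = ∑ k ∈ Finset.range (d + 1), t ^ k * c k K := ha
  have hk' : k < d + 1 := by omega
  have hx : ∀ i : ℕ, ((i : ℝ) + 1) ≠ 0 := fun i => by positivity
  have hco : ∀ (b : ℕ → ℝ), (∑ k ∈ Finset.range (d + 1), Polynomial.C (b k) * Polynomial.X ^ k).coeff k
      = b k := by
    intro b
    rw [Polynomial.finsetSum_coeff]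
    simp only [Polynomial.coeff_C_mul_X_pow, Finset.sum_ite_eq, Finset.mem_range, hk', if_true]
  have hev : ∀ (b : ℕ → ℝ) (t : ℝ),
      (∑ k ∈ Finset.range (d + 1), Polynomial.C (b k) * Polynomial.X ^ k).eval t
        = ∑ k ∈ Finset.range (d + 1), t ^ k * b k := by
    intro b t
    rw [Polynomial.eval_finsetSum]
    refine Finset.sum_congr rfl fun i _ => ?_
    rw [Polynomial.eval_mul, Polynomial.eval_C, Polynomial.eval_pow, Polynomial.eval_X, mul_comm]
  refine ⟨c k, Good.sum _ fun i _ => (hν.comp_smul (hx i)).const_mul _, fun K => ?_, fun K s hs => ?_,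
    fun C A h => ?_, fun A h K => ?_⟩
  · exact Finset.sum_congr rfl fun i _ => congrArg _ (he.comp_smul _ K)
  · rw [dilate_eq, ← hco fun k => c k (s • K)]
    rw [← hco fun k => s ^ k * c k K]
    congr 1
    refine Polynomial.eq_of_infinite_eval_eq _ _ ((Set.Ioi_infinite (0 : ℝ)).mono fun t ht => ?_)
    rw [Set.mem_ofPred_eq, hev, hev, ← ha' t ht, ← mul_smul, ha' (t * s) (mul_pos ht hs)]
    exact Finset.sum_congr rfl fun i _ => by ring
  · rw [← hco fun k => c k C]
    refine Polynomial.coeff_eq_of_tendsto (h.congr' ?_)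
    filter_upwards [eventually_gt_atTop 0] with t ht
    rw [hev, ha' t ht]
  · refine Finset.sum_congr rfl fun i _ => ?_
    rw [← mapB_smul, h]

end HomogeneousPart

section Frames

variable {n : ℕ}

/-- The frame `a, i a` for `a ∈ as` followed by `bs`. -/
def frameL (as bs : List (Ecl n)) : List (Ecl n) := (as.flatMap fun a => [a, Complex.I • a]) ++ bs

lemma length_frameL (as bs : List (Ecl n)) :
    (frameL as bs).length = 2 * as.length + bs.length := by
  simp [frameL, List.length_flatMap, mul_comm]

/-- The standard basis of `ℂⁿ`, extended by zero. -/
def stdE (n c : ℕ) : Ecl n := WithLp.toLp 2 fun i => if (i : ℕ) = c then 1 else 0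

lemma stdE_apply (c : ℕ) (i : Fin n) : stdE n c i = if (i : ℕ) = c then 1 else 0 := rfl

lemma inner_stdE {c c' : ℕ} (hc : c < n) :
    inner ℂ (stdE n c) (stdE n c') = if c = c' then 1 else 0 := by
  rw [PiLp.inner_apply]
  simp only [stdE_apply]
  rw [Finset.sum_eq_single (⟨c, hc⟩ : Fin n)]
  · by_cases h : c = c' <;> simp [h]
  · intro b _ hb
    have : (b : ℕ) ≠ c := fun h => hb (Fin.ext h)
    simp [this]
  · simp

/-- The complex, respectively real, standard frame vectors. -/
def stdA (n j : ℕ) : List (Ecl n) := (List.range j).map (stdE n)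

def stdB (n j l : ℕ) : List (Ecl n) := (List.range' j l).map (stdE n)

lemma mem_list_sum_body {V : Type*} [NormedAddCommGroup V] [NormedSpace ℝ V] {ι : Type*}
    (l : List ι) (x : ι → V) (B : ι → ConvexBody V) (h : ∀ i ∈ l, x i ∈ (B i : Set V)) :
    (l.map x).sum ∈ ((l.map B).sum : ConvexBody V) := by
  induction l with
  | nil => exact Set.mem_singleton (0 : V)
  | cons a l ih =>
    rw [List.map_cons, List.sum_cons, List.map_cons, List.sum_cons]
    exact Set.add_mem_add (h a (by simp)) (ih fun i hi => h i (by simp [hi]))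

lemma list_sum_body_of_mem {V : Type*} [NormedAddCommGroup V] [NormedSpace ℝ V] {ι : Type*}
    (l : List ι) (P : V →L[ℝ] V) (B : ι → ConvexBody V)
    (h : ∀ i ∈ l, ∀ x ∈ (B i : Set V), P x = x) :
    ∀ x ∈ (((l.map B).sum : ConvexBody V) : Set V), P x = x := by
  induction l with
  | nil =>
    intro x hx
    have : x = 0 := hx
    rw [this, map_zero]
  | cons a l ih =>
    rw [List.map_cons, List.sum_cons]
    rintro _ ⟨x, hx, y, hy, rfl⟩
    change P (x + y) = x + y
    rw [map_add, h a (by simp) x hx, ih (fun i hi => h i (by simp [hi])) y hy]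

lemma parL_frameL (as bs : List (Ecl n)) : parL (frameL as bs) =
    (as.map fun a => segB (Complex.I • a) + segB a).sum + (bs.map segB).sum := by
  rw [frameL, parL_append, ← parL_eq_sum]
  congr 1
  induction as with
  | nil => rfl
  | cons a as ih =>
    rw [List.flatMap_cons, parL_append, ih, List.map_cons, List.sum_cons]
    simp [parL]

/-- The coordinatewise real linear map of `ℂⁿ`. -/
def coordMap (n : ℕ) (f : ℕ → ℂ →L[ℝ] ℂ) : Ecl n →L[ℝ] Ecl n :=
  LinearMap.toContinuousLinearMap
    { toFun := fun z => WithLp.toLp 2 fun i => f i (z i)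
      map_add' := fun z w => by ext i; simp
      map_smul' := fun r z => by
        ext i
        change f i (r • z i) = r • f i (z i)
        rw [map_smul] }

lemma coordMap_apply (f : ℕ → ℂ →L[ℝ] ℂ) (z : Ecl n) (i : Fin n) :
    coordMap n f z i = f i (z i) := rfl

lemma det_coordMap (f : ℕ → ℂ →L[ℝ] ℂ) :
    LinearMap.det (coordMap n f : Ecl n →ₗ[ℝ] Ecl n) =
      ∏ i ∈ Finset.range n, LinearMap.det (f i : ℂ →ₗ[ℝ] ℂ) := by
  let e : Ecl n ≃ₗ[ℝ] (Fin n → ℂ) := WithLp.linearEquiv 2 ℝ (Fin n → ℂ)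
  rw [← LinearMap.det_conj _ e, Finset.prod_range, ← LinearMap.det_pi fun i : Fin n => (f i : ℂ →ₗ[ℝ] ℂ)]
  rfl

lemma det_complex (f : ℂ →L[ℝ] ℂ) :
    LinearMap.det (f : ℂ →ₗ[ℝ] ℂ) = (f 1).re * (f Complex.I).im - (f Complex.I).re * (f 1).im := by
  rw [← LinearMap.det_toMatrix Complex.basisOneI, Matrix.det_fin_two]
  simp [LinearMap.toMatrix_apply]

/-- The real coordinate projection `ℂ → ℝ ⊂ ℂ`. -/
def reP : ℂ →L[ℝ] ℂ := Complex.ofRealCLM ∘L Complex.reCLM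

lemma reP_apply (z : ℂ) : reP z = z.re := rfl

/-- Coordinates of the projection onto the span of a standard frame. -/
def frameC (j m c : ℕ) : ℂ →L[ℝ] ℂ :=
  if c < j then ContinuousLinearMap.id ℝ ℂ else if c < m then reP else 0

/-- Multiplication by `b i`. -/
def mulI (n : ℕ) (b : ℝ) : Ecl n →L[ℝ] Ecl n :=
  b • ((Complex.I • ContinuousLinearMap.id ℂ (Ecl n)).restrictScalars ℝ)

lemma mulI_apply (b : ℝ) (z : Ecl n) : mulI n b z = b • Complex.I • z := rfl

lemma norm_mulI_lt {b : ℝ} (hb : |b| < 1) : ‖mulI n b‖ < 1 := by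
  refine (ContinuousLinearMap.opNorm_le_bound _ (abs_nonneg b) fun z => ?_).trans_lt hb
  rw [mulI_apply, norm_smul, norm_smul, Complex.norm_I, one_mul, Real.norm_eq_abs]

lemma prod_range_ite {n j m : ℕ} (hjm : j ≤ m) (hmn : m ≤ n) (α β : ℝ) :
    ∏ i ∈ Finset.range n, (if i < j then α else if i < m then β else 1) = α ^ j * β ^ (m - j) := by
  obtain ⟨p, rfl⟩ := Nat.exists_eq_add_of_le hjm
  obtain ⟨q, rfl⟩ := Nat.exists_eq_add_of_le hmn
  rw [Finset.prod_range_add, Finset.prod_range_add]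
  have h1 : ∏ x ∈ Finset.range j, (if x < j then α else if x < j + p then β else 1) = α ^ j := by
    rw [Finset.prod_congr rfl (g := fun _ => α)]
    · simp
    · intro i hi; rw [if_pos (Finset.mem_range.1 hi)]
  have h2 : ∏ x ∈ Finset.range p, (if j + x < j then α else if j + x < j + p then β else 1)
      = β ^ p := by
    rw [Finset.prod_congr rfl (g := fun _ => β)]
    · simp
    · intro i hi
      rw [if_neg (by omega), if_pos (by have := Finset.mem_range.1 hi; omega)]
  have h3 : ∏ x ∈ Finset.range q, (if j + p + x < j then α else if j + p + x < j + p then β else 1)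
      = 1 := Finset.prod_eq_one fun i hi => by rw [if_neg (by omega), if_neg (by omega)]
  rw [h1, h2, h3, Nat.add_sub_cancel_left, mul_one]

lemma list_sum_stdE (w : ℕ → ℂ) {l : List ℕ} (hl : l.Nodup) (i : Fin n) :
    (l.map fun c => w c • stdE n c).sum i = if (i : ℕ) ∈ l then w i else 0 := by
  induction l with
  | nil => simp
  | cons a l ih =>
    rw [List.nodup_cons] at hl
    rw [List.map_cons, List.sum_cons, PiLp.add_apply, ih hl.2, PiLp.smul_apply, stdE_apply]
    by_cases h : (i : ℕ) = a
    · subst h; simp [hl.1]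
    · simp [h]

lemma stdFrame_mem {j l : ℕ} (z : Ecl n)
    (hA : ∀ i : Fin n, (i : ℕ) < j → 0 ≤ (z i).re ∧ (z i).re ≤ 1 ∧ 0 ≤ (z i).im ∧ (z i).im ≤ 1)
    (hB : ∀ i : Fin n, j ≤ (i : ℕ) → (i : ℕ) < j + l → 0 ≤ (z i).re ∧ (z i).re ≤ 1) :
    coordMap n (frameC j (j + l)) z ∈ (parL (frameL (stdA n j) (stdB n j l)) : Set (Ecl n)) := by
  let z' : ℕ → ℂ := fun c => if h : c < n then z ⟨c, h⟩ else 0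
  have hz' : ∀ i : Fin n, z' i = z i := fun i => by simp [z']
  have hA' : ∀ c < j, 0 ≤ (z' c).re ∧ (z' c).re ≤ 1 ∧ 0 ≤ (z' c).im ∧ (z' c).im ≤ 1 := by
    intro c hc
    by_cases h : c < n
    · simpa [z', h] using hA ⟨c, h⟩ hc
    · simp [z', h]
  have hB' : ∀ c, j ≤ c → c < j + l → 0 ≤ (z' c).re ∧ (z' c).re ≤ 1 := by
    intro c hc hc'
    by_cases h : c < n
    · simpa [z', h] using hB ⟨c, h⟩ hc hc'
    · simp [z', h]
  have e : coordMap n (frameC j (j + l)) z = ((List.range j).map fun c =>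
      ((z' c).im • Complex.I • stdE n c + (z' c).re • stdE n c)).sum +
      ((List.range' j l).map fun c => (z' c).re • stdE n c).sum := by
    have e1 : ∀ c, (z' c).im • Complex.I • stdE n c + (z' c).re • stdE n c = z' c • stdE n c := by
      intro c
      conv_rhs => rw [← Complex.re_add_im (z' c)]
      rw [add_smul, mul_smul, Complex.coe_smul, Complex.coe_smul, add_comm]
    have e2 : ∀ c, (z' c).re • stdE n c = ((z' c).re : ℂ) • stdE n c := fun c =>
      (Complex.coe_smul _ _).symm
    simp only [e1]
    simp only [e2]
    ext i
    rw [PiLp.add_apply, list_sum_stdE _ List.nodup_range, list_sum_stdE _ List.nodup_range',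
      coordMap_apply, frameC]
    simp only [List.mem_range, List.mem_range'_1, hz']
    by_cases h1 : (i : ℕ) < j
    · simp [h1, h1.not_ge]
    · by_cases h2 : (i : ℕ) < j + l
      · simp [h1, h2, not_lt.1 h1, reP_apply]
      · simp [h1, h2]
  rw [e, parL_frameL, stdA, stdB, List.map_map, List.map_map]
  refine Set.add_mem_add (mem_list_sum_body _ _ _ fun c hc => ?_) (mem_list_sum_body _ _ _ fun c hc => ?_)
  · obtain ⟨h1, h2, h3, h4⟩ := hA' c (List.mem_range.1 hc)
    exact Set.add_mem_add (mem_segB.2 ⟨_, h3, h4, rfl⟩) (mem_segB.2 ⟨_, h1, h2, rfl⟩)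
  · have := List.mem_range'_1.1 hc
    obtain ⟨h1, h2⟩ := hB' c this.1 this.2
    exact mem_segB.2 ⟨_, h1, h2, rfl⟩

lemma stdFrame_fixed {j l : ℕ} : ∀ x ∈ (parL (frameL (stdA n j) (stdB n j l)) : Set (Ecl n)),
    coordMap n (frameC j (j + l)) x = x := by
  rw [parL_frameL, stdA, stdB, List.map_map, List.map_map]
  rintro _ ⟨x, hx, y, hy, rfl⟩
  change coordMap n _ (x + y) = x + y
  rw [map_add, list_sum_body_of_mem _ _ _ ?_ x hx, list_sum_body_of_mem _ _ _ ?_ y hy]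
  · intro c hc w hw
    have hc := List.mem_range'_1.1 hc
    obtain ⟨t, -, -, rfl⟩ := mem_segB.1 hw
    ext i
    rw [coordMap_apply]
    by_cases hi : (i : ℕ) = c
    · simp [frameC, hi, hc.1.not_gt, hc.2, stdE_apply, reP_apply]
    · simp [stdE_apply, hi]
  · intro c hc w hw
    have hc := List.mem_range.1 hc
    obtain ⟨w1, hw1, w2, hw2, rfl⟩ := hw
    obtain ⟨t, -, -, rfl⟩ := mem_segB.1 hw1
    obtain ⟨s, -, -, rfl⟩ := mem_segB.1 hw2
    ext i
    rw [coordMap_apply]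
    by_cases hi : (i : ℕ) = c
    · simp [frameC, hi, hc]
    · simp [stdE_apply, hi]

/-- Twisted tube functionals have polynomial dependence on the twist on standard frames. -/
theorem tendsto_tube_stdFrame {j l k : ℕ} (hn : j + l ≤ n) (hk : 2 * j + l = k) :
    ∃ I : ℝ, 0 < I ∧ ∀ b : ℝ, |b| < 1 →
      Tendsto (fun t : ℝ => (t ^ k)⁻¹ * tube (mulI n b) (t • parL (frameL (stdA n j) (stdB n j l))))
        atTop (𝓝 ((1 + b ^ 2) ^ j * I)) := by
  set C := parL (frameL (stdA n j) (stdB n j l)) with hCdef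
  set P := coordMap n (frameC j (j + l)) with hP
  have hjm : j ≤ j + l := by omega
  have hPP : ∀ x, P (P x) = P x := fun x => by
    ext i
    simp only [hP, coordMap_apply, frameC]
    split_ifs <;> simp [reP_apply]
  have hPs : ∀ x y, ⟪P x, y⟫ = ⟪x, P y⟫ := fun x y => by
    rw [PiLp.inner_apply, PiLp.inner_apply]
    refine Finset.sum_congr rfl fun i _ => ?_
    simp only [hP, coordMap_apply, frameC]
    split_ifs <;> simp [reP_apply, Complex.inner]
  refine ⟨_, integral_tent_pos P hPP C (c := P (WithLp.toLp 2 fun _ => (1 + Complex.I) / 2))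
    (hPP _) (ε := 1 / 2) (by norm_num) ?_, fun b hb => ?_⟩
  · intro x hx
    have hxi : ∀ i : Fin n, ‖x i - P (WithLp.toLp 2 fun _ => (1 + Complex.I) / 2) i‖ < 1 / 2 :=
      fun i => (PiLp.norm_apply_le (p := 2) (x - P (WithLp.toLp 2 fun _ => (1 + Complex.I) / 2)) i).trans_lt hx
    have hre : ∀ i : Fin n, (i : ℕ) < j + l → 0 ≤ (x i).re ∧ (x i).re ≤ 1 := by
      intro i hi
      have h1 := (Complex.abs_re_le_norm _).trans_lt (hxi i)
      have h2 : (P (WithLp.toLp 2 fun _ => (1 + Complex.I) / 2) i).re = 1 / 2 := by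
        simp only [hP, coordMap_apply, frameC, hi]
        split_ifs <;> simp [reP_apply]
      rw [Complex.sub_re, h2, abs_lt] at h1
      constructor <;> linarith
    have him : ∀ i : Fin n, (i : ℕ) < j → 0 ≤ (x i).im ∧ (x i).im ≤ 1 := by
      intro i hi
      have h1 := (Complex.abs_im_le_norm _).trans_lt (hxi i)
      have h2 : (P (WithLp.toLp 2 fun _ => (1 + Complex.I) / 2) i).im = 1 / 2 := by
        simp only [hP, coordMap_apply, frameC, hi]
        simp
      rw [Complex.sub_im, h2, abs_lt] at h1
      constructor <;> linarith
    exact stdFrame_mem x (fun i hi => ⟨(hre i (by omega)).1, (hre i (by omega)).2, him i hi⟩)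
      fun i _ hi => hre i hi
  · refine tendsto_tube (norm_mulI_lt hb) P hPP hPs C stdFrame_fixed (fun t ht => ?_)
      (by positivity) ?_
    · have e : t • P + (ContinuousLinearMap.id ℝ (Ecl n) - P) = coordMap n fun c =>
          t • frameC j (j + l) c + (ContinuousLinearMap.id ℝ ℂ - frameC j (j + l) c) := rfl
      rw [e, det_coordMap, ← hk]
      have : ∀ c, LinearMap.det ((t • frameC j (j + l) c + (ContinuousLinearMap.id ℝ ℂ -
          frameC j (j + l) c) : ℂ →L[ℝ] ℂ) : ℂ →ₗ[ℝ] ℂ) =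
          if c < j then t ^ 2 else if c < j + l then t else 1 := by
        intro c
        rw [det_complex, frameC]
        split_ifs <;> simp [reP_apply, sq]
      simp only [this]
      rw [prod_range_ite hjm hn, ← pow_mul, Nat.add_sub_cancel_left, pow_add]
    · have e : ContinuousLinearMap.id ℝ (Ecl n) + mulI n b ∘L P = coordMap n fun c =>
          ContinuousLinearMap.id ℝ ℂ + (b • (Complex.I • ContinuousLinearMap.id ℂ ℂ).restrictScalars ℝ)
            ∘L frameC j (j + l) c := rfl
      rw [e, det_coordMap]
      have : ∀ c, LinearMap.det ((ContinuousLinearMap.id ℝ ℂ +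
          (b • (Complex.I • ContinuousLinearMap.id ℂ ℂ).restrictScalars ℝ)
            ∘L frameC j (j + l) c : ℂ →L[ℝ] ℂ) : ℂ →ₗ[ℝ] ℂ) =
          if c < j then 1 + b ^ 2 else if c < j + l then 1 else 1 := by
        intro c
        rw [det_complex, frameC]
        split_ifs <;> simp [reP_apply, sq]
      simp only [this]
      rw [prod_range_ite hjm hn, one_pow, mul_one]

end Frames

open scoped Quaternion

/-- The standard Gaussian measure on the quaternions. -/
local notation "γℍ" => stdGaussian ℍ[ℝ]

section RadialGaussian

lemma integral_stdGaussian_complex {f : ℝ → ℝ} (hf : PG f) :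
    ∫ z, f (‖z‖ ^ 2) ∂stdGaussian ℂ
      = ∫ r in Set.Ioi (0 : ℝ), r * (f (r ^ 2) * Real.exp (-r ^ 2 / 2)) := by
  have hre : ∀ t : ℝ, Complex.reCLM.adjoint t = (t : ℂ) := fun t => by
    refine ext_inner_left ℝ fun v => ?_
    rw [ContinuousLinearMap.adjoint_inner_right, Complex.inner]
    simp [mul_comm]
  have him : ∀ t : ℝ, Complex.imCLM.adjoint t = (t : ℂ) * Complex.I := fun t => by
    refine ext_inner_left ℝ fun v => ?_
    rw [ContinuousLinearMap.adjoint_inner_right, Complex.inner]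
    simp [mul_comm]
  have hF : PG fun p : ℝ × ℝ => f (p.1 ^ 2 + p.2 ^ 2) :=
    hf.comp ((PG.fst.pow 2).add (PG.snd.pow 2))
  have hm : ∀ L : ℂ →L[ℝ] ℝ, (∀ t, ‖L.adjoint t‖ = ‖t‖) →
      (stdGaussian ℂ).map L = gaussianReal 0 1 := fun L hL => by
    rw [stdGaussian_map_coisometry L hL]
    have h1 := stdGaussian_map_inner (1 : ℝ)
    simp only [RCLike.inner_apply, conj_trivial, mul_one, Measure.map_id', nnnorm_one,
      one_pow] at h1
    exact h1
  have h1 := integral_stdGaussian_pair Complex.reCLM Complex.imCLM (fun s t => by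
    rw [hre, him, Complex.inner]; simp) hF
  rw [hm _ (fun t => by rw [hre]; simp), hm _ (fun t => by rw [him]; simp)] at h1
  have h2 : ∀ z : ℂ, f (‖z‖ ^ 2) = f (Complex.reCLM z ^ 2 + Complex.imCLM z ^ 2) := fun z => by
    rw [← Complex.normSq_eq_norm_sq, Complex.normSq_apply]
    simp [pow_two]
  simp_rw [h2]
  rw [h1]
  have := (hm_of_isGaussian (gaussianReal 0 1)).1
  have hi := hF.integrable ((hm_of_isGaussian (gaussianReal 0 1)).prod
    (hm_of_isGaussian (gaussianReal 0 1)))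
  have h3 : ∫ a, ∫ b, f (a ^ 2 + b ^ 2) ∂gaussianReal 0 1 ∂gaussianReal 0 1
      = ∫ p : ℝ × ℝ, f (p.1 ^ 2 + p.2 ^ 2) * (gphi p.1 * gphi p.2) := by
    have hg : gaussianReal 0 1 = volume.withDensity (fun u => ENNReal.ofReal (gphi u)) := by
      rw [gaussianReal_of_var_ne_zero _ one_ne_zero]; rfl
    have hgm : Measurable fun u => ENNReal.ofReal (gphi u) :=
      (measurable_gaussianPDF 0 1)
    have hp : (gaussianReal 0 1).prod (gaussianReal 0 1) =
        (volume : Measure (ℝ × ℝ)).withDensity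
          (fun p => ENNReal.ofReal (gphi p.1) * ENNReal.ofReal (gphi p.2)) := by
      rw [hg, prod_withDensity hgm hgm]; rfl
    rw [← integral_prod _ hi, hp, integral_withDensity_eq_integral_toReal_smul]
    · refine integral_congr_ae (ae_of_all _ fun p => ?_)
      simp only [ENNReal.toReal_mul, ENNReal.toReal_ofReal (gphi_pos _).le, smul_eq_mul]
      ring
    · exact (hgm.comp measurable_fst).mul (hgm.comp measurable_snd)
    · exact ae_of_all _ fun p => ENNReal.mul_lt_top ENNReal.ofReal_lt_top ENNReal.ofReal_lt_top
  rw [h3, ← integral_comp_polarCoord_symm]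
  have h4 : ∀ p : ℝ × ℝ, p.1 • (f ((polarCoord.symm p).1 ^ 2 + (polarCoord.symm p).2 ^ 2) *
      (gphi (polarCoord.symm p).1 * gphi (polarCoord.symm p).2))
      = (p.1 * (f (p.1 ^ 2) * Real.exp (-p.1 ^ 2 / 2))) * (2 * Real.pi)⁻¹ := fun p => by
    have e1 : (polarCoord.symm p).1 ^ 2 + (polarCoord.symm p).2 ^ 2 = p.1 ^ 2 := by
      simp only [polarCoord_symm_apply]
      linear_combination p.1 ^ 2 * Real.cos_sq_add_sin_sq p.2
    have e2 : gphi (polarCoord.symm p).1 * gphi (polarCoord.symm p).2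
        = (2 * Real.pi)⁻¹ * Real.exp (-p.1 ^ 2 / 2) := by
      rw [gphi_eq, gphi_eq, mul_mul_mul_comm, ← Real.exp_add, ← mul_inv,
        Real.mul_self_sqrt (by positivity)]
      congr 2
      linear_combination (-1 / 2 : ℝ) * e1
    rw [e1, e2, smul_eq_mul]
    ring
  simp_rw [h4]
  rw [polarCoord_target, Measure.volume_eq_prod, ← Measure.prod_restrict,
    integral_prod_mul (fun r : ℝ => r * (f (r ^ 2) * Real.exp (-r ^ 2 / 2)))
      (fun _ : ℝ => (2 * Real.pi)⁻¹)]
  have : (∫ _ in Set.Ioo (-Real.pi) Real.pi, (2 * Real.pi)⁻¹) = 1 := by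
    rw [setIntegral_const, Measure.real, Real.volume_Ioo, ENNReal.toReal_ofReal (by
      linarith [Real.pi_pos])]
    have := Real.pi_pos
    simp only [smul_eq_mul]
    field_simp
    ring
  rw [this, mul_one]

lemma integral_exp_norm_sq {t : ℝ} (ht : 0 ≤ t) :
    ∫ z, Real.exp (-(t * |‖z‖ ^ 2|)) ∂stdGaussian ℂ = (1 + 2 * t)⁻¹ := by
  have hpg : PG fun x : ℝ => Real.exp (-(t * |x|)) :=
    PG.of_le (PG.const (1 : ℝ)) (by fun_prop) (C := 1) fun x => by
      have h1 : 0 ≤ t * |x| := by positivity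
      have h2 : Real.exp (-(t * |x|)) ≤ 1 := Real.exp_le_one_iff.2 (by linarith)
      rw [norm_one, Real.norm_of_nonneg (Real.exp_pos _).le]
      linarith
  rw [integral_stdGaussian_complex hpg]
  set b := t + 1 / 2 with hb
  have hb0 : 0 < b := by positivity
  have hd : ∀ r : ℝ, HasDerivAt (fun r => -(2 * b)⁻¹ * Real.exp (-(b * r ^ 2)))
      (r * Real.exp (-(b * r ^ 2))) r := fun r => by
    refine ((((hasDerivAt_pow 2 r).const_mul b).fun_neg.exp).const_mul (-(2 * b)⁻¹)).congr_deriv ?_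
    field_simp
    norm_num
  have hlim : Tendsto (fun r : ℝ => -(2 * b)⁻¹ * Real.exp (-(b * r ^ 2))) atTop (𝓝 0) := by
    have h1 : Tendsto (fun r : ℝ => b * r ^ 2) atTop atTop :=
      (tendsto_pow_atTop two_ne_zero).const_mul_atTop hb0
    simpa using (Real.tendsto_exp_neg_atTop_nhds_zero.comp h1).const_mul (-(2 * b)⁻¹)
  have h := integral_Ioi_of_hasDerivAt_of_nonneg (a := 0)
    (hd 0).continuousAt.continuousWithinAt (fun r _ => hd r)
    (fun r hr => mul_nonneg (le_of_lt hr) (Real.exp_pos _).le) hlim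
  have e : ∀ r : ℝ, r * (Real.exp (-(t * |r ^ 2|)) * Real.exp (-r ^ 2 / 2))
      = r * Real.exp (-(b * r ^ 2)) := fun r => by
    rw [← Real.exp_add, abs_of_nonneg (sq_nonneg r), hb]
    ring_nf
  simp_rw [e]
  rw [h, hb]
  have : 1 + 2 * t ≠ 0 := by positivity
  simp
  field_simp
  ring

lemma integral_abs_norm_sq_sub {α c : ℝ} (hα : 0 < α) (hc : 0 ≤ c) :
    ∫ z, |α * ‖z‖ ^ 2 - c| ∂stdGaussian ℂ = c - 2 * α + 4 * α * Real.exp (-(c / (2 * α))) := by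
  rw [integral_stdGaussian_complex (f := fun x => |α * x - c|)
    (((PG.id.const_mul α).sub (PG.const c)).abs)]
  set r₀ := √(c / α) with hr
  have hr0 : 0 ≤ r₀ := Real.sqrt_nonneg _
  have hr2 : α * r₀ ^ 2 = c := by
    rw [hr, Real.sq_sqrt (by positivity)]; field_simp
  set G : ℝ → ℝ := fun r => -(α * r ^ 2 - c + 2 * α) * Real.exp (-(r ^ 2 / 2)) with hG
  have hd : ∀ r : ℝ, HasDerivAt G (r * ((α * r ^ 2 - c) * Real.exp (-r ^ 2 / 2))) r := fun r => by
    refine ((((((hasDerivAt_pow 2 r).const_mul α).sub_const c).add_const (2 * α)).fun_neg).mul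
      (((hasDerivAt_pow 2 r).div_const 2).fun_neg.exp)).congr_deriv ?_
    rw [neg_div]
    norm_num
    ring
  have hlim : Tendsto G atTop (𝓝 0) := by
    have h1 : Tendsto (fun r : ℝ => r ^ 2 / 2) atTop atTop :=
      (tendsto_pow_atTop two_ne_zero).atTop_div_const two_pos
    have h2 := ((Real.tendsto_pow_mul_exp_neg_atTop_nhds_zero 1).const_mul (-(2 * α))).add
      ((Real.tendsto_pow_mul_exp_neg_atTop_nhds_zero 0).const_mul (c - 2 * α))
    rw [mul_zero, mul_zero, add_zero] at h2
    refine (h2.comp h1).congr fun r => ?_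
    simp only [hG, Function.comp]
    ring
  have hpos : ∀ r ∈ Set.Ioi r₀, 0 ≤ r * ((α * r ^ 2 - c) * Real.exp (-r ^ 2 / 2)) := by
    intro r hr
    have h1 : r₀ ^ 2 ≤ r ^ 2 := pow_le_pow_left₀ hr0 (le_of_lt hr) 2
    have h2 : 0 ≤ α * r ^ 2 - c := by rw [← hr2]; nlinarith
    have h3 : 0 ≤ r := hr0.trans (le_of_lt hr)
    positivity
  have h1 := integral_Ioi_of_hasDerivAt_of_nonneg (hd r₀).continuousAt.continuousWithinAt
    (fun r _ => hd r) hpos hlim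
  have h1i := integrableOn_Ioi_deriv_of_nonneg (hd r₀).continuousAt.continuousWithinAt
    (fun r _ => hd r) hpos hlim
  have hcont : Continuous fun r : ℝ => r * ((α * r ^ 2 - c) * Real.exp (-r ^ 2 / 2)) := by fun_prop
  have h2 := intervalIntegral.integral_eq_sub_of_hasDerivAt (fun r _ => hd r)
    (hcont.intervalIntegrable 0 r₀)
  rw [intervalIntegral.integral_of_le hr0] at h2
  have e1 : Set.EqOn (fun r : ℝ => r * (|α * r ^ 2 - c| * Real.exp (-r ^ 2 / 2)))
      (fun r => r * ((α * r ^ 2 - c) * Real.exp (-r ^ 2 / 2))) (Set.Ioi r₀) := fun r hr => by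
    have h1 : r₀ ^ 2 ≤ r ^ 2 := pow_le_pow_left₀ hr0 (le_of_lt hr) 2
    simp only
    rw [abs_of_nonneg]
    rw [← hr2]; nlinarith
  have e2 : Set.EqOn (fun r : ℝ => r * (|α * r ^ 2 - c| * Real.exp (-r ^ 2 / 2)))
      (fun r => -(r * ((α * r ^ 2 - c) * Real.exp (-r ^ 2 / 2)))) (Set.Ioc 0 r₀) := fun r hr => by
    have h1 : r ^ 2 ≤ r₀ ^ 2 := pow_le_pow_left₀ hr.1.le hr.2 2
    simp only
    rw [abs_of_nonpos]
    · ring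
    rw [← hr2]; nlinarith
  rw [← Set.Ioc_union_Ioi_eq_Ioi hr0, setIntegral_union (Set.Ioc_disjoint_Ioi le_rfl)
    measurableSet_Ioi, setIntegral_congr_fun measurableSet_Ioi e1,
    setIntegral_congr_fun measurableSet_Ioc e2, h1, integral_neg, h2]
  · have e3 : r₀ ^ 2 / 2 = c / (2 * α) := by rw [← hr2]; field_simp
    simp only [hG, e3, hr2]
    norm_num
    ring
  · exact (integrableOn_congr_fun e2 measurableSet_Ioc).2
      ((hcont.integrableOn_Icc.mono_set Set.Ioc_subset_Icc_self).neg)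
  · exact (integrableOn_congr_fun e1 measurableSet_Ioi).2 h1i

lemma integral_norm_sq_complex : ∫ z, ‖z‖ ^ 2 ∂stdGaussian ℂ = 2 := by
  have h := integral_abs_norm_sq_sub one_pos le_rfl
  simp only [one_mul, sub_zero, abs_pow, abs_norm] at h
  rw [h]
  norm_num

lemma integral_integral_abs_norm_sq {α β : ℝ} (hα : 0 < α) (hβ : 0 < β) :
    ∫ w, ∫ z, |α * ‖z‖ ^ 2 - β * ‖w‖ ^ 2| ∂stdGaussian ℂ ∂stdGaussian ℂ
      = 2 * (α ^ 2 + β ^ 2) / (α + β) := by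
  have h1 : ∀ w : ℂ, ∫ z, |α * ‖z‖ ^ 2 - β * ‖w‖ ^ 2| ∂stdGaussian ℂ
      = (β * ‖w‖ ^ 2 - 2 * α) + 4 * α * Real.exp (-(β / (2 * α) * |‖w‖ ^ 2|)) := fun w => by
    rw [integral_abs_norm_sq_sub hα (by positivity), abs_of_nonneg (sq_nonneg ‖w‖)]
    ring_nf
  simp_rw [h1]
  have := (hm_of_isGaussian (stdGaussian ℂ)).1
  have hi1 : Integrable (fun w : ℂ => β * ‖w‖ ^ 2) (stdGaussian ℂ) :=
    ((PG.id.norm.pow 2).const_mul β).integrable (hm_of_isGaussian _)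
  have hi2 : Integrable (fun w : ℂ => β * ‖w‖ ^ 2 - 2 * α) (stdGaussian ℂ) :=
    hi1.sub (integrable_const _)
  have hi3 : Integrable (fun w : ℂ => 4 * α * Real.exp (-(β / (2 * α) * |‖w‖ ^ 2|)))
      (stdGaussian ℂ) := by
    refine (PG.of_le (PG.const (1 : ℝ)) (by fun_prop) (C := 4 * α) fun w => ?_).integrable
      (hm_of_isGaussian _)
    have h2 : 0 ≤ β / (2 * α) * |‖w‖ ^ 2| := by positivity
    have h3 : Real.exp (-(β / (2 * α) * |‖w‖ ^ 2|)) ≤ 1 := Real.exp_le_one_iff.2 (by linarith)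
    rw [Real.norm_of_nonneg (by positivity), norm_one]
    exact mul_le_mul_of_nonneg_left (h3.trans (by norm_num)) (by positivity)
  rw [integral_add hi2 hi3, integral_sub hi1 (integrable_const _), integral_const_mul,
    integral_const_mul, integral_const_mul (4 * α), integral_exp_norm_sq (by positivity), integral_norm_sq_complex]
  simp only [integral_const, probReal_univ, smul_eq_mul]
  field_simp
  ring

end RadialGaussian

section QuaternionGaussian

instance : MeasurableSpace ℍ[ℝ] := borel _
instance : BorelSpace ℍ[ℝ] := ⟨rfl⟩

/-- The quaternion with given coordinates. -/
def qmk (a b c d : ℝ) : ℍ[ℝ] := ⟨a, b, c, d⟩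

@[simp] lemma qmk_re (a b c d : ℝ) : (qmk a b c d).re = a := rfl
@[simp] lemma qmk_imI (a b c d : ℝ) : (qmk a b c d).imI = b := rfl
@[simp] lemma qmk_imJ (a b c d : ℝ) : (qmk a b c d).imJ = c := rfl
@[simp] lemma qmk_imK (a b c d : ℝ) : (qmk a b c d).imK = d := rfl

/-- The quaternion units `i` and `j`. -/
def qI : ℍ[ℝ] := qmk 0 1 0 0

/-- The quaternion unit `j`. -/
def qJ : ℍ[ℝ] := qmk 0 0 1 0

@[simp] lemma qI_re : qI.re = 0 := rfl
@[simp] lemma qI_imI : qI.imI = 1 := rfl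
@[simp] lemma qI_imJ : qI.imJ = 0 := rfl
@[simp] lemma qI_imK : qI.imK = 0 := rfl
@[simp] lemma qJ_re : qJ.re = 0 := rfl
@[simp] lemma qJ_imI : qJ.imI = 0 := rfl
@[simp] lemma qJ_imJ : qJ.imJ = 1 := rfl
@[simp] lemma qJ_imK : qJ.imK = 0 := rfl

lemma qinner (a b : ℍ[ℝ]) :
    ⟪a, b⟫ = a.re * b.re + a.imI * b.imI + a.imJ * b.imJ + a.imK * b.imK := by
  rw [Quaternion.inner_def, Quaternion.re_mul]
  simp

lemma qnorm_sq (a : ℍ[ℝ]) : ‖a‖ ^ 2 = a.re ^ 2 + a.imI ^ 2 + a.imJ ^ 2 + a.imK ^ 2 := by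
  rw [pow_two, ← Quaternion.normSq_eq_norm_mul_self, Quaternion.normSq_def']

lemma qself_mul_star (a : ℍ[ℝ]) : a * star a = ((‖a‖ ^ 2 : ℝ) : ℍ[ℝ]) := by
  rw [Quaternion.self_mul_star, Quaternion.normSq_eq_norm_mul_self, pow_two]

lemma qstar_mul_self (a : ℍ[ℝ]) : star a * a = ((‖a‖ ^ 2 : ℝ) : ℍ[ℝ]) := by
  rw [Quaternion.star_mul_self, Quaternion.normSq_eq_norm_mul_self, pow_two]

lemma norm_qI : ‖qI‖ = 1 := by
  have := qnorm_sq qI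
  rw [← sq_eq_sq₀ (norm_nonneg _) zero_le_one, this]
  simp

lemma qinner_mul_left (s a b : ℍ[ℝ]) : ⟪s * a, s * b⟫ = ‖s‖ ^ 2 * ⟪a, b⟫ := by
  rw [qnorm_sq]
  simp only [qinner, Quaternion.re_mul, Quaternion.imI_mul, Quaternion.imJ_mul, Quaternion.imK_mul]
  ring

lemma qinner_mul_right (s a b : ℍ[ℝ]) : ⟪a * s, b * s⟫ = ‖s‖ ^ 2 * ⟪a, b⟫ := by
  rw [qnorm_sq]
  simp only [qinner, Quaternion.re_mul, Quaternion.imI_mul, Quaternion.imJ_mul, Quaternion.imK_mul]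
  ring

lemma qinner_mul_star (a b q : ℍ[ℝ]) : ⟪a * q, b⟫ = ⟪a, b * star q⟫ := by
  simp only [qinner, Quaternion.re_mul, Quaternion.imI_mul, Quaternion.imJ_mul,
    Quaternion.imK_mul, Quaternion.re_star, Quaternion.imI_star, Quaternion.imJ_star,
    Quaternion.imK_star]
  ring

/-- Left multiplication by a unit quaternion. -/
def lmulE {s : ℍ[ℝ]} (hs : ‖s‖ = 1) : ℍ[ℝ] ≃ₗᵢ[ℝ] ℍ[ℝ] where
  toLinearEquiv := LinearEquiv.ofLinear (LinearMap.mulLeft ℝ s) (LinearMap.mulLeft ℝ (star s))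
    (by ext1 x; simp [← mul_assoc, qself_mul_star, hs])
    (by ext1 x; simp [← mul_assoc, qstar_mul_self, hs])
  norm_map' x := by simp [hs]

/-- Right multiplication by a unit quaternion. -/
def rmulE {s : ℍ[ℝ]} (hs : ‖s‖ = 1) : ℍ[ℝ] ≃ₗᵢ[ℝ] ℍ[ℝ] where
  toLinearEquiv := LinearEquiv.ofLinear (LinearMap.mulRight ℝ s) (LinearMap.mulRight ℝ (star s))
    (by ext1 x; simp [mul_assoc, qstar_mul_self, hs])
    (by ext1 x; simp [mul_assoc, qself_mul_star, hs])
  norm_map' x := by simp [hs]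

@[simp] lemma lmulE_apply {s : ℍ[ℝ]} (hs : ‖s‖ = 1) (x : ℍ[ℝ]) : lmulE hs x = s * x := rfl
@[simp] lemma rmulE_apply {s : ℍ[ℝ]} (hs : ‖s‖ = 1) (x : ℍ[ℝ]) : rmulE hs x = x * s := rfl

lemma integral_stdGaussian_isometry {E F : Type*} [NormedAddCommGroup E] [InnerProductSpace ℝ E]
    [FiniteDimensional ℝ E] [MeasurableSpace E] [BorelSpace E] [NormedAddCommGroup F]
    [InnerProductSpace ℝ F] [FiniteDimensional ℝ F] [MeasurableSpace F] [BorelSpace F]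
    (e : E ≃ₗᵢ[ℝ] F) (f : F → ℝ) :
    ∫ g, f (e g) ∂stdGaussian E = ∫ g, f g ∂stdGaussian F := by
  rw [← stdGaussian_map e]
  exact (e.toHomeomorph.measurableEmbedding.integral_map f).symm

/-- The two complex coordinates of `g = z₁ + z₂ j`. -/
def qz1 : ℍ[ℝ] →L[ℝ] ℂ := LinearMap.toContinuousLinearMap
  { toFun := fun g => ⟨g.re, g.imI⟩
    map_add' := fun _ _ => rfl
    map_smul' := fun c g => by apply Complex.ext <;> simp }

/-- The second complex coordinate of a quaternion. -/
def qz2 : ℍ[ℝ] →L[ℝ] ℂ := LinearMap.toContinuousLinearMap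
  { toFun := fun g => ⟨g.imJ, g.imK⟩
    map_add' := fun _ _ => rfl
    map_smul' := fun c g => by apply Complex.ext <;> simp }

@[simp] lemma qz1_apply (g : ℍ[ℝ]) : qz1 g = ⟨g.re, g.imI⟩ := rfl
@[simp] lemma qz2_apply (g : ℍ[ℝ]) : qz2 g = ⟨g.imJ, g.imK⟩ := rfl

lemma integral_stdGaussian_quaternion {f : ℂ × ℂ → ℝ} (hf : PG f) :
    ∫ g, f (qz1 g, qz2 g) ∂γℍ = ∫ a, ∫ b, f (a, b) ∂stdGaussian ℂ ∂stdGaussian ℂ := by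
  have h1 : ∀ t : ℂ, qz1.adjoint t = qmk t.re t.im 0 0 := fun t => by
    refine ext_inner_left ℝ fun v => ?_
    rw [ContinuousLinearMap.adjoint_inner_right, Complex.inner, qinner]
    simp [mul_comm]
  have h2 : ∀ t : ℂ, qz2.adjoint t = qmk 0 0 t.re t.im := fun t => by
    refine ext_inner_left ℝ fun v => ?_
    rw [ContinuousLinearMap.adjoint_inner_right, Complex.inner, qinner]
    simp [mul_comm]
  have hn : ∀ (t : ℂ) (q : ℍ[ℝ]), q.re ^ 2 + q.imI ^ 2 + q.imJ ^ 2 + q.imK ^ 2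
      = t.re ^ 2 + t.im ^ 2 → ‖q‖ = ‖t‖ := fun t q h => by
    rw [← sq_eq_sq₀ (norm_nonneg _) (norm_nonneg _), qnorm_sq, h, ← Complex.normSq_eq_norm_sq,
      Complex.normSq_apply]
    ring
  rw [integral_stdGaussian_pair qz1 qz2 (fun s t => by rw [h1, h2, qinner]; simp) hf,
    stdGaussian_map_coisometry qz1 (fun t => by rw [h1]; exact hn t _ (by simp)),
    stdGaussian_map_coisometry qz2 (fun t => by rw [h2]; exact hn t _ (by simp))]

/-- Every purely imaginary quaternion is a rotation of a multiple of `i`. -/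
lemma exists_conj_qI (x : ℍ[ℝ]) : ∃ s : ℍ[ℝ], ‖s‖ = 1 ∧ x.im = ‖x.im‖ • (s * qI * star s) := by
  set m := ‖x.im‖ with hm
  suffices h : ∃ t : ℍ[ℝ], t ≠ 0 ∧ x.im * t = m • (t * qI) by
    obtain ⟨t, ht, h⟩ := h
    have ht' : ‖t‖ ≠ 0 := norm_ne_zero_iff.2 ht
    refine ⟨‖t‖⁻¹ • t, by rw [norm_smul, norm_inv, norm_norm, inv_mul_cancel₀ ht'], ?_⟩
    have h1 : m • (t * qI * star t) = (‖t‖ ^ 2) • x.im := by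
      rw [← smul_mul_assoc, ← h, mul_assoc, qself_mul_star, ← Quaternion.coe_commutes,
        Quaternion.coe_mul_eq_smul]
    rw [Quaternion.star_smul, smul_mul_assoc, smul_mul_assoc, mul_smul_comm, smul_comm,
      smul_comm m, h1, smul_smul, smul_smul]
    have : ‖t‖⁻¹ * ‖t‖⁻¹ * ‖t‖ ^ 2 = 1 := by field_simp
    rw [this, one_smul]
  have hm2 : m ^ 2 = x.imI ^ 2 + x.imJ ^ 2 + x.imK ^ 2 := by rw [hm, qnorm_sq]; simp
  by_cases hx : x.imJ = 0 ∧ x.imK = 0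
  · have h2 : m ^ 2 = x.imI ^ 2 := by rw [hm2, hx.1, hx.2]; ring
    rcases sq_eq_sq_iff_eq_or_eq_neg.1 h2 with h | h
    · refine ⟨1, one_ne_zero, ?_⟩
      ext <;> simp [hx, h]
    · refine ⟨qJ, fun h0 => by simpa using congrArg QuaternionAlgebra.imJ h0, ?_⟩
      ext <;> simp [hx, h, Quaternion.re_mul, Quaternion.imI_mul, Quaternion.imJ_mul,
        Quaternion.imK_mul]
  · refine ⟨qmk (m + x.imI) 0 (-x.imK) x.imJ, fun h0 => hx ?_, ?_⟩
    · have h1 := congrArg QuaternionAlgebra.imJ h0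
      have h2 := congrArg QuaternionAlgebra.imK h0
      change -x.imK = 0 at h1
      change x.imJ = 0 at h2
      exact ⟨h2, by linarith⟩
    · ext <;> simp only [Quaternion.re_mul, Quaternion.imI_mul, Quaternion.imJ_mul,
        Quaternion.imK_mul, Quaternion.re_im, Quaternion.imI_im, Quaternion.imJ_im,
        Quaternion.imK_im, Quaternion.re_smul, Quaternion.imI_smul, Quaternion.imJ_smul,
        Quaternion.imK_smul, qmk_re, qmk_imI, qmk_imJ, qmk_imK, qI_re, qI_imI, qI_imJ, qI_imK, smul_eq_mul] <;>
        first | linear_combination (0 : ℝ) * hm2 | linear_combination -hm2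

lemma qim_norm_sq (x : ℍ[ℝ]) : ‖x.im‖ ^ 2 = x.imI ^ 2 + x.imJ ^ 2 + x.imK ^ 2 := by
  rw [qnorm_sq]; simp

/-- The quaternionic Hopf-type map `g ↦ g (τ + i) ḡ`. -/
def cT (τ : ℝ) (g : ℍ[ℝ]) : ℍ[ℝ] := g * (qmk τ 1 0 0) * star g

lemma cT_re (τ : ℝ) (g : ℍ[ℝ]) : (cT τ g).re = τ * ‖g‖ ^ 2 := by
  rw [qnorm_sq]
  simp [cT, Quaternion.re_mul, Quaternion.imI_mul, Quaternion.imJ_mul, Quaternion.imK_mul]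
  ring

lemma inner_cT_mul (τ : ℝ) {x s : ℍ[ℝ]} (hs : ‖s‖ = 1) {m : ℝ}
    (hx : x.im = m • (s * qI * star s)) (g : ℍ[ℝ]) :
    ⟪x, cT τ (s * g)⟫ = (τ * x.re + m) * ‖qz1 g‖ ^ 2 + (τ * x.re - m) * ‖qz2 g‖ ^ 2 := by
  have h1 : ⟪x, cT τ (s * g)⟫ = x.re * (cT τ (s * g)).re + ⟪x.im, cT τ (s * g)⟫ := by
    simp [qinner]
    ring
  have h2 : cT τ (s * g) = s * cT τ g * star s := by
    simp [cT, mul_assoc]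
  have h3 : ⟪qI, cT τ g⟫ = ‖qz1 g‖ ^ 2 - ‖qz2 g‖ ^ 2 := by
    rw [← Complex.normSq_eq_norm_sq, ← Complex.normSq_eq_norm_sq, Complex.normSq_apply,
      Complex.normSq_apply]
    simp [qinner, cT, Quaternion.re_mul, Quaternion.imI_mul, Quaternion.imJ_mul,
      Quaternion.imK_mul]
    ring
  have h4 : ‖g‖ ^ 2 = ‖qz1 g‖ ^ 2 + ‖qz2 g‖ ^ 2 := by
    rw [← Complex.normSq_eq_norm_sq, ← Complex.normSq_eq_norm_sq, Complex.normSq_apply,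
      Complex.normSq_apply, qnorm_sq]
    simp
    ring
  rw [h1, hx, cT_re, norm_mul, hs, one_mul, real_inner_smul_left, h2, qinner_mul_right,
    qinner_mul_left, norm_star, hs, h3, h4]
  ring

lemma PG.of_homog {X Y : Type*} [NormedAddCommGroup X] [NormedAddCommGroup Y] {f : X → Y}
    (hf : Continuous f) {C : ℝ} {n : ℕ} (h : ∀ x, ‖f x‖ ≤ C * ‖x‖ ^ n) : PG f :=
  PG.of_le (PG.id.norm.pow n) hf (C := |C|) fun x => (h x).trans (by
    have h1 : C * ‖x‖ ^ n ≤ |C| * ‖x‖ ^ n :=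
      mul_le_mul_of_nonneg_right (le_abs_self C) (by positivity)
    have h2 : ‖‖x‖ ^ n‖ = ‖x‖ ^ n := Real.norm_of_nonneg (by positivity)
    rw [h2]
    nlinarith [abs_nonneg C])

lemma PG.cT (τ : ℝ) : PG (cT τ) := by
  refine PG.of_homog (C := ‖qmk τ 1 0 0‖) (n := 2) ?_ fun g => ?_
  · unfold _root_.cT
    fun_prop
  · rw [_root_.cT, norm_mul, norm_mul, norm_star]
    exact le_of_eq (by ring)

/-- The cosine transform of the law of `g (τ + i) ḡ` for a Gaussian quaternion `g`. -/
def hT (τ : ℝ) (x : ℍ[ℝ]) : ℝ := ∫ g, |⟪x, cT τ g⟫| ∂γℍ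

lemma hT_eq (τ : ℝ) (x : ℍ[ℝ]) : hT τ x = ∫ a, ∫ b, |(τ * x.re + ‖x.im‖) * ‖a‖ ^ 2
    + (τ * x.re - ‖x.im‖) * ‖b‖ ^ 2| ∂stdGaussian ℂ ∂stdGaussian ℂ := by
  obtain ⟨s, hs, hx⟩ := exists_conj_qI x
  rw [hT, ← integral_stdGaussian_isometry (lmulE hs)]
  simp_rw [lmulE_apply, inner_cT_mul τ hs hx]
  exact integral_stdGaussian_quaternion (f := fun p => |(τ * x.re + ‖x.im‖) * ‖p.1‖ ^ 2
    + (τ * x.re - ‖x.im‖) * ‖p.2‖ ^ 2|)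
    ((((PG.fst.norm.pow 2).const_mul _).add ((PG.snd.norm.pow 2).const_mul _)).abs)

lemma hT_of_lt {τ : ℝ} {x : ℍ[ℝ]} (h : τ * |x.re| < ‖x.im‖) (hτ : 0 ≤ τ) :
    hT τ x = 2 * (‖x.im‖ ^ 2 + τ ^ 2 * x.re ^ 2) / ‖x.im‖ := by
  rw [hT_eq]
  have h1 : |τ * x.re| < ‖x.im‖ := by rwa [abs_mul, abs_of_nonneg hτ]
  rw [abs_lt] at h1
  have h2 := integral_integral_abs_norm_sq (α := ‖x.im‖ - τ * x.re) (β := τ * x.re + ‖x.im‖)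
    (by linarith) (by linarith)
  have h3 : ∀ a b : ℂ, |(τ * x.re + ‖x.im‖) * ‖a‖ ^ 2 + (τ * x.re - ‖x.im‖) * ‖b‖ ^ 2|
      = |(‖x.im‖ - τ * x.re) * ‖b‖ ^ 2 - (τ * x.re + ‖x.im‖) * ‖a‖ ^ 2| := fun a b => by
    rw [abs_sub_comm]
    congr 1
    ring
  simp_rw [h3]
  rw [h2]
  have h4 : 0 < ‖x.im‖ := by linarith
  have e : ‖x.im‖ - τ * x.re + (τ * x.re + ‖x.im‖) = 2 * ‖x.im‖ := by ring
  rw [e]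
  field_simp
  ring

lemma integral_integral_norm_sq_add (α β : ℝ) :
    ∫ a : ℂ, ∫ b : ℂ, (α * ‖a‖ ^ 2 + β * ‖b‖ ^ 2) ∂stdGaussian ℂ ∂stdGaussian ℂ
      = 2 * α + 2 * β := by
  have := (hm_of_isGaussian (stdGaussian ℂ)).1
  have hi : ∀ γ : ℝ, Integrable (fun w : ℂ => γ * ‖w‖ ^ 2) (stdGaussian ℂ) := fun γ =>
    ((PG.id.norm.pow 2).const_mul γ).integrable (hm_of_isGaussian _)
  have h1 : ∀ a : ℂ, ∫ b : ℂ, (α * ‖a‖ ^ 2 + β * ‖b‖ ^ 2) ∂stdGaussian ℂ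
      = α * ‖a‖ ^ 2 + β * 2 := fun a => by
    rw [integral_add (integrable_const _) (hi β), integral_const_mul β, integral_norm_sq_complex]
    simp
  simp_rw [h1]
  rw [integral_add (hi α) (integrable_const _), integral_const_mul, integral_norm_sq_complex]
  simp
  ring

lemma hT_of_le {τ : ℝ} {x : ℍ[ℝ]} (h : ‖x.im‖ ≤ τ * |x.re|) (hτ : 0 ≤ τ) :
    hT τ x = 4 * (τ * |x.re|) := by
  rw [hT_eq]
  rcases le_total 0 x.re with h0 | h0
  · rw [abs_of_nonneg h0] at h ⊢
    have h3 : ∀ a b : ℂ, |(τ * x.re + ‖x.im‖) * ‖a‖ ^ 2 + (τ * x.re - ‖x.im‖) * ‖b‖ ^ 2|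
      = (τ * x.re + ‖x.im‖) * ‖a‖ ^ 2 + (τ * x.re - ‖x.im‖) * ‖b‖ ^ 2 := fun a b => by
      have h4 : 0 ≤ τ * x.re + ‖x.im‖ := by positivity
      have h5 : 0 ≤ τ * x.re - ‖x.im‖ := by linarith
      exact abs_of_nonneg (by positivity)
    simp_rw [h3]
    rw [integral_integral_norm_sq_add]
    ring
  · rw [abs_of_nonpos h0] at h ⊢
    have h3 : ∀ a b : ℂ, |(τ * x.re + ‖x.im‖) * ‖a‖ ^ 2 + (τ * x.re - ‖x.im‖) * ‖b‖ ^ 2|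
      = (-(τ * x.re) - ‖x.im‖) * ‖a‖ ^ 2 + (-(τ * x.re) + ‖x.im‖) * ‖b‖ ^ 2 := fun a b => by
      have h4 : 0 ≤ -(τ * x.re) - ‖x.im‖ := by linarith
      have h5 : 0 ≤ -(τ * x.re) + ‖x.im‖ := by linarith [norm_nonneg x.im]
      rw [abs_of_nonpos]
      · ring
      · have : 0 ≤ (-(τ * x.re) - ‖x.im‖) * ‖a‖ ^ 2 + (-(τ * x.re) + ‖x.im‖) * ‖b‖ ^ 2 := by
          positivity
        linarith
    simp_rw [h3]
    rw [integral_integral_norm_sq_add]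
    ring

end QuaternionGaussian

section Locality

variable {E : Type*} [NormedAddCommGroup E] [InnerProductSpace ℝ E] [FiniteDimensional ℝ E]

lemma union_inter_of_hB {Y K L M : ConvexBody E} {a b : E → ℝ} (hK : ∀ x, hB K x = hB Y x + a x)
    (hL : ∀ x, hB L x = hB Y x + b x) (hM : ∀ x, hB M x = hB Y x + (a x + b x))
    (ha : ∀ x, 0 ≤ a x) (hb : ∀ x, 0 ≤ b x) (hab : ∀ x, a x = 0 ∨ b x = 0) :
    (M : Set E) = (K : Set E) ∪ L ∧ (Y : Set E) = (K : Set E) ∩ L := by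
  have hYK : (Y : Set E) ⊆ K := body_subset_of_hB_le fun x => by linarith [hK x, ha x]
  have hYL : (Y : Set E) ⊆ L := body_subset_of_hB_le fun x => by linarith [hL x, hb x]
  have hKM : (K : Set E) ⊆ M := body_subset_of_hB_le fun x => by linarith [hK x, hM x, hb x]
  have hLM : (L : Set E) ⊆ M := body_subset_of_hB_le fun x => by linarith [hL x, hM x, ha x]
  refine ⟨Set.Subset.antisymm (fun x hx => ?_) (Set.union_subset hKM hLM),
    Set.Subset.antisymm (Set.subset_inter hYK hYL) fun x hx => mem_body_iff.2 fun ξ => ?_⟩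
  · by_contra hn
    rw [Set.mem_union, not_or, mem_body_iff, mem_body_iff] at hn
    push Not at hn
    obtain ⟨⟨ξ, hξ⟩, ⟨ζ, hζ⟩⟩ := hn
    have hx' := mem_body_iff.1 hx
    have hac : Continuous a := by
      have : a = fun x => hB K x - hB Y x := funext fun x => by rw [hK]; ring
      rw [this]
      exact (continuous_hB K).sub (continuous_hB Y)
    have hbc : Continuous b := by
      have : b = fun x => hB L x - hB Y x := funext fun x => by rw [hL]; ring
      rw [this]
      exact (continuous_hB L).sub (continuous_hB Y)
    have hpos : segment ℝ ξ ζ ⊆ {y | 0 < ⟪y, x⟫ - hB Y y} := by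
      rintro _ ⟨s, t, hs, ht, hst, rfl⟩
      change 0 < ⟪s • ξ + t • ζ, x⟫ - hB Y (s • ξ + t • ζ)
      have h1 := hB_add_le Y (s • ξ) (t • ζ)
      rw [hB_smul hs, hB_smul ht] at h1
      rw [inner_add_left, real_inner_smul_left, real_inner_smul_left]
      have h2 : 0 < ⟪ξ, x⟫ - hB Y ξ := by linarith [hK ξ, ha ξ]
      have h3 : 0 < ⟪ζ, x⟫ - hB Y ζ := by linarith [hL ζ, hb ζ]
      rcases eq_or_lt_of_le hs with h | h
      · have : t = 1 := by linarith
        subst this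
        rw [← h] at h1 ⊢
        linarith
      · nlinarith [mul_pos h h2, mul_nonneg ht h3.le]
    have hconn := (convex_segment ξ ζ).isPreconnected {y | 0 < a y} {y | 0 < b y}
      (isOpen_lt continuous_const hac) (isOpen_lt continuous_const hbc)
      (fun y hy => by
        have h1 : 0 < ⟪y, x⟫ - hB Y y := hpos hy
        have h2 := hx' y
        rw [hM] at h2
        rcases hab y with h | h
        · right; rw [h] at h2; change 0 < b y; linarith
        · left; rw [h] at h2; change 0 < a y; linarith)
      ⟨ζ, right_mem_segment _ _ _, by
        have := hx' ζ
        rw [hM] at this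
        rw [hL] at hζ
        change 0 < a ζ
        linarith⟩
      ⟨ξ, left_mem_segment _ _ _, by
        have := hx' ξ
        rw [hM] at this
        rw [hK] at hξ
        change 0 < b ξ
        linarith⟩
    obtain ⟨y, -, h1, h2⟩ := hconn
    have h1' : 0 < a y := h1
    have h2' : 0 < b y := h2
    rcases hab y with h | h <;> linarith
  · have h1 := mem_body_iff.1 hx.1 ξ
    have h2 := mem_body_iff.1 hx.2 ξ
    rw [hK] at h1
    rw [hL] at h2
    rcases hab ξ with h | h <;> linarith

end Locality

section WeightedSum

variable {X Y : Type*} [NormedAddCommGroup X] [MeasurableSpace X] [BorelSpace X]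
  [SecondCountableTopology X] [NormedAddCommGroup Y] [MeasurableSpace Y] [BorelSpace Y]
  [SecondCountableTopology Y]

/-- The mixture `∑ σᵢ (pᵢ)_* η`. -/
def wsum {ι : Type*} [Fintype ι] (η : Measure X) (σ : ι → ℝ≥0) (p : ι → X → Y) : Measure Y :=
  ∑ i, σ i • η.map (p i)

lemma HM.wsum {ι : Type*} [Fintype ι] {η : Measure X} (hη : HM η) (σ : ι → ℝ≥0) {p : ι → X → Y}
    (hp : ∀ i, PG (p i)) : HM (wsum η σ p) := by
  have h : ∀ i, HM (η.map (p i)) := fun i => hη.map (hp i)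
  have := fun i => (h i).1
  refine ⟨by unfold _root_.wsum; infer_instance, fun m => ?_⟩
  refine integrable_finsetSum_measure.2 fun i _ => ?_
  exact ((h i).2 m).smul_measure_nnreal

lemma integral_wsum {ι : Type*} [Fintype ι] {η : Measure X} (hη : HM η) (σ : ι → ℝ≥0)
    {p : ι → X → Y} (hp : ∀ i, PG (p i)) {f : Y → ℝ} (hf : PG f) :
    ∫ y, f y ∂wsum η σ p = ∑ i, (σ i : ℝ) * ∫ x, f (p i x) ∂η := by
  rw [wsum, integral_finsetSum_measure fun i _ => by
    exact (hf.integrable (hη.map (hp i))).smul_measure_nnreal]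
  refine Finset.sum_congr rfl fun i _ => ?_
  rw [integral_smul_nnreal_measure, integral_map (hp i).1.measurable.aemeasurable
    hf.1.measurable.aestronglyMeasurable]
  rfl

lemma integral_integral_wsum {ι κ : Type*} [Fintype ι] [Fintype κ] {η : Measure X} (hη : HM η)
    {p : ι → X → Y} (hp : ∀ i, PG (p i)) {q : κ → X → Y} (hq : ∀ j, PG (q j)) (σ : ι → ℝ≥0)
    (τ : κ → ℝ≥0) {f : Y × Y → ℝ} (hf : PG f) :
    ∫ w, ∫ y, f (y, w) ∂wsum η σ p ∂wsum η τ q =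
      ∑ i, ∑ j, (σ i : ℝ) * τ j * ∫ x', ∫ x, f (p i x, q j x') ∂η ∂η := by
  have h1 : ∀ w, ∫ y, f (y, w) ∂wsum η σ p = ∑ i, (σ i : ℝ) * ∫ x, f (p i x, w) ∂η := fun w =>
    integral_wsum hη σ hp (f := fun y => f (y, w)) (hf.comp (PG.id.prodMk (PG.const w)))
  simp_rw [h1]
  have h2 : ∀ i, PG fun w => ∫ x, f (p i x, w) ∂η := fun i =>
    PG.integral (f := fun z : Y × X => f (p i z.2, z.1))
      (hf.comp (((hp i).comp PG.snd).prodMk PG.fst)) hη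
  rw [integral_finsetSum _ fun i _ => ((h2 i).const_mul _).integrable (hη.wsum τ hq)]
  refine Finset.sum_congr rfl fun i _ => ?_
  rw [integral_const_mul, integral_wsum hη τ hq (h2 i), Finset.mul_sum]
  refine Finset.sum_congr rfl fun j _ => ?_
  ring

end WeightedSum

section LocalRelation

lemma PG.of_homogeneous {X : Type*} [NormedAddCommGroup X] [NormedSpace ℝ X]
    [FiniteDimensional ℝ X] {f : X → ℝ} (hf : Continuous f) {n : ℕ}
    (h : ∀ t : ℝ, 0 ≤ t → ∀ x, f (t • x) = t ^ n * f x) : PG f := by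
  obtain ⟨C, hC⟩ := (isCompact_closedBall (0 : X) 1).exists_bound_of_continuousOn hf.continuousOn
  have hC0 : 0 ≤ C := (norm_nonneg _).trans (hC 0 (by simp))
  refine PG.of_le ((PG.const (C : ℝ)).mul ((PG.const (1 : ℝ)).add (PG.id.norm.pow n))) hf (C := 1)
    fun x => ?_
  rw [one_mul]
  have h1 : ‖f x‖ ≤ C * (1 + ‖x‖ ^ n) := by
    rcases eq_or_ne x 0 with rfl | hx
    · refine (hC 0 (by simp)).trans ?_
      have : (0 : ℝ) ≤ ‖(0 : X)‖ ^ n := by positivity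
      nlinarith
    · have hx' : ‖x‖ ≠ 0 := norm_ne_zero_iff.2 hx
      have e : x = ‖x‖ • (‖x‖⁻¹ • x) := by rw [smul_smul, mul_inv_cancel₀ hx', one_smul]
      have h2 := hC (‖x‖⁻¹ • x) (by
        rw [mem_closedBall_zero_iff, norm_smul, norm_inv, norm_norm, inv_mul_cancel₀ hx'])
      have h3 : ‖f x‖ = ‖x‖ ^ n * ‖f (‖x‖⁻¹ • x)‖ := by
        conv_lhs => rw [e, h _ (norm_nonneg x), norm_mul, norm_pow, norm_norm]
      rw [h3]
      have : (0 : ℝ) ≤ ‖x‖ ^ n := by positivity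
      nlinarith
  refine h1.trans (le_trans (le_abs_self _) ?_)
  rw [Real.norm_eq_abs]
  linarith

variable {E : Type*} [NormedAddCommGroup E] [InnerProductSpace ℝ E] [FiniteDimensional ℝ E]

lemma Good.pg_Dv_Dv {ν : ConvexBody E → ℝ} (hν : Good ν) :
    PG fun p : E × E => _root_.Dv p.1 (_root_.Dv p.2 ν) 0 := by
  refine PG.of_homogeneous (n := 2) ?_ fun t ht p => ?_
  · simp_rw [Good.Dv_Dv_eq]
    have h1 : Continuous fun p : E × E => segB p.1 := continuous_segB.comp continuous_fst
    have h2 : Continuous fun p : E × E => segB p.2 := continuous_segB.comp continuous_snd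
    exact ((hν.cont.comp (h1.add h2)).sub (hν.cont.comp h1)).sub
      ((hν.cont.comp h2).sub continuous_const)
  · rw [Prod.smul_fst, Prod.smul_snd, (hν.Dv _).Dv_smul, Dv_comm, (hν.Dv _).Dv_smul,
      Dv_comm, abs_of_nonneg ht]
    ring

/-- Bilinear relations between the values of a valuation of degree two on pairs of segments,
coming from two functions with disjoint supports in the span of cosine functions. -/
lemma Homog.local_relation [MeasurableSpace E] [BorelSpace E] {ν : ConvexBody E → ℝ} (hν : Good ν)
    (h : Homog 2 ν) {X : Type*} [NormedAddCommGroup X] [MeasurableSpace X] [BorelSpace X]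
    [SecondCountableTopology X] {η : Measure X} (hη : HM η) {ι κ : Type*} [Fintype ι] [Fintype κ]
    {p : ι → X → E} (hp : ∀ i, PG (p i)) {q : κ → X → E} (hq : ∀ j, PG (q j)) (c : ι → ℝ) (d : κ → ℝ)
    (ha : ∀ x, 0 ≤ ∑ i, c i * ∫ g, |⟪x, p i g⟫| ∂η) (hb : ∀ x, 0 ≤ ∑ j, d j * ∫ g, |⟪x, q j g⟫| ∂η)
    (hab : ∀ x, ∑ i, c i * ∫ g, |⟪x, p i g⟫| ∂η = 0 ∨ ∑ j, d j * ∫ g, |⟪x, q j g⟫| ∂η = 0) :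
    ∑ i, ∑ j, c i * d j * ∫ g', ∫ g, _root_.Dv (p i g) (_root_.Dv (q j g') ν) 0 ∂η ∂η = 0 := by
  have hab' : ∀ x : E, PG fun y : E => |⟪x, y⟫| := fun x => ((PG.const x).inner PG.id).abs
  have hz : ∀ {γ : Measure E}, HM γ → ∃ Z : ConvexBody E, IsZon γ (fun y => y) Z := fun hl =>
    exists_isZon (PG.id.integrable hl)
  have hMp : ∀ σ : ι → ℝ≥0, HM (wsum η σ p) := fun σ => hη.wsum σ hp
  have hMq : ∀ σ : κ → ℝ≥0, HM (wsum η σ q) := fun σ => hη.wsum σ hq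
  choose Zp hZp using fun σ : ι → ℝ≥0 => hz (hMp σ)
  choose Zq hZq using fun σ : κ → ℝ≥0 => hz (hMq σ)
  have hκ := hν.pg_Dv_Dv
  have hV : ∀ σ τ, ν (Zp σ + Zq τ) - ν (Zp σ) - ν (Zq τ) =
      4 * ∑ i, ∑ j, (σ i : ℝ) * τ j *
        ∫ g', ∫ g, _root_.Dv (p i g) (_root_.Dv (q j g') ν) 0 ∂η ∂η := fun σ τ => by
    have := (hMp σ).1
    have := (hMq τ).1
    rw [Homog.two_zon hν h measurable_id (PG.id.integrable (hMp σ)) (hZp σ) measurable_id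
      (PG.id.integrable (hMq τ)) (hZq τ)]
    congr 1
    exact integral_integral_wsum hη hp hq σ τ hκ
  set cp : ι → ℝ≥0 := fun i => (c i).toNNReal
  set cm : ι → ℝ≥0 := fun i => (-c i).toNNReal
  set dp : κ → ℝ≥0 := fun i => (d i).toNNReal
  set dm : κ → ℝ≥0 := fun i => (-d i).toNNReal
  have ec : ∀ i, c i = cp i - cm i := fun i => by
    simp only [cp, cm, Real.coe_toNNReal']
    exact (max_zero_sub_max_neg_zero_eq_self (c i)).symm
  have ed : ∀ j, d j = dp j - dm j := fun j => by
    simp only [dp, dm, Real.coe_toNNReal']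
    exact (max_zero_sub_max_neg_zero_eq_self (d j)).symm
  have hhp : ∀ σ x, hB (Zp σ) x = ∑ i, (σ i : ℝ) * ∫ g, |⟪x, p i g⟫| ∂η := fun σ x => by
    rw [hZp σ x, integral_wsum hη σ hp (hab' x)]
  have hhq : ∀ σ x, hB (Zq σ) x = ∑ j, (σ j : ℝ) * ∫ g, |⟪x, q j g⟫| ∂η := fun σ x => by
    rw [hZq σ x, integral_wsum hη σ hq (hab' x)]
  have hda : ∀ x, hB (Zp cp) x = hB (Zp cm) x + ∑ i, c i * ∫ g, |⟪x, p i g⟫| ∂η := fun x => by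
    rw [hhp, hhp, ← Finset.sum_add_distrib]
    exact Finset.sum_congr rfl fun i _ => by rw [ec]; ring
  have hdb : ∀ x, hB (Zq dp) x = hB (Zq dm) x + ∑ j, d j * ∫ g, |⟪x, q j g⟫| ∂η := fun x => by
    rw [hhq, hhq, ← Finset.sum_add_distrib]
    exact Finset.sum_congr rfl fun i _ => by rw [ed]; ring
  obtain ⟨hU, hI⟩ := union_inter_of_hB (Y := Zp cm + Zq dm) (K := Zp cp + Zq dm)
    (L := Zp cm + Zq dp) (M := Zp cp + Zq dp)
    (fun x => by rw [hB_add, hB_add, hda]; ring) (fun x => by rw [hB_add, hB_add, hdb]; ring)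
    (fun x => by rw [hB_add, hB_add, hda, hdb]; ring) ha hb hab
  have hval := hν.val _ _ _ _ hU hI
  have e : ∀ σ τ, ν (Zp σ + Zq τ) = ν (Zp σ) + ν (Zq τ) +
      4 * ∑ i, ∑ j, (σ i : ℝ) * τ j *
        ∫ g', ∫ g, _root_.Dv (p i g) (_root_.Dv (q j g') ν) 0 ∂η ∂η := fun σ τ => by
    linarith [hV σ τ]
  rw [e, e, e, e] at hval
  have hfin : ∑ i, ∑ j, c i * d j * ∫ g', ∫ g, _root_.Dv (p i g) (_root_.Dv (q j g') ν) 0 ∂η ∂η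
      = (∑ i, ∑ j, (cp i : ℝ) * dp j *
          ∫ g', ∫ g, _root_.Dv (p i g) (_root_.Dv (q j g') ν) 0 ∂η ∂η)
        + (∑ i, ∑ j, (cm i : ℝ) * dm j *
          ∫ g', ∫ g, _root_.Dv (p i g) (_root_.Dv (q j g') ν) 0 ∂η ∂η)
        - (∑ i, ∑ j, (cp i : ℝ) * dm j *
          ∫ g', ∫ g, _root_.Dv (p i g) (_root_.Dv (q j g') ν) 0 ∂η ∂η)
        - (∑ i, ∑ j, (cm i : ℝ) * dp j *
          ∫ g', ∫ g, _root_.Dv (p i g) (_root_.Dv (q j g') ν) 0 ∂η ∂η) := by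
    simp only [← Finset.sum_add_distrib, ← Finset.sum_sub_distrib]
    refine Finset.sum_congr rfl fun i _ => Finset.sum_congr rfl fun j _ => ?_
    rw [ec, ed]
    ring
  rw [hfin]
  linarith

end LocalRelation

section Hump

lemma hT_le {τ : ℝ} (hτ : 0 ≤ τ) {x : ℍ[ℝ]} {M : ℝ} (hM : 0 < M) (h : ‖x.im‖ ≤ M) :
    hT τ x ≤ 2 * (M ^ 2 + τ ^ 2 * x.re ^ 2) / M := by
  have e : τ ^ 2 * x.re ^ 2 = (τ * |x.re|) ^ 2 := by rw [mul_pow, sq_abs]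
  have hT0 : 0 ≤ τ * |x.re| := by positivity
  rcases lt_or_ge (τ * |x.re|) ‖x.im‖ with h1 | h1
  · have hm : 0 < ‖x.im‖ := hT0.trans_lt h1
    rw [hT_of_lt h1 hτ, e, div_le_div_iff₀ hm hM]
    nlinarith [mul_nonneg (sub_nonneg.2 h) (show 0 ≤ ‖x.im‖ * M - (τ * |x.re|) ^ 2 by nlinarith)]
  · rw [hT_of_le h1 hτ, e, le_div_iff₀ hM]
    nlinarith [sq_nonneg (M - τ * |x.re|)]

lemma hT_eq_max {τ : ℝ} (hτ : 0 ≤ τ) {x : ℍ[ℝ]} {M : ℝ} (hM : 0 < M)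
    (h : M = max ‖x.im‖ (τ * |x.re|)) : hT τ x = 2 * (M ^ 2 + τ ^ 2 * x.re ^ 2) / M := by
  have e : τ ^ 2 * x.re ^ 2 = (τ * |x.re|) ^ 2 := by rw [mul_pow, sq_abs]
  rcases lt_or_ge (τ * |x.re|) ‖x.im‖ with h1 | h1
  · rw [hT_of_lt h1 hτ, h, max_eq_left h1.le]
  · rw [max_eq_right h1] at h
    rw [hT_of_le h1 hτ, e, ← h, eq_div_iff hM.ne']
    ring

lemma PG.hT (τ : ℝ) : PG (hT τ) := by
  have h : PG fun p : ℍ[ℝ] × ℍ[ℝ] => |⟪p.1, _root_.cT τ p.2⟫| :=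
    (PG.fst.inner ((PG.cT τ).comp PG.snd)).abs
  exact h.integral (hm_of_isGaussian _)

lemma hT_smul (τ t : ℝ) (x : ℍ[ℝ]) : hT τ (t • x) = |t| * hT τ x := by
  rw [hT, hT, ← integral_const_mul]
  simp_rw [real_inner_smul_left, abs_mul]

/-- Coefficients of a second difference of the functions `hT τ` in which the smooth parts cancel. -/
def humpC (τ : Fin 3 → ℝ) : Fin 3 → ℝ :=
  ![τ 1 ^ 2 - τ 2 ^ 2, τ 2 ^ 2 - τ 0 ^ 2, τ 0 ^ 2 - τ 1 ^ 2]

/-- A nonnegative combination of cosine functions which is supported near the real axis. -/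
def hump (τ : Fin 3 → ℝ) (x : ℍ[ℝ]) : ℝ := ∑ i, humpC τ i * hT (τ i) x

variable {τ : Fin 3 → ℝ}

lemma hump_def (x : ℍ[ℝ]) : hump τ x = (τ 1 ^ 2 - τ 2 ^ 2) * hT (τ 0) x +
    (τ 2 ^ 2 - τ 0 ^ 2) * hT (τ 1) x + (τ 0 ^ 2 - τ 1 ^ 2) * hT (τ 2) x := by
  simp [hump, humpC, Fin.sum_univ_three]

lemma PG.hump (τ : Fin 3 → ℝ) : PG (hump τ) :=
  PG.sum _ fun i _ => (PG.hT (τ i)).const_mul _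

lemma hump_smul (t : ℝ) (x : ℍ[ℝ]) : hump τ (t • x) = |t| * hump τ x := by
  simp only [hump_def, hT_smul]
  ring

lemma hump_nonneg (h0 : 0 < τ 0) (h1 : τ 0 < τ 1) (h2 : τ 1 < τ 2) (x : ℍ[ℝ]) : 0 ≤ hump τ x := by
  rcases eq_or_lt_of_le (show 0 ≤ max ‖x.im‖ (τ 1 * |x.re|) from le_max_of_le_left (norm_nonneg _))
    with hM | hM
  · have hr : |x.re| = 0 := by
      have := (le_max_right ‖x.im‖ (τ 1 * |x.re|)).trans hM.symm.le
      nlinarith [abs_nonneg x.re]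
    have hi : ‖x.im‖ ≤ 0 := (le_max_left _ _).trans hM.symm.le
    rw [hump_def, hT_of_le (by rw [hr]; simpa using hi) (by linarith),
      hT_of_le (by rw [hr]; simpa using hi) (by linarith),
      hT_of_le (by rw [hr]; simpa using hi) (by linarith), hr]
    simp
  · set M := max ‖x.im‖ (τ 1 * |x.re|) with hMd
    have hi : ‖x.im‖ ≤ M := le_max_left _ _
    have e0 := hT_le (τ := τ 0) h0.le hM hi
    have e1 := hT_eq_max (τ := τ 1) (by linarith) hM hMd
    have e2 := hT_le (τ := τ 2) (by linarith) hM hi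
    have c0 : τ 1 ^ 2 - τ 2 ^ 2 ≤ 0 := by nlinarith
    have c2 : τ 0 ^ 2 - τ 1 ^ 2 ≤ 0 := by nlinarith
    have k0 := mul_le_mul_of_nonpos_left e0 c0
    have k2 := mul_le_mul_of_nonpos_left e2 c2
    rw [hump_def, e1]
    have : (τ 1 ^ 2 - τ 2 ^ 2) * (2 * (M ^ 2 + τ 0 ^ 2 * x.re ^ 2) / M) +
        (τ 2 ^ 2 - τ 0 ^ 2) * (2 * (M ^ 2 + τ 1 ^ 2 * x.re ^ 2) / M) +
        (τ 0 ^ 2 - τ 1 ^ 2) * (2 * (M ^ 2 + τ 2 ^ 2 * x.re ^ 2) / M) = 0 := by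
      field_simp
      ring
    linarith

lemma hump_eq_zero (h0 : 0 < τ 0) (h1 : τ 0 < τ 1) (h2 : τ 1 < τ 2) {x : ℍ[ℝ]}
    (h : τ 2 * |x.re| ≤ ‖x.im‖) : hump τ x = 0 := by
  have hp := abs_nonneg x.re
  rcases eq_or_lt_of_le (norm_nonneg x.im) with hM | hM
  · have hr : |x.re| = 0 := by nlinarith
    rw [hump_def, hT_of_le (by rw [hr]; simp [← hM]) (by linarith),
      hT_of_le (by rw [hr]; simp [← hM]) (by linarith),
      hT_of_le (by rw [hr]; simp [← hM]) (by linarith), hr]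
    simp
  · have e : ∀ i, 0 ≤ τ i → τ i ≤ τ 2 →
        hT (τ i) x = 2 * (‖x.im‖ ^ 2 + τ i ^ 2 * x.re ^ 2) / ‖x.im‖ := fun i hi hi' =>
      hT_eq_max hi hM (max_eq_left (by nlinarith)).symm
    rw [hump_def, e 0 (by linarith) (by linarith), e 1 (by linarith) (by linarith),
      e 2 (by linarith) le_rfl]
    field_simp
    ring

lemma hump_one_pos (h0 : 0 < τ 0) (h1 : τ 0 < τ 1) (h2 : τ 1 < τ 2) : 0 < hump τ 1 := by
  have e : ∀ i, 0 ≤ τ i → hT (τ i) 1 = 4 * τ i := fun i hi => by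
    rw [hT_of_le (by simpa using hi) hi]; simp
  rw [hump_def, e 0 h0.le, e 1 (by linarith), e 2 (by linarith)]
  have : 0 < (τ 2 - τ 1) * (τ 2 - τ 0) * (τ 1 - τ 0) := by
    have a1 : 0 < τ 2 - τ 1 := by linarith
    have a2 : 0 < τ 2 - τ 0 := by linarith
    have a3 : 0 < τ 1 - τ 0 := by linarith
    positivity
  nlinarith

lemma hump_disjoint (h0 : 0 < τ 0) (h1 : τ 0 < τ 1) (h2 : τ 1 < τ 2) {σ : Fin 3 → ℝ}
    (k0 : 0 < σ 0) (k1 : σ 0 < σ 1) (k2 : σ 1 < σ 2) (h : τ 2 * σ 2 ≤ 1) (x : ℍ[ℝ]) :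
    hump τ x = 0 ∨ hump σ (x * star qI) = 0 := by
  by_contra! hn
  have a := not_le.1 fun hh => hn.1 (hump_eq_zero h0 h1 h2 hh)
  have b := not_le.1 fun hh => hn.2 (hump_eq_zero k0 k1 k2 hh)
  have e1 : (x * star qI).re = x.imI := by simp [Quaternion.re_mul]
  have e2 : |x.re| ≤ ‖(x * star qI).im‖ := by
    refine abs_le_of_sq_le_sq ?_ (norm_nonneg _) |> fun h => h
    rw [qim_norm_sq]
    simp only [Quaternion.imI_mul, Quaternion.imJ_mul, Quaternion.imK_mul, Quaternion.re_star,
      Quaternion.imI_star, Quaternion.imJ_star, Quaternion.imK_star, qI_re, qI_imI, qI_imJ, qI_imK]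
    nlinarith [sq_nonneg x.imJ, sq_nonneg x.imK]
  have e3 : |x.imI| ≤ ‖x.im‖ := by
    refine abs_le_of_sq_le_sq ?_ (norm_nonneg _) |> fun h => h
    rw [qim_norm_sq]
    nlinarith [sq_nonneg x.imJ, sq_nonneg x.imK]
  rw [e1] at b
  have p1 := abs_nonneg x.re
  have t2 : 0 < τ 2 := by linarith
  have s2 : 0 < σ 2 := by linarith
  have : |x.re| < σ 2 * (τ 2 * |x.re|) :=
    (e2.trans_lt b).trans_le (mul_le_mul_of_nonneg_left (e3.trans a.le) s2.le)
  nlinarith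

end Hump

section UTwo

/-- The function `w ↦ Dv 1 (Dv w ν) 0`, which determines `ν` on parallelograms. -/
def segF (ν : ConvexBody ℍ[ℝ] → ℝ) (w : ℍ[ℝ]) : ℝ := Dv 1 (Dv w ν) 0

/-- Valuations of degree two on `ℍ = ℂ²` invariant under `U(2)`. -/
structure UTwo (ν : ConvexBody ℍ[ℝ] → ℝ) : Prop where
  good : Good ν
  homog : Homog 2 ν
  right : ∀ {q : ℍ[ℝ]} (hq : ‖q‖ = 1) K, ν (mapB (rmulE hq : ℍ[ℝ] →L[ℝ] ℍ[ℝ]) K) = ν K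
  left : ∀ {z : ℍ[ℝ]} (hz : ‖z‖ = 1), z.imJ = 0 → z.imK = 0 →
    ∀ K, ν (mapB (lmulE hz : ℍ[ℝ] →L[ℝ] ℍ[ℝ]) K) = ν K

lemma Dv_mapB {V W : Type*} [NormedAddCommGroup V] [NormedSpace ℝ V] [NormedAddCommGroup W]
    [NormedSpace ℝ W] (A : V →L[ℝ] W) (μ : ConvexBody W → ℝ) (v : V) :
    Dv v (fun K => μ (mapB A K)) = fun K => Dv (A v) μ (mapB A K) := by
  funext K
  simp only [Dv, mapB_add, mapB_segB]

variable {ν : ConvexBody ℍ[ℝ] → ℝ}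

lemma dv_dv_smul (hν : Good ν) (s t : ℝ) (v u : ℍ[ℝ]) :
    Dv (s • v) (Dv (t • u) ν) 0 = |s| * |t| * Dv v (Dv u ν) 0 := by
  rw [(hν.Dv _).Dv_smul, Dv_comm, (hν.Dv _).Dv_smul, Dv_comm]
  ring

lemma dv_zero_left (hν : Good ν) (u : ℍ[ℝ]) : Dv 0 (Dv u ν) 0 = 0 := by
  have := dv_dv_smul hν 0 1 0 u
  simpa using this

lemma UTwo.Dv_Dv (h : UTwo ν) (v u : ℍ[ℝ]) : Dv v (Dv u ν) 0 = segF ν (u * star v) := by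
  rcases eq_or_ne v 0 with rfl | hv
  · rw [dv_zero_left h.good, segF, Dv_comm, star_zero, mul_zero,
      dv_zero_left h.good]
  have hv' : ‖v‖ ≠ 0 := norm_ne_zero_iff.2 hv
  have hq : ‖‖v‖⁻¹ • star v‖ = 1 := by
    rw [norm_smul, norm_inv, norm_norm, norm_star, inv_mul_cancel₀ hv']
  have e : ν = fun K => ν (mapB (rmulE hq : ℍ[ℝ] →L[ℝ] ℍ[ℝ]) K) := funext fun K => (h.right hq K).symm
  have e1 : v * ‖v‖⁻¹ • star v = ‖v‖ • (1 : ℍ[ℝ]) := by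
    rw [mul_smul_comm, qself_mul_star, ← Quaternion.coe_mul_eq_smul, ← Quaternion.coe_mul_eq_smul,
      mul_one, ← Quaternion.coe_mul]
    congr 1
    field_simp
  have e2 : u * ‖v‖⁻¹ • star v = ‖v‖⁻¹ • (u * star v) := mul_smul_comm _ _ _
  conv_lhs => rw [e, Dv_mapB, Dv_mapB]
  change Dv (rmulE hq v) (Dv (rmulE hq u) ν) (mapB _ 0) = _
  rw [mapB_zero, rmulE_apply, rmulE_apply, e1, e2, dv_dv_smul h.good, abs_of_nonneg (by simp),
    abs_of_nonneg (by simp), mul_inv_cancel₀ hv', one_mul, segF]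

lemma UTwo.segF_smul (h : UTwo ν) (t : ℝ) (w : ℍ[ℝ]) : segF ν (t • w) = |t| * segF ν w := by
  rw [segF, segF]
  have := dv_dv_smul h.good 1 t 1 w
  simpa using this

lemma UTwo.segF_im (h : UTwo ν) (w : ℍ[ℝ]) : segF ν w.im = segF ν w := by
  rw [segF, Dv_comm, segF, Dv_comm 1 w, ← h.good.Dv_shear h.homog w.im 1 w.re]
  have e : w.im + w.re • (1 : ℍ[ℝ]) = w := by ext <;> simp
  rw [e]

lemma UTwo.pg_segF (h : UTwo ν) : PG (segF ν) := by
  have := h.good.pg_Dv_Dv.comp ((PG.const (X := ℍ[ℝ]) (1 : ℍ[ℝ])).prodMk PG.id)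
  change PG fun w => segF ν w
  unfold segF
  exact this

lemma UTwo.segF_conj (h : UTwo ν) {z : ℍ[ℝ]} (hz : ‖z‖ = 1) (h2 : z.imJ = 0) (h3 : z.imK = 0)
    (w : ℍ[ℝ]) : segF ν (z * w * star z) = segF ν w := by
  have e : ν = fun K => ν (mapB (lmulE hz : ℍ[ℝ] →L[ℝ] ℍ[ℝ]) K) :=
    funext fun K => (h.left hz h2 h3 K).symm
  rw [← h.Dv_Dv]
  conv_rhs => rw [segF, e, Dv_mapB, Dv_mapB]
  change _ = Dv (lmulE hz 1) (Dv (lmulE hz w) ν) (mapB _ 0)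
  rw [mapB_zero, lmulE_apply, lmulE_apply, mul_one]

/-- The basic relation satisfied by all rotations of `segF ν`. -/
lemma UTwo.relation (h : UTwo ν) {τ σ : Fin 3 → ℝ} (h0 : 0 < τ 0) (h1 : τ 0 < τ 1) (h2 : τ 1 < τ 2)
    (k0 : 0 < σ 0) (k1 : σ 0 < σ 1) (k2 : σ 1 < σ 2) (hτσ : τ 2 * σ 2 ≤ 1) (r : ℍ[ℝ]) :
    ∑ i, ∑ j, humpC τ i * humpC σ j * ∫ g', ∫ g, segF ν (r * (cT (σ j) g' * qI * star (cT (τ i) g))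
      * star r) ∂γℍ ∂γℍ = 0 := by
  rcases eq_or_ne r 0 with rfl | hr
  · have : segF ν 0 = 0 := by simpa using h.segF_smul 0 0
    simp [this]
  set L : ℍ[ℝ] →L[ℝ] ℍ[ℝ] := LinearMap.toContinuousLinearMap (LinearMap.mulLeft ℝ r)
  set R : ℍ[ℝ] →L[ℝ] ℍ[ℝ] := LinearMap.toContinuousLinearMap (LinearMap.mulRight ℝ qI)
  have hL : ∀ x, L x = r * x := fun x => rfl
  have hR : ∀ x, R x = x * qI := fun x => rfl
  have hinj : Function.Injective L := fun x y hxy => mul_left_cancel₀ hr hxy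
  have hb : ∀ x j, ∫ g, |⟪x, R (cT (σ j) g)⟫| ∂γℍ = hT (σ j) (x * star qI) :=
    fun x j => by
      rw [hT]
      refine integral_congr_ae (.of_forall fun g => ?_)
      beta_reduce
      rw [hR, real_inner_comm, qinner_mul_star, real_inner_comm]
  have key := Homog.local_relation (h.good.comp_mapB L hinj) (h.homog.comp_mapB L)
    (hm_of_isGaussian (γℍ)) (p := fun i => cT (τ i)) (fun i => PG.cT (τ i))
    (q := fun j g => R (cT (σ j) g)) (fun j => (PG.clm R).comp (PG.cT (σ j))) (humpC τ) (humpC σ)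
    (fun x => hump_nonneg h0 h1 h2 x)
    (fun x => by simp_rw [hb]; exact hump_nonneg k0 k1 k2 _)
    (fun x => by simp_rw [hb]; exact hump_disjoint h0 h1 h2 k0 k1 k2 hτσ x)
  rw [← key]
  refine Finset.sum_congr rfl fun i _ => Finset.sum_congr rfl fun j _ => ?_
  congr 1
  refine integral_congr_ae (.of_forall fun g' => integral_congr_ae (.of_forall fun g => ?_))
  beta_reduce
  rw [Dv_mapB, Dv_mapB]
  beta_reduce
  rw [mapB_zero, h.Dv_Dv, hL, hL, hR]
  simp only [star_mul, mul_assoc]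

end UTwo

section Mollify

lemma PG.qmul {X : Type*} [NormedAddCommGroup X] {f g : X → ℍ[ℝ]} (hf : PG f) (hg : PG g) :
    PG fun x => f x * g x :=
  PG.of_le (C := 1) (hf.norm.mul hg.norm) (hf.1.mul hg.1) fun x => by
    rw [norm_mul, norm_mul, norm_norm, norm_norm]; linarith

lemma PG.qstar {X : Type*} [NormedAddCommGroup X] {f : X → ℍ[ℝ]} (hf : PG f) :
    PG fun x => star (f x) :=
  PG.of_le (C := 1) hf (continuous_star.comp hf.1) fun x => by
    rw [norm_star]; linarith

/-- The projections of a quaternion to its real and imaginary parts. -/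
def qreL : ℍ[ℝ] →L[ℝ] ℝ := LinearMap.toContinuousLinearMap
  { toFun := fun g => g.re
    map_add' := fun _ _ => rfl
    map_smul' := fun c g => by simp }

/-- The imaginary part as a linear map. -/
def qimL : ℍ[ℝ] →L[ℝ] ℍ[ℝ] := LinearMap.toContinuousLinearMap
  { toFun := fun g => g.im
    map_add' := fun x y => by ext <;> simp
    map_smul' := fun c g => by ext <;> simp }

lemma qreL_apply (g : ℍ[ℝ]) : qreL g = g.re := rfl
lemma qimL_apply (g : ℍ[ℝ]) : qimL g = g.im := rfl

lemma PG.qre : PG fun g : ℍ[ℝ] => g.re := PG.clm qreL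
lemma PG.qim : PG fun g : ℍ[ℝ] => g.im := PG.clm qimL

/-- The even moments of a standard Gaussian. -/
def reMoment (N : ℕ) : ℝ := ∫ r : ℍ[ℝ], r.re ^ (2 * N) ∂γℍ

lemma reMoment_eq (N : ℕ) : reMoment N = ∫ u, |u| ^ (2 * N) ∂gaussianReal 0 1 := by
  have h := integral_stdGaussian_inner_eq (1 : ℍ[ℝ]) (f := fun u => u ^ (2 * N)) (PG.id.pow _)
  simp only [norm_one, one_mul] at h
  simp_rw [(even_two_mul N).pow_abs]
  rw [← h, reMoment]
  simp [qinner]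

lemma reMoment_pos (N : ℕ) : 0 < reMoment N := by
  rw [reMoment_eq]; exact gaussian_abs_moment_pos _

lemma reMoment_succ (N : ℕ) : reMoment (N + 1) = (2 * N + 1) * reMoment N := by
  rw [reMoment_eq, reMoment_eq]
  have := gaussian_abs_moment_succ (2 * N)
  push_cast at this
  exact this

lemma integral_re_pow_mul_norm_im_sq (N : ℕ) :
    ∫ r : ℍ[ℝ], r.re ^ (2 * N) * ‖r.im‖ ^ 2 ∂γℍ =
      reMoment N * ∫ r : ℍ[ℝ], ‖r.im‖ ^ 2 ∂γℍ := by
  have hL : ∀ s, qreL.adjoint s = qmk s 0 0 0 := fun s => by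
    refine ext_inner_left ℝ fun v => ?_
    rw [ContinuousLinearMap.adjoint_inner_right, qinner]
    simp [qreL_apply, mul_comm]
  have hM : ∀ t, qimL.adjoint t = t.im := fun t => by
    refine ext_inner_left ℝ fun v => ?_
    rw [ContinuousLinearMap.adjoint_inner_right, qinner, qinner]
    simp [qimL_apply]
  have h := integral_stdGaussian_pair qreL qimL (fun s t => by rw [hL, hM, qinner]; simp)
    (f := fun p => p.1 ^ (2 * N) * ‖p.2‖ ^ 2) ((PG.fst.pow _).mul (PG.snd.norm.pow _))
  simp only [qreL_apply, qimL_apply] at h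
  rw [h]
  simp_rw [integral_const_mul]
  rw [integral_mul_const, integral_map (by fun_prop) (by fun_prop),
    integral_map (by fun_prop) (by fun_prop)]
  rfl

variable {F : ℍ[ℝ] → ℝ}

/-- The properties of `segF ν`, for a `U(2)`-invariant valuation `ν`, that are used below. -/
structure SegFun (F : ℍ[ℝ] → ℝ) : Prop where
  pg : PG F
  smul : ∀ (t : ℝ) (w : ℍ[ℝ]), F (t • w) = |t| * F w
  im : ∀ w, F w.im = F w
  conj : ∀ {z : ℍ[ℝ]}, ‖z‖ = 1 → z.imJ = 0 → z.imK = 0 → ∀ w, F (z * w * star z) = F w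
  rel : ∀ {τ σ : Fin 3 → ℝ}, 0 < τ 0 → τ 0 < τ 1 → τ 1 < τ 2 → 0 < σ 0 → σ 0 < σ 1 → σ 1 < σ 2 →
    τ 2 * σ 2 ≤ 1 → ∀ r : ℍ[ℝ], ∑ i, ∑ j, humpC τ i * humpC σ j * ∫ g', ∫ g,
      F (r * (cT (σ j) g' * qI * star (cT (τ i) g)) * star r) ∂γℍ ∂γℍ = 0

lemma UTwo.segFun {ν : ConvexBody ℍ[ℝ] → ℝ} (h : UTwo ν) : SegFun (segF ν) :=
  ⟨h.pg_segF, h.segF_smul, h.segF_im, h.segF_conj, h.relation⟩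

/-- Mollification of `F` over rotations concentrated near the identity. -/
def moll (F : ℍ[ℝ] → ℝ) (N : ℕ) (w : ℍ[ℝ]) : ℝ :=
  ∫ r : ℍ[ℝ], F (r * w * star r) * r.re ^ (2 * N) ∂γℍ

lemma PG.conj_pair : PG fun p : ℍ[ℝ] × ℍ[ℝ] => p.1 * p.2 * star p.1 :=
  (PG.fst.qmul PG.snd).qmul PG.fst.qstar

lemma SegFun.pg_moll_kernel (h : SegFun F) (N : ℕ) : PG fun p : ℍ[ℝ] × ℍ[ℝ] =>
    F (p.1 * p.2 * star p.1) * p.1.re ^ (2 * N) :=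
  (h.pg.comp PG.conj_pair).mul ((PG.qre.comp PG.fst).pow _)

lemma SegFun.moll_smul (h : SegFun F) (N : ℕ) (t : ℝ) (w : ℍ[ℝ]) :
    moll F N (t • w) = |t| * moll F N w := by
  rw [moll, moll, ← integral_const_mul]
  simp_rw [mul_smul_comm, smul_mul_assoc, h.smul, mul_assoc]

lemma im_conj (r w : ℍ[ℝ]) : (r * w * star r).im = r * w.im * star r := by
  ext
  all_goals
    simp [Quaternion.re_mul, Quaternion.imI_mul, Quaternion.imJ_mul, Quaternion.imK_mul]
    ring

lemma SegFun.moll_im (h : SegFun F) (N : ℕ) (w : ℍ[ℝ]) : moll F N w.im = moll F N w := by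
  rw [moll, moll]
  simp_rw [← im_conj, h.im]

lemma sum_integral_integral_eq_zero {X ι κ : Type*} [NormedAddCommGroup X] [MeasurableSpace X]
    [BorelSpace X] [SecondCountableTopology X] [Fintype ι] [Fintype κ] {η : Measure X} (hη : HM η)
    {f : ι → κ → (X × X) × X → ℝ} (hf : ∀ i j, PG (f i j)) {c : ι → κ → ℝ}
    (h : ∀ r, ∑ i, ∑ j, c i j * ∫ g', ∫ g, f i j ((g', g), r) ∂η ∂η = 0) :
    ∑ i, ∑ j, c i j * ∫ g', ∫ g, ∫ r, f i j ((g', g), r) ∂η ∂η ∂η = 0 := by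
  have hs : ∀ i j, ∫ g', ∫ g, ∫ r, f i j ((g', g), r) ∂η ∂η ∂η
      = ∫ r, ∫ g', ∫ g, f i j ((g', g), r) ∂η ∂η ∂η := fun i j => by
    have e1 : ∀ g', ∫ g, ∫ r, f i j ((g', g), r) ∂η ∂η = ∫ r, ∫ g, f i j ((g', g), r) ∂η ∂η :=
      fun g' => PG.integral_swap (f := fun p : X × X => f i j ((g', p.1), p.2))
        ((hf i j).comp (((PG.const g').prodMk PG.fst).prodMk PG.snd)) hη hη
    simp_rw [e1]
    exact PG.integral_swap (f := fun p : X × X => ∫ g, f i j ((p.1, g), p.2) ∂η)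
      (PG.integral (f := fun q : (X × X) × X => f i j ((q.1.1, q.2), q.1.2)) ((hf i j).comp
          (((PG.fst.comp PG.fst).prodMk PG.snd).prodMk (PG.snd.comp PG.fst))) hη) hη hη
  have hi : ∀ i j, Integrable (fun r => ∫ g', ∫ g, f i j ((g', g), r) ∂η ∂η) η := fun i j => by
    refine PG.integrable ?_ hη
    refine PG.integral (f := fun p : X × X => ∫ g, f i j ((p.2, g), p.1) ∂η) ?_ hη
    exact PG.integral (f := fun q : (X × X) × X => f i j ((q.1.2, q.2), q.1.1)) ((hf i j).comp
      (((PG.snd.comp PG.fst).prodMk PG.snd).prodMk (PG.fst.comp PG.fst))) hη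
  have e2 : ∑ i, ∑ j, c i j * ∫ r, ∫ g', ∫ g, f i j ((g', g), r) ∂η ∂η ∂η
      = ∫ r, ∑ i, ∑ j, c i j * ∫ g', ∫ g, f i j ((g', g), r) ∂η ∂η ∂η := by
    rw [integral_finsetSum _ fun i _ =>
      integrable_finsetSum _ fun j _ => (hi i j).const_mul _]
    refine Finset.sum_congr rfl fun i _ => ?_
    rw [integral_finsetSum _ fun j _ => (hi i j).const_mul _]
    exact Finset.sum_congr rfl fun j _ => (integral_const_mul _ _).symm
  simp_rw [hs]
  rw [e2]
  simp_rw [h]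
  exact integral_zero _ _

/-- The basic relation for the mollified function. -/
lemma SegFun.moll_relation (h : SegFun F) (N : ℕ) {τ σ : Fin 3 → ℝ} (h0 : 0 < τ 0) (h1 : τ 0 < τ 1)
    (h2 : τ 1 < τ 2) (k0 : 0 < σ 0) (k1 : σ 0 < σ 1) (k2 : σ 1 < σ 2) (hτσ : τ 2 * σ 2 ≤ 1) :
    ∑ i, ∑ j, humpC τ i * humpC σ j * ∫ g', ∫ g, moll F N (cT (σ j) g' * qI * star (cT (τ i) g))
      ∂γℍ ∂γℍ = 0 := by
  refine sum_integral_integral_eq_zero (hm_of_isGaussian (γℍ))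
    (f := fun i j p => F (p.2 * (cT (σ j) p.1.1 * qI * star (cT (τ i) p.1.2)) * star p.2) *
      p.2.re ^ (2 * N)) (fun i j => ?_) fun r => ?_
  · have h1 : PG fun p : (ℍ[ℝ] × ℍ[ℝ]) × ℍ[ℝ] => cT (σ j) p.1.1 := (PG.cT (σ j)).comp
      (PG.fst.comp PG.fst)
    have h2 : PG fun p : (ℍ[ℝ] × ℍ[ℝ]) × ℍ[ℝ] => cT (τ i) p.1.2 := (PG.cT (τ i)).comp
      (PG.snd.comp PG.fst)
    have h3 := (h.pg_moll_kernel N).comp (PG.snd.prodMk ((h1.qmul (PG.const qI)).qmul h2.qstar))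
    exact h3
  · have := congrArg (· * r.re ^ (2 * N)) (h.rel h0 h1 h2 k0 k1 k2 hτσ r)
    simp only [zero_mul, Finset.sum_mul] at this
    refine Eq.trans (Finset.sum_congr rfl fun i _ => Finset.sum_congr rfl fun j _ => ?_) this
    change _ * (∫ g', ∫ g, F (r * (cT (σ j) g' * qI * star (cT (τ i) g)) * star r) *
      r.re ^ (2 * N) ∂γℍ ∂γℍ) = _
    simp_rw [integral_mul_const]
    ring

lemma SegFun.tendsto_moll (h : SegFun F) (w : ℍ[ℝ]) :
    Tendsto (fun N => moll F N w / reMoment (N + 1)) atTop (𝓝 (F w)) := by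
  have hG := hm_of_isGaussian (γℍ)
  set G : ℍ[ℝ] → ℝ := fun r => F (r * w * star r) - r.re ^ 2 * F w with hGd
  have hPG : PG G := (h.pg.comp (PG.conj_pair.comp (PG.id.prodMk (PG.const w)))).sub
    ((PG.qre.pow 2).mul (PG.const _))
  have hGs : ∀ t r, G (t • r) = t ^ 2 * G r := fun t r => by
    simp only [hGd, smul_mul_assoc, Quaternion.star_smul, mul_smul_comm, smul_smul, h.smul]
    simp only [star_trivial, h.smul, Quaternion.re_smul, smul_eq_mul, abs_mul]
    linear_combination F (r * w * star r) * abs_mul_abs_self t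
  have hG1 : G 1 = 0 := by simp [hGd]
  have hbound : ∀ δ > 0, ∃ C, 0 ≤ C ∧ ∀ r : ℍ[ℝ], |G r| ≤ δ * r.re ^ 2 + C * ‖r.im‖ ^ 2 := fun δ hδ => by
    obtain ⟨K, hK⟩ := (isCompact_closedBall (0 : ℍ[ℝ]) 1).exists_bound_of_continuousOn
      hPG.1.continuousOn
    have hK0 : 0 ≤ K := (norm_nonneg _).trans (hK 0 (by simp))
    have hK' : ∀ r, |G r| ≤ K * ‖r‖ ^ 2 := fun r => by
      rcases eq_or_ne r 0 with rfl | hr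
      · have := hGs 0 0
        simp only [zero_smul] at this
        rw [this]; simp
      · have hr' : ‖r‖ ≠ 0 := norm_ne_zero_iff.2 hr
        have e := hGs ‖r‖ (‖r‖⁻¹ • r)
        rw [smul_smul, mul_inv_cancel₀ hr', one_smul] at e
        rw [e, abs_mul, abs_of_nonneg (by positivity), mul_comm]
        refine mul_le_mul_of_nonneg_right (hK _ ?_) (by positivity)
        rw [mem_closedBall_zero_iff, norm_smul, norm_inv, norm_norm, inv_mul_cancel₀ hr']
    obtain ⟨η, hη, hη'⟩ := Metric.continuousAt_iff.1 (hPG.1.continuousAt (x := 1)) δ hδ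
    refine ⟨K * (1 + (η ^ 2)⁻¹), by positivity, fun r => ?_⟩
    rcases lt_or_ge ‖r.im‖ (η * |r.re|) with h1 | h1
    · have hr0 : r.re ≠ 0 := fun h0 => by
        rw [h0, abs_zero, mul_zero] at h1
        exact absurd h1 (norm_nonneg _).not_gt
      have e : r = r.re • (1 + r.re⁻¹ • r.im) := by
        rw [smul_add, smul_smul, mul_inv_cancel₀ hr0, one_smul]
        ext <;> simp
      have h2 := hη' (x := 1 + r.re⁻¹ • r.im) (by
        rw [dist_eq_norm, add_sub_cancel_left, norm_smul, norm_inv, Real.norm_eq_abs,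
          inv_mul_lt_iff₀ (abs_pos.2 hr0), mul_comm]
        exact h1)
      rw [hG1, dist_zero_right, Real.norm_eq_abs] at h2
      have h3 : |G r| = r.re ^ 2 * |G (1 + r.re⁻¹ • r.im)| := by
        conv_lhs => rw [e, hGs, abs_mul, abs_of_nonneg (sq_nonneg _)]
      rw [h3]
      have : 0 ≤ K * (1 + (η ^ 2)⁻¹) * ‖r.im‖ ^ 2 := by positivity
      nlinarith [mul_le_mul_of_nonneg_left h2.le (sq_nonneg r.re)]
    · refine (hK' r).trans ?_
      have e : ‖r‖ ^ 2 = r.re ^ 2 + ‖r.im‖ ^ 2 := by rw [qim_norm_sq, qnorm_sq]; ring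
      have h2 : (η * |r.re|) ^ 2 ≤ ‖r.im‖ ^ 2 := pow_le_pow_left₀ (by positivity) h1 2
      rw [mul_pow, sq_abs] at h2
      have h3 : r.re ^ 2 ≤ (η ^ 2)⁻¹ * ‖r.im‖ ^ 2 := by
        rwa [le_inv_mul_iff₀ (by positivity)]
      rw [e]
      nlinarith [mul_le_mul_of_nonneg_left h3 hK0, mul_nonneg hδ.le (sq_nonneg r.re)]
  set V := ∫ r : ℍ[ℝ], ‖r.im‖ ^ 2 ∂γℍ with hV
  have hV0 : 0 ≤ V := integral_nonneg fun r => by positivity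
  have hN : ∀ δ > 0, ∃ C, 0 ≤ C ∧ ∀ N : ℕ, |moll F N w / reMoment (N + 1) - F w| ≤
      δ + C * (2 * N + 1 : ℝ)⁻¹ := fun δ hδ => by
    obtain ⟨C, hC, hb⟩ := hbound δ hδ
    refine ⟨C * V, by positivity, fun N => ?_⟩
    have hm := reMoment_pos (N + 1)
    have hm' := reMoment_pos N
    have e1 : moll F N w - reMoment (N + 1) * F w
        = ∫ r, G r * r.re ^ (2 * N) ∂γℍ := by
      rw [moll, reMoment, ← integral_mul_const, ← integral_sub]
      · refine integral_congr_ae (.of_forall fun r => ?_)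
        simp only [hGd]; ring
      · exact ((h.pg_moll_kernel N).comp (PG.id.prodMk (PG.const w))).integrable hG
      · exact ((PG.qre.pow _).mul (PG.const _)).integrable hG
    have e2 : |moll F N w - reMoment (N + 1) * F w| ≤
        δ * reMoment (N + 1) + C * (reMoment N * V) := by
      rw [e1, ← Real.norm_eq_abs, ← integral_re_pow_mul_norm_im_sq, reMoment, ← integral_const_mul δ,
        ← integral_const_mul C, ← integral_add]
      · refine norm_integral_le_of_norm_le ?_ (.of_forall fun r => ?_)
        · exact (((PG.qre.pow _).const_mul _).add (((PG.qre.pow _).mul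
            (PG.qim.norm.pow 2)).const_mul _)).integrable hG
        · rw [norm_mul, Real.norm_eq_abs, norm_pow, Real.norm_eq_abs, (even_two_mul N).pow_abs]
          have : 0 ≤ r.re ^ (2 * N) := (even_two_mul N).pow_nonneg _
          refine (mul_le_mul_of_nonneg_right (hb r) this).trans (le_of_eq ?_)
          ring
      · exact ((PG.qre.pow _).const_mul _).integrable hG
      · exact (((PG.qre.pow _).mul (PG.qim.norm.pow 2)).const_mul _).integrable hG
    have e3 : moll F N w / reMoment (N + 1) - F w =
        (moll F N w - reMoment (N + 1) * F w) / reMoment (N + 1) := by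
      field_simp
    rw [e3, abs_div, abs_of_pos hm, div_le_iff₀ hm]
    refine e2.trans (le_of_eq ?_)
    rw [reMoment_succ]
    field_simp
  rw [Metric.tendsto_atTop]
  intro ε hε
  obtain ⟨C, hC, hb⟩ := hN (ε / 2) (by positivity)
  have ht : Tendsto (fun N : ℕ => C * (2 * N + 1 : ℝ)⁻¹) atTop (𝓝 0) := by
    rw [← mul_zero C]
    exact (tendsto_inv_atTop_zero.comp (tendsto_atTop_add_const_right _ _
      (tendsto_natCast_atTop_atTop.const_mul_atTop two_pos))).const_mul C
  obtain ⟨N0, hN0⟩ := eventually_atTop.1 (ht.eventually (gt_mem_nhds (half_pos hε)))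
  refine ⟨N0, fun N hNN => ?_⟩
  rw [Real.dist_eq]
  linarith [hb N, hN0 N hNN]

end Mollify

section Representation

variable {F : ℍ[ℝ] → ℝ}

lemma integral_conj_unit {z : ℍ[ℝ]} (hz : ‖z‖ = 1) (f : ℍ[ℝ] → ℝ) :
    ∫ r, f (z * r * star z) ∂γℍ = ∫ r, f r ∂γℍ :=
  integral_stdGaussian_isometry ((lmulE hz).trans (rmulE (s := star z) (by rwa [norm_star]))) f

lemma unit_star_mul {z : ℍ[ℝ]} (hz : ‖z‖ = 1) : star z * z = 1 := by
  rw [qstar_mul_self, hz]; simp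

lemma re_conj_unit {z : ℍ[ℝ]} (hz : ‖z‖ = 1) (r : ℍ[ℝ]) : (z * r * star z).re = r.re := by
  have h : (z * r * star z).re = ‖z‖ ^ 2 * r.re := by
    rw [qnorm_sq]
    simp [Quaternion.re_mul, Quaternion.imI_mul, Quaternion.imJ_mul, Quaternion.imK_mul]
    ring
  rw [h, hz]; ring

lemma SegFun.moll_conj (h : SegFun F) (N : ℕ) {z : ℍ[ℝ]} (hz : ‖z‖ = 1) (h2 : z.imJ = 0)
    (h3 : z.imK = 0) (w : ℍ[ℝ]) : moll F N (z * w * star z) = moll F N w := by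
  rw [moll, ← integral_conj_unit hz, moll]
  refine integral_congr_ae (.of_forall fun r => ?_)
  beta_reduce
  rw [re_conj_unit hz]
  congr 1
  rw [← h.conj hz h2 h3 (r * w * star r)]
  congr 1
  have e := unit_star_mul hz
  have : z * r * star z * (z * w * star z) * star (z * r * star z)
      = z * (r * ((star z * z) * w * (star z * z)) * star r) * star z := by
    simp only [star_mul, star_star]
    noncomm_ring
  rw [this, e, one_mul, mul_one]

lemma inner_qI (g : ℍ[ℝ]) : ⟪qI, g⟫ = g.imI := by rw [qinner]; simp

lemma PG.qimI : PG fun g : ℍ[ℝ] => g.imI := by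
  simp_rw [← inner_qI]; exact (PG.const qI).inner PG.id

lemma PG.qimJ : PG fun g : ℍ[ℝ] => g.imJ := by
  have : ∀ g : ℍ[ℝ], g.imJ = ⟪qJ, g⟫ := fun g => by rw [qinner]; simp
  simp_rw [this]; exact (PG.const qJ).inner PG.id

lemma exists_even_part (P : Polynomial ℝ) :
    ∃ Q : Polynomial ℝ, ∀ z, P.eval z + P.eval (-z) = 2 * Q.eval (z ^ 2) := by
  induction P using Polynomial.induction_on' with
  | add p q hp hq =>
    obtain ⟨P, hP⟩ := hp
    obtain ⟨Q, hQ⟩ := hq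
    refine ⟨P + Q, fun z => ?_⟩
    simp only [Polynomial.eval_add]
    linear_combination hP z + hQ z
  | monomial n a =>
    rcases Nat.even_or_odd n with he | ho
    · obtain ⟨l, rfl⟩ := he.two_dvd
      refine ⟨Polynomial.monomial l a, fun z => ?_⟩
      simp only [Polynomial.eval_monomial, he.neg_pow, ← pow_mul]
      ring
    · refine ⟨0, fun z => ?_⟩
      simp [Polynomial.eval_monomial, ho.neg_pow]

/-- The mollification on a great circle is a polynomial in the height. -/
lemma SegFun.exists_poly_circle (h : SegFun F) (N : ℕ) : ∃ P : Polynomial ℝ, ∀ a b : ℝ,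
    a ^ 2 + b ^ 2 = 1 → moll F N (qmk 0 (a ^ 2 - b ^ 2) 0 (-(2 * a * b))) = P.eval (a ^ 2 - b ^ 2) := by
  set c : ℕ → ℝ := fun m => ((2 * N).choose m : ℝ) *
    ∫ r : ℍ[ℝ], F (r * qI * star r) * (r.re ^ m * r.imJ ^ (2 * N - m)) ∂γℍ with hc
  have hodd : ∀ l, c (2 * l + 1) = 0 := fun l => by
    rcases lt_or_ge (2 * N) (2 * l + 1) with hl | hl
    · simp [hc, Nat.choose_eq_zero_of_lt hl]
    · have ho : Odd (2 * N - (2 * l + 1)) := by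
        rw [Nat.odd_sub hl]; simp
      have e := integral_conj_unit norm_qI
        (fun r => F (r * qI * star r) * (r.re ^ (2 * l + 1) * r.imJ ^ (2 * N - (2 * l + 1))))
      have e' : ∀ r : ℍ[ℝ], F (qI * r * star qI * qI * star (qI * r * star qI)) *
          ((qI * r * star qI).re ^ (2 * l + 1) * (qI * r * star qI).imJ ^ (2 * N - (2 * l + 1)))
          = -(F (r * qI * star r) * (r.re ^ (2 * l + 1) * r.imJ ^ (2 * N - (2 * l + 1)))) := fun r => by
        have e1 : qI * r * star qI * qI * star (qI * r * star qI) = qI * (r * qI * star r) * star qI := by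
          have h1 : qI * r * star qI * qI * star (qI * r * star qI)
            = qI * r * (star qI * qI) * qI * star r * star qI := by
            simp only [star_mul, star_star]; noncomm_ring
          rw [h1, unit_star_mul norm_qI]; noncomm_ring
        have e2 : (qI * r * star qI).imJ = -r.imJ := by
          simp [Quaternion.re_mul, Quaternion.imI_mul, Quaternion.imJ_mul, Quaternion.imK_mul]
        rw [e1, h.conj norm_qI rfl rfl, re_conj_unit norm_qI, e2, ho.neg_pow]
        ring
      simp_rw [e', integral_neg] at e
      have : ∫ r : ℍ[ℝ], F (r * qI * star r) * (r.re ^ (2 * l + 1) *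
        r.imJ ^ (2 * N - (2 * l + 1))) ∂γℍ = 0 := by linarith
      simp only [hc, this, mul_zero]
  refine ⟨∑ l ∈ Finset.range (N + 1), Polynomial.C (c (2 * l)) *
    ((Polynomial.C (1 / 2) * (1 + Polynomial.X)) ^ l *
      (Polynomial.C (1 / 2) * (1 - Polynomial.X)) ^ (N - l)), fun a b hab => ?_⟩
  set s := qmk a 0 b 0 with hs
  have hsn : ‖s‖ = 1 := by
    have : ‖s‖ ^ 2 = 1 := by rw [qnorm_sq, hs]; simpa using hab
    exact (pow_eq_one_iff_of_nonneg (norm_nonneg _) two_ne_zero).1 this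
  have hw : qmk 0 (a ^ 2 - b ^ 2) 0 (-(2 * a * b)) = s * qI * star s := by
    ext <;> simp [hs, Quaternion.re_mul, Quaternion.imI_mul, Quaternion.imJ_mul,
      Quaternion.imK_mul] <;> ring
  have hsn' : ‖star s‖ = 1 := by rwa [norm_star]
  rw [hw, moll, ← integral_stdGaussian_isometry (rmulE hsn')]
  have e1 : ∀ r : ℍ[ℝ], F (rmulE hsn' r * (s * qI * star s) * star (rmulE hsn' r)) *
      (rmulE hsn' r).re ^ (2 * N) = ∑ m ∈ Finset.range (2 * N + 1), a ^ m * b ^ (2 * N - m) *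
        ((2 * N).choose m : ℝ) * (F (r * qI * star r) * (r.re ^ m * r.imJ ^ (2 * N - m))) := fun r => by
    have h1 : rmulE hsn' r * (s * qI * star s) * star (rmulE hsn' r) = r * qI * star r := by
      rw [rmulE_apply]
      have : r * star s * (s * qI * star s) * star (r * star s)
        = r * (star s * s) * qI * (star s * s) * star r := by
        simp only [star_mul, star_star]; noncomm_ring
      rw [this, unit_star_mul hsn, mul_one, mul_one]
    have h2 : (rmulE hsn' r).re = a * r.re + b * r.imJ := by
      rw [rmulE_apply, hs, Quaternion.re_mul]; simp; ring
    rw [h1, h2, add_pow, Finset.mul_sum]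
    refine Finset.sum_congr rfl fun m _ => ?_
    rw [mul_pow, mul_pow]; ring
  simp_rw [e1]
  have hPG : ∀ m, PG fun r : ℍ[ℝ] => F (r * qI * star r) * (r.re ^ m * r.imJ ^ (2 * N - m)) := fun m => by
    exact (h.pg.comp (PG.conj_pair.comp (PG.id.prodMk (PG.const qI)))).mul
      ((PG.qre.pow m).mul (PG.qimJ.pow _))
  rw [integral_finsetSum _ fun m _ => ((hPG m).integrable (hm_of_isGaussian _)).const_mul _]
  simp_rw [integral_const_mul]
  have e2 : ∀ m, a ^ m * b ^ (2 * N - m) * ((2 * N).choose m : ℝ) * ∫ r : ℍ[ℝ],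
      F (r * qI * star r) * (r.re ^ m * r.imJ ^ (2 * N - m)) ∂γℍ =
      a ^ m * b ^ (2 * N - m) * c m := fun m => by rw [hc]; ring
  simp_rw [e2]
  rw [sum_range_even_of_odd_eq_zero (F := fun m => a ^ m * b ^ (2 * N - m) * c m)
    (fun l => by rw [hodd, mul_zero]), Polynomial.eval_finsetSum]
  refine Finset.sum_congr rfl fun l _ => ?_
  simp only [Polynomial.eval_mul, Polynomial.eval_pow, Polynomial.eval_C, Polynomial.eval_add,
    Polynomial.eval_sub, Polynomial.eval_one, Polynomial.eval_X]
  rw [show 1 / 2 * (1 + (a ^ 2 - b ^ 2)) = a ^ 2 by linarith,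
    show 1 / 2 * (1 - (a ^ 2 - b ^ 2)) = b ^ 2 by linarith, ← pow_mul, ← pow_mul, ← Nat.mul_sub]
  ring

lemma exists_rotate (p q : ℝ) : ∃ c d : ℝ, c ^ 2 + d ^ 2 = 1 ∧
    (c ^ 2 - d ^ 2) * p - 2 * c * d * q = 0 ∧
    (c ^ 2 - d ^ 2) * q + 2 * c * d * p = -√(p ^ 2 + q ^ 2) := by
  rcases eq_or_ne (Complex.mk p q) 0 with h | h
  · obtain ⟨rfl, rfl⟩ := Complex.ext_iff.1 h
    exact ⟨1, 0, by simp⟩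
  obtain ⟨e, he⟩ := IsAlgClosed.exists_pow_nat_eq (-(Complex.I * ‖Complex.mk p q‖) / Complex.mk p q)
    two_pos
  have hn : ‖Complex.mk p q‖ = √(p ^ 2 + q ^ 2) := by
    rw [Complex.norm_def, Complex.normSq_mk]; congr 1; ring
  have h1 : ‖e‖ ^ 2 = 1 := by
    rw [← norm_pow, he, norm_div, norm_neg, norm_mul, Complex.norm_I, one_mul, Complex.norm_real,
      norm_norm, div_self (norm_ne_zero_iff.2 h)]
  rw [Complex.sq_norm, Complex.normSq_apply] at h1
  rw [eq_div_iff h, hn] at he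
  have hr := congrArg Complex.re he
  have hi := congrArg Complex.im he
  simp [pow_two] at hr hi
  refine ⟨e.re, e.im, by linarith, by linarith, ?_⟩
  rw [pow_two p, pow_two q]
  linarith

lemma SegFun.exists_poly_sphere (h : SegFun F) (N : ℕ) : ∃ Q : Polynomial ℝ, ∀ w : ℍ[ℝ],
    w.re = 0 → ‖w‖ = 1 → moll F N w = Q.eval (w.imI ^ 2) := by
  obtain ⟨P, hP⟩ := h.exists_poly_circle N
  obtain ⟨Q, hQ⟩ := exists_even_part P
  have key : ∀ w : ℍ[ℝ], w.re = 0 → ‖w‖ = 1 → moll F N w = P.eval w.imI := fun w h0 h1 => by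
    obtain ⟨c, d, e1, e2, e3⟩ := exists_rotate w.imJ w.imK
    have hw := qnorm_sq w
    rw [h1, h0] at hw
    set z := w.imI with hz
    have hz1 : z ≤ 1 := by nlinarith [sq_nonneg w.imJ, sq_nonneg w.imK]
    have hz2 : -1 ≤ z := by nlinarith [sq_nonneg w.imJ, sq_nonneg w.imK]
    have ha0 : 0 ≤ (1 + z) / 2 := by linarith
    have ha := Real.sq_sqrt ha0
    have hb := Real.sq_sqrt (show 0 ≤ (1 - z) / 2 by linarith)
    have hu : ‖qmk c d 0 0‖ = 1 := by
      have : ‖qmk c d 0 0‖ ^ 2 = 1 := by rw [qnorm_sq]; simpa using e1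
      exact (pow_eq_one_iff_of_nonneg (norm_nonneg _) two_ne_zero).1 this
    have := hP √((1 + z) / 2) √((1 - z) / 2) (by rw [ha, hb]; ring)
    rw [ha, hb, show (1 + z) / 2 - (1 - z) / 2 = z by ring] at this
    rw [← this, ← h.moll_conj N hu rfl rfl]
    congr 1
    have hs : 2 * √((1 + z) / 2) * √((1 - z) / 2) = √(w.imJ ^ 2 + w.imK ^ 2) := by
      rw [mul_assoc, ← Real.sqrt_mul ha0]
      rw [show w.imJ ^ 2 + w.imK ^ 2 = 2 ^ 2 * ((1 + z) / 2 * ((1 - z) / 2)) by nlinarith,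
        Real.sqrt_mul (sq_nonneg 2), Real.sqrt_sq zero_le_two]
    rw [hs]
    ext
    all_goals
      simp [Quaternion.re_mul, Quaternion.imI_mul, Quaternion.imJ_mul, Quaternion.imK_mul, h0, ← hz]
    · ring
    · linear_combination z * e1
    · linear_combination e2
    · linear_combination e3
  refine ⟨Q, fun w h0 h1 => ?_⟩
  have e1 := key w h0 h1
  have e2 := key (-w) (by simp [h0]) (by rwa [norm_neg])
  have e3 := h.moll_smul N (-1) w
  rw [neg_one_smul, abs_neg, abs_one, one_mul] at e3
  rw [Quaternion.imI_neg, e3] at e2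
  linarith [hQ w.imI]

/-- The mollification is a cosine transform of a polynomial in the squared height. -/
lemma SegFun.exists_cos_rep (h : SegFun F) (N : ℕ) : ∃ R : Polynomial ℝ, ∀ w : ℍ[ℝ],
    moll F N w = ∫ g : ℍ[ℝ], |⟪w.im, g⟫| * R.eval (g.imI ^ 2) ∂γℍ := by
  obtain ⟨Q, hQ⟩ := h.exists_poly_sphere N
  set R₀ : Polynomial ℝ := ∑ l ∈ Finset.range (Q.natDegree + 1),
    Polynomial.C (Q.coeff l / aHe (2 * l)) * He (2 * l) with hR₀
  obtain ⟨R, hR⟩ := exists_even_part R₀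
  refine ⟨R, fun w => ?_⟩
  have h1 : ∀ u : ℍ[ℝ], u.re = 0 → ‖u‖ = 1 → moll F N u =
      ∫ g : ℍ[ℝ], |⟪u, g⟫| * R₀.eval g.imI ∂γℍ := fun u h0 h1 => by
    rw [hQ u h0 h1, Polynomial.eval_eq_sum_range]
    have e : ∀ g : ℍ[ℝ], |⟪u, g⟫| * R₀.eval g.imI = ∑ l ∈ Finset.range (Q.natDegree + 1),
        Q.coeff l / aHe (2 * l) * (|⟪u, g⟫| * hHe (2 * l) ⟪qI, g⟫ ‖qI‖) := fun g => by
      rw [hR₀, Polynomial.eval_finsetSum, Finset.mul_sum]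
      refine Finset.sum_congr rfl fun l _ => ?_
      have := hHe_smul (2 * l) 1 g.imI
      rw [one_mul, one_pow, one_mul] at this
      rw [norm_qI, inner_qI, this, Polynomial.eval_mul, Polynomial.eval_C]
      ring
    simp_rw [e]
    have hi : ∀ l, Integrable (fun g : ℍ[ℝ] => |⟪u, g⟫| * hHe (2 * l) ⟪qI, g⟫ ‖qI‖)
        (γℍ) := fun l => by
      refine PG.integrable ?_ (hm_of_isGaussian _)
      simp only [hHe]
      exact ((PG.const u).inner PG.id).abs.mul (PG.sum _ fun m _ =>
        (((((PG.const qI).inner PG.id).pow m).mul (PG.const _)).const_mul _))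
    rw [integral_finsetSum _ fun l _ => (hi l).const_mul _]
    refine Finset.sum_congr rfl fun l _ => ?_
    rw [integral_const_mul, cos_power h1, real_inner_comm, inner_qI, pow_mul]
    have := aHe_ne_zero l
    field_simp
  have h2 : ∀ u : ℍ[ℝ], u.re = 0 → ‖u‖ = 1 → moll F N u =
      ∫ g : ℍ[ℝ], |⟪u, g⟫| * R.eval (g.imI ^ 2) ∂γℍ := fun u h0 hu => by
    have e := integral_stdGaussian_isometry (LinearIsometryEquiv.neg ℝ (E := ℍ[ℝ]))
      (fun g => |⟪u, g⟫| * R₀.eval g.imI)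
    simp only [LinearIsometryEquiv.coe_neg, inner_neg_right, abs_neg, Quaternion.imI_neg] at e
    have hp : ∀ S : Polynomial ℝ, ∀ {f : ℍ[ℝ] → ℝ}, PG f →
        Integrable (fun g : ℍ[ℝ] => |⟪u, g⟫| * S.eval (f g)) (γℍ) := fun S f hf =>
      PG.integrable (((PG.const u).inner PG.id).abs.mul ((PG.poly S).comp hf)) (hm_of_isGaussian _)
    have e2 : ∫ g : ℍ[ℝ], (|⟪u, g⟫| * R₀.eval g.imI + |⟪u, g⟫| * R₀.eval (-g.imI)) ∂γℍ
        = ∫ g : ℍ[ℝ], 2 * (|⟪u, g⟫| * R.eval (g.imI ^ 2)) ∂γℍ :=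
      integral_congr_ae (.of_forall fun g => by
        beta_reduce; linear_combination |⟪u, g⟫| * hR g.imI)
    rw [integral_add (hp R₀ PG.qimI) (hp R₀ PG.qimI.neg), e, ← h1 u h0 hu, integral_const_mul] at e2
    linarith
  rcases eq_or_ne ‖w.im‖ 0 with hw | hw
  · have := h.moll_smul N 0 0
    rw [← h.moll_im, norm_eq_zero.1 hw]
    simp only [zero_smul, abs_zero, zero_mul] at this
    simp [this]
  · have e : w.im = ‖w.im‖ • (‖w.im‖⁻¹ • w.im) := by
      rw [smul_smul, mul_inv_cancel₀ hw, one_smul]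
    rw [← h.moll_im, e, h.moll_smul, h2 (‖w.im‖⁻¹ • w.im) (by simp) (norm_smul_inv_norm (norm_ne_zero_iff.1 hw)),
      ← integral_const_mul]
    simp_rw [← e]
    refine integral_congr_ae (.of_forall fun g => ?_)
    beta_reduce
    conv_rhs => rw [e, real_inner_smul_left, abs_mul]
    ring

end Representation

section Factorization

lemma isOpenPosMeasure_stdGaussian {E : Type*} [NormedAddCommGroup E] [InnerProductSpace ℝ E]
    [FiniteDimensional ℝ E] [MeasurableSpace E] [BorelSpace E] :
    (stdGaussian E).IsOpenPosMeasure := by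
  have : (gaussianReal 0 1).IsOpenPosMeasure :=
    (gaussianReal_absolutelyContinuous' 0 one_ne_zero).isOpenPosMeasure
  refine Continuous.isOpenPosMeasure_map (by fun_prop) fun x => ?_
  exact ⟨fun i => (stdOrthonormalBasis ℝ E).repr x i, (stdOrthonormalBasis ℝ E).sum_repr x⟩

lemma PG.integral_stdGaussian_pos {E : Type*} [NormedAddCommGroup E] [InnerProductSpace ℝ E]
    [FiniteDimensional ℝ E] [MeasurableSpace E] [BorelSpace E] {f : E → ℝ} (hf : PG f)
    (h : ∀ x, 0 ≤ f x) {x : E} (hx : f x ≠ 0) : 0 < ∫ y, f y ∂stdGaussian E := by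
  have := isOpenPosMeasure_stdGaussian (E := E)
  rw [integral_pos_iff_support_of_nonneg h (hf.integrable (hm_of_isGaussian _))]
  exact hf.1.isOpen_support.measure_pos _ ⟨x, hx⟩

/-- Ratio of odd moments of the norm of the imaginary part. -/
def imRatio (m : ℕ) : ℝ := (∫ y : ℍ[ℝ], ‖y.im‖ ^ (2 * m + 1) ∂γℍ) /
  ∫ y : ℍ[ℝ], ‖y.im‖ ∂γℍ

lemma integral_norm_im_pow_pos (m : ℕ) : 0 < ∫ y : ℍ[ℝ], ‖y.im‖ ^ m ∂γℍ :=
  (PG.qim.norm.pow m).integral_stdGaussian_pos (fun y => by positivity) (x := qI) (by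
    have : qI.im = qI := by ext <;> simp
    rw [this, norm_qI, one_pow]; exact one_ne_zero)

lemma integral_norm_im_pos : 0 < ∫ y : ℍ[ℝ], ‖y.im‖ ∂γℍ := by
  simpa using integral_norm_im_pow_pos 1

lemma imRatio_pos (m : ℕ) : 0 < imRatio m :=
  div_pos (integral_norm_im_pow_pos _) integral_norm_im_pos

variable {A : ℍ[ℝ] → ℝ}

lemma integral_conj_im (hs : ∀ (t : ℝ) w, A (t • w) = |t| * A w) (m : ℕ) (r : ℍ[ℝ]) :
    ∫ y : ℍ[ℝ], ‖y.im‖ ^ (2 * m) * A (r * y.im * star r) ∂γℍ =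
      ‖r‖ ^ 2 * ∫ y : ℍ[ℝ], ‖y.im‖ ^ (2 * m) * A y.im ∂γℍ := by
  rcases eq_or_ne r 0 with rfl | hr
  · have := hs 0 0
    simp only [zero_smul, abs_zero, zero_mul] at this
    simp [this]
  · obtain ⟨s, hs1, hrs⟩ : ∃ s : ℍ[ℝ], ‖s‖ = 1 ∧ r = ‖r‖ • s :=
      ⟨‖r‖⁻¹ • r, norm_smul_inv_norm hr, by
        rw [smul_smul, mul_inv_cancel₀ (norm_ne_zero_iff.2 hr), one_smul]⟩
    rw [← integral_conj_unit hs1 fun y => ‖y.im‖ ^ (2 * m) * A y.im, ← integral_const_mul]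
    refine integral_congr_ae (.of_forall fun y => ?_)
    beta_reduce
    rw [im_conj, norm_mul, norm_mul, norm_star, hs1, one_mul, mul_one]
    have : r * y.im * star r = (‖r‖ ^ 2) • (s * y.im * star s) := by
      conv_lhs => rw [hrs, Quaternion.star_smul, smul_mul_assoc, mul_smul_comm,
        smul_mul_assoc, smul_smul, ← pow_two]
    rw [this, hs, abs_of_nonneg (by positivity)]
    ring

lemma integral_im_conj (hs : ∀ (t : ℝ) w, A (t • w) = |t| * A w) (m : ℕ) (y : ℍ[ℝ]) :
    ∫ r : ℍ[ℝ], ‖y.im‖ ^ (2 * m) * A (r * y.im * star r) ∂γℍ =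
      (∫ r : ℍ[ℝ], A (r * qI * star r) ∂γℍ) * ‖y.im‖ ^ (2 * m + 1) := by
  obtain ⟨s, hs1, hy⟩ := exists_conj_qI y
  rw [← integral_stdGaussian_isometry (rmulE hs1) fun r => A (r * qI * star r),
    ← integral_mul_const]
  refine integral_congr_ae (.of_forall fun r => ?_)
  beta_reduce
  have : r * y.im * star r = ‖y.im‖ • (rmulE hs1 r * qI * star (rmulE hs1 r)) := by
    conv_lhs => rw [hy]
    rw [rmulE_apply, star_mul, mul_smul_comm, smul_mul_assoc]
    congr 1; noncomm_ring
  rw [this, hs, abs_norm]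
  ring

lemma integral_norm_sq_mul (hA : PG A) (hs : ∀ (t : ℝ) w, A (t • w) = |t| * A w) (m : ℕ) :
    (∫ r : ℍ[ℝ], ‖r‖ ^ 2 ∂γℍ) *
      ∫ y : ℍ[ℝ], ‖y.im‖ ^ (2 * m) * A y.im ∂γℍ =
    (∫ r : ℍ[ℝ], A (r * qI * star r) ∂γℍ) *
      ∫ y : ℍ[ℝ], ‖y.im‖ ^ (2 * m + 1) ∂γℍ := by
  have hG := hm_of_isGaussian (γℍ)
  have h1 : PG fun p : ℍ[ℝ] × ℍ[ℝ] => p.1 * p.2.im * star p.1 :=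
    (PG.fst.qmul (PG.qim.comp PG.snd)).qmul PG.fst.qstar
  have h3 := ((PG.qim.comp PG.snd).norm.pow (2 * m)).mul (hA.comp h1)
  have h4 := PG.integral_swap (f := fun p : ℍ[ℝ] × ℍ[ℝ] =>
    ‖p.2.im‖ ^ (2 * m) * A (p.1 * p.2.im * star p.1)) h3 hG hG
  rw [← integral_mul_const, ← integral_const_mul]
  have e1 : ∀ r : ℍ[ℝ], ‖r‖ ^ 2 * ∫ y : ℍ[ℝ], ‖y.im‖ ^ (2 * m) * A y.im ∂γℍ =
      ∫ y : ℍ[ℝ], ‖y.im‖ ^ (2 * m) * A (r * y.im * star r) ∂γℍ :=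
    fun r => (integral_conj_im hs m r).symm
  simp_rw [e1, ← integral_im_conj hs m]
  exact h4

lemma integral_norm_im_pow_mul (hA : PG A) (hs : ∀ (t : ℝ) w, A (t • w) = |t| * A w)
    (m : ℕ) : ∫ y : ℍ[ℝ], ‖y.im‖ ^ (2 * m) * A y.im ∂γℍ =
      imRatio m * ∫ y : ℍ[ℝ], A y.im ∂γℍ := by
  have hVp : 0 < ∫ r : ℍ[ℝ], ‖r‖ ^ 2 ∂γℍ :=
    (PG.id.norm.pow 2).integral_stdGaussian_pos (fun y => by positivity) (x := (1 : ℍ[ℝ])) (by simp)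
  have k0 := integral_norm_sq_mul hA hs 0
  simp only [mul_zero, pow_zero, one_mul, zero_add, pow_one] at k0
  have hp := integral_norm_im_pos
  rw [imRatio, div_mul_eq_mul_div, eq_div_iff hp.ne']
  refine mul_left_cancel₀ hVp.ne' ?_
  linear_combination (∫ y : ℍ[ℝ], ‖y.im‖ ∂γℍ) * integral_norm_sq_mul hA hs m -
    (∫ y : ℍ[ℝ], ‖y.im‖ ^ (2 * m + 1) ∂γℍ) * k0

variable {τ : Fin 3 → ℝ}

lemma hump_zero : hump τ 0 = 0 := by simpa using hump_smul (τ := τ) 0 0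

/-- A hump function weighted by a power of the height. -/
def humpA (τ : Fin 3 → ℝ) (m : ℕ) (u w : ℍ[ℝ]) : ℝ := (w.imI / ‖w‖) ^ (2 * m) * hump τ (w * u)

lemma abs_div_norm_le_one (w : ℍ[ℝ]) : |w.imI / ‖w‖| ≤ 1 := by
  rw [abs_div, abs_norm]
  refine div_le_one_of_le₀ ?_ (norm_nonneg _)
  rw [← inner_qI]
  simpa [norm_qI] using abs_real_inner_le_norm qI w

lemma sq_div_norm_le_one (w : ℍ[ℝ]) : (w.imI / ‖w‖) ^ 2 ≤ 1 := by
  rw [← sq_abs]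
  exact pow_le_one₀ (abs_nonneg _) (abs_div_norm_le_one w)

lemma PG.humpA (τ : Fin 3 → ℝ) (m : ℕ) (u : ℍ[ℝ]) : PG (humpA τ m u) := by
  have h0 : PG fun w : ℍ[ℝ] => _root_.hump τ (w * u) := (PG.hump τ).comp (PG.id.qmul (PG.const u))
  have hle : ∀ w, ‖_root_.humpA τ m u w‖ ≤ ‖_root_.hump τ (w * u)‖ := fun w => by
    rw [_root_.humpA, norm_mul, norm_pow]
    exact mul_le_of_le_one_left (norm_nonneg _) (pow_le_one₀ (norm_nonneg _) (abs_div_norm_le_one w))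
  refine PG.of_le (C := 1) h0 ?_ fun w => (hle w).trans (by linarith)
  refine continuous_iff_continuousAt.2 fun w => ?_
  rcases eq_or_ne w 0 with rfl | hw
  · have e : _root_.humpA τ m u 0 = 0 := by simp [_root_.humpA, hump_zero]
    rw [ContinuousAt, e]
    refine squeeze_zero_norm hle ?_
    have := (h0.1.norm.tendsto 0)
    rwa [zero_mul, hump_zero, norm_zero] at this
  · exact (((PG.qimI.1.continuousAt).div continuous_norm.continuousAt
      (norm_ne_zero_iff.2 hw)).pow _).mul h0.1.continuousAt

lemma integral_hump_mul_pow (m : ℕ) (u : ℍ[ℝ]) :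
    ∫ y : ℍ[ℝ], hump τ (y.im * u) * y.imI ^ (2 * m) ∂γℍ =
      imRatio m * ∫ y : ℍ[ℝ], humpA τ m u y.im ∂γℍ := by
  rw [← integral_norm_im_pow_mul (PG.humpA τ m u)]
  · refine integral_congr_ae (.of_forall fun y => ?_)
    beta_reduce
    rcases eq_or_ne y.im 0 with h | h
    · simp [h, humpA, hump_zero]
    · rw [humpA, Quaternion.imI_im, div_pow]
      field_simp [norm_ne_zero_iff.2 h]
  · intro t w
    rw [humpA, humpA, smul_mul_assoc, hump_smul]
    rcases eq_or_ne t 0 with rfl | ht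
    · simp
    · have : ((t • w).imI / ‖t • w‖) ^ (2 * m) = (w.imI / ‖w‖) ^ (2 * m) := by
        rw [Quaternion.imI_smul, norm_smul, smul_eq_mul, mul_div_mul_comm, mul_pow, Real.norm_eq_abs,
          div_pow t, (even_two_mul m).pow_abs, div_self (pow_ne_zero _ ht), one_mul]
      rw [this]; ring

lemma abs_mul_norm_sq_sub_le {w u : ℍ[ℝ]} (hw : w.re = 0) {x δ : ℝ} (hx0 : 0 ≤ x) (hx1 : x ≤ 1)
    (hu : u.imI ^ 2 = x * ‖u‖ ^ 2) (hδ0 : 0 ≤ δ) (hδ : δ ≤ 1) (h : ‖(w * u).im‖ < δ * |(w * u).re|) :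
    |(w.imI / ‖w‖) ^ 2 - x| ≤ 4 * δ := by
  set p := (w * u).re with hp
  set v := (w * u).im with hv
  have hp0 : 0 < |p| := pos_of_mul_pos_right ((norm_nonneg _).trans_lt h) hδ0
  have hw0 : 0 < ‖w‖ := norm_pos_iff.2 fun h0 => by
    rw [h0, zero_mul] at hp
    rw [hp] at hp0; simp at hp0
  have e1 : p ^ 2 + ‖v‖ ^ 2 = ‖w‖ ^ 2 * ‖u‖ ^ 2 := by
    rw [← mul_pow, ← norm_mul, hv, qim_norm_sq, qnorm_sq]; ring
  have e2 : ‖w‖ ^ 2 * u.imI = -(p * w.imI) - ⟪qI, w * v⟫ := by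
    have : ⟪qI, w * v⟫ = (w * v).imI := inner_qI _
    rw [this, hp, hv, qnorm_sq]
    simp [Quaternion.re_mul, Quaternion.imI_mul, Quaternion.imJ_mul, Quaternion.imK_mul, hw]
    ring
  set e := ⟪qI, w * v⟫ with he
  have he1 : |e| ≤ δ * |p| * ‖w‖ := by
    refine (abs_real_inner_le_norm _ _).trans ?_
    rw [norm_qI, one_mul, norm_mul, mul_comm]
    exact mul_le_mul_of_nonneg_right h.le hw0.le
  have hwi : |w.imI| ≤ ‖w‖ := by
    rw [← inner_qI]; simpa [norm_qI] using abs_real_inner_le_norm qI w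
  have e3 : p ^ 2 * (w.imI ^ 2 - x * ‖w‖ ^ 2) =
      -(2 * (p * w.imI) * e) - e ^ 2 + x * ‖w‖ ^ 2 * ‖v‖ ^ 2 := by
    have := congrArg (· ^ 2) e2
    beta_reduce at this
    rw [mul_pow, hu] at this
    linear_combination -this - x * ‖w‖ ^ 2 * e1
  have a1 : |2 * (p * w.imI) * e| ≤ 2 * (|p| * ‖w‖) * (δ * |p| * ‖w‖) := by
    rw [abs_mul, abs_mul, abs_mul, abs_two]
    gcongr
  have a2 : e ^ 2 ≤ (δ * |p| * ‖w‖) ^ 2 := sq_le_sq' (by linarith [neg_abs_le e]) ((le_abs_self e).trans he1)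
  have a3 : ‖v‖ ^ 2 ≤ (δ * |p|) ^ 2 := pow_le_pow_left₀ (norm_nonneg _) h.le 2
  have hδ2 : δ ^ 2 ≤ δ := by nlinarith
  have hpp : |p| ^ 2 = p ^ 2 := sq_abs p
  have a4 : 0 ≤ x * ‖w‖ ^ 2 * ‖v‖ ^ 2 := by positivity
  have hP : 0 ≤ p ^ 2 * ‖w‖ ^ 2 := by positivity
  have a5 : x * ‖w‖ ^ 2 * ‖v‖ ^ 2 ≤ δ * (p ^ 2 * ‖w‖ ^ 2) := by
    calc x * ‖w‖ ^ 2 * ‖v‖ ^ 2 ≤ 1 * ‖w‖ ^ 2 * (δ * |p|) ^ 2 := by gcongr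
      _ = δ ^ 2 * (p ^ 2 * ‖w‖ ^ 2) := by rw [mul_pow, hpp]; ring
      _ ≤ _ := mul_le_mul_of_nonneg_right hδ2 hP
  have a6 : (δ * |p| * ‖w‖) ^ 2 ≤ δ * (p ^ 2 * ‖w‖ ^ 2) := by
    calc (δ * |p| * ‖w‖) ^ 2 = δ ^ 2 * (p ^ 2 * ‖w‖ ^ 2) := by rw [mul_pow, mul_pow, hpp]; ring
      _ ≤ _ := mul_le_mul_of_nonneg_right hδ2 hP
  have a7 : 2 * (|p| * ‖w‖) * (δ * |p| * ‖w‖) = 2 * δ * (p ^ 2 * ‖w‖ ^ 2) := by rw [← hpp]; ring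
  have a8 : p ^ 2 * |w.imI ^ 2 - x * ‖w‖ ^ 2| ≤ p ^ 2 * (4 * δ * ‖w‖ ^ 2) := by
    rw [← abs_of_nonneg (sq_nonneg p), ← abs_mul, e3, abs_of_nonneg (sq_nonneg p), abs_le]
    have := abs_le.1 a1
    constructor <;> nlinarith [sq_nonneg e, mul_nonneg hδ0 hP]
  have a9 := le_of_mul_le_mul_left a8 (by rw [← hpp]; positivity)
  have : (w.imI / ‖w‖) ^ 2 - x = (w.imI ^ 2 - x * ‖w‖ ^ 2) / ‖w‖ ^ 2 := by field_simp
  rw [this, abs_div, abs_of_pos (pow_pos hw0 2), div_le_iff₀ (pow_pos hw0 2)]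
  exact a9

lemma abs_humpA_sub_le (h0 : 0 < τ 0) (h1 : τ 0 < τ 1) (h2 : τ 1 < τ 2) (h3 : τ 2 ≤ 1) {u : ℍ[ℝ]}
    {x : ℝ} (hx0 : 0 ≤ x) (hx1 : x ≤ 1) (hu : u.imI ^ 2 = x * ‖u‖ ^ 2) (m : ℕ) (y : ℍ[ℝ]) :
    |humpA τ m u y.im - x ^ m * hump τ (y.im * u)| ≤ 4 * τ 2 * m * hump τ (y.im * u) := by
  have hn := hump_nonneg h0 h1 h2 (y.im * u)
  have e : humpA τ m u y.im - x ^ m * hump τ (y.im * u) =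
      (((y.im.imI / ‖y.im‖) ^ 2) ^ m - x ^ m) * hump τ (y.im * u) := by
    rw [humpA, pow_mul]; ring
  rw [e, abs_mul, abs_of_nonneg hn]
  rcases lt_or_ge ‖(y.im * u).im‖ (τ 2 * |(y.im * u).re|) with h | h
  · refine mul_le_mul_of_nonneg_right ?_ hn
    have hz := sq_div_norm_le_one y.im
    have hm : max |(y.im.imI / ‖y.im‖) ^ 2| |x| ^ (m - 1) ≤ 1 :=
      pow_le_one₀ (le_max_of_le_left (abs_nonneg _)) (max_le (by rwa [abs_of_nonneg (sq_nonneg _)])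
        (by rwa [abs_of_nonneg hx0]))
    have hd := abs_mul_norm_sq_sub_le (Quaternion.re_im y) hx0 hx1 hu (by linarith) h3 h
    refine (abs_pow_sub_pow_le _ _ _).trans ?_
    refine (mul_le_of_le_one_right (by positivity) hm).trans ?_
    exact mul_le_mul_of_nonneg_right hd (Nat.cast_nonneg m)
  · rw [hump_eq_zero h0 h1 h2 h]; simp

end Factorization

section Determinant

variable {F : ℍ[ℝ] → ℝ} {τ σ : Fin 3 → ℝ}

lemma abs_inner_im_mul_star (q c y : ℍ[ℝ]) : |⟪(q * star c).im, y⟫| = |⟪y.im * q, c⟫| := by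
  rw [← abs_neg]
  congr 1
  rw [qinner, qinner]
  simp [Quaternion.re_mul, Quaternion.imI_mul, Quaternion.imJ_mul, Quaternion.imK_mul]
  ring

/-- The moments of the hump function transported by the map `cT s`. -/
def humpM (τ : Fin 3 → ℝ) (s : ℝ) (m : ℕ) (g : ℍ[ℝ]) : ℝ :=
  ∫ y : ℍ[ℝ], hump τ (y.im * (cT s g * qI)) * y.imI ^ (2 * m) ∂γℍ

lemma PG.hump_kernel (τ : Fin 3 → ℝ) (s : ℝ) : PG fun p : ℍ[ℝ] × ℍ[ℝ] =>
    _root_.hump τ (p.2.im * (_root_.cT s p.1 * qI)) := by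
  have h1 : PG fun p : ℍ[ℝ] × ℍ[ℝ] => p.2.im * (_root_.cT s p.1 * qI) :=
    (PG.qim.comp PG.snd).qmul (((PG.cT s).comp PG.fst).qmul (PG.const qI))
  exact (PG.hump τ).comp h1

lemma PG.hump_mul (τ : Fin 3 → ℝ) (u : ℍ[ℝ]) : PG fun y : ℍ[ℝ] => _root_.hump τ (y.im * u) := by
  have h1 : PG fun y : ℍ[ℝ] => y.im * u := PG.qim.qmul (PG.const _)
  exact (PG.hump τ).comp h1

lemma PG.humpM (τ : Fin 3 → ℝ) (s : ℝ) (m : ℕ) : PG (humpM τ s m) :=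
  PG.integral (f := fun p : ℍ[ℝ] × ℍ[ℝ] =>
    _root_.hump τ (p.2.im * (_root_.cT s p.1 * qI)) * p.2.imI ^ (2 * m))
    ((PG.hump_kernel τ s).mul ((PG.qimI.comp PG.snd).pow _)) (hm_of_isGaussian _)

lemma SegFun.hump_relation (h : SegFun F) {N : ℕ} {R : Polynomial ℝ}
    (hR : ∀ w : ℍ[ℝ], moll F N w = ∫ g : ℍ[ℝ], |⟪w.im, g⟫| * R.eval (g.imI ^ 2) ∂γℍ)
    (h0 : 0 < τ 0) (h1 : τ 0 < τ 1) (h2 : τ 1 < τ 2) (k0 : 0 < σ 0) (k1 : σ 0 < σ 1)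
    (k2 : σ 1 < σ 2) (hτσ : τ 2 * σ 2 ≤ 1) :
    ∑ j, humpC σ j * ∑ m ∈ Finset.range (R.natDegree + 1),
      R.coeff m * ∫ g, humpM τ (σ j) m g ∂γℍ = 0 := by
  have hG := hm_of_isGaussian (γℍ)
  have hRP : PG fun y : ℍ[ℝ] => R.eval (y.imI ^ 2) := (PG.poly R).comp (PG.qimI.pow 2)
  rw [← h.moll_relation N h0 h1 h2 k0 k1 k2 hτσ, Finset.sum_comm]
  refine Finset.sum_congr rfl fun j _ => ?_
  have e1 : ∀ i g', ∫ g, moll F N (cT (σ j) g' * qI * star (cT (τ i) g)) ∂γℍ =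
      ∫ y : ℍ[ℝ], hT (τ i) (y.im * (cT (σ j) g' * qI)) * R.eval (y.imI ^ 2) ∂γℍ :=
    fun i g' => by
    simp_rw [hR, abs_inner_im_mul_star, hT, ← integral_mul_const]
    refine PG.integral_swap (f := fun p : ℍ[ℝ] × ℍ[ℝ] =>
      |⟪p.2.im * (cT (σ j) g' * qI), cT (τ i) p.1⟫| * R.eval (p.2.imI ^ 2)) ?_ hG hG
    have a1 : PG fun p : ℍ[ℝ] × ℍ[ℝ] => p.2.im * (cT (σ j) g' * qI) :=
      (PG.qim.comp PG.snd).qmul (PG.const _)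
    exact (a1.inner ((PG.cT (τ i)).comp PG.fst)).abs.mul (hRP.comp PG.snd)
  have hi : ∀ i g', Integrable (fun y : ℍ[ℝ] => hT (τ i) (y.im * (cT (σ j) g' * qI)) *
      R.eval (y.imI ^ 2)) (γℍ) := fun i g' => by
    have a1 : PG fun y : ℍ[ℝ] => y.im * (cT (σ j) g' * qI) := PG.qim.qmul (PG.const _)
    exact (((PG.hT (τ i)).comp a1).mul hRP).integrable hG
  have hI : ∀ i, Integrable (fun g' => ∫ y : ℍ[ℝ], hT (τ i) (y.im * (cT (σ j) g' * qI)) *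
      R.eval (y.imI ^ 2) ∂γℍ) (γℍ) := fun i => by
    have a1 : PG fun p : ℍ[ℝ] × ℍ[ℝ] => p.2.im * (cT (σ j) p.1 * qI) :=
      (PG.qim.comp PG.snd).qmul (((PG.cT (σ j)).comp PG.fst).qmul (PG.const qI))
    exact (PG.integral (f := fun p : ℍ[ℝ] × ℍ[ℝ] => hT (τ i) (p.2.im * (cT (σ j) p.1 * qI)) *
      R.eval (p.2.imI ^ 2)) (((PG.hT (τ i)).comp a1).mul (hRP.comp PG.snd)) hG).integrable hG
  simp_rw [e1]
  have e2 : ∑ i, humpC τ i * humpC σ j * ∫ g', ∫ y : ℍ[ℝ], hT (τ i) (y.im * (cT (σ j) g' * qI)) *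
      R.eval (y.imI ^ 2) ∂γℍ ∂γℍ = humpC σ j * ∫ g', ∫ y : ℍ[ℝ],
      hump τ (y.im * (cT (σ j) g' * qI)) * R.eval (y.imI ^ 2) ∂γℍ ∂γℍ := by
    have e3 : ∀ g', ∫ y : ℍ[ℝ], hump τ (y.im * (cT (σ j) g' * qI)) * R.eval (y.imI ^ 2)
        ∂γℍ = ∑ i, humpC τ i * ∫ y : ℍ[ℝ], hT (τ i) (y.im * (cT (σ j) g' * qI)) *
          R.eval (y.imI ^ 2) ∂γℍ := fun g' => by
      simp_rw [hump, Finset.sum_mul, mul_assoc]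
      rw [integral_finsetSum _ fun i _ => (hi i g').const_mul _]
      simp_rw [integral_const_mul]
    simp_rw [e3]
    rw [integral_finsetSum _ fun i _ => (hI i).const_mul _, Finset.mul_sum]
    simp_rw [integral_const_mul]
    exact Finset.sum_congr rfl fun i _ => by ring
  rw [e2]
  congr 1
  have e4 : ∀ g', ∫ y : ℍ[ℝ], hump τ (y.im * (cT (σ j) g' * qI)) * R.eval (y.imI ^ 2)
      ∂γℍ = ∑ m ∈ Finset.range (R.natDegree + 1), R.coeff m * humpM τ (σ j) m g' :=
    fun g' => by
    have a1 := PG.hump_mul τ (cT (σ j) g' * qI)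
    simp_rw [humpM, ← integral_const_mul]
    rw [← integral_finsetSum _ fun m _ =>
      ((a1.mul (PG.qimI.pow (2 * m))).integrable hG).const_mul _]
    refine integral_congr_ae (.of_forall fun y => ?_)
    beta_reduce
    rw [Polynomial.eval_eq_sum_range, Finset.mul_sum]
    refine Finset.sum_congr rfl fun m _ => ?_
    rw [pow_mul]; ring
  simp_rw [e4]
  rw [integral_finsetSum _ fun m _ => ((PG.humpM τ (σ j) m).integrable hG).const_mul _]
  simp_rw [integral_const_mul]

/-- The squared height selected by the parameter `s`. -/
def ht (s : ℝ) : ℝ := s ^ 2 / (1 + s ^ 2)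

lemma ht_nonneg (s : ℝ) : 0 ≤ ht s := by unfold ht; positivity
lemma ht_le_one (s : ℝ) : ht s ≤ 1 := div_le_one_of_le₀ (by linarith) (by positivity)

lemma cT_mul_qI_sq (s : ℝ) (g : ℍ[ℝ]) : (cT s g * qI).imI ^ 2 = ht s * ‖cT s g * qI‖ ^ 2 := by
  have e1 : (cT s g * qI).imI = s * ‖g‖ ^ 2 := by
    rw [← cT_re]; simp [Quaternion.imI_mul]
  have e2 : ‖cT s g * qI‖ = ‖g‖ * ‖qmk s 1 0 0‖ * ‖g‖ := by
    rw [norm_mul, norm_qI, mul_one, cT, norm_mul, norm_mul, norm_star]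
  have e3 : ‖qmk s 1 0 0‖ ^ 2 = 1 + s ^ 2 := by rw [qnorm_sq]; simp; ring
  have : (1 + s ^ 2) ≠ 0 := by positivity
  rw [e1, e2, mul_pow, mul_pow, mul_pow, e3, ht]
  field_simp

lemma humpM_zero (s : ℝ) (g : ℍ[ℝ]) :
    humpM τ s 0 g = ∫ y : ℍ[ℝ], hump τ (y.im * (cT s g * qI)) ∂γℍ := by
  simp [humpM]

lemma abs_humpM_sub_le (h0 : 0 < τ 0) (h1 : τ 0 < τ 1) (h2 : τ 1 < τ 2) (h3 : τ 2 ≤ 1) (s : ℝ)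
    (m : ℕ) (g : ℍ[ℝ]) : |humpM τ s m g - imRatio m * ht s ^ m * humpM τ s 0 g| ≤
      imRatio m * (4 * τ 2 * m) * humpM τ s 0 g := by
  have hG := hm_of_isGaussian (γℍ)
  have a1 := PG.hump_mul τ (cT s g * qI)
  rw [humpM_zero, humpM, integral_hump_mul_pow, mul_assoc (imRatio m), mul_assoc (imRatio m),
    ← mul_sub, abs_mul, abs_of_pos (imRatio_pos m)]
  refine mul_le_mul_of_nonneg_left ?_ (imRatio_pos m).le
  rw [← integral_const_mul, ← integral_const_mul, ← integral_sub
    (((PG.humpA τ m _).comp PG.qim).integrable hG) ((a1.integrable hG).const_mul _),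
    ← Real.norm_eq_abs]
  refine norm_integral_le_of_norm_le ((a1.integrable hG).const_mul _) (.of_forall fun y => ?_)
  exact abs_humpA_sub_le h0 h1 h2 h3 (ht_nonneg s) (ht_le_one s) (cT_mul_qI_sq s g) m y

lemma abs_integral_humpM_sub_le (h0 : 0 < τ 0) (h1 : τ 0 < τ 1) (h2 : τ 1 < τ 2) (h3 : τ 2 ≤ 1)
    (s : ℝ) (m : ℕ) : |(∫ g, humpM τ s m g ∂γℍ) -
      imRatio m * ht s ^ m * ∫ g, humpM τ s 0 g ∂γℍ| ≤
      imRatio m * (4 * τ 2 * m) * ∫ g, humpM τ s 0 g ∂γℍ := by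
  have hi := fun m => (PG.humpM τ s m).integrable (hm_of_isGaussian (γℍ))
  rw [← integral_const_mul, ← integral_const_mul, ← integral_sub (hi m) ((hi 0).const_mul _),
    ← Real.norm_eq_abs]
  exact norm_integral_le_of_norm_le ((hi 0).const_mul _) (.of_forall fun g =>
    abs_humpM_sub_le h0 h1 h2 h3 s m g)

lemma integral_humpM_zero_pos (h0 : 0 < τ 0) (h1 : τ 0 < τ 1) (h2 : τ 1 < τ 2) (s : ℝ) :
    0 < ∫ g, humpM τ s 0 g ∂γℍ := by
  refine (PG.humpM τ s 0).integral_stdGaussian_pos (fun g => ?_) (x := qmk 1 0 0 1) ?_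
  · rw [humpM_zero]
    exact integral_nonneg fun y => hump_nonneg h0 h1 h2 _
  · rw [humpM_zero]
    have a1 := PG.hump_mul τ (cT s (qmk 1 0 0 1) * qI)
    refine (a1.integral_stdGaussian_pos (fun y => hump_nonneg h0 h1 h2 _)
      (x := qmk 0 (-(2 * s)) 0 2) ?_).ne'
    have e : (qmk 0 (-(2 * s)) 0 2).im * (cT s (qmk 1 0 0 1) * qI) =
        (4 * s ^ 2 + 4) • (1 : ℍ[ℝ]) := by
      ext <;> simp [cT, Quaternion.re_mul, Quaternion.imI_mul, Quaternion.imJ_mul,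
        Quaternion.imK_mul] <;> ring
    rw [e, hump_smul]
    have := hump_one_pos h0 h1 h2
    positivity

/-- The polynomial whose coefficients are rescaled by `imRatio`. -/
def scaleP (R : Polynomial ℝ) : Polynomial ℝ :=
  ∑ m ∈ Finset.range (R.natDegree + 1), Polynomial.monomial m (R.coeff m * imRatio m)

lemma coeff_scaleP (R : Polynomial ℝ) (m : ℕ) : (scaleP R).coeff m = R.coeff m * imRatio m := by
  simp only [scaleP, Polynomial.finsetSum_coeff, Polynomial.coeff_monomial]
  rw [Finset.sum_ite_eq' (Finset.range (R.natDegree + 1)) m fun m => R.coeff m * imRatio m]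
  split_ifs with h
  · rfl
  · rw [Polynomial.coeff_eq_zero_of_natDegree_lt, zero_mul]
    simpa [Nat.lt_succ_iff] using h

lemma SegFun.abs_sum_le (h : SegFun F) {N : ℕ} {R : Polynomial ℝ}
    (hR : ∀ w : ℍ[ℝ], moll F N w = ∫ g : ℍ[ℝ], |⟪w.im, g⟫| * R.eval (g.imI ^ 2) ∂γℍ)
    (k0 : 0 < σ 0) (k1 : σ 0 < σ 1) (k2 : σ 1 < σ 2) (h0 : 0 < τ 0) (h1 : τ 0 < τ 1)
    (h2 : τ 1 < τ 2) (h3 : τ 2 ≤ 1) (hτσ : τ 2 * σ 2 ≤ 1) :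
    |∑ j, humpC σ j * (∫ g, humpM τ (σ j) 0 g ∂γℍ) * (scaleP R).eval (ht (σ j))| ≤
      τ 2 * (∑ m ∈ Finset.range (R.natDegree + 1), |R.coeff m| * (imRatio m * (4 * m))) *
        ∑ j, |humpC σ j * ∫ g, humpM τ (σ j) 0 g ∂γℍ| := by
  have hr := h.hump_relation hR h0 h1 h2 k0 k1 k2 hτσ
  rw [← sub_zero (∑ j, humpC σ j * (∫ g, humpM τ (σ j) 0 g ∂γℍ) * _), ← hr,
    ← Finset.sum_sub_distrib, Finset.mul_sum]
  refine (Finset.abs_sum_le_sum_abs _ _).trans (Finset.sum_le_sum fun j _ => ?_)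
  have hp := integral_humpM_zero_pos h0 h1 h2 (σ j)
  set ω := ∫ g, humpM τ (σ j) 0 g ∂γℍ with hω
  have e : humpC σ j * ω * (scaleP R).eval (ht (σ j)) - humpC σ j *
      ∑ m ∈ Finset.range (R.natDegree + 1), R.coeff m * ∫ g, humpM τ (σ j) m g ∂γℍ
      = humpC σ j * ∑ m ∈ Finset.range (R.natDegree + 1), R.coeff m *
        (imRatio m * ht (σ j) ^ m * ω - ∫ g, humpM τ (σ j) m g ∂γℍ) := by
    rw [mul_assoc, ← mul_sub, scaleP, Polynomial.eval_finsetSum, Finset.mul_sum,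
      ← Finset.sum_sub_distrib]
    congr 1
    refine Finset.sum_congr rfl fun m _ => ?_
    rw [Polynomial.eval_monomial]; ring
  rw [e, abs_mul, abs_mul, abs_of_pos hp]
  have : |∑ m ∈ Finset.range (R.natDegree + 1), R.coeff m * (imRatio m * ht (σ j) ^ m * ω -
      ∫ g, humpM τ (σ j) m g ∂γℍ)| ≤ τ 2 * (∑ m ∈ Finset.range (R.natDegree + 1),
        |R.coeff m| * (imRatio m * (4 * m))) * ω := by
    refine (Finset.abs_sum_le_sum_abs _ _).trans ?_
    rw [Finset.mul_sum, Finset.sum_mul]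
    refine Finset.sum_le_sum fun m _ => ?_
    rw [abs_mul, abs_sub_comm]
    refine (mul_le_mul_of_nonneg_left (abs_integral_humpM_sub_le h0 h1 h2 h3 (σ j) m)
      (abs_nonneg _)).trans (le_of_eq ?_)
    rw [← hω]; ring
  refine (mul_le_mul_of_nonneg_left this (abs_nonneg _)).trans (le_of_eq ?_)
  ring

lemma det_le_of_approx {ι : Type*} [Fintype ι] [DecidableEq ι] (A : Matrix ι ι ℝ) {K : ℝ} :
    ∃ C, ∀ (v : ι → ℝ) (δ : ℝ), 0 ≤ δ → 0 < ∑ j, |v j| →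
      (∀ a, |∑ j, v j * A a j| ≤ δ * K * ∑ j, |v j|) → |A.det| ≤ C * δ := by
  refine ⟨∑ i, ∑ a, |A.adjugate i a| * K, fun v δ _ hv h => ?_⟩
  have e : A.adjugate.mulVec (A.mulVec v) = A.det • v := by
    rw [Matrix.mulVec_mulVec, Matrix.adjugate_mul, Matrix.smul_mulVec, Matrix.one_mulVec]
  refine le_of_mul_le_mul_right (a := ∑ j, |v j|) ?_ hv
  calc |A.det| * ∑ j, |v j| = ∑ i, |(A.det • v) i| := by
        rw [Finset.mul_sum]; simp [abs_mul]
    _ ≤ ∑ i, ∑ a, |A.adjugate i a| * K * (δ * ∑ j, |v j|) := by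
        refine Finset.sum_le_sum fun i _ => ?_
        rw [← e]
        refine (Finset.abs_sum_le_sum_abs _ _).trans (Finset.sum_le_sum fun a _ => ?_)
        rw [abs_mul, mul_assoc]
        refine mul_le_mul_of_nonneg_left ?_ (abs_nonneg _)
        have := h a
        simp only [Matrix.mulVec, dotProduct]
        simp_rw [mul_comm (A a _)]
        linarith
    _ = _ := by simp_rw [← Finset.sum_mul, mul_assoc]

variable {Fs : Fin 3 → ℍ[ℝ] → ℝ}

lemma det_scaleP_eq_zero_of_lt (h : ∀ a, SegFun (Fs a)) {N : ℕ} {R : Fin 3 → Polynomial ℝ}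
    (hR : ∀ a, ∀ w : ℍ[ℝ], moll (Fs a) N w =
      ∫ g : ℍ[ℝ], |⟪w.im, g⟫| * (R a).eval (g.imI ^ 2) ∂γℍ)
    (k0 : 0 < σ 0) (k1 : σ 0 < σ 1) (k2 : σ 1 < σ 2) :
    (Matrix.of fun a j => (scaleP (R a)).eval (ht (σ j))).det = 0 := by
  set K : Fin 3 → ℝ := fun a => ∑ m ∈ Finset.range ((R a).natDegree + 1),
    |(R a).coeff m| * (imRatio m * (4 * m)) with hK
  have hK0 : ∀ a, 0 ≤ K a := fun a => Finset.sum_nonneg fun m _ => by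
    have := imRatio_pos m; positivity
  obtain ⟨C, hC⟩ := det_le_of_approx (Matrix.of fun a j => (scaleP (R a)).eval (ht (σ j)))
    (K := ∑ a, K a)
  have hle : ∀ δ, 0 < δ → δ ≤ 1 → δ * σ 2 ≤ 1 →
      |(Matrix.of fun a j => (scaleP (R a)).eval (ht (σ j))).det| ≤ C * δ := fun δ d0 d1 d2 => by
    set τ : Fin 3 → ℝ := ![δ / 3, δ / 2, δ] with hτ
    have t0 : 0 < τ 0 := by simp [hτ]; positivity
    have t1 : τ 0 < τ 1 := by simp [hτ]; linarith
    have t2 : τ 1 < τ 2 := by simp [hτ]; linarith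
    have t3 : τ 2 = δ := by simp [hτ]
    refine hC (fun j => humpC σ j * ∫ g, humpM τ (σ j) 0 g ∂γℍ) δ d0.le ?_ fun a => ?_
    · refine Finset.sum_pos' (fun j _ => abs_nonneg _) ⟨0, Finset.mem_univ _, abs_pos.2 ?_⟩
      refine mul_ne_zero ?_ (integral_humpM_zero_pos t0 t1 t2 _).ne'
      have : humpC σ 0 = σ 1 ^ 2 - σ 2 ^ 2 := rfl
      rw [this]
      nlinarith
    · refine ((h a).abs_sum_le (hR a) k0 k1 k2 t0 t1 t2 (t3.trans_le d1) (by rwa [t3])).trans ?_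
      rw [t3]
      refine mul_le_mul_of_nonneg_right (mul_le_mul_of_nonneg_left ?_ d0.le)
        (Finset.sum_nonneg fun j _ => abs_nonneg _)
      exact Finset.single_le_sum (f := K) (fun a _ => hK0 a) (Finset.mem_univ a)
  refine abs_nonpos_iff.1 ?_
  have ht : Tendsto (fun δ : ℝ => C * δ) (𝓝[>] 0) (𝓝 (C * 0)) :=
    ((continuous_const_mul C).tendsto 0).mono_left nhdsWithin_le_nhds
  rw [mul_zero] at ht
  refine ge_of_tendsto ht ?_
  have hs2 : 0 < σ 2 := by linarith
  filter_upwards [Ioo_mem_nhdsGT (show (0 : ℝ) < min 1 (1 / σ 2) by positivity)] with δ hδ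
  have := lt_min_iff.1 hδ.2
  exact hle δ hδ.1 this.1.le ((lt_div_iff₀ hs2).1 this.2).le

lemma det_scaleP_eq_zero (h : ∀ a, SegFun (Fs a)) {N : ℕ} {R : Fin 3 → Polynomial ℝ}
    (hR : ∀ a, ∀ w : ℍ[ℝ], moll (Fs a) N w =
      ∫ g : ℍ[ℝ], |⟪w.im, g⟫| * (R a).eval (g.imI ^ 2) ∂γℍ)
    (hσ : ∀ j, 0 < σ j) : (Matrix.of fun a j => (scaleP (R a)).eval (ht (σ j))).det = 0 := by
  by_cases hi : Function.Injective σ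
  · have hm : StrictMono (σ ∘ Tuple.sort σ) :=
      (Tuple.monotone_sort σ).strictMono_of_injective (hi.comp (Tuple.sort σ).injective)
    have h1 := det_scaleP_eq_zero_of_lt h hR (σ := σ ∘ Tuple.sort σ) (hσ _)
      (hm (by decide)) (hm (by decide))
    have h2 := Matrix.det_permute' (Tuple.sort σ)
      (Matrix.of fun a j => (scaleP (R a)).eval (ht (σ j)))
    have h3 : ((Matrix.of fun a j => (scaleP (R a)).eval (ht (σ j))).submatrix id (Tuple.sort σ)).det
      = 0 := h1
    rw [h3] at h2
    rcases mul_eq_zero.1 h2.symm with h4 | h4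
    · rcases Int.units_eq_one_or (Equiv.Perm.sign (Tuple.sort σ)) with h5 | h5 <;>
        simp [h5] at h4
    · exact h4
  · simp only [Function.Injective, not_forall] at hi
    obtain ⟨i, j, hij, hne⟩ := hi
    exact Matrix.det_zero_of_column_eq hne fun a => by simp [hij]

lemma exists_det_ne_zero {X ι : Type*} [Fintype ι] [DecidableEq ι] (f : ι → X → ℝ)
    (h : ∀ c : ι → ℝ, (∀ x, ∑ a, c a * f a x = 0) → c = 0) :
    ∃ x : ι → X, (Matrix.of fun a b => f a (x b)).det ≠ 0 := by
  set v : X → ι → ℝ := fun x a => f a x with hv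
  have hs : Submodule.span ℝ (Set.range v) = ⊤ := by
    by_contra hne
    obtain ⟨φ, hφ, hle⟩ := Submodule.exists_le_ker_of_lt_top _ (lt_top_iff_ne_top.2 hne)
    refine hφ (LinearMap.pi_ext' fun a => LinearMap.ext_ring ?_)
    have hc := h (fun a => φ (Pi.single a 1)) fun x => by
      have h1 : φ (v x) = 0 := hle (Submodule.subset_span ⟨x, rfl⟩)
      rw [LinearMap.pi_apply_eq_sum_univ φ] at h1
      rw [← h1]
      refine Finset.sum_congr rfl fun a _ => ?_
      rw [smul_eq_mul, mul_comm]
      congr 2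
      ext b; simp [Pi.single_apply, eq_comm]
    simpa using congrFun hc a
  obtain ⟨b, hb, hsp, hli⟩ := exists_linearIndependent ℝ (Set.range v)
  rw [hs] at hsp
  let B := Module.Basis.mk hli (by rw [Subtype.range_coe, hsp])
  have : Fintype b := FiniteDimensional.fintypeBasisIndex B
  have e : ι ≃ b := Fintype.equivOfCardEq (by
    rw [← Module.finrank_eq_card_basis B, Module.finrank_fintype_fun_eq_card])
  choose x hx using fun i => hb (e i).2
  refine ⟨x, ?_⟩
  have hl : LinearIndependent ℝ fun i => v (x i) := by
    simp_rw [hx]; exact hli.comp e e.injective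
  have h1 := (Matrix.linearIndependent_rows_iff_isUnit (A := Matrix.of fun i => v (x i))).1 hl
  rw [Matrix.isUnit_iff_isUnit_det, ← Matrix.det_transpose] at h1
  exact h1.ne_zero

/-- Functions satisfying the relation span a space of dimension at most two. -/
theorem SegFun.det_eq_zero (h : ∀ a, SegFun (Fs a)) (w : Fin 3 → ℍ[ℝ]) :
    (Matrix.of fun a b => Fs a (w b)).det = 0 := by
  have hN : ∀ N, (Matrix.of fun a b => moll (Fs a) N (w b) / reMoment (N + 1)).det = 0 := fun N => by
    by_contra hne
    choose R hR using fun a => (h a).exists_cos_rep N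
    obtain ⟨x, hx⟩ := exists_det_ne_zero
      (fun a (s : Set.Ioi (0 : ℝ)) => (scaleP (R a)).eval (ht s)) fun c hc => by
      have hp : ∑ a, Polynomial.C (c a) * scaleP (R a) = 0 := by
        refine Polynomial.eq_zero_of_infinite_isRoot _ (Set.Infinite.mono
          (s := (fun s : ℝ => ht s) '' Set.Ioi 0) ?_ ((Set.Ioi_infinite 0).image ?_))
        · rintro _ ⟨s, hs, rfl⟩
          change Polynomial.eval _ _ = 0
          rw [Polynomial.eval_finsetSum, ← hc ⟨s, hs⟩]
          simp
        · intro s hs t ht' hst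
          have hs' : (0 : ℝ) < s := hs
          have ht'' : (0 : ℝ) < t := ht'
          simp only [ht] at hst
          rw [div_eq_div_iff (by positivity) (by positivity)] at hst
          exact (pow_left_inj₀ hs'.le ht''.le two_ne_zero).1 (by linarith)
      have hp' : ∑ a, Polynomial.C (c a) * R a = 0 := by
        ext m
        have := congrArg (fun p => Polynomial.coeff p m) hp
        simp only [Polynomial.finsetSum_coeff, Polynomial.coeff_C_mul, coeff_scaleP,
          Polynomial.coeff_zero, ← mul_assoc, ← Finset.sum_mul] at this ⊢
        exact (mul_eq_zero.1 this).resolve_right (imRatio_pos m).ne'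
      have hm : ∀ v, ∑ a, c a * moll (Fs a) N v = 0 := fun v => by
        simp_rw [hR, ← integral_const_mul]
        rw [← integral_finsetSum _ fun a _ => Integrable.const_mul
          ((((PG.const v.im).inner PG.id).abs.mul ((PG.poly (R a)).comp
            (PG.qimI.pow 2))).integrable (hm_of_isGaussian _)) _]
        · refine (integral_congr_ae (.of_forall fun g => ?_)).trans (integral_zero _ _)
          have := congrArg (Polynomial.eval (g.imI ^ 2)) hp'
          simp only [Polynomial.eval_finsetSum, Polynomial.eval_mul, Polynomial.eval_C,
            Polynomial.eval_zero] at this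
          calc ∑ a, c a * (|⟪v.im, g⟫| * (R a).eval (g.imI ^ 2))
              = |⟪v.im, g⟫| * ∑ a, c a * (R a).eval (g.imI ^ 2) := by
                rw [Finset.mul_sum]; exact Finset.sum_congr rfl fun a _ => by ring
            _ = 0 := by rw [this, mul_zero]
      refine Matrix.eq_zero_of_vecMul_eq_zero hne (funext fun b => ?_)
      simp only [Matrix.vecMul, dotProduct, Matrix.of_apply, Pi.zero_apply, ← mul_div_assoc,
        ← Finset.sum_div, hm, zero_div]
    exact hx (det_scaleP_eq_zero h hR (σ := fun j => (x j : ℝ)) fun j => (x j).2)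
  have ht : Tendsto (fun N => (Matrix.of fun a b => moll (Fs a) N (w b) / reMoment (N + 1)).det)
      atTop (𝓝 (Matrix.of fun a b => Fs a (w b)).det) := by
    simp only [Matrix.det_apply]
    refine tendsto_finsetSum _ fun π _ => Tendsto.const_smul ?_ _
    exact tendsto_finsetProd _ fun b _ => (h _).tendsto_moll _
  simp only [hN] at ht
  exact tendsto_nhds_unique ht tendsto_const_nhds

end Determinant

section Models

variable {n k : ℕ}

lemma re_inner_eq (u v : Ecl n) : ⟪u, v⟫ = (inner ℂ u v).re := by
  simp only [PiLp.inner_apply, Complex.re_sum]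
  rfl

lemma inner_I_smul_left (u v : Ecl n) : ⟪Complex.I • u, v⟫ = (inner ℂ u v).im := by
  rw [re_inner_eq, inner_smul_left]; simp

lemma inner_eq_zero_of_real {u v : Ecl n} (h : ⟪u, v⟫ = 0) (h' : ⟪Complex.I • u, v⟫ = 0) :
    inner ℂ u v = 0 :=
  Complex.ext ((re_inner_eq u v).symm.trans h) ((inner_I_smul_left u v).symm.trans h')

/-- Invariance under the complex linear isometries. -/
def CInv (μ : ConvexBody (Ecl n) → ℝ) : Prop := ∀ A : Ecl n ≃ₗᵢ[ℝ] Ecl n,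
  (∀ z, A (Complex.I • z) = Complex.I • A z) → ∀ K, μ (mapB (A : Ecl n →L[ℝ] Ecl n) K) = μ K

lemma mapB_parL {V W : Type*} [NormedAddCommGroup V] [NormedSpace ℝ V] [NormedAddCommGroup W]
    [NormedSpace ℝ W] (A : V →L[ℝ] W) (l : List V) : mapB A (parL l) = parL (l.map A) := by
  induction l with
  | nil => exact mapB_zero A
  | cons v l ih => rw [parL, mapB_add, ih, mapB_segB]; rfl

lemma DL_mapB {V W : Type*} [NormedAddCommGroup V] [NormedSpace ℝ V] [NormedAddCommGroup W]
    [NormedSpace ℝ W] (A : V →L[ℝ] W) (μ : ConvexBody W → ℝ) (l : List V) :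
    DL l (fun K => μ (mapB A K)) = fun K => DL (l.map A) μ (mapB A K) := by
  induction l generalizing μ with
  | nil => rfl
  | cons v l ih => rw [DL, Dv_mapB, ih]; rfl

/-- Invariant valuations with prescribed values on the standard frames. -/
theorem exists_model (n k : ℕ) (hk : k ≤ 2 * n) : ∃ I : ℕ → ℝ, (∀ j, 0 < I j) ∧ ∀ b : ℝ, |b| < 1 →
    ∃ μ : ConvexBody (Ecl n) → ℝ, Good μ ∧ Homog k μ ∧ CInv μ ∧ ∀ j l, j + l ≤ n → 2 * j + l = k →
      μ (parL (frameL (stdA n j) (stdB n j l))) = (1 + b ^ 2) ^ j * I j := by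
  have h : ∀ j, ∃ I : ℝ, 0 < I ∧ ∀ l, j + l ≤ n → 2 * j + l = k → ∀ b : ℝ, |b| < 1 →
      Tendsto (fun t : ℝ => (t ^ k)⁻¹ * tube (mulI n b) (t • parL (frameL (stdA n j) (stdB n j l))))
        atTop (𝓝 ((1 + b ^ 2) ^ j * I)) := fun j => by
    by_cases hj : j + (k - 2 * j) ≤ n ∧ 2 * j + (k - 2 * j) = k
    · obtain ⟨I, hI, h⟩ := tendsto_tube_stdFrame hj.1 hj.2
      refine ⟨I, hI, fun l h1 h2 => ?_⟩
      obtain rfl : l = k - 2 * j := by omega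
      exact h
    · exact ⟨1, one_pos, fun l h1 h2 => absurd ⟨by omega, by omega⟩ hj⟩
  choose I hI h using h
  refine ⟨I, hI, fun b hb => ?_⟩
  have hT := norm_mulI_lt (n := n) hb
  have hf : k ≤ Module.finrank ℝ (Ecl n) := by
    rw [finrank_real_of_complex, finrank_euclideanSpace_fin]; exact hk
  obtain ⟨μ, h1, -, h3, h4, h5⟩ := (good_tube hT).exists_homog_part (evenVal_tube hT) hf
  refine ⟨μ, h1, h3, fun A hA => h5 _ (tube_mapB hT A fun z => ?_), fun j l hn h2 =>
    h4 _ _ (h j l hn h2 b hb)⟩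
  rw [mulI_apply, mulI_apply, map_smul, hA]

/-- The isometric embedding of the quaternions given by two vectors. -/
def embQ {x z : Ecl n} (hx : inner ℂ x x = 1) (hz : inner ℂ z z = 1) (hxz : inner ℂ x z = 0) :
    ℍ[ℝ] →ₗᵢ[ℝ] Ecl n where
  toFun g := qz1 g • x + qz2 g • z
  map_add' g h := by simp only [map_add, add_smul]; abel
  map_smul' r g := by simp only [map_smul, smul_add, smul_assoc, RingHom.id_apply]
  norm_map' g := by
    refine (sq_eq_sq₀ (norm_nonneg _) (norm_nonneg _)).1 ?_
    have hzx : inner ℂ z x = 0 := by rw [← inner_conj_symm, hxz, map_zero]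
    rw [qnorm_sq, ← real_inner_self_eq_norm_sq, re_inner_eq]
    change (inner ℂ (qz1 g • x + qz2 g • z) (qz1 g • x + qz2 g • z)).re = _
    simp only [inner_add_left, inner_add_right, inner_smul_left, inner_smul_right, hx, hz, hxz, hzx]
    simp
    ring

section Extension

variable (e : ℍ[ℝ] →ₗᵢ[ℝ] Ecl n) (he : ∀ g, e (qI * g) = Complex.I • e g)

include he in
lemma exists_isometry_extension (R : ℍ[ℝ] ≃ₗᵢ[ℝ] ℍ[ℝ]) (hR : ∀ g, R (qI * g) = qI * R g) :
    ∃ A : Ecl n ≃ₗᵢ[ℝ] Ecl n, (∀ z, A (Complex.I • z) = Complex.I • A z) ∧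
      (∀ g, A (e g) = e (R g)) ∧ ∀ w, (∀ g, ⟪w, e g⟫ = 0) → A w = w := by
  set κ := e.toContinuousLinearMap.adjoint with hκ
  have h1 : ∀ w g, ⟪κ w, g⟫ = ⟪w, e g⟫ := fun w g =>
    ContinuousLinearMap.adjoint_inner_left e.toContinuousLinearMap g w
  have h2 : ∀ z, κ (Complex.I • z) = qI * κ z := fun z => by
    refine ext_inner_right ℝ fun g => ?_
    have h3 : ⟪Complex.I • z, Complex.I • e (star qI * g)⟫ = ⟪z, e (star qI * g)⟫ := by
      rw [re_inner_eq, re_inner_eq, inner_smul_left, inner_smul_right]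
      simp [← mul_assoc]
    have h4 : e g = Complex.I • e (star qI * g) := by
      rw [← he, ← mul_assoc, qself_mul_star, norm_qI]; simp
    rw [h1, h4, h3, ← h1]
    simp [qinner, Quaternion.re_mul, Quaternion.imI_mul, Quaternion.imJ_mul, Quaternion.imK_mul]
    ring
  let L : Ecl n →ₗ[ℝ] Ecl n := LinearMap.id +
    e.toLinearMap ∘ₗ ((R : ℍ[ℝ] →ₗ[ℝ] ℍ[ℝ]) - LinearMap.id) ∘ₗ (κ : Ecl n →ₗ[ℝ] ℍ[ℝ])
  have hL : ∀ w, L w = w + e (R (κ w) - κ w) := fun _ => rfl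
  let A : Ecl n →ₗᵢ[ℝ] Ecl n := ⟨L, fun w => by
    refine (sq_eq_sq₀ (norm_nonneg _) (norm_nonneg _)).1 ?_
    rw [hL, norm_add_sq_real, ← h1, e.norm_map, norm_sub_sq_real, inner_sub_right, R.norm_map,
      real_inner_self_eq_norm_sq, real_inner_comm (κ w)]
    ring⟩
  refine ⟨A.toLinearIsometryEquiv rfl, fun z => ?_, fun g => ?_, fun w hw => ?_⟩
  · change L _ = _ • L _
    rw [hL, hL, h2, hR, ← mul_sub, he, smul_add]
  · change L _ = _
    have : κ (e g) = g := ext_inner_right ℝ fun g' => by rw [h1, e.inner_map_map]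
    rw [hL, this, map_sub, add_sub_cancel]
  · change L _ = _
    have : κ w = 0 := ext_inner_right ℝ fun g => by rw [h1, hw, inner_zero_left]
    rw [hL, this]; simp

include he in
lemma UTwo.of_pullback {μ : ConvexBody (Ecl n) → ℝ} (hμ : Good μ) (hc : CInv μ) (l : List (Ecl n))
    (h : Homog (2 + l.length) μ) (hl : ∀ w ∈ l, ∀ g, ⟪w, e g⟫ = 0) :
    UTwo fun K => DL l μ (mapB e.toContinuousLinearMap K) := by
  have key : ∀ R : ℍ[ℝ] ≃ₗᵢ[ℝ] ℍ[ℝ], (∀ g, R (qI * g) = qI * R g) → ∀ K,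
      DL l μ (mapB e.toContinuousLinearMap (mapB (R : ℍ[ℝ] →L[ℝ] ℍ[ℝ]) K)) =
        DL l μ (mapB e.toContinuousLinearMap K) := fun R hR K => by
    obtain ⟨A, hA, hAe, hAw⟩ := exists_isometry_extension e he R hR
    have h1 : (fun K => μ (mapB (A : Ecl n →L[ℝ] Ecl n) K)) = μ := funext (hc A hA)
    have h2 := DL_mapB (A : Ecl n →L[ℝ] Ecl n) μ l
    rw [h1, show l.map (A : Ecl n →L[ℝ] Ecl n) = l from
      (List.map_congr_left fun w hw => hAw w (hl w hw)).trans (List.map_id l)] at h2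
    rw [congrFun h2 (mapB e.toContinuousLinearMap K), mapB_mapB, mapB_mapB]
    congr 2
    ext1 g
    exact (hAe g).symm
  refine ⟨(hμ.DL l).comp_mapB _ e.injective, (h.DL hμ l).comp_mapB _, fun hq K => key _ ?_ K,
    fun {z} hz h1 h2 K => key _ ?_ K⟩
  · intro g; rw [rmulE_apply, rmulE_apply, mul_assoc]
  · intro g
    rw [lmulE_apply, lmulE_apply, ← mul_assoc, ← mul_assoc]
    congr 1
    ext <;> simp [Quaternion.re_mul, Quaternion.imI_mul, Quaternion.imJ_mul, Quaternion.imK_mul,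
      h1, h2]

lemma segF_pullback {μ : ConvexBody (Ecl n) → ℝ} (hμ : Good μ) (l : List (Ecl n))
    (h : Homog (2 + l.length) μ) (g : ℍ[ℝ]) :
    segF (fun K => DL l μ (mapB e.toContinuousLinearMap K)) g = μ (parL (e 1 :: e g :: l)) := by
  have h1 : (e 1 :: e g :: l).Perm (l ++ [e g, e 1]) :=
    ((List.Perm.swap _ _ _).trans (List.perm_append_comm (l₁ := [e g, e 1])))
  rw [parL_perm h1, Homog.parL_eq_DL hμ _ (by simpa [add_comm] using h), DL_append, segF, Dv_mapB,
    Dv_mapB]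
  beta_reduce
  rw [mapB_zero]
  rfl

end Extension

lemma embQ_apply {x z : Ecl n} (hx : inner ℂ x x = 1) (hz : inner ℂ z z = 1)
    (hxz : inner ℂ x z = 0) (g : ℍ[ℝ]) : embQ hx hz hxz g = qz1 g • x + qz2 g • z := rfl

lemma embQ_qI_mul {x z : Ecl n} (hx : inner ℂ x x = 1) (hz : inner ℂ z z = 1)
    (hxz : inner ℂ x z = 0) (g : ℍ[ℝ]) :
    embQ hx hz hxz (qI * g) = Complex.I • embQ hx hz hxz g := by
  rw [embQ_apply, embQ_apply, smul_add, smul_smul, smul_smul]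
  congr 2 <;> apply Complex.ext <;> simp [Quaternion.re_mul, Quaternion.imI_mul,
    Quaternion.imJ_mul, Quaternion.imK_mul]

lemma qz_one : qz1 1 = 1 ∧ qz2 1 = 0 := ⟨rfl, rfl⟩
lemma qz_qI : qz1 qI = Complex.I ∧ qz2 qI = 0 := ⟨rfl, rfl⟩
lemma qz_qJ : qz1 qJ = 0 ∧ qz2 qJ = 1 := ⟨rfl, rfl⟩

/-- An invariant valuation of degree two on `ℂ²` is determined by two of its values. -/
theorem UTwo.segF_eq_zero {ν : ConvexBody ℍ[ℝ] → ℝ} (h : UTwo ν) (hI : segF ν qI = 0)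
    (hJ : segF ν qJ = 0) (v : ℍ[ℝ]) : segF ν v = 0 := by
  obtain ⟨I, hI0, hI'⟩ := exists_model 2 2 (by norm_num)
  have hx : inner ℂ (stdE 2 0) (stdE 2 0) = (1 : ℂ) := inner_stdE two_pos
  have hz : inner ℂ (stdE 2 1) (stdE 2 1) = (1 : ℂ) := inner_stdE one_lt_two
  have hxz : inner ℂ (stdE 2 0) (stdE 2 1) = (0 : ℂ) := inner_stdE two_pos
  have hm : ∀ b : ℝ, |b| < 1 → ∃ F, SegFun F ∧ F qI = (1 + b ^ 2) * I 1 ∧ F qJ = I 0 := fun b hb => by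
    obtain ⟨μ, h1, h2, h3, h4⟩ := hI' b hb
    refine ⟨_, (UTwo.of_pullback (embQ hx hz hxz) (embQ_qI_mul hx hz hxz) h1 h3 [] h2
      (by simp)).segFun, ?_, ?_⟩
    · rw [segF_pullback _ h1 [] h2, embQ_apply, embQ_apply, qz_one.1, qz_one.2, qz_qI.1, qz_qI.2]
      simpa [frameL, stdA, stdB, List.range_succ] using h4 1 0 (by norm_num) rfl
    · rw [segF_pullback _ h1 [] h2, embQ_apply, embQ_apply, qz_one.1, qz_one.2, qz_qJ.1, qz_qJ.2]
      simpa [frameL, stdA, stdB, List.range'] using h4 0 2 le_rfl rfl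
  obtain ⟨F, hF, hF1, hF2⟩ := hm 0 (by norm_num)
  obtain ⟨G, hG, hG1, hG2⟩ := hm (1 / 2) (by norm_num [abs_lt])
  have hd := SegFun.det_eq_zero (Fs := ![segF ν, F, G])
    (fun a => by fin_cases a; exacts [h.segFun, hF, hG]) ![qI, qJ, v]
  rw [Matrix.det_fin_three] at hd
  simp only [Matrix.of_apply, Matrix.cons_val_zero, Matrix.cons_val_one, Matrix.cons_val, hI, hJ, hF1,
    hF2, hG1, hG2] at hd
  have h1 := mul_pos (hI0 0) (hI0 1)
  have h2 : segF ν v * (I 0 * I 1) = 0 := by linear_combination -4 * hd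
  exact (mul_eq_zero.1 h2).resolve_right h1.ne'

end Models

section NormalForm

variable {n k : ℕ}

/-- Lists of vectors in normal form: blocks of size one or two, Hermitian orthogonal to each
other. -/
inductive NForm : List (Ecl n) → Prop
  | nil : NForm []
  | one {x l} : inner ℂ x x = (1 : ℂ) → (∀ u ∈ l, inner ℂ x u = 0) → NForm l → NForm (x :: l)
  | two {x y l} : inner ℂ x x = (1 : ℂ) → ⟪x, y⟫ = 0 → (∀ u ∈ l, inner ℂ x u = 0 ∧ inner ℂ y u = 0) → NForm l →
      NForm (x :: y :: l)

lemma inner_normalize {x : Ecl n} (hx : x ≠ 0) :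
    inner ℂ (‖x‖⁻¹ • x) (‖x‖⁻¹ • x) = (1 : ℂ) := by
  rw [inner_self_eq_norm_sq_to_K, norm_smul, norm_inv, norm_norm,
    inv_mul_cancel₀ (norm_ne_zero_iff.2 hx)]
  simp

lemma exists_invariant_pair (F : Submodule ℝ (Ecl n)) (hF : F ≠ ⊥) : ∃ x y : Ecl n,
    x ∈ F ∧ y ∈ F ∧ inner ℂ x x = (1 : ℂ) ∧ ⟪x, y⟫ = 0 ∧
    ∀ u ∈ F, ⟪x, u⟫ = 0 → ⟪y, u⟫ = 0 → inner ℂ x u = 0 ∧ inner ℂ y u = 0 := by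
  have hsk : ∀ u v : Ecl n, ⟪Complex.I • u, v⟫ = -⟪u, Complex.I • v⟫ := fun u v => by
    rw [inner_I_smul_left, re_inner_eq, inner_smul_right]; simp
  let T : F →ₗ[ℝ] F := F.orthogonalProjection.toLinearMap ∘ₗ
    (mulI n 1 : Ecl n →ₗ[ℝ] Ecl n) ∘ₗ F.subtype
  have hT : ∀ u v : F, ⟪T u, v⟫ = ⟪Complex.I • (u : Ecl n), (v : Ecl n)⟫ := fun u v => by
    have : T u = F.orthogonalProjection (Complex.I • (u : Ecl n)) := by
      change F.orthogonalProjection (mulI n 1 u) = _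
      rw [mulI_apply, one_smul]
    rw [this, Submodule.inner_orthogonalProjection_eq_of_mem_right]
  have hT' : ∀ u v : F, ⟪T u, v⟫ = -⟪u, T v⟫ := fun u v => by
    rw [hT, hsk, real_inner_comm, ← hT, real_inner_comm]
  have hS : LinearMap.IsSymmetric (𝕜 := ℝ) (E := F) (T ∘ₗ T) := fun u v => by
    change ⟪T (T u), v⟫ = ⟪u, T (T v)⟫
    rw [hT', hT', neg_neg]
  have : Nontrivial F := Submodule.nontrivial_iff_ne_bot.2 hF
  obtain ⟨x₀, hx⟩ := hS.hasEigenvalue_iSup_of_finiteDimensional.exists_hasEigenvector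
  set x : F := ‖(x₀ : Ecl n)‖⁻¹ • x₀ with hxdef
  have hx1 : ∃ c : ℝ, (T ∘ₗ T) x = c • x := ⟨_, by
    rw [hxdef, map_smul, hx.apply_eq_smul, smul_comm]⟩
  obtain ⟨c, hx1⟩ := hx1
  refine ⟨x, T x, x.2, (T x).2, inner_normalize fun h => hx.2 (Subtype.ext h), ?_, fun u hu h1 h2 => ⟨?_, ?_⟩⟩
  · have := hT' x x
    rw [real_inner_comm] at this
    change ⟪x, T x⟫ = 0
    linarith
  · exact inner_eq_zero_of_real h1 ((hT x ⟨u, hu⟩).symm.trans h2)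
  · refine inner_eq_zero_of_real h2 ((hT (T x) ⟨u, hu⟩).symm.trans ?_)
    change ⟪(T ∘ₗ T) x, _⟫ = _
    rw [hx1]
    change ⟪c • (x : Ecl n), u⟫ = 0
    rw [real_inner_smul_left, h1, mul_zero]

lemma exists_nForm (d : ℕ) : ∀ F : Submodule ℝ (Ecl n), Module.finrank ℝ F = d →
    ∃ l : List (Ecl n), NForm l ∧ l.length = d ∧ (∀ u ∈ l, u ∈ F) ∧
      F ≤ Submodule.span ℝ {u | u ∈ l} := by
  induction d using Nat.strong_induction_on with
  | _ d ih =>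
    intro F hd
    by_cases hF : F = ⊥
    · subst hF
      exact ⟨[], .nil, (finrank_bot ℝ (Ecl n)).symm.trans hd, by simp, bot_le⟩
    obtain ⟨x, y, hx, hy, hx1, hxy, hu⟩ := exists_invariant_pair F hF
    have key : ∀ s : List (Ecl n), Module.finrank ℝ (Submodule.span ℝ {u | u ∈ s}) = s.length →
        s ≠ [] → (∀ u ∈ s, u ∈ F) → (∀ u ∈ F, (∀ v ∈ s, ⟪v, u⟫ = 0) → ⟪x, u⟫ = 0 ∧ ⟪y, u⟫ = 0) →
        (∀ l, (∀ u ∈ l, inner ℂ x u = 0 ∧ inner ℂ y u = 0) → NForm l → NForm (s ++ l)) →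
        ∃ l : List (Ecl n), NForm l ∧ l.length = d ∧ (∀ u ∈ l, u ∈ F) ∧
          F ≤ Submodule.span ℝ {u | u ∈ l} := fun s hs hs0 hsF hsu hsN => by
      set S := Submodule.span ℝ {u | u ∈ s} with hS
      have hSF : S ≤ F := Submodule.span_le.2 hsF
      have hdim := Submodule.finrank_add_inf_finrank_orthogonal hSF
      have hpos := List.length_pos_iff.2 hs0
      obtain ⟨l, h1, h2, h3, h4⟩ := ih (Module.finrank ℝ (Sᗮ ⊓ F : Submodule ℝ (Ecl n))) (by omega)
        _ rfl
      refine ⟨s ++ l, hsN l (fun u hul => ?_) h1, by rw [List.length_append]; omega, fun u hul => ?_, ?_⟩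
      · obtain ⟨h5, h6⟩ := h3 u hul
        obtain ⟨h7, h8⟩ := hsu u h6 fun v hv => h5 v (Submodule.subset_span hv)
        exact hu u h6 h7 h8
      · exact (List.mem_append.1 hul).elim (hsF u) fun h => (h3 u h).2
      · rw [← Submodule.sup_orthogonal_inf_of_hasOrthogonalProjection hSF]
        exact sup_le (Submodule.span_mono fun u hu' => List.mem_append_left _ hu')
          (h4.trans (Submodule.span_mono fun u hu' => List.mem_append_right _ hu'))
    have hx0 : x ≠ 0 := by rintro rfl; simp at hx1
    by_cases hy0 : y = 0
    · refine key [x] ?_ (by simp) (by simpa using hx) (fun u _ h => ⟨h x (by simp), by simp [hy0]⟩)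
        fun l hl => .one hx1 fun u hul => (hl u hul).1
      have h2 : {u | u ∈ [x]} = {x} := by ext; simp
      rw [h2, finrank_span_singleton hx0]; rfl
    · refine key [x, y] ?_ (by simp) (by simp [hx, hy]) (fun u _ h => ⟨h x (by simp), h y (by simp)⟩)
        fun l hl => .two hx1 hxy hl
      have hli : LinearIndependent ℝ ![x, y] :=
        linearIndependent_of_ne_zero_of_inner_eq_zero (fun i => by fin_cases i <;> simpa)
          fun i j hij => by
            fin_cases i <;> fin_cases j <;> simp_all [real_inner_comm]
      have h2 : {u | u ∈ [x, y]} = Set.range ![x, y] := by ext; simp [or_comm]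
      rw [h2, finrank_span_eq_card hli]; rfl

end NormalForm

section Reduction

variable {n k : ℕ} {μ : ConvexBody (Ecl n) → ℝ}

/-- Hermitian orthonormal lists. -/
def HON (l : List (Ecl n)) : Prop :=
  l.Pairwise (fun u v => inner ℂ u v = 0) ∧ ∀ u ∈ l, inner ℂ u u = (1 : ℂ)

lemma HON.perm {l l' : List (Ecl n)} (h : HON l) (hp : l.Perm l') : HON l' :=
  ⟨(hp.pairwise_iff fun {a b} h => by rw [← inner_conj_symm, h, map_zero]).1 h.1,
    fun u hu => h.2 u (hp.mem_iff.2 hu)⟩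

lemma HON.cons {l : List (Ecl n)} (h : HON l) {x : Ecl n} (hx : inner ℂ x x = (1 : ℂ))
    (hl : ∀ u ∈ l, inner ℂ x u = 0) : HON (x :: l) :=
  ⟨List.pairwise_cons.2 ⟨hl, h.1⟩, List.forall_mem_cons.2 ⟨hx, h.2⟩⟩

lemma CInv.parL_frameL (hc : CInv μ) {as bs : List (Ecl n)} (h : HON (as ++ bs)) :
    as.length + bs.length ≤ n ∧ μ (parL (frameL as bs)) =
      μ (parL (frameL (stdA n as.length) (stdB n as.length bs.length))) := by
  set L := as ++ bs with hL
  have ho : Orthonormal ℂ fun i : Fin L.length => L[i] := by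
    rw [orthonormal_iff_ite]
    intro i j
    have hp := List.pairwise_iff_getElem.1 h.1
    split_ifs with hij
    · subst hij; exact h.2 _ (List.getElem_mem _)
    · rcases lt_or_gt_of_ne hij with h1 | h1
      · exact hp _ _ _ _ h1
      · rw [← inner_conj_symm, show inner ℂ L[j] L[i] = (0 : ℂ) from hp _ _ _ _ h1, map_zero]
  have hn : L.length ≤ n := by
    have := ho.linearIndependent.fintype_card_le_finrank
    simpa using this
  have hlen : L.length = as.length + bs.length := List.length_append
  refine ⟨hlen ▸ hn, ?_⟩
  have ho' : Orthonormal ℂ (({i : Fin n | (i : ℕ) < L.length} : Set (Fin n)).domRestrict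
      fun i => L.getD i 0) := by
    convert ho.comp (fun i : {i : Fin n | (i : ℕ) < L.length} => (⟨i, i.2⟩ : Fin L.length))
      fun i j hij => Subtype.ext (Fin.ext (by simpa using hij)) using 1
    funext i
    exact List.getD_eq_getElem _ _ i.2
  obtain ⟨b, hb⟩ := ho'.exists_orthonormalBasis_extension_of_card_eq (by simp)
  let A : Ecl n ≃ₗᵢ[ℝ] Ecl n := ⟨b.repr.symm.toLinearEquiv.restrictScalars ℝ, b.repr.symm.norm_map⟩
  have hA : ∀ i (hi : i < L.length), A (stdE n i) = L[i] := fun i hi => by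
    have h1 : stdE n i = EuclideanSpace.single (⟨i, hi.trans_le hn⟩ : Fin n) 1 := by
      ext j; simp [stdE_apply, Pi.single_apply, Fin.ext_iff]
    have h2 := hb ⟨i, hi.trans_le hn⟩ hi
    rw [h1]
    refine (b.repr_symm_single _).trans (h2.trans (List.getD_eq_getElem _ _ hi))
  have hAI : ∀ z, A (Complex.I • z) = Complex.I • A z := fun z => map_smul b.repr.symm _ z
  rw [← hc A hAI (parL (frameL (stdA n _) _)), mapB_parL]
  congr 2
  have e1 : (stdA n as.length).map A = as := by
    refine List.ext_getElem (by simp [stdA]) fun i h1 h2 => ?_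
    simp only [stdA, List.getElem_map, List.getElem_range]
    rw [hA i (by omega)]
    simp [hL, h2]
  have e2 : (stdB n as.length bs.length).map A = bs := by
    refine List.ext_getElem (by simp [stdB]) fun i h1 h2 => ?_
    simp only [stdB, List.getElem_map, List.getElem_range']
    rw [hA _ (by omega)]
    simp [hL]
  conv_lhs => rw [← e1, ← e2]
  rw [frameL, frameL, List.map_append, List.map_flatMap, List.flatMap_map]
  congr 1
  simp [hAI]

lemma parL_cons_smul (hμ : Good μ) {l : List (Ecl n)} {x : Ecl n} (hk : Homog (l.length + 1) μ)
    (c : ℝ) : μ (parL (c • x :: l)) = |c| * μ (parL (x :: l)) := by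
  rw [Homog.parL_eq_DL hμ (c • x :: l) hk, Homog.parL_eq_DL hμ (x :: l) hk, DL, DL,
    show Dv (c • x) μ = fun K => |c| * Dv x μ K from funext (hμ.Dv_smul x c), DL_const_mul]

lemma forall_mem_middle {α : Type*} {P : α → Prop} {a : α} (s t : List α) :
    (∀ u ∈ s ++ a :: t, P u) ↔ P a ∧ ∀ u ∈ s ++ t, P u := by
  simp only [List.mem_append, List.mem_cons]; grind

lemma parL_eq_zero_of_nForm (hμ : Good μ) (hk : Homog k μ) (hc : CInv μ)
    (h : ∀ j l, j + l ≤ n → 2 * j + l = k → μ (parL (frameL (stdA n j) (stdB n j l))) = 0)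
    {l : List (Ecl n)} (hl : NForm l) : ∀ as bs : List (Ecl n), HON (as ++ bs) →
      (∀ u ∈ l, ∀ w ∈ as ++ bs, inner ℂ u w = 0) → (frameL as bs ++ l).length = k →
      μ (parL (frameL as bs ++ l)) = 0 := by
  induction hl with
  | nil =>
    intro as bs hO _ hlen
    rw [List.append_nil] at *
    obtain ⟨h1, h2⟩ := hc.parL_frameL hO
    rw [h2]
    exact h _ _ h1 (by rwa [length_frameL] at hlen)
  | @one x l h1 hx hl ih =>
    intro as bs hO hu hlen
    have hp : (frameL as bs ++ x :: l).Perm (frameL as (x :: bs) ++ l) := by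
      rw [frameL, frameL, List.append_assoc, List.append_assoc]
      exact List.perm_middle.append_left _
    rw [parL_perm hp]
    exact ih as (x :: bs) ((hO.cons h1 (hu x (by simp))).perm List.perm_middle.symm)
      (fun u hul => (forall_mem_middle _ _).2 ⟨inner_eq_zero_symm.1 (hx u hul),
        hu u (List.mem_cons_of_mem _ hul)⟩) (hp.length_eq.symm.trans hlen)
  | @two x y l h1 hxy hx hl ih =>
    intro as bs hO hu hlen
    set R := frameL as bs ++ l with hR
    have hp : (frameL as bs ++ x :: y :: l).Perm (x :: y :: R) :=
      List.perm_middle.trans (List.perm_middle.cons x)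
    rw [parL_perm hp]
    have hlR : R.length + 2 = k := hp.length_eq.symm.trans hlen
    have hu' : ∀ u ∈ l, ∀ w ∈ as ++ bs, inner ℂ u w = 0 := fun u hul =>
      hu u (List.mem_cons_of_mem _ (List.mem_cons_of_mem _ hul))
    have hux := hu x (by simp)
    have huy := hu y (by simp)
    have hlx : ∀ u ∈ l, inner ℂ u x = 0 := fun u hul => inner_eq_zero_symm.1 (hx u hul).1
    have hIx : μ (parL (x :: Complex.I • x :: R)) = 0 := ih (x :: as) bs (hO.cons h1 hux)
      (fun u hul => List.forall_mem_cons.2 ⟨hlx u hul, hu' u hul⟩)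
      (by simpa [frameL, hR, add_assoc] using hlR)
    set c : ℂ := inner ℂ x y with hc0
    have hcr : c.re = 0 := by rw [hc0, ← re_inner_eq, hxy]
    set w := y - c • x with hw
    have hxw : inner ℂ x w = 0 := by rw [hw, inner_sub_right, inner_smul_right, h1]; simp [hc0]
    by_cases hw0 : w = 0
    · have hy : y = c.im • Complex.I • x := by
        rw [sub_eq_zero.1 hw0, ← smul_assoc]
        congr 1
        apply Complex.ext <;> simp [hcr]
      rw [parL_perm (List.Perm.swap _ _ _), hy, parL_cons_smul hμ (by simpa [hlR] using hk),
        parL_perm (List.Perm.swap _ _ _), hIx, mul_zero]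
    set z := ‖w‖⁻¹ • w with hz
    have h2 : inner ℂ z z = (1 : ℂ) := inner_normalize hw0
    have hzr : ∀ u : Ecl n, inner ℂ x u = 0 → inner ℂ y u = 0 → inner ℂ z u = 0 := fun u h3 h4 => by
      have hwu : inner ℂ w u = 0 := by rw [hw, inner_sub_left, inner_smul_left, h3, h4]; simp
      rw [hz, ← Complex.coe_smul, inner_smul_left, hwu, mul_zero]
    have hxz : inner ℂ x z = 0 := by rw [hz, ← Complex.coe_smul, inner_smul_right, hxw, mul_zero]
    have hlz : ∀ u ∈ l, inner ℂ u z = 0 := fun u hul =>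
      inner_eq_zero_symm.1 (hzr u (hx u hul).1 (hx u hul).2)
    have huz : ∀ u ∈ as ++ bs, inner ℂ z u = 0 := fun u hua => hzr u (hux u hua) (huy u hua)
    have hpz : (frameL as (x :: z :: bs) ++ l).Perm (x :: z :: R) := by
      rw [hR, frameL, frameL, List.append_assoc, List.append_assoc]
      exact List.perm_middle.trans (List.perm_middle.cons x)
    have hxz0 : μ (parL (x :: z :: R)) = 0 := by
      rw [← parL_perm hpz]
      refine ih as (x :: z :: bs) (((hO.cons h2 huz).cons h1 (List.forall_mem_cons.2 ⟨hxz, hux⟩)).perm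
        (List.perm_middle.trans (List.perm_middle.cons x)).symm) (fun u hul => ?_)
        (hpz.length_eq.trans hlR)
      exact (forall_mem_middle _ _).2 ⟨hlx u hul, (forall_mem_middle _ _).2 ⟨hlz u hul, hu' u hul⟩⟩
    have hk' : Homog (2 + R.length) μ := by rwa [add_comm, hlR]
    set e := embQ h1 h2 hxz with he
    have hU : UTwo fun K => DL R μ (mapB e.toContinuousLinearMap K) := by
      refine UTwo.of_pullback e (embQ_qI_mul h1 h2 hxz) hμ hc R hk' fun v hv g => ?_
      have hv2 : ∀ v : Ecl n, inner ℂ x v = 0 → inner ℂ z v = 0 → inner ℂ v (e g) = 0 :=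
        fun v h3 h4 => by
        rw [he, embQ_apply, inner_add_right, inner_smul_right, inner_smul_right,
          inner_eq_zero_symm.1 h3, inner_eq_zero_symm.1 h4]
        simp
      have hv3 : inner ℂ v (e g) = 0 := by
        rcases List.mem_append.1 hv with hv | hv
        · rcases List.mem_append.1 hv with hv | hv
          · obtain ⟨a, ha, hv⟩ := List.mem_flatMap.1 hv
            have ha' := List.mem_append_left bs ha
            have := hv2 a (hux a ha') (huz a ha')
            rcases List.mem_pair.1 hv with rfl | rfl
            · exact this
            · rw [inner_smul_left, this, mul_zero]
          · have ha' := List.mem_append_right as hv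
            exact hv2 v (hux v ha') (huz v ha')
        · exact hv2 v (hx v hv).1 (inner_eq_zero_symm.1 (hlz v hv))
      rw [re_inner_eq, hv3, Complex.zero_re]
    have hseg := segF_pullback e hμ R hk'
    have e1 : e 1 = x := by rw [he, embQ_apply, qz_one.1, qz_one.2]; simp
    have h0 := hU.segF_eq_zero
      (by rw [hseg, e1, he, embQ_apply, qz_qI.1, qz_qI.2, zero_smul, add_zero, hIx])
      (by rw [hseg, e1, he, embQ_apply, qz_qJ.1, qz_qJ.2, zero_smul, zero_add, one_smul, hxz0])
      (qmk c.re c.im ‖w‖ 0)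
    have e2 : e (qmk c.re c.im ‖w‖ 0) = y := by
      have h3 : (⟨‖w‖, 0⟩ : ℂ) • z = w := by
        change ((‖w‖ : ℝ) : ℂ) • z = w
        rw [Complex.coe_smul, hz, smul_inv_smul₀ (norm_ne_zero_iff.2 hw0)]
      rw [he, embQ_apply]
      exact (congrArg (_ + ·) h3).trans (add_sub_cancel _ _)
    rwa [hseg, e1, e2] at h0

/-- An invariant valuation vanishing on all standard frames vanishes. -/
theorem CInv.eq_zero (hc : CInv μ) (hμ : Good μ) (hk : Homog k μ)
    (h : ∀ j l, j + l ≤ n → 2 * j + l = k → μ (parL (frameL (stdA n j) (stdB n j l))) = 0)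
    (K : ConvexBody (Ecl n)) : μ K = 0 := by
  refine hk.klain hμ (fun K => ?_) (fun v hv => ?_) K
  · rw [reflect_eq]
    exact hc (LinearIsometryEquiv.neg ℝ) (fun z => (smul_neg _ _).symm) K
  · obtain ⟨l, h1, h2, -, h4⟩ := exists_nForm k (Submodule.span ℝ (Set.range v))
      ((finrank_span_eq_card hv).trans (Fintype.card_fin k))
    subst h2
    refine hk.parB_eq_zero_of_mem_span hμ (w := l.get) (fun i => ?_) ?_
    · have := h4 (Submodule.subset_span (Set.mem_range_self i))
      rwa [← Set.range_list_get] at this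
    · rw [parB_eq_parL, List.ofFn_get]
      exact parL_eq_zero_of_nForm hμ hk hc h h1 [] [] ⟨List.Pairwise.nil, by simp⟩ (by simp) rfl

end Reduction

section Unitary

variable {n : ℕ} {μ : ConvexBody (Ecl n) → ℝ}

lemma toEuclideanLin_mul_apply (A B : Matrix (Fin n) (Fin n) ℂ) (x : Ecl n) :
    Matrix.toEuclideanLin (A * B) x = Matrix.toEuclideanLin A (Matrix.toEuclideanLin B x) := by
  simp [Matrix.toLpLin_apply, Matrix.mulVec_mulVec]

lemma inner_toEuclideanLin (A : Matrix (Fin n) (Fin n) ℂ) (x y : Ecl n) :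
    inner ℂ (Matrix.toEuclideanLin A x) (Matrix.toEuclideanLin A y) =
      inner ℂ x (Matrix.toEuclideanLin (A.conjTranspose * A) y) := by
  rw [toEuclideanLin_mul_apply, Matrix.toEuclideanLin_conjTranspose_eq_adjoint,
    LinearMap.adjoint_inner_right]

lemma CInv.uInv (h : CInv μ) : UInv μ := fun M hM K => by
  have hn : ∀ x : Ecl n, ‖Matrix.toEuclideanLin M x‖ = ‖x‖ := fun x => by
    rw [@norm_eq_sqrt_re_inner ℂ, @norm_eq_sqrt_re_inner ℂ _ _ _ _ x, inner_toEuclideanLin,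
      ← Matrix.star_eq_conjTranspose, Matrix.mem_unitaryGroup_iff'.1 hM]
    simp
  let A₀ : Ecl n →ₗᵢ[ℝ] Ecl n := ⟨(Matrix.toEuclideanLin M).restrictScalars ℝ, hn⟩
  let A : Ecl n ≃ₗᵢ[ℝ] Ecl n := A₀.toLinearIsometryEquiv rfl
  exact (congrArg μ (ConvexBody.ext rfl)).trans
    (h A (fun z => (Matrix.toEuclideanLin M).map_smul Complex.I z) K)

lemma UInv.cInv (h : UInv μ) : CInv μ := fun A hA K => by
  have hc : ∀ (c : ℂ) z, A (c • z) = c • A z := fun c z => by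
    rw [← Complex.re_add_im c, add_smul, add_smul, map_add, mul_smul, mul_smul]
    simp only [Complex.coe_smul, map_smul, hA]
  let L : Ecl n →ₗ[ℂ] Ecl n := ⟨⟨A, map_add A⟩, hc⟩
  obtain ⟨M, hM⟩ := (Matrix.toEuclideanLin (𝕜 := ℂ) (m := Fin n) (n := Fin n)).surjective L
  have hi : ∀ x y, inner ℂ (L x) (L y) = inner ℂ x y :=
    (LinearMap.norm_map_iff_inner_map_map L).1 A.norm_map
  have hu : M ∈ Matrix.unitaryGroup (Fin n) ℂ := by
    rw [Matrix.mem_unitaryGroup_iff', Matrix.star_eq_conjTranspose]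
    refine (Matrix.toEuclideanLin (𝕜 := ℂ) (m := Fin n) (n := Fin n)).injective
      (LinearMap.ext fun y => ext_inner_left ℂ fun x => ?_)
    rw [← inner_toEuclideanLin, hM, hi]
    simp
  refine (congrArg μ (ConvexBody.ext ?_)).trans (h M hu K)
  change A '' _ = Matrix.toEuclideanLin M '' _
  rw [hM]
  rfl

end Unitary

/-- Bodies on which a family is unisolvent, and which determine the ambient class, give a basis. -/
lemma exists_unique_of_isUnit_det {X : Type*} {N : ℕ} (b : Fin N → X → ℝ) (F : Fin N → X)
    (hdet : IsUnit (Matrix.of fun r i => b i (F r)).det) (μ : X → ℝ)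
    (h : ∀ c : Fin N → ℝ, (∀ r, μ (F r) - ∑ i, c i * b i (F r) = 0) →
      ∀ K, μ K - ∑ i, c i * b i K = 0) :
    ∃! c : Fin N → ℝ, ∀ K, μ K = ∑ i, c i * b i K := by
  set M : Matrix (Fin N) (Fin N) ℝ := Matrix.of fun r i => b i (F r) with hM
  have hmul : ∀ (c : Fin N → ℝ) r, M.mulVec c r = ∑ i, c i * b i (F r) := fun c r => by
    simp [Matrix.mulVec, dotProduct, hM, mul_comm]
  refine ⟨M⁻¹.mulVec fun r => μ (F r), fun K => sub_eq_zero.1 (h _ (fun r => ?_) K), fun c hc => ?_⟩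
  · rw [← hmul, Matrix.mulVec_mulVec, Matrix.mul_nonsing_inv _ hdet, Matrix.one_mulVec, sub_self]
  · have : (fun r => μ (F r)) = M.mulVec c := funext fun r => (hc _).trans (hmul c r).symm
    rw [this, Matrix.mulVec_mulVec, Matrix.nonsing_inv_mul _ hdet, Matrix.one_mulVec]

lemma isUnit_det_of_pow_mul {N : ℕ} (x a : Fin N → ℝ) (hx : Function.Injective x)
    (hx0 : ∀ i, x i ≠ 0) (ha : ∀ r, a r ≠ 0) (j : ℕ) :
    IsUnit (Matrix.of fun r i : Fin N => x i ^ (j + (r : ℕ)) * a r).det := by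
  have : (Matrix.of fun r i : Fin N => x i ^ (j + (r : ℕ)) * a r) = Matrix.diagonal a *
      (Matrix.vandermonde x).transpose * Matrix.diagonal fun i => x i ^ j := by
    ext r i
    simp [Matrix.mul_diagonal, Matrix.diagonal_mul, Matrix.vandermonde, pow_add]
    ring
  rw [this, isUnit_iff_ne_zero, Matrix.det_mul, Matrix.det_mul, Matrix.det_diagonal,
    Matrix.det_diagonal, Matrix.det_transpose]
  exact mul_ne_zero (mul_ne_zero (Finset.prod_ne_zero_iff.2 fun r _ => ha r)
    (Matrix.det_vandermonde_ne_zero_iff.2 hx)) (Finset.prod_ne_zero_iff.2 fun i _ =>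
      pow_ne_zero _ (hx0 i))

/-- **(Alesker.)** The space `Val_k^{U(n)}` of continuous, translation invariant,
`U(n)`-invariant valuations on `ℂⁿ` homogeneous of degree `k` has dimension
`min(⌊k/2⌋, ⌊(2n−k)/2⌋) + 1`: it admits a basis of that size. -/
theorem dim_valU (n k : ℕ) (hn : 1 ≤ n) (hk : k ≤ 2 * n) :
    ∃ b : Fin (min (k / 2) ((2 * n - k) / 2) + 1) → ConvexBody (Ecl n) → ℝ,
      (∀ i, IsValuation (b i) ∧ Continuous (b i) ∧ TransInv (b i) ∧ Homog k (b i) ∧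
        UInv (b i)) ∧
      ∀ μ : ConvexBody (Ecl n) → ℝ,
        IsValuation μ → Continuous μ → TransInv μ → Homog k μ → UInv μ →
          ∃! c : Fin (min (k / 2) ((2 * n - k) / 2) + 1) → ℝ,
            ∀ K : ConvexBody (Ecl n), μ K = ∑ i, c i * b i K := by
  obtain ⟨I, hI, hmod⟩ := exists_model n k hk
  set N := min (k / 2) ((2 * n - k) / 2) + 1 with hN
  have hb : ∀ i : Fin N, |((i : ℕ) + 2 : ℝ)⁻¹| < 1 := fun i => by
    rw [abs_of_pos (by positivity)]
    exact inv_lt_one_of_one_lt₀ (by linarith [(i : ℕ).cast_nonneg (α := ℝ)])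
  choose b hgood hhom hinv hval using fun i => hmod _ (hb i)
  let F : Fin N → ConvexBody (Ecl n) := fun r =>
    parL (frameL (stdA n (k - n + r)) (stdB n (k - n + r) (k - 2 * (k - n + r))))
  have hF : ∀ i r, b i (F r) = (1 + ((i : ℕ) + 2 : ℝ)⁻¹ ^ 2) ^ (k - n + (r : ℕ)) *
      I (k - n + r) := fun i r => by
    have := r.2
    exact hval i _ _ (by omega) (by omega)
  refine ⟨b, fun i => ⟨(hgood i).val, (hgood i).cont, (hgood i).ti, hhom i, (hinv i).uInv⟩,
    fun μ h1 h2 h3 h4 h5 => exists_unique_of_isUnit_det b F ?_ μ fun c hc => ?_⟩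
  · simp only [hF]
    refine isUnit_det_of_pow_mul (fun i : Fin N => 1 + ((i : ℕ) + 2 : ℝ)⁻¹ ^ 2) _
      (fun i j hij => ?_) (fun i => by positivity) (fun r => (hI _).ne') _
    have h6 := (pow_left_inj₀ (by positivity) (by positivity) two_ne_zero).1 (add_left_cancel hij)
    exact Fin.ext (Nat.cast_injective (R := ℝ) (add_right_cancel (inv_injective h6)))
  · refine CInv.eq_zero (k := k) (fun A hA K => ?_)
      (Good.sub ⟨h1, h2, h3⟩ (Good.sum _ fun i _ => (hgood i).const_mul (c i)))
      (fun K t ht => ?_) fun j l h6 h7 => ?_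
    · simp only [h5.cInv A hA K, hinv _ A hA K]
    · simp only [h4 K t ht, hhom _ K t ht, mul_sub, Finset.mul_sum, mul_left_comm]
    · convert hc ⟨j - (k - n), by omega⟩ <;> simp only <;> omega
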